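/- Let d ≥ 5, N ≥ 1, Q_{4N} ⊆ D ⊆ Z^d, and let k ≥ 1 and m ≥ 4 satisfy N/2 ≤ k m < N - m. Let L be the loop erasure of simple random walk from 0 stopped at its first exit from D; for j = 1,…,k let Y_j be the endpoint of the initial segment of L up to its first hit of ∂_i Q(0, jm), let β_j be the segment of L from Y_j to its first hit of ∂_i Q(Y_j, m), let A(Y_j) be the box A defined with respect to x₀ = Y_j, and let Y_{j,2} be the point x₂ defined with respect to x₀ = Y_j. Then there exist constants c₁, c₂, c > 0 and C₂ < ∞, depending only on d, such that P( G(c₁,c₂,C₂) ) ≥ 1 - exp(-c k), where G(c₁,c₂,C₂) is the event that for at least c₂ k indices j ∈ {1,…,k} one has both P( simple random walk from Y_{j,2} hits A(Y_j) ∩ β_j in finite time | L ) ≥ c₁ m^{4-d} and |Q(Y_j,m) ∩ β_j| ≤ C₂ m². -/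

import Mathlib

open MeasureTheory
open scoped ENNReal Classical

namespace USFPaper

/-- Vertices of the nearest-neighbour integer lattice `ℤ^d`. -/
abbrev V (d : ℕ) := Fin d → ℤ

variable {d : ℕ}

/-- Nearest-neighbour adjacency in `ℤ^d`. -/
def adj (x y : V d) : Prop := (∑ i, |x i - y i|) = 1

/-- The cube `Q(x,r) = { y : ‖x - y‖_∞ ≤ r }`. -/
def cube (x : V d) (r : ℕ) : Set (V d) := { y | ∀ i, |y i - x i| ≤ (r : ℤ) }

/-- Inner boundary `∂ᵢA` of a set `A`. -/
def innerBdry (A : Set (V d)) : Set (V d) := { x | x ∈ A ∧ ∃ y, adj x y ∧ y ∉ A }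

/-- Euclidean distance on `ℤ^d`. -/
noncomputable def eudist (x y : V d) : ℝ := Real.sqrt (∑ i, ((x i : ℝ) - (y i : ℝ)) ^ 2)

/-- The `k`-th coordinate unit vector. -/
def unitVec (k : ℕ) : V d := fun i => if (i : ℕ) = k then 1 else 0

/-- `μ` is the law of simple random walk on `ℤ^d` started at `x`, as a probability
measure on path space: every nearest-neighbour cylinder of length `n` starting at `x`
has probability `(2d)⁻ⁿ`. -/
def IsSRWLaw (μ : Measure (ℕ → V d)) (x : V d) : Prop :=
  IsProbabilityMeasure μ ∧
  ∀ (n : ℕ) (γ : ℕ → V d), γ 0 = x → (∀ i < n, adj (γ i) (γ (i + 1))) →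
    μ { ω | ∀ i ≤ n, ω i = γ i } = (2 * (d : ℝ≥0∞))⁻¹ ^ n

/-- First exit time `τ_A` from `A`, valued in `ℕ∞` (`⊤` if the path never leaves `A`). -/
noncomputable def exitTimeE (A : Set (V d)) (ω : ℕ → V d) : ENat :=
  if h : ∃ j, ω j ∉ A then (Nat.find h : ENat) else ⊤

/-- First hitting time `T_A` of `A`, valued in `ℕ∞`. -/
noncomputable def hitTimeE (A : Set (V d)) (ω : ℕ → V d) : ENat :=
  if h : ∃ j, ω j ∈ A then (Nat.find h : ENat) else ⊤

/-- First positive hitting time `T⁺_A` of `A`, valued in `ℕ∞`. -/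
noncomputable def hitTimePosE (A : Set (V d)) (ω : ℕ → V d) : ENat :=
  if h : ∃ j, 1 ≤ j ∧ ω j ∈ A then (Nat.find h : ENat) else ⊤

/-- First exit time from `A` as a natural number (junk value `0` if the path never exits). -/
noncomputable def exitTime (A : Set (V d)) (ω : ℕ → V d) : ℕ := (exitTimeE A ω).toNat

/-- Index of the first hit of `A` (junk value `0` if `A` is never hit). -/
noncomputable def hitIdx (A : Set (V d)) (γ : ℕ → V d) : ℕ := (hitTimeE A γ).toNat

/-- First index `≥ t` at which the path lies in `A` (junk value `t`). -/
noncomputable def hitIdxFrom (A : Set (V d)) (t : ℕ) (γ : ℕ → V d) : ℕ :=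
  if h : ∃ j, t ≤ j ∧ γ j ∈ A then Nat.find h else t

/-- The path frozen at its first exit from `D`. -/
noncomputable def stopAt (D : Set (V d)) (ω : ℕ → V d) : ℕ → V d :=
  fun j => if (j : ENat) ≤ exitTimeE D ω then ω j else ω (exitTime D ω)

/-- Time of the last visit of the path to the point `ω t`, at or after time `t`
(junk value if there are infinitely many such visits). -/
noncomputable def lastVisit (ω : ℕ → V d) (t : ℕ) : ℕ := sSup { j | t ≤ j ∧ ω j = ω t }

/-- The times of the chronological loop erasure (last-exit decomposition). -/
noncomputable def leTime (ω : ℕ → V d) : ℕ → ℕ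
  | 0 => lastVisit ω 0
  | k + 1 => lastVisit ω (leTime ω k + 1)

/-- Chronological loop erasure of an (infinite, transient) path. -/
noncomputable def infLoopErase (ω : ℕ → V d) : ℕ → V d := fun k => ω (leTime ω k)

/-- The loop erasure `L` of the walk stopped at its first exit from `D`. -/
noncomputable def lerw (D : Set (V d)) (ω : ℕ → V d) : ℕ → V d := infLoopErase (stopAt D ω)

/-- The event `T_A > τ_D`: the walk does not visit `A` at any time up to (and
including) its first exit from `D`; if it never exits `D`, it never visits `A`. -/
def avoidBeforeExit (D A : Set (V d)) (ω : ℕ → V d) : Prop :=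
  ∀ j : ℕ, (j : ENat) ≤ exitTimeE D ω → ω j ∉ A

/-- The event `T⁺_A > τ_D` (visits of `A` at positive times only). -/
def avoidBeforeExitPos (D A : Set (V d)) (ω : ℕ → V d) : Prop :=
  ∀ j : ℕ, 1 ≤ j → (j : ENat) ≤ exitTimeE D ω → ω j ∉ A

/-- The right-hand face (in the first coordinate direction) of the cube `Q(x₀,m)`. -/
def rightFace (x₀ : V d) (m : ℕ) : Set (V d) :=
  { y | y ∈ cube x₀ m ∧ ∀ i : Fin d, (i : ℕ) = 0 → y i = x₀ i + (m : ℤ) }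


/-- The unit vector pointing towards the face of the cube `Q(0,n)` on which `x₀`
lies (the first coordinate realising `|x₀ i| = n`; junk value `0` if there is none). -/
noncomputable def faceDir (x₀ : V d) (n : ℕ) : V d :=
  if h : ∃ i : Fin d, |x₀ i| = (n : ℤ) then
    fun j => if j = Classical.choose h then (if 0 ≤ x₀ (Classical.choose h) then 1 else -1) else 0
  else 0

/-- The point `x₁ = x₀ + (m/2) e₁` (with `e₁` replaced by the unit vector pointing
towards the face of `Q(0,n)` containing `x₀`). -/
noncomputable def x1pt (x₀ : V d) (n m : ℕ) : V d := x₀ + ((m / 2 : ℕ) : ℤ) • faceDir x₀ n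

/-- The box `A = Q(x₁, m/4)`. -/
noncomputable def boxA (x₀ : V d) (n m : ℕ) : Set (V d) := cube (x1pt x₀ n m) (m / 4)

/-- A second unit direction, orthogonal to `faceDir x₀ n`, reflected according to the
sign of the corresponding coordinate of `x₀` (junk value `0` in degenerate cases). -/
noncomputable def sideDir (x₀ : V d) (n : ℕ) : V d :=
  if h : ∃ i : Fin d, |x₀ i| = (n : ℤ) then
    (if h2 : ∃ j : Fin d, j ≠ Classical.choose h then
      fun t => if t = Classical.choose h2 then (if x₀ (Classical.choose h2) ≤ 0 then 1 else -1) else 0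
    else 0)
  else 0

/-- The point `x₂ = x₁ + m e₂` (suitably rotated/reflected). -/
noncomputable def x2pt (x₀ : V d) (n m : ℕ) : V d := x1pt x₀ n m + (m : ℤ) • sideDir x₀ n

/-- `α`: the initial segment of the loop erasure `L = lerw D ω` up to its first hit
of `∂ᵢ Q(0,n)`, as a list. -/
noncomputable def alphaList (D : Set (V d)) (n : ℕ) (ω : ℕ → V d) : List (V d) :=
  (List.range (hitIdx (innerBdry (cube 0 n)) (lerw D ω) + 1)).map (lerw D ω)

/-- The endpoint `x₀` of a finite path (junk value `0` for the empty path). -/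
def endPt (a : List (V d)) : V d := (a.getLast?).getD 0

/-- `β`: the segment of the loop erasure `L = lerw D ω` from its first hit `x₀` of
`∂ᵢ Q(0,n)` up to its first subsequent hit of `∂ᵢ Q(x₀,m)`, as a list. -/
noncomputable def betaList (D : Set (V d)) (n m : ℕ) (ω : ℕ → V d) : List (V d) :=
  let γ := lerw D ω
  let k₁ := hitIdx (innerBdry (cube 0 n)) γ
  let k₂ := hitIdxFrom (innerBdry (cube (γ k₁) m)) k₁ γ
  (List.range (k₂ - k₁ + 1)).map fun i => γ (k₁ + i)

/-- `H_A(γ)`: the number of points of the path `γ` lying in the set `A`. -/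
noncomputable def hitCount (A : Set (V d)) (l : List (V d)) : ℕ :=
  (l.map fun v => if v ∈ A then 1 else 0).sum

/-- The endpoint `Y_j` of the initial segment of the loop erasure `lerw D ω` up to its
first hit of `∂ᵢ Q(0,n)`. -/
noncomputable def hitPt (D : Set (V d)) (n : ℕ) (ω : ℕ → V d) : V d :=
  lerw D ω (hitIdx (innerBdry (cube 0 n)) (lerw D ω))


end USFPaper

namespace USFPaper
variable {d : ℕ}

/-- unit vector -/
def ev (i : Fin d) : V d := Pi.single i 1

/-- one-step average -/
noncomputable def avg (f : V d → ℝ) (x : V d) : ℝ :=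
  (2 * (d : ℝ))⁻¹ * ∑ i : Fin d, (f (x + ev i) + f (x - ev i))

lemma avg_mono {f g : V d → ℝ} {x : V d} (h1 : ∀ i, f (x + ev i) ≤ g (x + ev i))
    (h2 : ∀ i, f (x - ev i) ≤ g (x - ev i)) : avg f x ≤ avg g x := by
  unfold avg
  apply mul_le_mul_of_nonneg_left _ (by positivity)
  exact Finset.sum_le_sum fun i _ => add_le_add (h1 i) (h2 i)

lemma avg_mono' {f g : V d → ℝ} (h : ∀ y, f y ≤ g y) (x : V d) : avg f x ≤ avg g x :=
  avg_mono (fun _ => h _) (fun _ => h _)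

lemma avg_add (f g : V d → ℝ) (x : V d) : avg (fun y => f y + g y) x = avg f x + avg g x := by
  unfold avg; rw [← mul_add, ← Finset.sum_add_distrib]; congr 1
  exact Finset.sum_congr rfl fun i _ => by ring

lemma avg_smul (a : ℝ) (f : V d → ℝ) (x : V d) : avg (fun y => a * f y) x = a * avg f x := by
  unfold avg; rw [mul_left_comm]; congr 1; rw [Finset.mul_sum]
  exact Finset.sum_congr rfl fun i _ => by ring

lemma avg_sub (f g : V d → ℝ) (x : V d) : avg (fun y => f y - g y) x = avg f x - avg g x := by
  have := avg_add f (fun y => (-1) * g y) x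
  rw [avg_smul] at this
  rw [sub_eq_add_neg, ← neg_one_mul, ← this]; congr 1; funext y; ring

lemma avg_const (hd : 0 < d) (a : ℝ) (x : V d) : avg (fun _ => a) x = a := by
  unfold avg; simp; field_simp; ring

lemma avg_nonneg {f : V d → ℝ} (h : ∀ y, 0 ≤ f y) (x : V d) : 0 ≤ avg f x := by
  unfold avg
  exact mul_nonneg (by positivity) (Finset.sum_nonneg fun i _ => add_nonneg (h _) (h _))

lemma avg_sum {ι : Type*} (s : Finset ι) (f : ι → V d → ℝ) (x : V d) :
    avg (fun y => ∑ j ∈ s, f j y) x = ∑ j ∈ s, avg (f j) x := by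
  induction s using Finset.induction_on with
  | empty => simp [avg]
  | insert a s ha ih =>
    simp only [Finset.sum_insert ha]; rw [avg_add, ih]

lemma avg_nbr {f : V d → ℝ} (h : ∀ y, 0 ≤ f y) (x : V d) (i : Fin d) :
    f (x + ev i) + f (x - ev i) ≤ 2 * d * avg f x := by
  have hd : (0:ℝ) < d := by have := i.pos; exact_mod_cast this
  unfold avg
  rw [← mul_assoc, mul_inv_cancel₀ (by positivity), one_mul]
  exact Finset.single_le_sum (f := fun i => f (x + ev i) + f (x - ev i))
    (fun j _ => add_nonneg (h _) (h _)) (Finset.mem_univ i)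

lemma avg_shift (f : V d → ℝ) (v x : V d) : avg (fun y => f (y + v)) x = avg f (x + v) := by
  unfold avg; congr 1
  exact Finset.sum_congr rfl fun i _ => by
    simp only [add_right_comm x v, sub_add_eq_add_sub]

/-- minimum principle -/
lemma minP (hd : 0 < d) {f : V d → ℝ} {B : Set (V d)} (h1 : ∀ x ∈ B, avg f x ≤ f x)
    (h2 : ∀ x ∉ B, 0 ≤ f x) (h3 : ∀ ε > 0, {x | f x < -ε}.Finite) (x : V d) : 0 ≤ f x := by
  by_contra hx
  push Not at hx
  let i0 : Fin d := ⟨0, hd⟩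
  have hfin : {y | f y ≤ f x}.Finite := (h3 (-f x / 2) (by linarith)).subset fun y hy => by
    simp only [Set.mem_ofPred_eq] at *; linarith
  obtain ⟨z, hz, hzmin⟩ := Set.exists_min_image _ f hfin ⟨x, le_refl (f x)⟩
  have hfin2 : {y | f y ≤ f z}.Finite := hfin.subset fun y hy => by simp at *; linarith
  obtain ⟨w, hw, hwmax⟩ := Set.exists_max_image _ (fun y => y i0) hfin2 ⟨z, le_refl (f z)⟩
  simp only [Set.mem_ofPred_eq] at *
  have hall : ∀ y, f w ≤ f y := fun y => by
    by_cases h : f y ≤ f x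
    · exact hw.trans (hzmin y h)
    · linarith
  have hwB : w ∈ B := by
    by_contra h; have := h2 w h; linarith
  have h4 := h1 w hwB
  have h5 := avg_nbr (f := fun y => f y - f w) (fun y => sub_nonneg.2 (hall y)) w i0
  rw [avg_sub, avg_const hd] at h5
  have hd' : (0:ℝ) < d := by exact_mod_cast hd
  have h6 : f (w + ev i0) ≤ f w := by
    have := hall (w - ev i0)
    have h7 : 2 * (d:ℝ) * (avg f w - f w) ≤ 0 := mul_nonpos_of_nonneg_of_nonpos (by positivity) (by linarith)
    linarith
  have h8 := hwmax (w + ev i0) (h6.trans hw)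
  simp [ev] at h8

lemma iter_nonneg {g : V d → ℝ} (h : ∀ y, 0 ≤ g y) (t : ℕ) (x : V d) : 0 ≤ avg^[t] g x := by
  induction t generalizing x with
  | zero => exact h x
  | succ t ih => rw [Function.iterate_succ_apply']; exact avg_nonneg ih x

lemma pot_le {g F : V d → ℝ} (h : ∀ x, g x + avg F x ≤ F x) (h0 : ∀ x, 0 ≤ F x) (T : ℕ) (x : V d) :
    ∑ t ∈ Finset.range T, avg^[t] g x ≤ F x := by
  induction T generalizing x with
  | zero => simpa using h0 x
  | succ T ih =>
    rw [Finset.sum_range_succ']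
    have e : ∀ t, avg^[t+1] g x = avg (avg^[t] g) x := fun t => Function.iterate_succ_apply' _ _ _ ▸ rfl
    simp only [e]
    rw [← avg_sum]
    have := avg_mono' ih x
    have := h x
    simp only [Function.iterate_zero, id]; linarith

/-- squared norm -/
def nsq (x : V d) : ℝ := ∑ j, (x j : ℝ) ^ 2

lemma nsq_nonneg (x : V d) : 0 ≤ nsq x := Finset.sum_nonneg fun _ _ => sq_nonneg _

lemma nsq_add (x : V d) (i : Fin d) : nsq (x + ev i) = nsq x + 1 + 2 * x i := by
  unfold nsq ev
  rw [← Finset.add_sum_erase _ _ (Finset.mem_univ i), ← Finset.add_sum_erase _ (fun j => (x j : ℝ)^2) (Finset.mem_univ i)]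
  have : ∀ j ∈ Finset.univ.erase i, (((x + Pi.single i 1 : V d) j : ℤ) : ℝ) ^ 2 = (x j : ℝ)^2 := by
    intro j hj; simp [Pi.single_eq_of_ne (Finset.ne_of_mem_erase hj)]
  rw [Finset.sum_congr rfl this]; simp; ring

lemma nsq_sub (x : V d) (i : Fin d) : nsq (x - ev i) = nsq x + 1 - 2 * x i := by
  have := nsq_add (x - ev i) i
  rw [sub_add_cancel] at this
  simp [ev] at this ⊢; linarith

lemma sq_le_nsq (x : V d) (i : Fin d) : (x i : ℝ)^2 ≤ nsq x :=
  Finset.single_le_sum (f := fun j => (x j : ℝ)^2) (fun _ _ => sq_nonneg _) (Finset.mem_univ i)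

lemma nsq_finite (R : ℝ) : {x : V d | nsq x ≤ R}.Finite := by
  obtain ⟨n, hn⟩ := exists_nat_ge R
  apply (Set.finite_Icc (fun _ => -(n:ℤ) : V d) (fun _ => (n:ℤ))).subset
  intro x hx
  have key : ∀ i, |x i| ≤ (n:ℤ) := fun i => by
    have h1 := (sq_le_nsq x i).trans (le_trans hx hn)
    have h2 : |x i|^2 ≤ (n:ℤ) := by rw [sq_abs]; exact_mod_cast h1
    nlinarith [abs_nonneg (x i), sq_nonneg (|x i| - 1)]
  exact ⟨fun i => (abs_le.1 (key i)).1, fun i => (abs_le.1 (key i)).2⟩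
end USFPaper

namespace USFPaper
variable {d : ℕ}

lemma tay (α : ℝ) : ∃ C > 0, ∃ δ > 0, ∃ c3 : ℝ, ∀ u : ℝ, |u| ≤ δ →
    |(1+u)^(-α) - (1 - α * u + α*(α+1)/2 * u^2 + c3 * u^3)| ≤ C * u^4 := by
  have h := (Real.one_add_rpow_hasFPowerSeriesAt_zero (a := -α)).isBigO_sub_partialSum_pow 4
  obtain ⟨C, hC, hb⟩ := h.exists_pos
  rw [Asymptotics.IsBigOWith_def, Metric.eventually_nhds_iff] at hb
  obtain ⟨δ, hδ, hb⟩ := hb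
  refine ⟨C, hC, δ/2, by positivity, Ring.choose (-α) 3, fun u hu => ?_⟩
  have := hb (y := u) (by simp; linarith)
  simp [FormalMultilinearSeries.partialSum, binomialSeries, Finset.sum_range_succ] at this
  have e2 : Ring.choose (-α) 2 = α*(α+1)/2 := by
    have := Ring.descPochhammer_eq_factorial_smul_choose (-α) 2
    simp [descPochhammer_succ_right, Polynomial.smeval_mul, Polynomial.smeval_sub,
      Polynomial.smeval_X, Polynomial.smeval_one, Nat.factorial] at this
    linarith
  rw [e2] at this
  have e4 : |u|^4 = u^4 := by rw [← abs_pow]; exact abs_of_nonneg (by positivity)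
  rw [e4] at this
  convert this using 2; ring

/-- the radial function `(|x|^2+A)^(-α)` -/
noncomputable def rad (α A : ℝ) (x : V d) : ℝ := (nsq x + A) ^ (-α)

lemma rad_tay (hd : 0 < d) (α : ℝ) : ∃ C > 0, ∃ a0 ≥ 2, ∀ (A : ℝ) (x : V d),
    a0 ≤ nsq x + A + 1 → nsq x ≤ 2 * (nsq x + A + 1) →
    |rad α A x - avg (rad α A) x - (nsq x + A + 1)^(-α) *
      (α / (nsq x + A + 1) - 2*α*(α+1)*nsq x / (d * (nsq x + A + 1)^2))|
      ≤ C * (nsq x + A + 1)^(-α) / (nsq x + A + 1)^2 := by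
  obtain ⟨C, hC, δ, hδ, c3, h⟩ := tay α
  have hd' : (1:ℝ) ≤ d := by exact_mod_cast hd
  refine ⟨64 * C + |α*(α+1)/2| + |c3| + C, by positivity, max 9 (8/δ^2 + 1/δ), by
    exact le_trans (by norm_num) (le_max_left _ _), fun A x ha hx => ?_⟩
  set a := nsq x + A + 1 with had
  have ha9 : 9 ≤ a := (le_max_left _ _).trans ha
  have haδ : 8/δ^2 + 1/δ ≤ a := (le_max_right _ _).trans ha
  have ha0 : 0 < a := by linarith
  have hap : 0 < a^(-α) := Real.rpow_pos_of_pos ha0 _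
  set u : Fin d → ℝ := fun i => 2 * x i / a with hu
  have hui : ∀ i, (u i)^2 ≤ 8 / a := fun i => by
    have h1 := (sq_le_nsq x i).trans hx
    have : (u i)^2 = 4 * (x i)^2 / a^2 := by simp only [hu]; ring
    rw [this, div_le_div_iff₀ (by positivity) ha0]
    nlinarith
  have hu8 : ∀ i, (u i)^2 < 1 := fun i => (hui i).trans_lt (by rw [div_lt_one ha0]; linarith)
  have hud : ∀ i, |u i| ≤ δ := fun i => by
    apply abs_le_of_sq_le_sq _ hδ.le
    apply (hui i).trans
    rw [div_le_iff₀ ha0, ← div_le_iff₀' (by positivity)]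
    have : 0 < 1/δ := by positivity
    linarith
  have hsum : ∑ i, (u i)^2 = 4 * nsq x / a^2 := by
    simp only [hu, nsq]; rw [Finset.mul_sum, Finset.sum_div]
    exact Finset.sum_congr rfl fun i _ => by ring
  have hsum4 : ∑ i, (u i)^4 ≤ 64 / a^2 := by
    calc ∑ i, (u i)^4 ≤ ∑ i, (u i)^2 * (8/a) := Finset.sum_le_sum fun i _ => by
          have := hui i; nlinarith [sq_nonneg (u i)]
      _ = 4 * nsq x / a^2 * (8/a) := by rw [← Finset.sum_mul, hsum]
      _ ≤ 4 * (2*a) / a^2 * (8/a) := by gcongr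
      _ = 64/a^2 := by field_simp; ring
  have r1 : ∀ i, rad α A (x + ev i) = a^(-α) * (1 + u i)^(-α) := fun i => by
    have h1 : 0 ≤ 1 + u i := by nlinarith [hu8 i]
    rw [← Real.mul_rpow ha0.le h1]; unfold rad; rw [nsq_add]; congr 1
    simp only [hu]; field_simp; rw [had]; ring_nf
  have r2 : ∀ i, rad α A (x - ev i) = a^(-α) * (1 + -u i)^(-α) := fun i => by
    have h1 : 0 ≤ 1 + -u i := by nlinarith [hu8 i]
    rw [← Real.mul_rpow ha0.le h1]; unfold rad; rw [nsq_sub]; congr 1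
    simp only [hu]; field_simp; rw [had]; ring_nf
  have r0 : rad α A x = a^(-α) * (1 + -(1/a))^(-α) := by
    have h1 : 0 ≤ 1 + -(1/a) := by
      have : 1/a ≤ 1 := by rw [div_le_one ha0]; linarith
      linarith
    rw [← Real.mul_rpow ha0.le h1]; unfold rad; congr 1
    field_simp; rw [had]; ring_nf
  have t0 := h (-(1/a)) (by
    rw [abs_neg, abs_of_pos (by positivity), div_le_iff₀ ha0, ← div_le_iff₀' hδ]
    have : 0 < 8/δ^2 := by positivity
    linarith)
  have hav : |∑ i, ((1 + u i)^(-α) + (1 + -u i)^(-α) - (2 + α*(α+1)*(u i)^2))| ≤ 2 * C * (64/a^2) := by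
    apply (Finset.abs_sum_le_sum_abs _ _).trans
    calc _ ≤ ∑ i, 2 * C * (u i)^4 := Finset.sum_le_sum fun i _ => by
          have h1 := h (u i) (hud i)
          have h2 := h (-u i) (by rw [abs_neg]; exact hud i)
          rw [abs_le] at *
          constructor <;> nlinarith
      _ ≤ _ := by rw [← Finset.mul_sum]; gcongr
  rw [Finset.sum_sub_distrib, Finset.sum_add_distrib (f := fun _ => (2:ℝ)), ← Finset.mul_sum, hsum] at hav
  have havg : avg (rad α A) x = a^(-α) * ((2 * (d : ℝ))⁻¹ * ∑ i, ((1 + u i)^(-α) + (1 + -u i)^(-α))) := by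
    unfold avg; simp only [r1, r2, ← mul_add]; rw [← Finset.mul_sum]; ring
  set S := ∑ i, ((1 + u i)^(-α) + (1 + -u i)^(-α)) with hS
  simp only [Finset.sum_const, Finset.card_univ, Fintype.card_fin, nsmul_eq_mul] at hav
  set R := (1 + -(1/a))^(-α) with hR
  rw [r0, havg]
  have e1 : |(2 * (d : ℝ))⁻¹ * S - (1 + 2*α*(α+1) * nsq x / (d * a^2))| ≤ 64 * C/a^2 := by
    have : (2 * (d : ℝ))⁻¹ * S - (1 + 2*α*(α+1) * nsq x / (d * a^2)) =
      (2 * (d : ℝ))⁻¹ * (S - (d * 2 + α*(α+1)*(4 * nsq x / a^2))) := by field_simp; ring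
    rw [this, abs_mul, abs_of_pos (by positivity)]
    calc (2 * (d : ℝ))⁻¹ * _ ≤ (2 * (d : ℝ))⁻¹ * (2*C*(64/a^2)) := by gcongr
      _ ≤ (2 * (1 : ℝ))⁻¹ * (2*C*(64/a^2)) := by gcongr
      _ = _ := by ring
  have e0 : |R - (1 + α/a)| ≤ (|α*(α+1)/2| + |c3| + C)/a^2 := by
    have i1 : 1/a ≤ 1 := by rw [div_le_one ha0]; linarith
    have i0 : 0 < 1/a := by positivity
    set v := 1/a with hv
    have hv2 : ∀ z : ℝ, z / a^2 = z * v^2 := fun z => by rw [hv]; ring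
    have hv1 : α / a = α * v := by rw [hv]; ring
    rw [hv2, hv1]
    have k3 : |c3| * v^3 ≤ |c3| * v^2 := mul_le_mul_of_nonneg_left (pow_le_pow_of_le_one i0.le i1 (by norm_num)) (abs_nonneg _)
    have k4 : C * v^4 ≤ C * v^2 := mul_le_mul_of_nonneg_left (pow_le_pow_of_le_one i0.le i1 (by norm_num)) hC.le
    have k2 := abs_nonneg (α*(α+1)/2)
    have j2 := mul_le_mul_of_nonneg_right (le_abs_self (α*(α+1)/2)) (sq_nonneg v)
    have j2' := mul_le_mul_of_nonneg_right (neg_abs_le (α*(α+1)/2)) (sq_nonneg v)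
    have j3 := mul_le_mul_of_nonneg_right (le_abs_self c3) (pow_nonneg i0.le 3)
    have j3' := mul_le_mul_of_nonneg_right (neg_abs_le c3) (pow_nonneg i0.le 3)
    have q1 : (1 - α * -v + α*(α+1)/2 * (-v)^2 + c3 * (-v)^3) = 1 + α*v + α*(α+1)/2 * v^2 - c3 * v^3 := by ring
    have q2 : C * (-v)^4 = C * v^4 := by ring
    rw [q1, q2] at t0
    rw [abs_le] at t0 ⊢
    obtain ⟨t1, t2⟩ := t0
    rw [add_mul, add_mul]
    constructor <;> linarith
  have : a^(-α) * R - a^(-α) * ((2 * (d : ℝ))⁻¹ * S) - a^(-α) * (α / a - 2*α*(α+1)*nsq x / (d * a^2))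
    = a^(-α) * ((R - (1 + α/a)) - ((2 * (d : ℝ))⁻¹ * S - (1 + 2*α*(α+1) * nsq x / (d * a^2)))) := by ring
  rw [this, abs_mul, abs_of_pos hap]
  have h3 := (abs_sub (R - (1 + α/a)) ((2 * (d : ℝ))⁻¹ * S - (1 + 2*α*(α+1) * nsq x / (d * a^2)))).trans (add_le_add e0 e1)
  calc _ ≤ a^(-α) * _ := mul_le_mul_of_nonneg_left h3 hap.le
    _ = _ := by ring
end USFPaper

namespace USFPaper
variable {d : ℕ}

lemma step_chain (hd : 0 < d) {u : V d → ℝ} (hu : ∀ y, 0 ≤ u y) {lo hi : V d}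
    (h : ∀ y ∈ Set.Icc lo hi, avg u y ≤ u y) (n : ℕ) (y y' : V d) (hy : y ∈ Set.Icc lo hi)
    (hy' : y' ∈ Set.Icc lo hi) (hn : ∑ i, (y i - y' i).natAbs ≤ n) :
    u y' ≤ (2 * d) ^ n * u y := by
  induction n generalizing y with
  | zero =>
    have : y = y' := by
      funext i
      have := Finset.sum_eq_zero_iff.1 (Nat.le_zero.1 hn) i (Finset.mem_univ i)
      omega
    simp [this]
  | succ n ih =>
    have hd1 : (1:ℝ) ≤ d := by exact_mod_cast hd
    by_cases he : y = y'
    · subst he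
      exact le_mul_of_one_le_left (hu y) (one_le_pow₀ (by linarith))
    obtain ⟨i, hi'⟩ := Function.ne_iff.1 he
    have key : ∀ z : V d, (∀ j, j ≠ i → z j = y j) → (z i = y i + 1 ∧ y i < y' i ∨ z i = y i - 1 ∧ y' i < y i) →
        u z ≤ 2 * d * avg u y → u y' ≤ (2 * d) ^ (n+1) * u y := by
      intro z hz1 hz2 hz3
      have hz : z ∈ Set.Icc lo hi := by
        constructor <;> intro j <;> by_cases hj : j = i
        · subst hj; have h1 : lo j ≤ y j := hy.1 j
          have h2 : lo j ≤ y' j := hy'.1 j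
          show lo j ≤ z j
          omega
        · rw [hz1 j hj]; exact hy.1 j
        · subst hj; have h1 : y j ≤ hi j := hy.2 j
          have h2 : y' j ≤ hi j := hy'.2 j
          show z j ≤ hi j
          omega
        · rw [hz1 j hj]; exact hy.2 j
      have hs : ∑ j, (z j - y' j).natAbs ≤ n := by
        rw [← Finset.add_sum_erase _ _ (Finset.mem_univ i)] at hn ⊢
        have : ∑ j ∈ Finset.univ.erase i, (z j - y' j).natAbs = ∑ j ∈ Finset.univ.erase i, (y j - y' j).natAbs :=
          Finset.sum_congr rfl fun j hj => by rw [hz1 j (Finset.ne_of_mem_erase hj)]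
        omega
      have := ih z hz hs
      have h2 := h y hy
      calc u y' ≤ (2*d)^n * u z := this
        _ ≤ (2*d)^n * (2 * d * u y) := by gcongr; exact hz3.trans (by gcongr)
        _ = _ := by ring
    have hnb := avg_nbr hu y i
    rcases lt_or_gt_of_ne hi' with hlt | hlt
    · apply key (y + ev i)
      · intro j hj; simp [ev, hj]
      · simp [ev]; omega
      · have := hu (y - ev i); linarith
    · apply key (y - ev i)
      · intro j hj; simp [ev, hj]
      · simp [ev]; omega
      · have := hu (y + ev i); linarith

lemma rad_pos {α A : ℝ} (hA : 0 < A) (x : V d) : 0 < rad α A x :=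
  Real.rpow_pos_of_pos (by have := nsq_nonneg x; linarith) _

lemma rad_gain (hd : 0 < d) {α : ℝ} (hα : 0 < α) :
    ∃ A0 ≥ (1:ℝ), ∀ A ≥ A0, ∀ x : V d, (nsq x + A + 1)^(-α) *
      (α * (1 - 2*(α+1)/d) / (nsq x + A + 1) + 1 / (nsq x + A + 1)^2) ≤ rad α A x - avg (rad α A) x := by
  obtain ⟨C, hC, a0, ha0, h⟩ := rad_tay hd α
  have hd' : (0:ℝ) < d := by exact_mod_cast hd
  refine ⟨a0 + d * (C + 1) / (2*α*(α+1)), ?_, fun A hA x => ?_⟩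
  · have : 0 < d * (C + 1) / (2*α*(α+1)) := by positivity
    linarith
  have hx := nsq_nonneg x
  have hp : 0 < d * (C + 1) / (2*α*(α+1)) := by positivity
  have h1 := (abs_le.1 (h A x (by linarith) (by linarith))).1
  set a := nsq x + A + 1 with ha
  have hapos : 0 < a := by linarith
  have hap : 0 < a^(-α) := Real.rpow_pos_of_pos hapos _
  have h2 : d * (C+1) ≤ 2*α*(α+1) * (A+1) := by
    rw [mul_comm (2*α*(α+1)), ← div_le_iff₀ (by positivity)]; linarith
  have e : a^(-α) * (α / a - 2*α*(α+1)*nsq x / (d * a^2)) - C * a^(-α) / a^2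
      - a^(-α) * (α * (1 - 2*(α+1)/d) / a + 1 / a^2)
      = a^(-α) * (2*α*(α+1)*(A+1) - d * (C+1)) / (d * a^2) := by
    have : nsq x = a - (A + 1) := by rw [ha]; ring
    rw [this]; field_simp; ring
  have : 0 ≤ a^(-α) * (2*α*(α+1)*(A+1) - d * (C+1)) / (d * a^2) :=
    div_nonneg (mul_nonneg hap.le (by linarith)) (by positivity)
  linarith

/-- gain with constant in terms of `rad (α+1)` -/
lemma rad_gain' (hd : 0 < d) {α : ℝ} (hα : 0 < α) (h2 : 2 * (α+1) < d) :
    ∃ A0 ≥ (1:ℝ), ∃ c > 0, ∀ A ≥ A0, ∀ x : V d, c * rad (α+1) A x + avg (rad α A) x ≤ rad α A x := by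
  obtain ⟨A0, hA0, h⟩ := rad_gain hd hα
  have hd' : (0:ℝ) < d := by exact_mod_cast hd
  have hg : 0 < 1 - 2*(α+1)/d := by rw [sub_pos, div_lt_one hd']; exact h2
  refine ⟨A0, hA0, 2^(-(α+1)) * (α * (1 - 2*(α+1)/d)), by positivity, fun A hA x => ?_⟩
  have := h A hA x
  have hx := nsq_nonneg x
  unfold rad at *
  set s := nsq x + A with hs
  have hs1 : 1 ≤ s := by linarith
  have h3 : (2 * s)^(-(α+1)) ≤ (s+1)^(-(α+1)) :=
    Real.rpow_le_rpow_of_nonpos (by linarith) (by linarith) (by linarith)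
  rw [Real.mul_rpow (by norm_num) (by linarith)] at h3
  have e : (s+1)^(-(α+1)) = (s+1)^(-α) / (s+1) := by
    rw [neg_add, Real.rpow_add (by linarith), Real.rpow_neg_one]; rfl
  have h4 : 0 < (s+1)^(-α) := Real.rpow_pos_of_pos (by linarith) _
  have h5 : 0 ≤ (s+1)^(-α) * (1 / (s+1)^2) := by positivity
  calc _ = (2^(-(α+1)) * s^(-(α+1))) * (α * (1 - 2*(α+1)/d)) + avg (fun x => (nsq x + A)^(-α)) x := by ring
    _ ≤ (s+1)^(-(α+1)) * (α * (1 - 2*(α+1)/d)) + avg (fun x => (nsq x + A)^(-α)) x := by gcongr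
    _ = (s+1)^(-α) * (α * (1 - 2*(α+1)/d) / (s+1)) + avg (fun x => (nsq x + A)^(-α)) x := by rw [e]; ring
    _ ≤ _ := by rw [mul_add] at this; linarith

/-- delta at zero, Green function -/
noncomputable def dl (x : V d) : ℝ := if x = 0 then 1 else 0
noncomputable def G (x : V d) : ℝ := ∑' t, avg^[t] dl x

lemma dl_nonneg (x : V d) : 0 ≤ dl x := by unfold dl; split_ifs <;> norm_num

/-- exponent -/
noncomputable def ex (d : ℕ) : ℝ := ((d:ℝ) - 2) / 2

lemma G_basic (hd : 5 ≤ d) : (∀ x : V d, Summable (fun t => avg^[t] dl x)) ∧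
    ∃ A ≥ (1:ℝ), ∃ C > 0, ∀ x : V d, G x ≤ C * rad (ex d) A x := by
  have hd5 : (5:ℝ) ≤ d := by exact_mod_cast hd
  obtain ⟨A, hA, h⟩ := rad_gain (d := d) (by omega) (α := ex d) (by unfold ex; linarith)
  have h0 : 2 * (ex d + 1) / d = 1 := by unfold ex; field_simp; ring
  set c := (A+1)^(-ex d) * (1/(A+1)^2) with hc
  have hcp : 0 < c := mul_pos (Real.rpow_pos_of_pos (by linarith) _) (by positivity)
  have hF : ∀ x : V d, dl x + avg (fun y => c⁻¹ * rad (ex d) A y) x ≤ c⁻¹ * rad (ex d) A x := by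
    intro x
    rw [avg_smul]
    have h1 := h A le_rfl x
    rw [h0] at h1
    by_cases hx : x = 0
    · have : nsq x = 0 := by simp [hx, nsq]
      simp [this] at h1
      rw [show ((A+1)^2)⁻¹ = 1/(A+1)^2 by ring, ← hc] at h1
      have := mul_le_mul_of_nonneg_left h1 (inv_pos.2 hcp).le
      rw [inv_mul_cancel₀ hcp.ne', mul_sub] at this
      simp only [dl, hx, if_true] at this ⊢; linarith
    · have h3 : 0 ≤ rad (ex d) A x - avg (rad (ex d) A) x := by
        refine le_trans (mul_nonneg (Real.rpow_nonneg ?_ _) ?_) h1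
        · have := nsq_nonneg x; linarith
        · simp; positivity
      have := mul_nonneg (inv_pos.2 hcp).le h3
      simp only [dl, hx, if_false]; linarith
  have hF0 : ∀ x : V d, 0 ≤ c⁻¹ * rad (ex d) A x := fun x =>
    mul_nonneg (inv_pos.2 hcp).le (rad_pos (by linarith) x).le
  refine ⟨fun x => summable_of_sum_range_le (fun t => iter_nonneg dl_nonneg t x)
    (fun T => pot_le hF hF0 T x), A, hA, c⁻¹, by positivity, fun x => ?_⟩
  exact Real.tsum_le_of_sum_range_le (fun t => iter_nonneg dl_nonneg t x) (fun T => pot_le hF hF0 T x)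

lemma G_nonneg (x : V d) : 0 ≤ G x := tsum_nonneg fun t => iter_nonneg dl_nonneg t x

lemma avg_G (hd : 5 ≤ d) (x : V d) : avg G x = G x - dl x := by
  have hs := (G_basic hd).1
  have h1 : G x = dl x + ∑' t, avg^[t+1] dl x := by
    unfold G; rw [(hs x).tsum_eq_zero_add]; rfl
  rw [h1]
  have h2 : ∀ t, avg^[t+1] dl x = (2 * (d : ℝ))⁻¹ * ∑ i : Fin d, (avg^[t] dl (x + ev i) + avg^[t] dl (x - ev i)) :=
    fun t => by rw [Function.iterate_succ_apply']; rfl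
  simp only [h2]
  rw [show avg G x = (2 * (d : ℝ))⁻¹ * ∑ i : Fin d, (G (x + ev i) + G (x - ev i)) from rfl, tsum_mul_left, Summable.tsum_finsetSum (fun i _ => (hs _).add (hs _))]
  rw [add_sub_cancel_left]; congr 1
  exact Finset.sum_congr rfl fun i _ => by rw [(hs _).tsum_add (hs _)]; rfl

lemma G_pos (hd : 5 ≤ d) (x : V d) : 0 < G x := by
  have h0 : 1 ≤ G (0 : V d) := by
    have := avg_G hd 0
    have h2 := avg_nonneg (f := G) G_nonneg (0 : V d)
    simp [dl] at this; linarith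
  have := step_chain (by omega) (u := G) G_nonneg (lo := x ⊓ 0) (hi := x ⊔ 0)
    (fun y _ => by rw [avg_G hd]; have := dl_nonneg y; linarith)
    (∑ i, (x i - (0 : V d) i).natAbs) x 0 ⟨inf_le_left, le_sup_left⟩ ⟨inf_le_right, le_sup_right⟩ le_rfl
  by_contra hx
  have hx0 : G x = 0 := le_antisymm (not_lt.1 hx) (G_nonneg x)
  rw [hx0, mul_zero] at this; linarith

lemma G_lower (hd : 5 ≤ d) : ∃ c > 0, ∀ x : V d, c * rad (ex d) 1 x ≤ G x := by
  have hd5 : (5:ℝ) ≤ d := by exact_mod_cast hd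
  have hd' : (0:ℝ) < d := by linarith
  have hα : 0 < ex d := by unfold ex; linarith
  obtain ⟨C, hC, a0, ha0, h⟩ := rad_tay (d := d) (by omega) (ex d)
  set α := ex d with hαd
  set A := 1 + d * C / (2*α*(α+1)) with hA
  have hA1 : 1 ≤ A := by have : 0 < d * C / (2*α*(α+1)) := by positivity
                         linarith
  have hCA : d * C ≤ 2*α*(α+1) * (A - 1) := by rw [hA]; field_simp; linarith
  set f : V d → ℝ := rad α (-A) with hf
  set R := 2 * A + a0 with hR
  have hsub : ∀ x : V d, R ≤ nsq x → f x ≤ avg f x := by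
    intro x hx
    have h1 := (abs_le.1 (h (-A) x (by linarith) (by linarith))).2
    set a := nsq x + -A + 1 with ha
    have hapos : 0 < a := by linarith
    have hap : 0 < a^(-α) := Real.rpow_pos_of_pos hapos _
    have e : a^(-α) * (α / a - 2*α*(α+1)*nsq x / (d * a^2)) + C * a^(-α) / a^2
      = a^(-α) * (d * C - 2*α*(α+1)*(A-1)) / (d * a^2) := by
      have : nsq x = a + (A - 1) := by rw [ha]; ring
      have hh : (d:ℝ) = 2 * (α + 1) := by rw [hαd]; unfold ex; ring
      rw [this, hh]; field_simp; ring
    have : a^(-α) * (d * C - 2*α*(α+1)*(A-1)) / (d * a^2) ≤ 0 :=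
      div_nonpos_of_nonpos_of_nonneg (mul_nonpos_of_nonneg_of_nonpos hap.le (by linarith)) (by positivity)
    rw [hf]; linarith
  obtain ⟨K, hK⟩ := ((nsq_finite (d := d) R).image (fun x => (|f x| + 1) / G x)).bddAbove
  have hKx : ∀ x : V d, nsq x ≤ R → |f x| + 1 ≤ K * G x := fun x hx => by
    have := hK ⟨x, hx, rfl⟩
    rwa [div_le_iff₀ (G_pos hd x)] at this
  have hK0 : 0 < K := by
    have := hKx 0 (by simp [nsq]; linarith)
    by_contra hk
    have h2 := mul_nonpos_of_nonpos_of_nonneg (not_lt.1 hk) (G_nonneg (0 : V d))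
    have := abs_nonneg (f 0); linarith
  have main : ∀ x : V d, 0 ≤ K * G x - f x := by
    apply minP (by omega) (B := {x | R < nsq x})
    · intro x hx
      simp only [Set.mem_ofPred_eq] at hx
      rw [avg_sub, avg_smul, avg_G hd]
      have := hsub x hx.le
      have := mul_nonneg hK0.le (dl_nonneg x)
      linarith
    · intro x hx
      simp only [Set.mem_ofPred_eq, not_lt] at hx
      have := hKx x hx; have := le_abs_self (f x); linarith
    · intro ε hε
      apply (nsq_finite (d := d) (R + ε^(-(1/α)) + A)).subset
      intro x hx
      simp only [Set.mem_ofPred_eq] at *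
      by_contra hlt
      push Not at hlt
      have hp := Real.rpow_pos_of_pos hε (-(1/α))
      have h3 : f x ≤ ε := by
        rw [hf]; unfold rad
        calc (nsq x + -A)^(-α) ≤ (ε^(-(1/α)))^(-α) :=
              Real.rpow_le_rpow_of_nonpos hp (by linarith) (by linarith)
          _ = ε := by rw [← Real.rpow_mul hε.le]; field_simp; simp
      have := mul_nonneg hK0.le (G_nonneg x)
      linarith
  refine ⟨K⁻¹, by positivity, fun x => ?_⟩
  rw [inv_mul_le_iff₀ hK0]
  by_cases hx : nsq x ≤ R
  · have := hKx x hx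
    have h1 : rad α 1 x ≤ 1 := Real.rpow_le_one_of_one_le_of_nonpos (by have := nsq_nonneg x; linarith) (by linarith)
    have := abs_nonneg (f x); linarith
  · have := main x
    have h1 : rad α 1 x ≤ f x := Real.rpow_le_rpow_of_nonpos (by linarith) (by linarith) (by linarith)
    linarith
end USFPaper

namespace USFPaper
variable {d : ℕ}

lemma rad_pow {r : ℝ} (hr : 0 < r) (hd : 5 ≤ d) : (r^2)^(-ex d) = (r^(d-2))⁻¹ := by
  have : ((d - 2 : ℕ) : ℝ) = (d:ℝ) - 2 := by rw [Nat.cast_sub (by omega)]; norm_num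
  rw [Real.rpow_neg (by positivity), ← Real.rpow_natCast r 2, ← Real.rpow_mul hr.le]
  unfold ex
  rw [← Real.rpow_natCast r (d-2), this]; congr 2; push_cast; ring

lemma GU (hd : 5 ≤ d) : ∃ C > 0, ∀ r : ℕ, 1 ≤ r → ∀ (x : V d) (i : Fin d), (r:ℤ) ≤ |x i| →
    G x * (r:ℝ)^(d-2) ≤ C := by
  obtain ⟨A, hA, C, hC, h⟩ := (G_basic hd).2
  refine ⟨C, hC, fun r hr x i hx => ?_⟩
  have hr' : (0:ℝ) < r := by exact_mod_cast hr
  have h1 : (r:ℝ)^2 ≤ nsq x := by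
    refine le_trans ?_ (sq_le_nsq x i)
    have : (r:ℝ) ≤ |(x i : ℝ)| := by exact_mod_cast hx
    rw [← sq_abs (x i : ℝ)]; gcongr
  have h2 : rad (ex d) A x ≤ ((r:ℝ)^(d-2))⁻¹ := by
    rw [← rad_pow hr' hd]
    exact Real.rpow_le_rpow_of_nonpos (by positivity) (by linarith) (by
      have : (5:ℝ) ≤ d := by exact_mod_cast hd
      unfold ex; linarith)
  calc G x * (r:ℝ)^(d-2) ≤ C * ((r:ℝ)^(d-2))⁻¹ * (r:ℝ)^(d-2) := by
        gcongr; exact (h x).trans (by gcongr)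
    _ = C := by field_simp

lemma GLow (hd : 5 ≤ d) : ∃ c > 0, ∀ r : ℕ, 1 ≤ r → ∀ x : V d, (∀ i, |x i| ≤ (r:ℤ)) →
    c ≤ G x * (r:ℝ)^(d-2) := by
  obtain ⟨c, hc, h⟩ := G_lower hd
  have hd0 : (0:ℝ) < d := by exact_mod_cast (by omega : 0 < d)
  refine ⟨c * ((d:ℝ)+1)^(-ex d), mul_pos hc (Real.rpow_pos_of_pos (by linarith) _), fun r hr x hx => ?_⟩
  have hr' : (1:ℝ) ≤ r := by exact_mod_cast hr
  have h1 : nsq x + 1 ≤ (d+1) * (r:ℝ)^2 := by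
    have : nsq x ≤ ∑ _i : Fin d, (r:ℝ)^2 := Finset.sum_le_sum fun i _ => by
      have : |(x i : ℝ)| ≤ r := by exact_mod_cast hx i
      rw [← sq_abs]; gcongr
    simp at this; nlinarith
  have h2 : ((d:ℝ)+1)^(-ex d) * ((r:ℝ)^(d-2))⁻¹ ≤ rad (ex d) 1 x := by
    rw [← rad_pow (by linarith) hd, ← Real.mul_rpow (by linarith) (by positivity)]
    exact Real.rpow_le_rpow_of_nonpos (by have := nsq_nonneg x; linarith) h1 (by
      have : (5:ℝ) ≤ d := by exact_mod_cast hd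
      unfold ex; linarith)
  calc c * ((d:ℝ)+1)^(-ex d) = c * (((d:ℝ)+1)^(-ex d) * ((r:ℝ)^(d-2))⁻¹) * (r:ℝ)^(d-2) := by field_simp
    _ ≤ c * rad (ex d) 1 x * (r:ℝ)^(d-2) := by gcongr
    _ ≤ _ := by gcongr; exact h x

lemma SBP {φ h : V d → ℝ} (hφ : φ.support.Finite) (hh : ∀ y, φ y ≠ 0 → avg h y = h y) :
    Summable (fun y => h y * (avg φ y - φ y)) ∧ ∑' y, h y * (avg φ y - φ y) = 0 := by
  have s0 : ∀ (g : V d → ℝ) (v : V d), Summable (fun y => g y * φ (y + v)) := fun g v => by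
    apply summable_of_hasFiniteSupport
    apply (hφ.preimage (f := fun y => y + v) (by intro a _ b _ h; simpa using h)).subset
    intro y hy
    simp at hy ⊢; exact hy.2
  have s1 : ∀ (g : V d → ℝ), Summable (fun y => g y * φ y) := fun g => by simpa using s0 g 0
  have t0 : ∀ (v : V d), ∑' y, h y * φ (y + v) = ∑' y, h (y - v) * φ y := fun v => by
    rw [← (Equiv.addRight v).tsum_eq (fun y => h (y - v) * φ y)]
    simp
  have s2 : ∀ i : Fin d, Summable fun y => h y * φ (y + ev i) + h y * φ (y - ev i) := fun i => by
    simpa [sub_eq_add_neg] using (s0 h (ev i)).add (s0 h (-ev i))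
  have s3 : ∀ i : Fin d, Summable fun y => h (y + ev i) * φ y + h (y - ev i) * φ y := fun i =>
    (s1 _).add (s1 _)
  have e1 : ∀ y, h y * (avg φ y - φ y) =
      (2 * (d : ℝ))⁻¹ * ∑ i, (h y * φ (y + ev i) + h y * φ (y - ev i)) - h y * φ y := fun y => by
    unfold avg; rw [mul_sub, mul_left_comm, Finset.mul_sum]; simp only [mul_add]
  have s4 := (summable_sum (s := Finset.univ) fun i _ => s2 i).mul_left (2 * (d : ℝ))⁻¹
  simp only [e1]
  refine ⟨s4.sub (s1 h), ?_⟩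
  rw [s4.tsum_sub (s1 h), tsum_mul_left, Summable.tsum_finsetSum (fun i _ => s2 i)]
  have e2 : ∀ i : Fin d, ∑' y, (h y * φ (y + ev i) + h y * φ (y - ev i)) =
      ∑' y, (h (y + ev i) * φ y + h (y - ev i) * φ y) := fun i => by
    have := t0 (-ev i)
    simp only [← sub_eq_add_neg, sub_neg_eq_add] at this
    rw [(s0 h (ev i)).tsum_add (by simpa [sub_eq_add_neg] using s0 h (-ev i)), t0, this,
      (s1 _).tsum_add (s1 _), add_comm]
  simp only [e2]
  rw [← Summable.tsum_finsetSum (fun i _ => s3 i), ← tsum_mul_left, sub_eq_zero]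
  apply tsum_congr
  intro y
  by_cases hy : φ y = 0
  · simp [hy]
  · rw [← hh y hy]; unfold avg; simp only [← add_mul]; rw [← Finset.sum_mul]; ring

lemma cube_finite (z : V d) (r : ℕ) : (cube z r).Finite := by
  apply (Set.finite_Icc (fun i => z i - r : V d) (fun i => z i + r)).subset
  intro y hy
  exact ⟨fun i => by have := abs_le.1 (hy i); show z i - r ≤ y i; omega,
    fun i => by have := abs_le.1 (hy i); show y i ≤ z i + r; omega⟩

lemma ev_abs (i j : Fin d) : |(ev i : V d) j| ≤ 1 := by
  unfold ev; by_cases h : j = i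
  · subst h; simp
  · simp [h]

lemma avg_Gs (hd : 5 ≤ d) (x y : V d) : avg (fun w => G (w - x)) y = G (y - x) - dl (y - x) := by
  have := avg_shift G (-x) y
  simp only [← sub_eq_add_neg] at this
  rw [this, avg_G hd]

lemma harnack0 (hd : 5 ≤ d) : ∃ M : ℕ, 1 ≤ M ∧ ∃ C > 0, ∀ ρ : ℕ, 1 ≤ ρ → ∀ (z : V d) (h : V d → ℝ),
    (∀ y, 0 ≤ h y) → (∀ y ∈ cube z (M * ρ), avg h y = h y) → ∀ x ∈ cube z ρ, ∀ x' ∈ cube z ρ,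
    h x ≤ C * h x' := by
  obtain ⟨C1, hC1, hU⟩ := GU hd
  obtain ⟨c, hc, hL⟩ := GLow hd
  set C := 2 * C1 * 4^(d-2) / c with hC
  have hC0 : 0 < C := by positivity
  obtain ⟨M, hM⟩ := exists_nat_ge (2 * C1 * 4^(d-2) / c)
  refine ⟨M + 4, by omega, C, hC0, fun ρ hρ z h h0 hh x hx x' hx' => ?_⟩
  have hρ' : (1:ℝ) ≤ ρ := by exact_mod_cast hρ
  have hM0 : 0 < (M:ℝ) := lt_of_lt_of_le hC0 hM
  have hM1 : 1 ≤ M := by exact_mod_cast hM0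
  set D := (ρ:ℝ)^(d-2) with hD
  have hDp : 0 < D := by positivity
  set b := C1 / D with hb
  set κ := C * (C1 / ((M * ρ : ℕ):ℝ)^(d-2)) with hκ
  have key1 : ∀ (w : V d), w ∈ cube z ρ → ∀ (R r : ℕ), R = r + ρ → ∀ y ∉ cube z R, 1 ≤ r →
      G (y - w) ≤ C1 / (r:ℝ)^(d-2) := by
    intro w hw R r hR y hy hr
    simp only [cube, Set.mem_ofPred_eq, not_forall, not_le] at hy
    obtain ⟨i, hi⟩ := hy
    rw [le_div_iff₀ (by positivity)]
    apply hU r hr _ i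
    have := hw i
    simp only [Pi.sub_apply]
    have h3 := abs_sub_abs_le_abs_sub (y i - z i) (w i - z i)
    rw [sub_sub_sub_cancel_right] at h3
    push_cast [hR] at hi; omega
  have hκle : κ ≤ C * (c / 4^(d-2) / 2) / D := by
    rw [hκ, mul_div_assoc]; refine mul_le_mul_of_nonneg_left ?_ hC0.le
    rw [div_le_div_iff₀ (by positivity) hDp]
    have h5 : (M:ℝ) * D ≤ ((M * ρ : ℕ):ℝ)^(d-2) := by
      push_cast; rw [mul_pow]; gcongr
      exact le_self_pow₀ (by exact_mod_cast hM1) (by omega)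
    calc C1 * D = c / 4^(d-2) / 2 * (2 * C1 * 4^(d-2) / c * D) := by field_simp
      _ ≤ c / 4^(d-2) / 2 * (M * D) := by gcongr
      _ ≤ _ := by gcongr
  have hnear : ∀ y ∈ cube z (3*ρ), b ≤ C * G (y - x') - κ := by
    intro y hy
    have h1 := hL (4*ρ) (by omega) (y - x') (fun i => by
      have h1 := abs_le.1 (hy i); have h2 := abs_le.1 (hx' i)
      push_cast at *
      rw [abs_le, Pi.sub_apply]; constructor <;> linarith)
    have h2 : c / 4^(d-2) / D ≤ G (y - x') := by
      rw [div_div, div_le_iff₀ (by positivity)]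
      push_cast at h1; rw [mul_pow] at h1; exact h1
    have : C * (c / 4^(d-2) / D) - C * (c / 4^(d-2) / 2) / D = b := by
      rw [hb, hC]; field_simp; ring
    have := mul_le_mul_of_nonneg_left h2 hC0.le
    linarith
  set Ψ : V d → ℝ := fun y => max (C * G (y - x') - κ) (min (G (y - x)) b) with hΨ
  set φ : V d → ℝ := fun y => Ψ y - G (y - x) with hφd
  have hsupp : ∀ y ∉ cube z ((M+4)*ρ), φ y = 0 := by
    intro y hy
    have hy1 : y ∉ cube z (M * ρ + ρ) := fun h' => hy fun i => (h' i).trans (by push_cast; nlinarith)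
    have hy2 : y ∉ cube z (ρ + ρ) := fun h' => hy fun i => (h' i).trans (by push_cast; nlinarith)
    have h1 := key1 x' hx' _ (M*ρ) rfl y hy1 (by nlinarith)
    have h2 := key1 x hx _ ρ rfl y hy2 hρ
    have h3 : C * G (y - x') ≤ κ := by rw [hκ]; gcongr
    have h4 := G_nonneg (y - x)
    simp only [hφd, hΨ]
    rw [min_eq_left h2, max_eq_right (by linarith), sub_self]
  have hfin : φ.support.Finite := (cube_finite z ((M+4)*ρ)).subset fun y hy => by
    by_contra h'; exact hy (hsupp y h')
  obtain ⟨hs, ht⟩ := SBP hfin (h := h) (fun y hy => hh y (by by_contra h'; exact hy (hsupp y h')))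
  have hpt : ∀ y, dl (y - x) - C * dl (y - x') ≤ avg φ y - φ y := by
    intro y
    have e1 : avg φ y = avg Ψ y - (G (y - x) - dl (y - x)) := by rw [hφd, avg_sub, avg_Gs hd]
    suffices Ψ y - C * dl (y - x') ≤ avg Ψ y by rw [e1]; simp only [hφd]; linarith
    by_cases hc1 : min (G (y - x)) b ≤ C * G (y - x') - κ
    · have : Ψ y = C * G (y - x') - κ := max_eq_left hc1
      have h2 : avg (fun w => C * G (w - x') - κ) y ≤ avg Ψ y := avg_mono' (fun w => le_max_left _ _) y
      rw [avg_sub, avg_const (by omega), avg_smul, avg_Gs hd] at h2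
      linarith
    · have hfar : y ∉ cube z (3*ρ) := fun h' => hc1 ((min_le_right _ _).trans (hnear y h'))
      have hG : ∀ w : V d, (∀ i, |w i - y i| ≤ 1) → G (w - x) ≤ b := fun w hw => by
        refine key1 x hx _ ρ rfl w (fun h' => hfar fun i => ?_) hρ
        have h1 := abs_le.1 (h' i); have h2 := abs_le.1 (hw i)
        push_cast at *
        rw [abs_le]; constructor <;> linarith
      have h0' : G (y - x) ≤ b := hG y (by simp)
      have hyx : y - x ≠ 0 := fun h' => by
        rw [sub_eq_zero] at h'; subst h'
        exact hfar fun i => (hx i).trans (by push_cast; linarith)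
      have h1 : Ψ y = G (y - x) := by
        simp only [hΨ]; rw [min_eq_left h0'] at hc1 ⊢; exact max_eq_right (not_le.1 hc1).le
      have hnb : ∀ w : V d, (∀ i, |w i - y i| ≤ 1) → G (w - x) ≤ Ψ w := fun w hw =>
        le_trans (le_min le_rfl (hG w hw)) (le_max_right _ _)
      have h2 : avg (fun w => G (w - x)) y ≤ avg Ψ y := avg_mono
        (fun i => hnb _ fun j => by simpa using ev_abs i j)
        (fun i => hnb _ fun j => by simpa using ev_abs i j)
      rw [avg_Gs hd] at h2
      have : dl (y - x) = 0 := by simp [dl, hyx]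
      have h3 := mul_nonneg hC0.le (dl_nonneg (y - x'))
      rw [h1]; linarith
  have hd1 : ∀ w : V d, HasSum (fun y => h y * dl (y - w)) (h w) := fun w => by
    have := hasSum_ite_eq w (h w)
    convert this using 2 with y
    simp only [dl, sub_eq_zero]; split_ifs with h1 <;> simp [h1]
  have h5 := (hd1 x).sub ((hd1 x').mul_left C)
  have h6 := hasSum_le (fun y => ?_) h5 (hs.hasSum_iff.2 ht)
  · linarith
  · have := mul_le_mul_of_nonneg_left (hpt y) (h0 y)
    linarith

lemma box_chain {u : V d → ℝ} {C : ℝ} (hC : 0 ≤ C) {lo hi : V d} {ρ : ℕ}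
    (h : ∀ y ∈ Set.Icc lo hi, ∀ y' ∈ Set.Icc lo hi, (∀ i, |y i - y' i| ≤ (ρ:ℤ)) → u y ≤ C * u y')
    (k : ℕ) (y y' : V d) (hy : y ∈ Set.Icc lo hi) (hy' : y' ∈ Set.Icc lo hi)
    (hk : ∀ i, |y i - y' i| ≤ (k * ρ : ℕ)) : u y ≤ C ^ k * u y' := by
  induction k generalizing y with
  | zero =>
    have : y = y' := by
      funext i; have := hk i; simp at this; omega
    simp [this]
  | succ k ih =>
    set z : V d := fun i => max (y i - ρ) (min (y i + ρ) (y' i)) with hz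
    have b : ∀ i, (lo i ≤ z i ∧ z i ≤ hi i) ∧ |y i - z i| ≤ ρ ∧ |z i - y' i| ≤ (k * ρ : ℕ) := fun i => by
      have h1 : lo i ≤ y i := hy.1 i
      have h2 : lo i ≤ y' i := hy'.1 i
      have h3 : y i ≤ hi i := hy.2 i
      have h4 : y' i ≤ hi i := hy'.2 i
      have h5 := hk i
      have h6 : (k + 1) * ρ = k * ρ + ρ := by ring
      rw [h6] at h5
      generalize k * ρ = q at *
      simp only [hz, abs_le] at *; push_cast at h5; omega
    have hzm : z ∈ Set.Icc lo hi := ⟨fun i => (b i).1.1, fun i => (b i).1.2⟩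
    calc u y ≤ C * u z := h y hy z hzm fun i => (b i).2.1
      _ ≤ C * (C^k * u y') := by gcongr; exact ih z hzm fun i => (b i).2.2
      _ = _ := by ring

lemma harnack (hd : 5 ≤ d) (K : ℕ) : ∃ C > 0, ∀ r : ℕ, 1 ≤ r → ∀ (lo hi : V d) (h : V d → ℝ),
    (∀ i, hi i - lo i ≤ (K * r : ℕ)) → (∀ y, 0 ≤ h y) →
    (∀ y ∈ Set.Icc lo hi, ∀ w ∈ cube y (r - 1), avg h w = h w) →
    ∀ y ∈ Set.Icc lo hi, ∀ y' ∈ Set.Icc lo hi, h y ≤ C * h y' := by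
  obtain ⟨M, hM, C, hC, H⟩ := harnack0 hd
  have hd1 : (1:ℝ) ≤ d := by exact_mod_cast (by omega : 1 ≤ d)
  refine ⟨C ^ (K * (3 * M)) + (2 * d) ^ (d * (K * M)), by positivity, fun r hr lo hi h hw h0 hh y hy y' hy' => ?_⟩
  have hdist : ∀ i, |y i - y' i| ≤ (K * r : ℕ) := fun i => by
    have h1 : lo i ≤ y i := hy.1 i
    have h2 : lo i ≤ y' i := hy'.1 i
    have h3 : y i ≤ hi i := hy.2 i
    have h4 : y' i ≤ hi i := hy'.2 i
    have := hw i; rw [abs_le]; omega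
  rw [add_mul]
  by_cases hrM : r ≤ M
  · have h1 := step_chain (by omega) h0 (lo := lo) (hi := hi)
      (fun w hw => (hh w hw w (fun i => by simp)).le) (d * (K * M)) y' y hy' hy (by
        calc _ ≤ ∑ _i : Fin d, K * M := Finset.sum_le_sum fun i _ => by
              have := hdist i
              have h3 : K * r ≤ K * M := by gcongr
              rw [abs_sub_comm, Int.abs_eq_natAbs] at this
              exact le_trans (by exact_mod_cast this) h3
          _ = _ := by simp)
    have := mul_nonneg (pow_nonneg hC.le (K * (3*M))) (h0 y')
    linarith
  · set ρ := (r - 1) / M with hρ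
    have hρ1 : 1 ≤ ρ := (Nat.one_le_div_iff (by omega)).2 (by omega)
    have hρ2 : M * ρ ≤ r - 1 := Nat.mul_div_le _ _
    have hρ3 : r - 1 < M * ρ + M := by
      have := Nat.div_add_mod (r-1) M; have := Nat.mod_lt (r-1) (show 0 < M by omega)
      rw [← hρ] at *; omega
    have h1 := box_chain hC.le (u := h) (lo := lo) (hi := hi) (ρ := ρ) (fun w hw w' hw' hd' =>
      H ρ hρ1 w h h0 (fun v hv => hh w hw v fun i => (hv i).trans (by exact_mod_cast hρ2)) w
        (fun i => by simp) w' (fun i => by rw [abs_sub_comm]; exact hd' i)) (K * (3*M)) y y' hy hy'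
      (fun i => (hdist i).trans (by
        have : M ≤ M * ρ := Nat.le_mul_of_pos_right _ hρ1
        have h3 : r ≤ 3 * M * ρ := by rw [mul_assoc]; omega
        have : K * r ≤ K * (3 * M) * ρ := by rw [mul_assoc]; gcongr
        exact_mod_cast this))
    have : (0:ℝ) ≤ (2 * d) ^ (d * (K * M)) * h y' := mul_nonneg (by positivity) (h0 y')
    linarith
end USFPaper

namespace USFPaper
variable {d : ℕ}

lemma wharn0 (hd : 5 ≤ d) : ∃ M : ℕ, 1 ≤ M ∧ ∃ c > 0, c ≤ 1 ∧ ∀ ρ : ℕ, 1 ≤ ρ → ∀ (z : V d) (u : V d → ℝ) (a : ℝ),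
    0 ≤ a → (∀ y, 0 ≤ u y) → (∀ y ∈ cube z (M * ρ), avg u y ≤ u y) → (∀ y ∈ cube z ρ, a ≤ u y) →
    ∀ x ∈ cube z (2 * ρ), c * a ≤ u x := by
  obtain ⟨C1, hC1, hU⟩ := GU hd
  obtain ⟨c, hc, hL⟩ := GLow hd
  obtain ⟨M, hM⟩ := exists_nat_ge (2 * C1 * 2^(d-2) / c)
  refine ⟨M + 1, by omega, min 1 (c / 2^(d-2) / (2 * C1)), by positivity, min_le_left _ _, ?_⟩
  intro ρ hρ z u a ha u0 hu hz x hx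
  by_cases hxz : x ∈ cube z ρ
  · exact le_trans (mul_le_of_le_one_left ha (min_le_left _ _)) (hz x hxz)
  have hρ' : (1:ℝ) ≤ ρ := by exact_mod_cast hρ
  set D := (ρ:ℝ)^(d-2) with hD
  have hDp : 0 < D := by positivity
  set g := C1 / D with hg
  set κ := C1 / (((M+1) * ρ : ℕ):ℝ)^(d-2) with hκ
  have key : ∀ (r : ℕ) (y : V d) (i : Fin d), 1 ≤ r → (r:ℤ) ≤ |y i - z i| → G (y - z) ≤ C1 / (r:ℝ)^(d-2) := by
    intro r y i hr hy
    rw [le_div_iff₀ (by positivity)]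
    exact hU r hr _ i hy
  have hout : ∀ (r : ℕ) (y : V d), y ∉ cube z r → ∃ i, (r:ℤ) + 1 ≤ |y i - z i| := by
    intro r y hy
    simp only [cube, Set.mem_ofPred_eq, not_forall, not_le] at hy
    exact hy
  have hκle : κ ≤ c / 2^(d-2) / 2 / D := by
    rw [hκ, div_le_div_iff₀ (by positivity) hDp]
    have h5 : (M:ℝ) * D ≤ (((M+1) * ρ : ℕ):ℝ)^(d-2) := by
      push_cast; rw [mul_pow]; gcongr
      calc (M:ℝ) ≤ M + 1 := by linarith
        _ ≤ _ := le_self_pow₀ (by linarith [Nat.cast_nonneg (α := ℝ) M]) (by omega)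
    calc C1 * D = c / 2^(d-2) / 2 * (2 * C1 * 2^(d-2) / c * D) := by field_simp
      _ ≤ c / 2^(d-2) / 2 * (M * D) := by gcongr
      _ ≤ _ := by gcongr
  have hκ0 : 0 ≤ κ := by positivity
  have hgp : 0 < g := by positivity
  have hag : 0 ≤ a / g := by positivity
  have hmain := minP (by omega) (f := fun y => u y - a / g * (min (G (y - z)) g - κ))
    (B := cube z ((M+1) * ρ) \ cube z ρ) ?_ ?_ ?_ x
  · obtain ⟨i, hi⟩ := hout _ _ hxz
    have h1 : G (x - z) ≤ g := key ρ x i hρ (by linarith)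
    simp only [min_eq_left h1] at hmain
    have h2 : c / 2^(d-2) / D ≤ G (x - z) := by
      have h1 := hL (2*ρ) (by omega) (x - z) hx
      rw [div_div, div_le_iff₀ (by positivity)]
      push_cast at h1; rw [mul_pow] at h1; exact h1
    calc min 1 (c / 2^(d-2) / (2 * C1)) * a ≤ c / 2^(d-2) / (2 * C1) * a := by
          gcongr; exact min_le_right _ _
      _ = a / g * (c / 2^(d-2) / D - c / 2^(d-2) / 2 / D) := by rw [hg]; field_simp; ring
      _ ≤ a / g * (G (x - z) - κ) := by gcongr
      _ ≤ _ := by linarith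
  · rintro y ⟨hy1, hy2⟩
    obtain ⟨i, hi⟩ := hout _ _ hy2
    have hnb : ∀ w : V d, (∀ i, |w i - y i| ≤ 1) → G (w - z) ≤ g := fun w hw => by
      refine key ρ w i hρ ?_
      have h1 := abs_sub_abs_le_abs_sub (y i - z i) (w i - z i)
      have h2 := hw i
      rw [abs_sub_comm] at h2
      rw [sub_sub_sub_cancel_right] at h1; omega
    have hyz : y - z ≠ 0 := fun h' => by
      rw [sub_eq_zero] at h'; subst h'; exact hy2 fun i => by simp
    rw [avg_sub, avg_smul, avg_sub, avg_const (by omega)]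
    have h2 : avg (fun w => G (w - z)) y ≤ avg (fun w => min (G (w - z)) g) y := avg_mono
        (fun i => le_min le_rfl (hnb _ fun j => by simpa using ev_abs i j))
        (fun i => le_min le_rfl (hnb _ fun j => by simpa using ev_abs i j))
    rw [avg_Gs hd] at h2
    have : dl (y - z) = 0 := by simp [dl, hyz]
    rw [this, sub_zero] at h2
    have h3 := min_le_left (G (y - z)) g
    have h4 := hu y hy1
    have h5 : a / g * (min (G (y - z)) g - κ) ≤ a / g * (avg (fun w => min (G (w - z)) g) y - κ) := by
      gcongr; linarith
    linarith
  · intro y hy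
    by_cases h1 : y ∈ cube z ρ
    · have h2 : a / g * (min (G (y - z)) g - κ) ≤ a / g * g := by
        gcongr; linarith [min_le_right (G (y - z)) g]
      rw [div_mul_cancel₀ _ hgp.ne'] at h2
      linarith [hz y h1]
    · have h2 : y ∉ cube z ((M+1)*ρ) := fun h => hy ⟨h, h1⟩
      obtain ⟨i, hi⟩ := hout _ _ h2
      have h3 : G (y - z) ≤ κ := key ((M+1)*ρ) y i (by nlinarith) (by linarith)
      have : a / g * (min (G (y - z)) g - κ) ≤ 0 := mul_nonpos_of_nonneg_of_nonpos hag
        (by linarith [min_le_left (G (y - z)) g])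
      linarith [u0 y]
  · intro ε hε
    refine ((cube_finite z ((M+1)*ρ)).subset fun y hy => ?_)
    by_contra h2
    obtain ⟨i, hi⟩ := hout _ _ h2
    have h3 : G (y - z) ≤ κ := key ((M+1)*ρ) y i (by nlinarith) (by linarith)
    have : a / g * (min (G (y - z)) g - κ) ≤ 0 := mul_nonpos_of_nonneg_of_nonpos hag
      (by linarith [min_le_left (G (y - z)) g])
    simp only [Set.mem_ofPred_eq] at hy
    linarith [u0 y]

lemma wharnack (hd : 5 ≤ d) (K : ℕ) : ∃ c > 0, ∀ r : ℕ, 1 ≤ r → ∀ (lo hi : V d) (u : V d → ℝ) (a : ℝ),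
    (∀ i, hi i - lo i ≤ (K * r : ℕ)) → (∀ y, 0 ≤ u y) →
    (∀ y ∈ Set.Icc lo hi, ∀ w ∈ cube y (r - 1), avg u w ≤ u w) → 0 ≤ a →
    ∀ b ∈ Set.Icc lo hi, (∀ y ∈ cube b r, a ≤ u y) → ∀ y ∈ Set.Icc lo hi, c * a ≤ u y := by
  obtain ⟨M, hM, c, hc, hc1, H⟩ := wharn0 hd
  have hd1 : (1:ℝ) ≤ d := by exact_mod_cast (by omega : 1 ≤ d)
  refine ⟨min (c ^ (K * (3 * M))) ((2 * d) ^ (d * (K * M)))⁻¹, by positivity, ?_⟩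
  intro r hr lo hi u a hw u0 hu ha b hb hab y hy
  have hdist : ∀ i, |y i - b i| ≤ (K * r : ℕ) := fun i => by
    have h1 : lo i ≤ y i := hy.1 i
    have h2 : lo i ≤ b i := hb.1 i
    have h3 : y i ≤ hi i := hy.2 i
    have h4 : b i ≤ hi i := hb.2 i
    have := hw i; rw [abs_le]; omega
  by_cases hrM : r ≤ M
  · have h1 := step_chain (by omega) u0 (lo := lo) (hi := hi)
      (fun w hw => (hu w hw w (fun i => by simp))) (d * (K * M)) y b hy hb (by
        calc _ ≤ ∑ _i : Fin d, K * M := Finset.sum_le_sum fun i _ => by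
              have := hdist i
              have h3 : K * r ≤ K * M := by gcongr
              rw [Int.abs_eq_natAbs] at this
              rw [← Int.natAbs_neg, neg_sub] at *
              exact le_trans (by exact_mod_cast this) h3
          _ = _ := by simp)
    have h2 := hab b (fun i => by simp)
    calc _ ≤ ((2 * (d:ℝ)) ^ (d * (K * M)))⁻¹ * u b := by
          gcongr; exact min_le_right _ _
      _ ≤ _ := by rw [inv_mul_le_iff₀ (by positivity)]; exact h1
  · set ρ := (r - 1) / M with hρ
    have hρ1 : 1 ≤ ρ := (Nat.one_le_div_iff (by omega)).2 (by omega)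
    have hρ2 : M * ρ ≤ r - 1 := Nat.mul_div_le _ _
    have hρ3 : r - 1 < M * ρ + M := by
      have := Nat.div_add_mod (r-1) M; have := Nat.mod_lt (r-1) (show 0 < M by omega)
      rw [← hρ] at *; omega
    have hρr : ρ ≤ r := by have := Nat.le_mul_of_pos_left ρ hM; omega
    set v : V d → ℝ := fun z => ⨅ w : cube z ρ, u w.1 with hv
    have hbd : ∀ z, BddBelow (Set.range fun w : cube z ρ => u w.1) := fun z =>
      ⟨0, by rintro _ ⟨w, rfl⟩; exact u0 _⟩
    have hne : ∀ z : V d, Nonempty (cube z ρ) := fun z => ⟨⟨z, fun i => by simp⟩⟩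
    have hv0 : ∀ z, 0 ≤ v z := fun z => Real.iInf_nonneg fun w => u0 _
    have h1 := box_chain (u := v) (C := c⁻¹) (by positivity) (lo := lo) (hi := hi) (ρ := ρ)
      (fun w hw w' hw' hd' => by
        rw [inv_mul_eq_div, le_div_iff₀ hc, mul_comm]
        refine le_ciInf fun x => H ρ hρ1 w u (v w) (hv0 _) u0 (fun y hy => hu w hw y fun i =>
          (hy i).trans (by exact_mod_cast hρ2)) (fun y hy => ciInf_le (hbd w) ⟨y, hy⟩) x fun i => ?_
        have h2 := x.2 i
        have h3 := hd' i
        push_cast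
        rw [abs_le] at *; constructor <;> linarith) (K * (3*M)) b y hb hy
      (fun i => by
        rw [abs_sub_comm]
        exact (hdist i).trans (by
          have : M ≤ M * ρ := Nat.le_mul_of_pos_right _ hρ1
          have h3 : r ≤ 3 * M * ρ := by rw [mul_assoc]; omega
          have : K * r ≤ K * (3 * M) * ρ := by rw [mul_assoc]; gcongr
          exact_mod_cast this))
    have h2 : a ≤ v b := le_ciInf fun w => hab w fun i => (w.2 i).trans (by exact_mod_cast hρr)
    have h3 : v y ≤ u y := ciInf_le (hbd y) ⟨y, fun i => by simp⟩
    rw [inv_pow, inv_mul_eq_div, le_div_iff₀ (by positivity)] at h1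
    calc _ ≤ c ^ (K * (3*M)) * a := by gcongr; exact min_le_left _ _
      _ ≤ c ^ (K * (3*M)) * v b := by gcongr
      _ ≤ _ := by linarith
end USFPaper

namespace USFPaper
variable {d : ℕ}

/-- neighbours -/
def nb (x y : V d) : Prop := ∃ i, y = x + ev i ∨ y = x - ev i

lemma avg_mono_nb {f g : V d → ℝ} {x : V d} (h : ∀ y, nb x y → f y ≤ g y) : avg f x ≤ avg g x :=
  avg_mono (fun i => h _ ⟨i, Or.inl rfl⟩) (fun i => h _ ⟨i, Or.inr rfl⟩)

/-- expectation of `f` at the walk stopped on leaving `B` or at time `k` -/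
noncomputable def Ex (B : Set (V d)) (f : V d → ℝ) : ℕ → V d → ℝ
  | 0, x => f x
  | k + 1, x => if x ∈ B then avg (Ex B f k) x else f x

lemma Ex_nonneg {B : Set (V d)} {f : V d → ℝ} (h : ∀ x, 0 ≤ f x) (k : ℕ) (x : V d) : 0 ≤ Ex B f k x := by
  induction k generalizing x with
  | zero => exact h x
  | succ k ih => rw [Ex]; split_ifs; exacts [avg_nonneg ih x, h x]

lemma Ex_out {B : Set (V d)} {f : V d → ℝ} (k : ℕ) {x : V d} (h : x ∉ B) : Ex B f k x = f x := by
  cases k with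
  | zero => rfl
  | succ k => rw [Ex, if_neg h]

lemma Ex_add (B : Set (V d)) (f g : V d → ℝ) (k : ℕ) (x : V d) :
    Ex B (fun y => f y + g y) k x = Ex B f k x + Ex B g k x := by
  induction k generalizing x with
  | zero => rfl
  | succ k ih =>
    rw [Ex, Ex, Ex]; split_ifs
    · rw [← avg_add]; congr 1; funext y; exact ih y
    · rfl

lemma Ex_in {B : Set (V d)} {f : V d → ℝ} (k : ℕ) {x : V d} (h : x ∈ B) :
    Ex B f (k+1) x = avg (Ex B f k) x := by rw [Ex, if_pos h]

lemma Ex_le_self {B : Set (V d)} {f : V d → ℝ} (h : ∀ x ∈ B, avg f x ≤ f x) (k : ℕ) (x : V d) :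
    Ex B f (k+1) x ≤ Ex B f k x := by
  by_cases hx : x ∈ B
  · induction k generalizing x with
    | zero => rw [Ex_in _ hx]; exact h x hx
    | succ k ih =>
      rw [Ex_in _ hx, Ex_in _ hx]
      refine avg_mono' (fun y => ?_) x
      by_cases hy : y ∈ B
      · exact ih y hy
      · rw [Ex_out _ hy, Ex_out _ hy]
  · rw [Ex_out _ hx, Ex_out _ hx]

lemma Ex_anti {B : Set (V d)} {f : V d → ℝ} (h : ∀ x ∈ B, avg f x ≤ f x) (x : V d) {k l : ℕ} (hkl : k ≤ l) :
    Ex B f l x ≤ Ex B f k x := antitone_nat_of_succ_le (f := fun k => Ex B f k x) (fun k => Ex_le_self h k x) hkl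

lemma Ex_neg (B : Set (V d)) (f : V d → ℝ) (k : ℕ) (x : V d) :
    Ex B (fun y => - f y) k x = - Ex B f k x := by
  have := Ex_add B f (fun y => - f y) k x
  simp only [add_neg_cancel] at this
  have h0 : Ex B (fun _ => (0:ℝ)) k x = 0 := by
    clear this
    induction k generalizing x with
    | zero => rfl
    | succ k ih => rw [Ex]; split_ifs <;> simp [avg, ih]
  linarith

lemma Ex_mono_t {B : Set (V d)} {f : V d → ℝ} (h : ∀ x ∈ B, f x ≤ avg f x) (x : V d) {k l : ℕ} (hkl : k ≤ l) :
    Ex B f k x ≤ Ex B f l x := by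
  have := Ex_anti (B := B) (f := fun y => - f y) (fun x hx => by
    have h1 := avg_smul (-1) f x
    simp only [neg_mul, one_mul] at h1
    rw [h1]; linarith [h x hx]) x hkl
  rw [Ex_neg, Ex_neg] at this; linarith

/-- height -/
def ht (i₀ : Fin d) (σ : ℤ) (x₀ y : V d) : ℤ := σ * (y i₀ - x₀ i₀)

/-- lateral squared distance -/
def lt2 (i₀ : Fin d) (x₀ y : V d) : ℝ := nsq (y - x₀) - ((y i₀ - x₀ i₀ : ℤ) : ℝ) ^ 2

lemma sig {σ : ℤ} (hσ : σ * σ = 1) : σ = 1 ∨ σ = -1 := mul_self_eq_one_iff.1 hσ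

lemma ht_nb {i₀ : Fin d} {σ : ℤ} (hσ : σ * σ = 1) (x₀ : V d) {x y : V d} (h : nb x y) :
    ht i₀ σ x₀ y ≤ ht i₀ σ x₀ x + 1 ∧ ht i₀ σ x₀ x - 1 ≤ ht i₀ σ x₀ y := by
  obtain ⟨i, h⟩ := h
  have h1 := abs_le.1 (ev_abs i i₀)
  rcases sig hσ with rfl | rfl <;> rcases h with rfl | rfl <;>
    simp only [ht, Pi.add_apply, Pi.sub_apply] <;> omega

lemma sq_le_lt2 {i i₀ : Fin d} (hi : i ≠ i₀) (x₀ x : V d) : ((x i - x₀ i : ℤ) : ℝ)^2 ≤ lt2 i₀ x₀ x := by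
  unfold lt2 nsq
  have := Finset.add_le_sum (s := Finset.univ) (f := fun j => (((x - x₀) j : ℤ) : ℝ)^2)
    (fun _ _ => sq_nonneg _) (Finset.mem_univ i) (Finset.mem_univ i₀) hi
  simp only [Pi.sub_apply] at this ⊢
  linarith

lemma lt2_nonneg (i₀ : Fin d) (x₀ x : V d) : 0 ≤ lt2 i₀ x₀ x := by
  unfold lt2
  have := sq_le_nsq (x - x₀) i₀
  simp only [Pi.sub_apply] at this; linarith

lemma lt2_nb {i₀ : Fin d} (x₀ : V d) {x y : V d} (h : nb x y) :
    lt2 i₀ x₀ y ≤ 21 / 20 * lt2 i₀ x₀ x + 21 := by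
  obtain ⟨i, h⟩ := h
  have h0 := lt2_nonneg i₀ x₀ x
  by_cases hi : i = i₀
  · subst hi
    have : lt2 i x₀ y = lt2 i x₀ x := by
      rcases h with rfl | rfl
      · unfold lt2; rw [add_sub_right_comm, nsq_add]; simp [ev]; ring
      · unfold lt2; rw [sub_right_comm, nsq_sub]; simp [ev]; ring
    linarith
  · have h1 := sq_le_lt2 hi x₀ x
    have h2 : ev i i₀ = 0 := by simp [ev, Ne.symm hi]
    have : lt2 i₀ x₀ y ≤ lt2 i₀ x₀ x + 1 + 2 * |((x i - x₀ i : ℤ) : ℝ)| := by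
      have h5 := neg_abs_le ((x i - x₀ i : ℤ) : ℝ)
      have h6 := le_abs_self ((x i - x₀ i : ℤ) : ℝ)
      rcases h with rfl | rfl
      · unfold lt2; rw [add_sub_right_comm, nsq_add]; simp only [Pi.add_apply, h2, Pi.sub_apply]; simp only [add_zero] at *; linarith
      · unfold lt2; rw [sub_right_comm, nsq_sub]; simp only [Pi.sub_apply, h2]; simp only [sub_zero] at *; linarith
    rw [← sq_abs] at h1
    nlinarith [sq_nonneg (|((x i - x₀ i : ℤ) : ℝ)| - 20)]

lemma avg_poly (hd : 0 < d) {i₀ : Fin d} {σ : ℤ} (hσ : σ * σ = 1) (x₀ x : V d) (a b c e : ℝ) :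
    avg (fun y => a + b * (ht i₀ σ x₀ y : ℝ) + c * (ht i₀ σ x₀ y : ℝ)^2 + e * nsq (y - x₀)) x =
    a + b * (ht i₀ σ x₀ x : ℝ) + c * (ht i₀ σ x₀ x : ℝ)^2 + e * nsq (x - x₀) + (c / d + e) := by
  have hd' : (0:ℝ) < d := by exact_mod_cast hd
  have hs : (σ:ℝ) * σ = 1 := by exact_mod_cast hσ
  unfold avg
  have : ∀ i : Fin d, (a + b * (ht i₀ σ x₀ (x + ev i) : ℝ) + c * (ht i₀ σ x₀ (x + ev i) : ℝ)^2 + e * nsq (x + ev i - x₀)) + (a + b * (ht i₀ σ x₀ (x - ev i) : ℝ) + c * (ht i₀ σ x₀ (x - ev i) : ℝ)^2 + e * nsq (x - ev i - x₀)) =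
      2 * (a + b * (ht i₀ σ x₀ x : ℝ) + c * (ht i₀ σ x₀ x : ℝ)^2 + e * nsq (x - x₀) + e) + (if i = i₀ then 2 * c else 0) := by
    intro i
    rw [add_sub_right_comm, sub_right_comm, nsq_add, nsq_sub]
    by_cases h : i = i₀
    · subst h; simp [ht, ev]
      linear_combination 2 * c * hs
    · simp [ht, ev, h, Ne.symm h]
      ring
  simp only [this]
  rw [Finset.sum_add_distrib]
  simp
  field_simp
  ring
end USFPaper

namespace USFPaper
variable {d : ℕ}

/-- indicator -/
noncomputable def ind (A : Set (V d)) : V d → ℝ := fun y => if y ∈ A then 1 else 0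

lemma ind_nonneg (A : Set (V d)) (y : V d) : 0 ≤ ind A y := by unfold ind; split_ifs <;> norm_num
lemma ind_le_one (A : Set (V d)) (y : V d) : ind A y ≤ 1 := by unfold ind; split_ifs <;> norm_num
lemma ind_pos {A : Set (V d)} {y : V d} (h : y ∈ A) : ind A y = 1 := if_pos h
lemma ind_neg {A : Set (V d)} {y : V d} (h : y ∉ A) : ind A y = 0 := if_neg h

lemma Ex_mono {B : Set (V d)} {f g : V d → ℝ} (h : ∀ x, f x ≤ g x) (k : ℕ) (x : V d) :
    Ex B f k x ≤ Ex B g k x := by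
  induction k generalizing x with
  | zero => exact h x
  | succ k ih => rw [Ex, Ex]; split_ifs; exacts [avg_mono' ih x, h x]

/-- reflection -/
def rf (i₀ : Fin d) (c : ℤ) (y : V d) : V d := Function.update y i₀ (c - y i₀)

lemma rf_self (i₀ : Fin d) (c : ℤ) (y : V d) : rf i₀ c y i₀ = c - y i₀ := by simp [rf]
lemma rf_ne {i i₀ : Fin d} (h : i ≠ i₀) (c : ℤ) (y : V d) : rf i₀ c y i = y i := by simp [rf, h]
lemma rf_rf (i₀ : Fin d) (c : ℤ) (y : V d) : rf i₀ c (rf i₀ c y) = y := by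
  funext i; by_cases h : i = i₀
  · subst h; simp [rf]
  · simp [rf, h]

lemma avg_rf (i₀ : Fin d) (c : ℤ) (f : V d → ℝ) (x : V d) :
    avg (fun y => f (rf i₀ c y)) x = avg f (rf i₀ c x) := by
  unfold avg; congr 1; refine Finset.sum_congr rfl fun i _ => ?_
  by_cases h : i = i₀
  · subst h
    have h1 : rf i c (x + ev i) = rf i c x - ev i := by
      funext j; by_cases h : j = i
      · subst h; simp [rf, ev]; ring
      · simp [rf, ev, h]
    have h2 : rf i c (x - ev i) = rf i c x + ev i := by
      funext j; by_cases h : j = i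
      · subst h; simp [rf, ev]; ring
      · simp [rf, ev, h]
    simp only [h1, h2]; ring
  · have h1 : rf i₀ c (x + ev i) = rf i₀ c x + ev i := by
      funext j; by_cases h' : j = i₀
      · subst h'; simp [rf, ev, Ne.symm h]
      · simp [rf, h']
    have h2 : rf i₀ c (x - ev i) = rf i₀ c x - ev i := by
      funext j; by_cases h' : j = i₀
      · subst h'; simp [rf, ev, Ne.symm h]
      · simp [rf, h']
    simp only [h1, h2]

lemma nsq_rf (i₀ : Fin d) (x₀ y : V d) : nsq (rf i₀ (2 * x₀ i₀) y - x₀) = nsq (y - x₀) := by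
  unfold nsq; refine Finset.sum_congr rfl fun i _ => ?_
  by_cases h : i = i₀
  · subst h; simp [rf]; ring
  · simp [rf, h]

lemma ht_rf (i₀ : Fin d) (σ : ℤ) (x₀ y : V d) : ht i₀ σ x₀ (rf i₀ (2 * x₀ i₀) y) = - ht i₀ σ x₀ y := by
  simp [ht, rf]; ring

lemma lt2_rf (i₀ : Fin d) (x₀ y : V d) : lt2 i₀ x₀ (rf i₀ (2 * x₀ i₀) y) = lt2 i₀ x₀ y := by
  unfold lt2; rw [nsq_rf, rf_self]; push_cast; ring

/-- flat box -/
def FB (i₀ : Fin d) (σ : ℤ) (x₀ : V d) (q : ℕ) : Set (V d) :=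
  {y | |ht i₀ σ x₀ y| < q ∧ lt2 i₀ x₀ y < 64 * d * (q:ℝ)^2}

noncomputable def su (i₀ : Fin d) (σ : ℤ) (x₀ : V d) (K : Set (V d)) (q : ℕ) : ℕ → V d → ℝ :=
  Ex (FB i₀ σ x₀ q \ K) (ind Kᶜ)
noncomputable def hv (i₀ : Fin d) (σ : ℤ) (x₀ : V d) (K : Set (V d)) (q : ℕ) : ℕ → V d → ℝ :=
  Ex (FB i₀ σ x₀ q \ K) (ind {y | ht i₀ σ x₀ y = q})
noncomputable def hlo (i₀ : Fin d) (σ : ℤ) (x₀ : V d) (K : Set (V d)) (q : ℕ) : ℕ → V d → ℝ :=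
  Ex (FB i₀ σ x₀ q \ K) (ind {y | ht i₀ σ x₀ y = -q ∧ y ∉ K})
noncomputable def rst (i₀ : Fin d) (σ : ℤ) (x₀ : V d) (K : Set (V d)) (q : ℕ) : ℕ → V d → ℝ :=
  Ex (FB i₀ σ x₀ q \ K) (ind {y | |ht i₀ σ x₀ y| ≠ q ∧ y ∉ K})

lemma su_le (i₀ : Fin d) (σ : ℤ) (x₀ : V d) (K : Set (V d)) (q t : ℕ) (x : V d) :
    su i₀ σ x₀ K q t x ≤ hv i₀ σ x₀ K q t x + hlo i₀ σ x₀ K q t x + rst i₀ σ x₀ K q t x := by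
  unfold su hv hlo rst
  rw [← Ex_add, ← Ex_add]
  refine Ex_mono (fun y => ?_) t x
  by_cases hy : y ∈ K
  · rw [ind_neg (by simpa using hy)]
    have := ind_nonneg {y | ht i₀ σ x₀ y = q} y
    have := ind_nonneg {y | ht i₀ σ x₀ y = -q ∧ y ∉ K} y
    have := ind_nonneg {y | |ht i₀ σ x₀ y| ≠ q ∧ y ∉ K} y
    linarith
  · rw [ind_pos (by simpa using hy)]
    have := ind_nonneg {y | ht i₀ σ x₀ y = q} y
    have := ind_nonneg {y | ht i₀ σ x₀ y = -q ∧ y ∉ K} y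
    have := ind_nonneg {y | |ht i₀ σ x₀ y| ≠ q ∧ y ∉ K} y
    by_cases h1 : ht i₀ σ x₀ y = q
    · have := ind_pos (A := {y | ht i₀ σ x₀ y = q}) h1; linarith
    by_cases h2 : ht i₀ σ x₀ y = -q
    · have := ind_pos (A := {y | ht i₀ σ x₀ y = -q ∧ y ∉ K}) ⟨h2, hy⟩; linarith
    · have := ind_pos (A := {y | |ht i₀ σ x₀ y| ≠ q ∧ y ∉ K}) (y := y) ⟨by
        simp only [ne_eq]; rw [abs_eq (by positivity)]; tauto, hy⟩
      linarith

section
variable {i₀ : Fin d} {σ : ℤ} {x₀ : V d} {K : Set (V d)} {q : ℕ}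

lemma avg_mono_pair {f g : V d → ℝ} {x : V d}
    (h : ∀ i, f (x + ev i) + f (x - ev i) ≤ g (x + ev i) + g (x - ev i)) : avg f x ≤ avg g x := by
  unfold avg; exact mul_le_mul_of_nonneg_left (Finset.sum_le_sum fun i _ => h i) (by positivity)

lemma nbp (x : V d) (i : Fin d) : nb x (x + ev i) := ⟨i, Or.inl rfl⟩
lemma nbm (x : V d) (i : Fin d) : nb x (x - ev i) := ⟨i, Or.inr rfl⟩

lemma refl_ind (hσ : σ * σ = 1) (hK : ∀ y ∈ K, ht i₀ σ x₀ y ≤ 0) (hq : 1 ≤ q) (t : ℕ) :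
    (∀ x, 0 ≤ ht i₀ σ x₀ x → hlo i₀ σ x₀ K q t x ≤ hv i₀ σ x₀ K q t x) ∧
    (∀ x, 0 ≤ ht i₀ σ x₀ x → hlo i₀ σ x₀ K q t x + hlo i₀ σ x₀ K q t (rf i₀ (2 * x₀ i₀) x) ≤
      hv i₀ σ x₀ K q t x + hv i₀ σ x₀ K q t (rf i₀ (2 * x₀ i₀) x)) := by
  set R := rf i₀ (2 * x₀ i₀) with hR
  have base1 : ∀ x, 0 ≤ ht i₀ σ x₀ x → ind {y | ht i₀ σ x₀ y = -q ∧ y ∉ K} x ≤ ind {y | ht i₀ σ x₀ y = q} x := by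
    intro x hx
    rw [ind_neg]; exact ind_nonneg _ _
    rintro ⟨h1, -⟩; omega
  have base2 : ∀ x, 0 ≤ ht i₀ σ x₀ x → ind {y | ht i₀ σ x₀ y = -q ∧ y ∉ K} x + ind {y | ht i₀ σ x₀ y = -q ∧ y ∉ K} (R x)
      ≤ ind {y | ht i₀ σ x₀ y = q} x + ind {y | ht i₀ σ x₀ y = q} (R x) := by
    intro x hx
    rw [ind_neg (y := x) (A := {y | ht i₀ σ x₀ y = -q ∧ y ∉ K}) (by rintro ⟨h1, -⟩; omega)]
    have h0 := ind_nonneg {y | ht i₀ σ x₀ y = q} (R x)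
    by_cases h : ht i₀ σ x₀ x = q
    · rw [ind_pos (A := {y | ht i₀ σ x₀ y = q}) h]
      have := ind_le_one {y | ht i₀ σ x₀ y = -q ∧ y ∉ K} (R x); linarith
    · rw [ind_neg (y := R x) (A := {y | ht i₀ σ x₀ y = -q ∧ y ∉ K})]
      · have := ind_nonneg {y | ht i₀ σ x₀ y = q} x; linarith
      · rintro ⟨h1, -⟩; rw [hR, ht_rf] at h1; omega
  have hRx : ∀ x, ht i₀ σ x₀ x = 0 → R x = x := by
    intro x hx
    have : x i₀ = x₀ i₀ := by
      unfold ht at hx; rcases sig hσ with rfl | rfl <;> omega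
    funext j; by_cases h : j = i₀
    · subst h; simp [hR, rf]; omega
    · simp [hR, rf, h]
  have hRF : ∀ x, R x ∈ FB i₀ σ x₀ q ↔ x ∈ FB i₀ σ x₀ q := fun x => by
    simp only [FB, Set.mem_ofPred_eq, hR, ht_rf, lt2_rf, abs_neg]
  induction t with
  | zero => exact ⟨base1, base2⟩
  | succ t ih =>
    obtain ⟨ih1, ih2⟩ := ih
    have A : ∀ x, 0 ≤ ht i₀ σ x₀ x → hlo i₀ σ x₀ K q (t+1) x ≤ hv i₀ σ x₀ K q (t+1) x := by
      intro x hx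
      by_cases hB : x ∈ FB i₀ σ x₀ q \ K
      · unfold hlo hv; rw [Ex_in _ hB, Ex_in _ hB]
        change avg (hlo i₀ σ x₀ K q t) x ≤ avg (hv i₀ σ x₀ K q t) x
        rcases hx.lt_or_eq with h | h
        · exact avg_mono_nb fun y hy => ih1 y (by have := (ht_nb (i₀ := i₀) hσ x₀ hy).2; omega)
        · apply avg_mono_pair; intro i
          by_cases hi : i = i₀
          · subst hi
            have e1 : R (x + ev i) = x - ev i := by
              have := hRx x h.symm
              have h2 := congrFun this i
              funext j; by_cases h : j = i
              · subst h; simp [hR, rf, ev] at h2 ⊢; omega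
              · simp [hR, rf, ev, h]
            have e2 : R (x - ev i) = x + ev i := by rw [← e1, hR, rf_rf]
            rcases sig hσ with h1 | h1
            · have := ih2 (x + ev i) (by simp [ht, h1, ev] at h ⊢; omega)
              rwa [e1] at this
            · have := ih2 (x - ev i) (by simp [ht, h1, ev] at h ⊢; omega)
              rw [e2] at this; linarith
          · have h1 := ih1 (x + ev i) (by unfold ht at h ⊢; simp only [Pi.add_apply, Pi.sub_apply, ev, Pi.single_eq_of_ne (Ne.symm hi), add_zero, sub_zero]; exact h.le)
            have h2 := ih1 (x - ev i) (by unfold ht at h ⊢; simp only [Pi.add_apply, Pi.sub_apply, ev, Pi.single_eq_of_ne (Ne.symm hi), add_zero, sub_zero]; exact h.le)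
            linarith
      · unfold hlo hv; rw [Ex_out _ hB, Ex_out _ hB]; exact base1 x hx
    refine ⟨A, fun x hx => ?_⟩
    rcases hx.lt_or_eq with h | h
    swap
    · rw [hRx x h.symm]; have := A x hx; linarith
    have hxK : x ∉ K := fun h' => by have := hK x h'; omega
    by_cases hF : x ∈ FB i₀ σ x₀ q
    · by_cases hRK : R x ∈ K
      · have h1 : hlo i₀ σ x₀ K q (t+1) (R x) = 0 := by
          unfold hlo; rw [Ex_out _ (fun h => h.2 hRK), ind_neg]; rintro ⟨-, h⟩; exact h hRK
        have h2 : 0 ≤ hv i₀ σ x₀ K q (t+1) (R x) := Ex_nonneg (ind_nonneg _) _ _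
        have := A x hx; linarith
      · have b1 : x ∈ FB i₀ σ x₀ q \ K := ⟨hF, hxK⟩
        have b2 : R x ∈ FB i₀ σ x₀ q \ K := ⟨(hRF x).2 hF, hRK⟩
        unfold hlo hv; rw [Ex_in _ b1, Ex_in _ b1, Ex_in _ b2, Ex_in _ b2, hR, ← avg_rf, ← avg_rf, ← avg_add, ← avg_add]
        exact avg_mono_nb fun y hy => ih2 y (by have := (ht_nb (i₀ := i₀) hσ x₀ hy).2; omega)
    · have b1 : x ∉ FB i₀ σ x₀ q \ K := fun h => hF h.1
      have b2 : R x ∉ FB i₀ σ x₀ q \ K := fun h => hF ((hRF x).1 h.1)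
      unfold hlo hv; rw [Ex_out _ b1, Ex_out _ b1, Ex_out _ b2, Ex_out _ b2]; exact base2 x hx

lemma refl_x0 (hσ : σ * σ = 1) (hK : ∀ y ∈ K, ht i₀ σ x₀ y ≤ 0) (hq : 1 ≤ q) (t : ℕ) :
    avg (hlo i₀ σ x₀ K q t) x₀ ≤ avg (hv i₀ σ x₀ K q t) x₀ := by
  obtain ⟨ih1, ih2⟩ := refl_ind (x₀ := x₀) (q := q) hσ hK hq t
  apply avg_mono_pair; intro i
  by_cases hi : i = i₀
  · subst hi
    have e1 : rf i (2 * x₀ i) (x₀ + ev i) = x₀ - ev i := by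
      funext j; by_cases h : j = i
      · subst h; simp [rf, ev]; omega
      · simp [rf, ev, h]
    have e2 : rf i (2 * x₀ i) (x₀ - ev i) = x₀ + ev i := by rw [← e1, rf_rf]
    rcases sig hσ with h1 | h1
    · have := ih2 (x₀ + ev i) (by simp [ht, h1, ev])
      rwa [e1] at this
    · have := ih2 (x₀ - ev i) (by simp [ht, h1, ev])
      rw [e2] at this; linarith
  · have h1 := ih1 (x₀ + ev i) (by simp [ht, ev, Ne.symm hi])
    have h2 := ih1 (x₀ - ev i) (by simp [ht, ev, Ne.symm hi])
    linarith

lemma FB_nb (hd : 5 ≤ d) (hq : 1 ≤ q) (hσ : σ * σ = 1) {x y : V d} (hx : x ∈ FB i₀ σ x₀ q) (h : nb x y) :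
    |ht i₀ σ x₀ y| ≤ q ∧ lt2 i₀ x₀ y ≤ 72 * d * (q:ℝ)^2 := by
  have hd' : (5:ℝ) ≤ d := by exact_mod_cast hd
  have hq' : (1:ℝ) ≤ q := by exact_mod_cast hq
  obtain ⟨h1, h2⟩ := hx
  have h3 := ht_nb (i₀ := i₀) hσ x₀ h
  have h4 := lt2_nb (i₀ := i₀) x₀ h
  constructor
  · rw [abs_lt] at h1; rw [abs_le]; constructor <;> omega
  · nlinarith [mul_le_mul hd' (one_le_pow₀ hq' (n := 2)) (by norm_num) (by linarith)]

lemma rst_bar (hd : 5 ≤ d) (hσ : σ * σ = 1) (hq : 1 ≤ q) (k : ℕ) (hk : k ≤ 64 * d * q^2) (x : V d)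
    (hx : |ht i₀ σ x₀ x| ≤ q) : rst i₀ σ x₀ K q k x ≤
      (lt2 i₀ x₀ x + (2 * d - 1) * ((q:ℝ)^2 - (ht i₀ σ x₀ x : ℝ)^2) + (64 * d * (q:ℝ)^2 - k)) / (64 * d * (q:ℝ)^2) := by
  have hd' : (5:ℝ) ≤ d := by exact_mod_cast hd
  have hq' : (1:ℝ) ≤ q := by exact_mod_cast hq
  have hsq : ((σ:ℝ)) * σ = 1 := by exact_mod_cast hσ
  set R := 64 * d * (q:ℝ)^2 with hR
  have hRp : 0 < R := by positivity
  have l0 : ∀ y : V d, lt2 i₀ x₀ y = nsq (y - x₀) - (ht i₀ σ x₀ y : ℝ)^2 := fun y => by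
    unfold lt2 ht; push_cast; rw [mul_pow, sq (σ:ℝ), hsq, one_mul]
  have hsmall : ∀ y : V d, |ht i₀ σ x₀ y| ≤ q → 0 ≤ (2 * d - 1) * ((q:ℝ)^2 - (ht i₀ σ x₀ y : ℝ)^2) := fun y hy => by
    have : |(ht i₀ σ x₀ y : ℝ)| ≤ q := by exact_mod_cast hy
    have := sq_le_sq' (by linarith [abs_le.1 this]) (abs_le.1 this).2
    apply mul_nonneg <;> linarith
  have key : ∀ (k : ℕ) (y : V d), (lt2 i₀ x₀ y + (2 * d - 1) * ((q:ℝ)^2 - (ht i₀ σ x₀ y : ℝ)^2) + (R - k)) / R =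
      ((2 * d - 1) * (q:ℝ)^2 + R - k) / R + 0 * (ht i₀ σ x₀ y : ℝ) + (- 2 * d / R) * (ht i₀ σ x₀ y : ℝ)^2 + (1 / R) * nsq (y - x₀) := by
    intro k y; rw [l0]; field_simp; ring
  induction k generalizing x with
  | zero =>
    refine (ind_le_one _ _).trans ?_
    rw [le_div_iff₀ hRp]; have := hsmall x hx; have := lt2_nonneg i₀ x₀ x
    push_cast; linarith
  | succ k ih =>
    by_cases hB : x ∈ FB i₀ σ x₀ q \ K
    · unfold rst; rw [Ex_in _ hB]
      refine (avg_mono_nb (g := fun y => _) fun y hy => ih (by omega) y (FB_nb hd hq hσ hB.1 hy).1).trans ?_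
      simp only [key]
      rw [avg_poly (by omega) hσ]
      apply le_of_eq; push_cast; field_simp; ring
    · unfold rst; rw [Ex_out _ hB]
      have hk' : ((k+1 : ℕ):ℝ) ≤ R := by rw [hR]; exact_mod_cast hk
      have h1 := hsmall x hx; have h2 := lt2_nonneg i₀ x₀ x
      by_cases hA : |ht i₀ σ x₀ x| ≠ q ∧ x ∉ K
      · refine (ind_le_one _ _).trans ?_
        have : R ≤ lt2 i₀ x₀ x := by
          by_contra h'
          exact hB ⟨⟨lt_of_le_of_ne hx hA.1, not_le.1 h'⟩, hA.2⟩
        rw [le_div_iff₀ hRp]; linarith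
      · rw [ind_neg (by exact hA)]; apply div_nonneg _ hRp.le; linarith

lemma hv_bar (hd : 5 ≤ d) (hσ : σ * σ = 1) (hK : ∀ y ∈ K, ht i₀ σ x₀ y ≤ 0) (hq : 1 ≤ q) (k : ℕ) (hk : k ≤ 64 * d * q^2) (x : V d)
    (hx : 0 ≤ ht i₀ σ x₀ x) (hx' : ht i₀ σ x₀ x ≤ q) : (ht i₀ σ x₀ x : ℝ) / q -
      (lt2 i₀ x₀ x + (2 * d - 1) * ((ht i₀ σ x₀ x : ℝ) * (q - ht i₀ σ x₀ x)) + (64 * d * (q:ℝ)^2 - k)) / (64 * d * (q:ℝ)^2) ≤ hv i₀ σ x₀ K q k x := by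
  have hd' : (5:ℝ) ≤ d := by exact_mod_cast hd
  have hq' : (1:ℝ) ≤ q := by exact_mod_cast hq
  have hsq : ((σ:ℝ)) * σ = 1 := by exact_mod_cast hσ
  set R := 64 * d * (q:ℝ)^2 with hR
  have hRp : 0 < R := by positivity
  have l0 : ∀ y : V d, lt2 i₀ x₀ y = nsq (y - x₀) - (ht i₀ σ x₀ y : ℝ)^2 := fun y => by
    unfold lt2 ht; push_cast; rw [mul_pow, sq (σ:ℝ), hsq, one_mul]
  have hsmall : ∀ y : V d, 0 ≤ ht i₀ σ x₀ y → ht i₀ σ x₀ y ≤ q → 0 ≤ (2 * d - 1) * ((ht i₀ σ x₀ y : ℝ) * (q - ht i₀ σ x₀ y)) := fun y hy hy' => by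
    have h1 : (ht i₀ σ x₀ y : ℝ) ≤ q := by exact_mod_cast hy'
    have h2 : (0:ℝ) ≤ (ht i₀ σ x₀ y : ℝ) := by exact_mod_cast hy
    exact mul_nonneg (by linarith) (mul_nonneg h2 (by linarith))
  have key : ∀ (k : ℕ) (y : V d), (ht i₀ σ x₀ y : ℝ) / q - (lt2 i₀ x₀ y + (2 * d - 1) * ((ht i₀ σ x₀ y : ℝ) * (q - ht i₀ σ x₀ y)) + (R - k)) / R =
      (k - R) / R + (1 / q - (2 * d - 1) * q / R) * (ht i₀ σ x₀ y : ℝ) + (2 * d / R) * (ht i₀ σ x₀ y : ℝ)^2 + (-1 / R) * nsq (y - x₀) := by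
    intro k y; rw [l0]; field_simp; ring
  have hone : ∀ y : V d, ht i₀ σ x₀ y ≤ q → (ht i₀ σ x₀ y : ℝ) / q ≤ 1 := fun y hy => by
    rw [div_le_one (by linarith)]; exact_mod_cast hy
  induction k generalizing x with
  | zero =>
    refine le_trans ?_ (ind_nonneg _ _)
    have h1 := hone x hx'
    have h2 : 1 ≤ (lt2 i₀ x₀ x + (2 * d - 1) * ((ht i₀ σ x₀ x : ℝ) * (q - ht i₀ σ x₀ x)) + (R - (0:ℕ))) / R := by
      rw [le_div_iff₀ hRp]; have := hsmall x hx hx'; have := lt2_nonneg i₀ x₀ x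
      push_cast; linarith
    linarith
  | succ k ih =>
    have hk' : ((k+1 : ℕ):ℝ) ≤ R := by rw [hR]; exact_mod_cast hk
    have h1 := hsmall x hx hx'; have h2 := lt2_nonneg i₀ x₀ x
    have h3 := hone x hx'
    by_cases hxq : ht i₀ σ x₀ x = q
    · unfold hv; rw [Ex_out _ (fun h => by have := h.1.1; rw [hxq] at this; simp at this), ind_pos (by exact hxq)]
      have : 0 ≤ (lt2 i₀ x₀ x + (2 * d - 1) * ((ht i₀ σ x₀ x : ℝ) * (q - ht i₀ σ x₀ x)) + (R - (k+1:ℕ))) / R := by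
        apply div_nonneg _ hRp.le; linarith
      linarith
    have hnn : 0 ≤ hv i₀ σ x₀ K q (k+1) x := Ex_nonneg (ind_nonneg _) _ _
    rcases hx.lt_or_eq with hp | hz
    · by_cases hB : lt2 i₀ x₀ x < R
      · have hB' : x ∈ FB i₀ σ x₀ q \ K := ⟨⟨by rw [abs_of_pos hp]; omega, hB⟩, fun h => by have := hK x h; omega⟩
        unfold hv; rw [Ex_in _ hB']
        refine le_trans ?_ (avg_mono_nb (f := fun y => _) fun y hy => ih (by omega) y (by have := (ht_nb (i₀ := i₀) hσ x₀ hy).2; omega) (by have := (ht_nb (i₀ := i₀) hσ x₀ hy).1; omega))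
        simp only [key]
        rw [avg_poly (by omega) hσ]
        apply le_of_eq; push_cast; field_simp; ring
      · refine le_trans ?_ hnn
        have : 1 ≤ (lt2 i₀ x₀ x + (2 * d - 1) * ((ht i₀ σ x₀ x : ℝ) * (q - ht i₀ σ x₀ x)) + (R - (k+1:ℕ))) / R := by
          rw [le_div_iff₀ hRp]; linarith
        linarith
    · refine le_trans ?_ hnn
      have : 0 ≤ (lt2 i₀ x₀ x + (2 * d - 1) * ((ht i₀ σ x₀ x : ℝ) * (q - ht i₀ σ x₀ x)) + (R - (k+1:ℕ))) / R := by
        apply div_nonneg _ hRp.le; linarith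
      rw [← hz] at *; simp at *; linarith
end
end USFPaper

set_option linter.unusedSimpArgs false
namespace USFPaper
variable {d : ℕ}
section
variable {i₀ : Fin d} {σ : ℤ} {x₀ : V d} {K : Set (V d)} {p : ℕ}

lemma rst_le (hd : 5 ≤ d) (hσ : σ * σ = 1) (hp : 1 ≤ p) (t : ℕ) (x : V d)
    (hx : |ht i₀ σ x₀ x| ≤ p) (hl : lt2 i₀ x₀ x ≤ 72 * d * (p:ℝ)^2) :
    rst i₀ σ x₀ K (4*p) (t + 64 * d * (4*p)^2) x ≤ 13/128 * su i₀ σ x₀ K p t x := by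
  have hd' : (5:ℝ) ≤ d := by exact_mod_cast hd
  have hp' : (1:ℝ) ≤ p := by exact_mod_cast hp
  have small : ∀ k ≥ 64 * d * (4*p)^2, ∀ x : V d, |ht i₀ σ x₀ x| ≤ p → lt2 i₀ x₀ x ≤ 72 * d * (p:ℝ)^2 →
      rst i₀ σ x₀ K (4*p) k x ≤ 13/128 := by
    intro k hk x hx hl
    refine (Ex_anti (fun y hy => ?_) x hk).trans ((rst_bar hd hσ (by omega) _ le_rfl x (by push_cast; omega)).trans ?_)
    · rw [ind_pos (A := {y | |ht i₀ σ x₀ y| ≠ (4*p:ℕ) ∧ y ∉ K}) ⟨hy.1.1.ne, hy.2⟩]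
      exact (avg_mono' (g := fun _ => 1) (fun y => ind_le_one _ y) y).trans (avg_const (by omega) 1 y).le
    · push_cast
      rw [div_le_iff₀ (by positivity)]
      have := sq_nonneg (ht i₀ σ x₀ x : ℝ)
      nlinarith
  induction t generalizing x with
  | zero =>
    by_cases hK : x ∈ K
    · have : rst i₀ σ x₀ K (4*p) (0 + 64 * d * (4*p)^2) x = 0 := by
        unfold rst; rw [Ex_out _ (fun h => h.2 hK), ind_neg]; exact fun h => h.2 hK
      rw [this]; have : 0 ≤ su i₀ σ x₀ K p 0 x := Ex_nonneg (ind_nonneg _) _ _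
      linarith
    · have : su i₀ σ x₀ K p 0 x = 1 := ind_pos (A := Kᶜ) hK
      rw [this]; linarith [small (0 + 64 * d * (4*p)^2) (by omega) x hx hl]
  | succ t ih =>
    by_cases hK : x ∈ K
    · have : rst i₀ σ x₀ K (4*p) (t + 1 + 64 * d * (4*p)^2) x = 0 := by
        unfold rst; rw [Ex_out _ (fun h => h.2 hK), ind_neg]; exact fun h => h.2 hK
      rw [this]; have : 0 ≤ su i₀ σ x₀ K p (t+1) x := Ex_nonneg (ind_nonneg _) _ _
      linarith
    by_cases hF : x ∈ FB i₀ σ x₀ p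
    · have b1 : x ∈ FB i₀ σ x₀ p \ K := ⟨hF, hK⟩
      have b2 : x ∈ FB i₀ σ x₀ (4*p) \ K := ⟨⟨by have := hF.1; push_cast; omega, by
        have := hF.2; push_cast; nlinarith [mul_pos (by linarith : (0:ℝ) < d) (by positivity : (0:ℝ) < (p:ℝ)^2)]⟩, hK⟩
      rw [show t + 1 + 64 * d * (4*p)^2 = (t + 64 * d * (4*p)^2) + 1 by omega]
      unfold rst su; rw [Ex_in _ b1, Ex_in _ b2, ← avg_smul]
      exact avg_mono_nb fun y hy => ih y (FB_nb hd hp hσ hF hy).1 (FB_nb hd hp hσ hF hy).2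
    · have : su i₀ σ x₀ K p (t+1) x = 1 := by
        unfold su; rw [Ex_out _ fun h => hF h.1]; exact ind_pos (A := Kᶜ) hK
      rw [this]; linarith [small (t + 1 + 64 * d * (4*p)^2) (by omega) x hx hl]

lemma hv_le (hd : 5 ≤ d) (hσ : σ * σ = 1) (hK : ∀ y ∈ K, ht i₀ σ x₀ y ≤ 0) (hp : 1 ≤ p) (t : ℕ) (x : V d)
    (hx : |ht i₀ σ x₀ x| ≤ p) (hl : lt2 i₀ x₀ x ≤ 72 * d * (p:ℝ)^2) :
    hv i₀ σ x₀ K p t x ≤ 128/22 * hv i₀ σ x₀ K (4*p) (t + 64 * d * (4*p)^2) x := by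
  have hd' : (5:ℝ) ≤ d := by exact_mod_cast hd
  have hp' : (1:ℝ) ≤ p := by exact_mod_cast hp
  have big : ∀ k ≥ 64 * d * (4*p)^2, ∀ x : V d, ht i₀ σ x₀ x = p → lt2 i₀ x₀ x ≤ 72 * d * (p:ℝ)^2 →
      22/128 ≤ hv i₀ σ x₀ K (4*p) k x := by
    intro k hk x hx hl
    refine le_trans (le_trans ?_ (hv_bar hd hσ hK (by omega) _ le_rfl x (by omega) (by push_cast; omega))) (Ex_mono_t (fun y hy => ?_) x hk)
    · rw [hx]; push_cast
      rw [le_sub_comm, div_le_iff₀ (by positivity)]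
      have : (p:ℝ) / (4 * p) = 1/4 := by field_simp
      rw [this]
      have : 0 < (d:ℝ) * (p:ℝ)^2 := by positivity
      nlinarith
    · rw [ind_neg (A := {y | ht i₀ σ x₀ y = (4*p:ℕ)})]
      · exact avg_nonneg (ind_nonneg _) _
      · intro h; have h1 := hy.1.1; simp only [Set.mem_ofPred_eq] at h; rw [h] at h1; simp at h1
  have out : ∀ t (x : V d), |ht i₀ σ x₀ x| ≤ p → lt2 i₀ x₀ x ≤ 72 * d * (p:ℝ)^2 →
      ind {y | ht i₀ σ x₀ y = p} x ≤ 128/22 * hv i₀ σ x₀ K (4*p) (t + 64 * d * (4*p)^2) x := by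
    intro t x hx hl
    by_cases h : ht i₀ σ x₀ x = p
    · have h1 := big (t + 64 * d * (4*p)^2) (by omega) x h hl
      have := ind_le_one {y | ht i₀ σ x₀ y = p} x
      linarith
    · rw [ind_neg (by exact h)]
      have : 0 ≤ hv i₀ σ x₀ K (4*p) (t + 64 * d * (4*p)^2) x := Ex_nonneg (ind_nonneg _) _ _
      linarith
  induction t generalizing x with
  | zero => exact out 0 x hx hl
  | succ t ih =>
    by_cases b1 : x ∈ FB i₀ σ x₀ p \ K
    · have b2 : x ∈ FB i₀ σ x₀ (4*p) \ K := ⟨⟨by have := b1.1.1; push_cast; omega, by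
        have := b1.1.2; push_cast; nlinarith [mul_pos (by linarith : (0:ℝ) < d) (by positivity : (0:ℝ) < (p:ℝ)^2)]⟩, b1.2⟩
      rw [show t + 1 + 64 * d * (4*p)^2 = (t + 64 * d * (4*p)^2) + 1 by omega]
      unfold hv; rw [Ex_in _ b1, Ex_in _ b2, ← avg_smul]
      exact avg_mono_nb fun y hy => ih y (FB_nb hd hp hσ b1.1 hy).1 (FB_nb hd hp hσ b1.1 hy).2
    · have h2 := out (t+1) x hx hl
      unfold hv at h2 ⊢
      rw [Ex_out (B := FB i₀ σ x₀ p \ K) _ b1]; exact h2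

lemma lemA (hd : 5 ≤ d) (hσ : σ * σ = 1) (hK : ∀ y ∈ K, ht i₀ σ x₀ y ≤ 0) (a : ℕ) :
    avg (su i₀ σ x₀ K (4^a) (128 * d * (4^a)^2)) x₀ ≤ 2 * d * avg (hv i₀ σ x₀ K (4^a) (128 * d * (4^a)^2)) x₀ := by
  have hd' : (5:ℝ) ≤ d := by exact_mod_cast hd
  have hx0 : ∀ p : ℕ, 1 ≤ p → x₀ ∈ FB i₀ σ x₀ p := fun p hp => by
    have hp' : (1:ℝ) ≤ p := by exact_mod_cast hp
    constructor
    · simp [ht]; omega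
    · simp [lt2, nsq]; positivity
  induction a with
  | zero =>
    have h1 : avg (su i₀ σ x₀ K (4^0) (128 * d * (4^0)^2)) x₀ ≤ 1 := by
      refine (avg_mono' (g := fun _ => 1) (fun y => ?_) _).trans (avg_const (by omega) _ _).le
      exact (Ex_mono (g := fun _ => 1) (fun z => ind_le_one _ z) _ y).trans (le_of_eq (by
        generalize 128 * d * (4^0)^2 = t
        induction t generalizing y with
        | zero => rfl
        | succ t ih =>
          rw [Ex]; split_ifs
          · rw [show Ex (FB i₀ σ x₀ (4^0) \ K) (fun _ => (1:ℝ)) t = fun _ => 1 from funext ih, avg_const (by omega)]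
          · rfl))
    have hn : ∀ y, 0 ≤ hv i₀ σ x₀ K (4^0) (128 * d * (4^0)^2) y := fun y => Ex_nonneg (ind_nonneg _) _ _
    have h2 := avg_nbr hn x₀ i₀
    have h3 : ∀ y, ht i₀ σ x₀ y = 1 → hv i₀ σ x₀ K (4^0) (128 * d * (4^0)^2) y = 1 := fun y hy => by
      unfold hv; rw [Ex_out]
      · exact ind_pos (by simpa using hy)
      · intro h; have := h.1.1; rw [hy] at this; simp at this
    rcases sig hσ with h | h
    · have h4 := h3 (x₀ + ev i₀) (by simp [ht, h, ev])
      linarith [hn (x₀ - ev i₀)]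
    · have h4 := h3 (x₀ - ev i₀) (by simp [ht, h, ev])
      linarith [hn (x₀ + ev i₀)]
  | succ a ih =>
    have hp : 1 ≤ 4^a := Nat.one_le_pow _ _ (by norm_num)
    rw [pow_succ, mul_comm (4^a) 4]
    set p := 4^a with hpd
    set T := 128 * d * (4*p)^2 with hT
    have hTle : 128 * d * p^2 + 64 * d * (4*p)^2 ≤ T := by rw [hT]; nlinarith [Nat.zero_le (d * p^2)]
    have e1 : avg (su i₀ σ x₀ K (4*p) T) x₀ ≤ avg (hv i₀ σ x₀ K (4*p) T) x₀ + avg (hlo i₀ σ x₀ K (4*p) T) x₀ + avg (rst i₀ σ x₀ K (4*p) T) x₀ := by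
      rw [← avg_add, ← avg_add]; exact avg_mono' (fun y => su_le ..) _
    have e2 := refl_x0 (x₀ := x₀) hσ hK (q := 4*p) (by omega) T
    have e3 : avg (rst i₀ σ x₀ K (4*p) T) x₀ ≤ 13/128 * avg (su i₀ σ x₀ K p (128 * d * p^2)) x₀ := by
      rw [← avg_smul]
      refine avg_mono_nb fun y hy => le_trans (Ex_anti (fun y hy => ?_) y hTle) (rst_le hd hσ hp _ y (FB_nb hd hp hσ (hx0 p hp) hy).1 (FB_nb hd hp hσ (hx0 p hp) hy).2)
      rw [ind_pos (A := {y | |ht i₀ σ x₀ y| ≠ (4*p:ℕ) ∧ y ∉ K}) ⟨hy.1.1.ne, hy.2⟩]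
      exact (avg_mono' (g := fun _ => 1) (fun y => ind_le_one _ y) y).trans (avg_const (by omega) 1 y).le
    have e4 : avg (hv i₀ σ x₀ K p (128 * d * p^2)) x₀ ≤ 128/22 * avg (hv i₀ σ x₀ K (4*p) T) x₀ := by
      rw [← avg_smul]
      refine avg_mono_nb fun y hy => le_trans (hv_le hd hσ hK hp _ y (FB_nb hd hp hσ (hx0 p hp) hy).1 (FB_nb hd hp hσ (hx0 p hp) hy).2) ?_
      refine mul_le_mul_of_nonneg_left (Ex_mono_t (fun y hy => ?_) y hTle) (by norm_num)
      rw [ind_neg (A := {y | ht i₀ σ x₀ y = (4*p:ℕ)})]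
      · exact avg_nonneg (ind_nonneg _) _
      · intro h; have h1 := hy.1.1; simp only [Set.mem_ofPred_eq] at h; rw [h] at h1; simp at h1
    have e5 : 0 ≤ avg (hv i₀ σ x₀ K (4*p) T) x₀ := avg_nonneg (fun y => Ex_nonneg (ind_nonneg _) _ _) _
    have e6 : avg (su i₀ σ x₀ K p (128 * d * p^2)) x₀ ≤ 2 * d * (128/22 * avg (hv i₀ σ x₀ K (4*p) T) x₀) :=
      ih.trans (by gcongr)
    nlinarith
end
end USFPaper

namespace USFPaper
variable {d : ℕ}

lemma adj_ev (x : V d) (i : Fin d) : adj x (x + ev i) ∧ adj x (x - ev i) := by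
  unfold adj
  have : ∀ j, |ev i j| = if j = i then 1 else 0 := fun j => by
    unfold ev; rw [Pi.single_apply]; split_ifs <;> simp
  constructor
  · simp [this]
  · simp [this]

lemma adj_nb {x y : V d} (h : adj x y) : nb x y := by
  unfold adj at h
  have hex : ∃ i, x i ≠ y i := by
    by_contra hc; push Not at hc; simp [hc] at h
  obtain ⟨i, hi⟩ := hex
  have h1 : 1 ≤ |x i - y i| := Int.one_le_abs (sub_ne_zero.2 hi)
  rw [← Finset.add_sum_erase _ _ (Finset.mem_univ i)] at h
  have h0 : 0 ≤ ∑ j ∈ Finset.univ.erase i, |x j - y j| := Finset.sum_nonneg fun _ _ => abs_nonneg _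
  have h2 : ∀ j, j ≠ i → x j = y j := fun j hj => by
    have := Finset.single_le_sum (f := fun j => |x j - y j|) (fun _ _ => abs_nonneg _)
      (Finset.mem_erase.2 ⟨hj, Finset.mem_univ j⟩)
    have h3 : |x j - y j| = 0 := le_antisymm (by omega) (abs_nonneg _)
    exact sub_eq_zero.1 (abs_eq_zero.1 h3)
  have h4 : |x i - y i| = 1 := by omega
  refine ⟨i, ?_⟩
  rcases (abs_eq (by norm_num)).1 h4 with h5 | h5
  · right; funext j; by_cases hj : j = i
    · subst hj; simp [ev]; omega
    · simp [ev, hj, h2 j hj]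
  · left; funext j; by_cases hj : j = i
    · subst hj; simp [ev]; omega
    · simp [ev, hj, h2 j hj]

/-- neighbour indexed by direction and sign -/
def nbv (x : V d) (p : Fin d × Bool) : V d := if p.2 then x + ev p.1 else x - ev p.1

lemma nbv_inj (x : V d) : Function.Injective (nbv x) := by
  rintro ⟨i, a⟩ ⟨j, b⟩ h
  have h1 := congrFun h i
  have h2 := congrFun h j
  by_cases hij : i = j
  · subst hij; cases a <;> cases b <;> simp [nbv, ev] at h1 ⊢ <;> omega
  · cases a <;> cases b <;> simp [nbv, ev, hij] at h1

lemma nbv_adj (x : V d) (p : Fin d × Bool) : adj x (nbv x p) := by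
  unfold nbv; split_ifs; exacts [(adj_ev x _).1, (adj_ev x _).2]

lemma adj_nbv {x y : V d} (h : adj x y) : ∃ p, nbv x p = y := by
  obtain ⟨i, h | h⟩ := adj_nb h
  · exact ⟨(i, true), by simp [nbv, h]⟩
  · exact ⟨(i, false), by simp [nbv, h]⟩

lemma avg_nbv (f : V d → ℝ) (x : V d) : avg f x = (2 * (d:ℝ))⁻¹ * ∑ p, f (nbv x p) := by
  unfold avg; congr 1; rw [Fintype.sum_prod_type]; simp [nbv]

/-- cylinder -/
def cyl (n : ℕ) (γ : ℕ → V d) : Set (ℕ → V d) := { ω | ∀ i ≤ n, ω i = γ i }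

lemma cyl_meas (n : ℕ) (γ : ℕ → V d) : MeasurableSet (cyl n γ) := by
  have : cyl n γ = ⋂ i ∈ Finset.range (n+1), (fun ω : ℕ → V d => ω i) ⁻¹' {γ i} := by
    ext ω; simp [cyl]
  rw [this]
  exact Finset.measurableSet_biInter _ fun i _ => (measurable_pi_apply i) (measurableSet_singleton _)

lemma cyl_full {μ : Measure (ℕ → V d)} {x : V d} (hd : 0 < d) (h : IsSRWLaw μ x) (n : ℕ) (γ : ℕ → V d) :
    μ (cyl n γ) = if γ 0 = x ∧ ∀ i < n, adj (γ i) (γ (i+1)) then (2 * (d : ℝ≥0∞))⁻¹ ^ n else 0 := by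
  have := h.1
  split_ifs with hc
  · exact h.2 n γ hc.1 hc.2
  · induction n with
    | zero =>
      have h1 : γ 0 ≠ x := fun h0 => hc ⟨h0, fun i hi => absurd hi (by omega)⟩
      have h2 := h.2 0 (fun _ => x) rfl (by simp)
      simp only [pow_zero] at h2
      have h3 := prob_compl_eq_zero_iff (μ := μ) (cyl_meas 0 (fun _ => x)) |>.2 h2
      refine measure_mono_null (fun ω hω => ?_) h3
      intro h4; exact h1 ((hω 0 le_rfl).symm.trans (h4 0 le_rfl))
    | succ n ih =>
      by_cases hn : γ 0 = x ∧ ∀ i < n, adj (γ i) (γ (i+1))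
      swap
      · exact measure_mono_null (show cyl (n+1) γ ⊆ cyl n γ from fun ω hω i hi => hω i (by omega)) (ih hn)
      have hna : ¬ adj (γ n) (γ (n+1)) := fun ha => hc ⟨hn.1, fun i hi => by
        rcases Nat.lt_succ_iff_lt_or_eq.1 hi with h | h
        · exact hn.2 i h
        · rw [h]; exact ha⟩
      let g : Fin d × Bool → ℕ → V d := fun p => Function.update γ (n+1) (nbv (γ n) p)
      have hg : ∀ p, μ (cyl (n+1) (g p)) = (2 * (d : ℝ≥0∞))⁻¹ ^ (n+1) := fun p => by
        apply h.2
        · simp [g, hn.1]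
        · intro i hi
          rcases Nat.lt_succ_iff_lt_or_eq.1 hi with h | h
          · have e1 : g p i = γ i := Function.update_of_ne (by omega) _ _
            have e2 : g p (i+1) = γ (i+1) := Function.update_of_ne (by omega) _ _
            rw [e1, e2]; exact hn.2 i h
          · subst h
            have e1 : g p i = γ i := Function.update_of_ne (by omega) _ _
            have e2 : g p (i+1) = nbv (γ i) p := Function.update_self _ _ _
            rw [e1, e2]; exact nbv_adj _ _
      have hcn := h.2 n γ hn.1 hn.2
      have hU : μ (⋃ p, cyl (n+1) (g p)) = μ (cyl n γ) := by
        rw [measure_iUnion _ (fun p => cyl_meas _ _)]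
        · simp only [hg, tsum_fintype, Finset.sum_const, Finset.card_univ]
          rw [show cyl n γ = { ω | ∀ i ≤ n, ω i = γ i } from rfl, hcn]
          simp only [Fintype.card_prod, Fintype.card_fin, Fintype.card_bool, nsmul_eq_mul]
          rw [pow_succ]
          have : ((d * 2 : ℕ) : ℝ≥0∞) * (2 * (d : ℝ≥0∞))⁻¹ = 1 := by
            push_cast
            rw [mul_comm (d:ℝ≥0∞)]
            exact ENNReal.mul_inv_cancel (by simp; omega) (by finiteness)
          rw [mul_left_comm, this, mul_one]
        · intro p q hpq
          refine Set.disjoint_left.2 fun ω h1 h2 => hpq (nbv_inj (γ n) ?_)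
          have a := h1 (n+1) le_rfl
          have b := h2 (n+1) le_rfl
          simp only [g, Function.update_self] at a b
          exact a.symm.trans b
      have hsub : (⋃ p, cyl (n+1) (g p)) ⊆ cyl n γ := Set.iUnion_subset fun p ω hω i hi => by
        rw [hω i (by omega)]; exact Function.update_of_ne (by omega) _ _
      have hdiff : μ (cyl n γ \ ⋃ p, cyl (n+1) (g p)) = 0 := by
        rw [measure_sdiff hsub (MeasurableSet.iUnion fun p => cyl_meas _ _).nullMeasurableSet (by finiteness), hU, tsub_self]
      refine measure_mono_null (show cyl (n+1) γ ⊆ _ from fun ω hω => ?_) hdiff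
      refine ⟨fun i hi => hω i (by omega), ?_⟩
      intro hm
      obtain ⟨p, hp⟩ := Set.mem_iUnion.1 hm
      apply hna
      have a := hp (n+1) le_rfl
      simp only [g, Function.update_self] at a
      rw [← hω (n+1) le_rfl, a]; exact nbv_adj _ _

lemma cyl_gen : (MeasurableSpace.pi : MeasurableSpace (ℕ → V d)) =
    MeasurableSpace.generateFrom (insert ∅ {s | ∃ n γ, s = cyl n γ}) := by
  apply le_antisymm
  · rw [MeasurableSpace.pi]
    refine iSup_le fun i => ?_
    rw [← measurable_iff_comap_le]
    refine @measurable_to_countable' _ _ _ _ (_) _ fun v => ?_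
    have : (fun ω : ℕ → V d => ω i) ⁻¹' {v} = ⋃ γ : Fin i → V d, cyl i (fun j => if hj : j < i then γ ⟨j, hj⟩ else v) := by
      ext ω
      simp only [Set.mem_preimage, Set.mem_singleton_iff, Set.mem_iUnion, cyl, Set.mem_ofPred_eq]
      constructor
      · intro h
        refine ⟨fun j => ω j, fun j hj => ?_⟩
        split_ifs with h1
        · rfl
        · rw [← h]; congr 1; omega
      · rintro ⟨γ, h⟩
        simpa using h i le_rfl
    rw [this]
    refine @MeasurableSet.iUnion _ _ (MeasurableSpace.generateFrom _) _ _ fun γ => MeasurableSpace.measurableSet_generateFrom ?_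
    exact Or.inr ⟨_, _, rfl⟩
  · apply MeasurableSpace.generateFrom_le
    rintro s (rfl | ⟨n, γ, rfl⟩)
    · exact MeasurableSet.empty
    · exact cyl_meas n γ

lemma srw_unique (hd : 0 < d) {μ ν : Measure (ℕ → V d)} {x : V d} (h1 : IsSRWLaw μ x) (h2 : IsSRWLaw ν x) : μ = ν := by
  have := h1.1
  have := h2.1
  refine ext_of_generate_finite _ cyl_gen ?_ ?_ (by simp)
  · rintro s hs t ht hst
    rcases hs with rfl | ⟨n, γ, rfl⟩
    · simp at hst
    rcases ht with rfl | ⟨n', γ', rfl⟩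
    · simp at hst
    right
    obtain ⟨ω, ha, hb⟩ := hst
    refine ⟨max n n', ω, ?_⟩
    ext η
    simp only [Set.mem_inter_iff, cyl, Set.mem_ofPred_eq] at *
    constructor
    · rintro ⟨h3, h4⟩ i hi
      rcases le_max_iff.1 hi with h | h
      · rw [h3 i h, ha i h]
      · rw [h4 i h, hb i h]
    · intro h3
      exact ⟨fun i hi => by rw [h3 i (by omega), ha i hi], fun i hi => by rw [h3 i (by omega), hb i hi]⟩
  · rintro s (rfl | ⟨n, γ, rfl⟩)
    · simp
    · rw [cyl_full hd h1, cyl_full hd h2]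

/-- prepend a point -/
def cons (x : V d) (ω : ℕ → V d) : ℕ → V d := fun n => Nat.casesOn n x ω

@[simp] lemma cons_zero (x : V d) (ω : ℕ → V d) : cons x ω 0 = x := rfl
@[simp] lemma cons_succ (x : V d) (ω : ℕ → V d) (n : ℕ) : cons x ω (n+1) = ω n := rfl

lemma cons_meas (x : V d) : Measurable (cons x) := by
  refine measurable_pi_lambda _ fun n => ?_
  cases n with
  | zero => exact measurable_const
  | succ n => exact measurable_pi_apply n

lemma master (hd : 0 < d) {P : V d → Measure (ℕ → V d)} (hP : ∀ x, IsSRWLaw (P x) x) (x : V d) :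
    P x = (2 * (d:ℝ≥0∞))⁻¹ • ∑ p, (P (nbv x p)).map (cons x) := by
  have hc : ((2 * d : ℕ) : ℝ≥0∞) = 2 * (d:ℝ≥0∞) := by push_cast; rfl
  have hne : (2 * (d:ℝ≥0∞)) ≠ 0 := by simp; omega
  apply srw_unique hd (hP x)
  constructor
  · constructor
    have : ∀ p, ((P (nbv x p)).map (cons x)) Set.univ = 1 := fun p => by
      rw [Measure.map_apply (cons_meas x) MeasurableSet.univ]
      have := (hP (nbv x p)).1; simp
    simp only [Measure.smul_apply, Measure.coe_finsetSum, Finset.sum_apply, this]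
    simp only [Finset.sum_const, Finset.card_univ, Fintype.card_prod, Fintype.card_fin, Fintype.card_bool, nsmul_eq_mul, smul_eq_mul, mul_one]
    rw [mul_comm d 2, hc]
    exact ENNReal.inv_mul_cancel hne (by finiteness)
  · intro n γ h0 hadj
    rw [show { ω | ∀ i ≤ n, ω i = γ i } = cyl n γ from rfl]
    simp only [Measure.smul_apply, Measure.coe_finsetSum, Finset.sum_apply]
    have hm : ∀ p, ((P (nbv x p)).map (cons x)) (cyl n γ) = P (nbv x p) (cons x ⁻¹' cyl n γ) := fun p =>
      Measure.map_apply (cons_meas x) (cyl_meas n γ)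
    simp only [hm]
    cases n with
    | zero =>
      have : cons x ⁻¹' cyl 0 γ = Set.univ := by
        ext ω; simp [cyl, h0]
      simp only [this, pow_zero]
      have : ∀ p, P (nbv x p) Set.univ = 1 := fun p => by have := (hP (nbv x p)).1; simp
      simp only [this]
      simp only [Finset.sum_const, Finset.card_univ, Fintype.card_prod, Fintype.card_fin, Fintype.card_bool, nsmul_eq_mul, smul_eq_mul, mul_one]
      rw [mul_comm d 2, hc]
      exact ENNReal.inv_mul_cancel hne (by finiteness)
    | succ n =>
      have : cons x ⁻¹' cyl (n+1) γ = cyl n (fun i => γ (i+1)) := by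
        ext ω; simp only [Set.mem_preimage, cyl, Set.mem_ofPred_eq]
        constructor
        · intro h i hi; exact h (i+1) (by omega)
        · intro h i hi
          cases i with
          | zero => exact h0.symm
          | succ i => exact h i (by omega)
      simp only [this]
      obtain ⟨p, hp⟩ := adj_nbv (hadj 0 (by omega))
      rw [h0] at hp
      rw [Finset.sum_eq_single p]
      · rw [cyl_full hd (hP _), if_pos ⟨hp.symm, fun i hi => hadj (i+1) (by omega)⟩, pow_succ']
        rfl
      · intro q _ hq
        rw [cyl_full hd (hP _), if_neg]
        rintro ⟨h1, -⟩
        exact hq (nbv_inj x (h1.symm.trans hp.symm))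
      · simp
end USFPaper

namespace USFPaper
variable {d : ℕ} {P : V d → Measure (ℕ → V d)}

/-- real probability -/
noncomputable def pr (P : V d → Measure (ℕ → V d)) (x : V d) (E : Set (ℕ → V d)) : ℝ := (P x).real E

lemma pr_nonneg (x : V d) (E : Set (ℕ → V d)) : 0 ≤ pr P x E := measureReal_nonneg

lemma pr_le_one (hP : ∀ x, IsSRWLaw (P x) x) (x : V d) (E : Set (ℕ → V d)) : pr P x E ≤ 1 := by
  have := (hP x).1; exact measureReal_le_one

lemma pr_mono (hP : ∀ x, IsSRWLaw (P x) x) (x : V d) {E F : Set (ℕ → V d)} (h : E ⊆ F) : pr P x E ≤ pr P x F := by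
  have := (hP x).1; exact measureReal_mono h

lemma pr_start (hP : ∀ x, IsSRWLaw (P x) x) (x : V d) : ∀ᵐ ω ∂(P x), ω 0 = x := by
  have := (hP x).1
  have h := (hP x).2 0 (fun _ => x) rfl (by simp)
  have h3 := (prob_compl_eq_zero_iff (μ := P x) (cyl_meas 0 (fun _ => x))).2 (by simpa [cyl] using h)
  filter_upwards [compl_mem_ae_iff.2 h3] with ω hω
  simp only [compl_compl, cyl] at hω
  exact hω 0 le_rfl

lemma pr_mono_ae (hP : ∀ x, IsSRWLaw (P x) x) (x : V d) {E F : Set (ℕ → V d)} (h : ∀ ω, ω 0 = x → ω ∈ E → ω ∈ F) :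
    pr P x E ≤ pr P x F := by
  have := (hP x).1
  refine ENNReal.toReal_mono (by finiteness) (measure_mono_ae ?_)
  filter_upwards [pr_start hP x] with ω hω hE using h ω hω hE

lemma M1 (hd : 0 < d) (hP : ∀ x, IsSRWLaw (P x) x) (x : V d) {E : Set (ℕ → V d)} (hE : MeasurableSet E) :
    pr P x E = avg (fun y => pr P y (cons x ⁻¹' E)) x := by
  unfold pr
  have := fun x => (hP x).1
  rw [avg_nbv, Measure.real, master hd hP x]
  simp only [Measure.smul_apply, Measure.coe_finsetSum, Finset.sum_apply, smul_eq_mul, ENNReal.toReal_mul,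
    Measure.map_apply (cons_meas x) hE]
  rw [ENNReal.toReal_sum (fun _ _ => by finiteness)]
  simp [Measure.real]

lemma M1i (hd : 0 < d) (hP : ∀ x, IsSRWLaw (P x) x) (x : V d) {F : (ℕ → V d) → ℝ} (hF : Measurable F) {C : ℝ}
    (hC : ∀ ω, |F ω| ≤ C) : ∫ ω, F ω ∂(P x) = avg (fun y => ∫ ω, F (cons x ω) ∂(P y)) x := by
  have := fun x => (hP x).1
  rw [avg_nbv]
  conv_lhs => rw [master hd hP x]
  rw [integral_smul_measure, integral_finsetSum_measure]
  · simp only [ENNReal.toReal_inv, ENNReal.toReal_mul, smul_eq_mul]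
    congr 1
    refine Finset.sum_congr rfl fun p _ => ?_
    exact integral_map (cons_meas x).aemeasurable hF.aestronglyMeasurable
  · intro p _
    have := Measure.isProbabilityMeasure_map (μ := P (nbv x p)) (cons_meas x).aemeasurable
    exact Integrable.of_bound hF.aestronglyMeasurable C (Filter.Eventually.of_forall hC)

/-- path frozen at time t -/
def stp (t : ℕ) (ω : ℕ → V d) : ℕ → V d := fun i => ω (min i t)
/-- shift -/
def th (t : ℕ) (ω : ℕ → V d) : ℕ → V d := fun i => ω (i + t)

lemma th_meas (t : ℕ) : Measurable (th t : (ℕ → V d) → (ℕ → V d)) :=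
  measurable_pi_lambda _ fun i => measurable_pi_apply (i + t)

lemma stp_cons (t : ℕ) (x : V d) (ω : ℕ → V d) : stp (t+1) (cons x ω) = cons x (stp t ω) := by
  funext i
  cases i with
  | zero => simp [stp]
  | succ i => simp [stp, Nat.succ_min_succ]

lemma th_th (s t : ℕ) (ω : ℕ → V d) : th s (th t ω) = th (s + t) ω := by
  funext i; simp [th, add_assoc]

lemma th_cons (t : ℕ) (x : V d) (ω : ℕ → V d) : th (t+1) (cons x ω) = th t ω := rfl

lemma meas_mk (t : ℕ) (A : Set (ℕ → V d)) {Ev : (ℕ → V d) → Set (ℕ → V d)} (hE : ∀ γ, MeasurableSet (Ev γ)) :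
    MeasurableSet {ω : ℕ → V d | stp t ω ∈ A ∧ th t ω ∈ Ev (stp t ω)} := by
  let g : (Fin (t+1) → V d) → (ℕ → V d) := fun f i => f ⟨min i t, by omega⟩
  have : {ω : ℕ → V d | stp t ω ∈ A ∧ th t ω ∈ Ev (stp t ω)} =
      ⋃ f : Fin (t+1) → V d, {ω | g f ∈ A ∧ (fun j : Fin (t+1) => ω j) = f} ∩ th t ⁻¹' Ev (g f) := by
    ext ω
    simp only [Set.mem_iUnion, Set.mem_inter_iff, Set.mem_ofPred_eq, Set.mem_preimage]
    constructor
    · rintro ⟨h1, h2⟩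
      exact ⟨fun j => ω j, ⟨h1, rfl⟩, h2⟩
    · rintro ⟨f, ⟨h1, rfl⟩, h2⟩
      exact ⟨h1, h2⟩
  rw [this]
  refine MeasurableSet.iUnion fun f => MeasurableSet.inter ?_ (th_meas t (hE _))
  by_cases h : g f ∈ A
  · simp only [h, true_and]
    have hm : Measurable (fun (ω : ℕ → V d) (j : Fin (t+1)) => ω j) :=
      measurable_pi_lambda _ fun j => measurable_pi_apply _
    exact hm (measurableSet_singleton f)
  · simp [h]

lemma meas_loc (t : ℕ) (A : Set (ℕ → V d)) : MeasurableSet {ω : ℕ → V d | stp t ω ∈ A} := by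
  have := meas_mk t A (Ev := fun _ => Set.univ) (fun _ => MeasurableSet.univ)
  simpa using this

/-- a set depending on finitely many coordinates is measurable -/
lemma meas_loc' (t : ℕ) {A : Set (ℕ → V d)} (h : ∀ ω ω' : ℕ → V d, (∀ i ≤ t, ω i = ω' i) → ω ∈ A → ω' ∈ A) : MeasurableSet A := by
  have : A = {ω : ℕ → V d | stp t ω ∈ A} := by
    ext ω
    have h1 : ∀ i ≤ t, ω i = stp t ω i := fun i hi => by simp [stp, hi]
    exact ⟨fun hω => h _ _ h1 hω, fun hω => h _ _ (fun i hi => (h1 i hi).symm) hω⟩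
  rw [this]; exact meas_loc t A

lemma markov_ge (hd : 0 < d) (hP : ∀ x, IsSRWLaw (P x) x) (t : ℕ) {κ : ℝ} (x : V d) (A : Set (ℕ → V d))
    {Ev : (ℕ → V d) → Set (ℕ → V d)} (hE : ∀ γ, MeasurableSet (Ev γ))
    (hκ : ∀ γ ∈ A, κ ≤ pr P (γ t) (Ev γ)) :
    κ * pr P x {ω | stp t ω ∈ A} ≤ pr P x {ω | stp t ω ∈ A ∧ th t ω ∈ Ev (stp t ω)} := by
  induction t generalizing x A Ev with
  | zero =>
    by_cases hx : (fun _ => x) ∈ A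
    · have h1 := hκ _ hx
      have h2 : pr P x (Ev fun _ => x) ≤ pr P x {ω | stp 0 ω ∈ A ∧ th 0 ω ∈ Ev (stp 0 ω)} := by
        apply pr_mono_ae hP x
        intro ω h0 h
        have : stp 0 ω = fun _ => x := by funext i; simp [stp, h0]
        simp only [Set.mem_ofPred_eq, this]; exact ⟨hx, h⟩
      by_cases hk : 0 ≤ κ
      · have := mul_le_mul_of_nonneg_left (pr_le_one hP x {ω | stp 0 ω ∈ A}) hk
        linarith
      · have := mul_nonneg (by linarith : 0 ≤ -κ) (pr_nonneg (P := P) x {ω | stp 0 ω ∈ A})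
        have := pr_nonneg (P := P) x {ω | stp 0 ω ∈ A ∧ th 0 ω ∈ Ev (stp 0 ω)}
        linarith
    · have h2 : pr P x {ω | stp 0 ω ∈ A} ≤ pr P x ∅ := by
        apply pr_mono_ae hP x
        intro ω h0 h
        have : stp 0 ω = fun _ => x := by funext i; simp [stp, h0]
        simp only [Set.mem_ofPred_eq, this] at h; exact absurd h hx
      have h3 : pr P x {ω | stp 0 ω ∈ A} = 0 := le_antisymm (by simpa [pr] using h2) (pr_nonneg _ _)
      rw [h3, mul_zero]; exact pr_nonneg _ _
  | succ t ih =>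
    rw [M1 hd hP x (meas_loc _ _), M1 hd hP x (meas_mk _ _ hE), ← avg_smul]
    refine avg_mono' (fun y => ?_) x
    have := ih y (cons x ⁻¹' A) (Ev := fun γ => Ev (cons x γ)) (fun γ => hE _) (fun γ hγ => hκ _ hγ)
    simpa only [Set.preimage_ofPred_eq, stp_cons, th_cons, Set.mem_preimage] using this

lemma markov_le (hd : 0 < d) (hP : ∀ x, IsSRWLaw (P x) x) (t : ℕ) {κ : ℝ} (x : V d) (A : Set (ℕ → V d))
    {Ev : (ℕ → V d) → Set (ℕ → V d)} (hE : ∀ γ, MeasurableSet (Ev γ))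
    (hκ : ∀ γ ∈ A, pr P (γ t) (Ev γ) ≤ κ) :
    pr P x {ω | stp t ω ∈ A ∧ th t ω ∈ Ev (stp t ω)} ≤ κ * pr P x {ω | stp t ω ∈ A} := by
  have h1 := markov_ge hd hP t (κ := 1 - κ) x A (Ev := fun γ => (Ev γ)ᶜ) (fun γ => (hE γ).compl) (fun γ hγ => by
    have := hκ γ hγ
    have := (hP (γ t)).1
    have h2 := probReal_compl_eq_one_sub (μ := P (γ t)) (hE γ)
    unfold pr at *; linarith)
  have := (hP x).1
  have h3 : pr P x {ω | stp t ω ∈ A} = pr P x {ω | stp t ω ∈ A ∧ th t ω ∈ Ev (stp t ω)} +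
      pr P x {ω | stp t ω ∈ A ∧ th t ω ∈ (Ev (stp t ω))ᶜ} := by
    unfold pr
    rw [← measureReal_union _ (meas_mk t A fun γ => (hE γ).compl)]
    · congr 1; ext ω; simp only [Set.mem_union, Set.mem_ofPred_eq, Set.mem_compl_iff]; tauto
    · refine Set.disjoint_left.2 fun ω h1 h2 => h2.2 h1.2
  linarith

lemma stage (hd : 0 < d) (hP : ∀ x, IsSRWLaw (P x) x) (T : ℕ) {κ : ℝ} (x : V d) {A B : Set (V d)}
    {Ev : ℕ → (ℕ → V d) → Set (ℕ → V d)} (hE : ∀ j γ, MeasurableSet (Ev j γ))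
    (hκ : ∀ j ≤ T, ∀ γ : ℕ → V d, (∀ i < j, γ i ∈ B) → γ j ∈ A → κ ≤ pr P (γ j) (Ev j γ)) :
    κ * Ex B (ind A) T x ≤
      pr P x {ω | ∃ j ≤ T, (∀ i < j, ω i ∈ B) ∧ ω j ∈ A ∧ th j ω ∈ Ev j (stp j ω)} := by
  have hmeas : ∀ (T : ℕ) (Ev : ℕ → (ℕ → V d) → Set (ℕ → V d)), (∀ j γ, MeasurableSet (Ev j γ)) →
      MeasurableSet {ω : ℕ → V d | ∃ j ≤ T, (∀ i < j, ω i ∈ B) ∧ ω j ∈ A ∧ th j ω ∈ Ev j (stp j ω)} := by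
    intro T Ev hE
    have : {ω : ℕ → V d | ∃ j ≤ T, (∀ i < j, ω i ∈ B) ∧ ω j ∈ A ∧ th j ω ∈ Ev j (stp j ω)} =
      ⋃ j, {ω | stp j ω ∈ {γ | j ≤ T ∧ (∀ i < j, γ i ∈ B) ∧ γ j ∈ A} ∧ th j ω ∈ Ev j (stp j ω)} := by
      ext ω
      simp only [Set.mem_iUnion, Set.mem_ofPred_eq, stp, min_self]
      refine exists_congr fun j => ?_
      have : (∀ i < j, ω (min i j) ∈ B) ↔ (∀ i < j, ω i ∈ B) :=
        forall₂_congr fun i hi => by rw [min_eq_left hi.le]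
      rw [this]; tauto
    rw [this]; exact MeasurableSet.iUnion fun j => meas_mk _ _ (hE j)
  have hbase : ∀ (T : ℕ) (x : V d) (Ev : ℕ → (ℕ → V d) → Set (ℕ → V d)),
      (∀ j ≤ T, ∀ γ : ℕ → V d, (∀ i < j, γ i ∈ B) → γ j ∈ A → κ ≤ pr P (γ j) (Ev j γ)) →
      κ * ind A x ≤ pr P x {ω | ∃ j ≤ T, (∀ i < j, ω i ∈ B) ∧ ω j ∈ A ∧ th j ω ∈ Ev j (stp j ω)} := by
    intro T x Ev hκ
    by_cases hx : x ∈ A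
    · rw [ind_pos hx, mul_one]
      refine (hκ 0 (Nat.zero_le _) (fun _ => x) (fun i hi => absurd hi (by omega)) hx).trans ?_
      apply pr_mono_ae hP x
      intro ω h0 h
      refine ⟨0, Nat.zero_le _, fun i hi => absurd hi (by omega), by rwa [h0], ?_⟩
      have : stp 0 ω = fun _ => x := by funext i; simp [stp, h0]
      rw [this]; exact h
    · rw [ind_neg hx, mul_zero]; exact pr_nonneg _ _
  induction T generalizing x Ev with
  | zero => exact hbase 0 x Ev hκ
  | succ T ih =>
    by_cases hx : x ∈ B
    · rw [Ex_in _ hx, M1 hd hP x (hmeas _ _ hE), ← avg_smul]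
      refine avg_mono' (fun y => ?_) x
      refine (ih y (Ev := fun j γ => Ev (j+1) (cons x γ)) (fun j γ => hE _ _) (fun j hj γ h1 h2 => ?_)).trans
        (pr_mono hP y ?_)
      · refine hκ (j+1) (by omega) (cons x γ) (fun i hi => ?_) h2
        cases i with
        | zero => exact hx
        | succ i => exact h1 i (by omega)
      · rintro ω ⟨j, hj, h1, h2, h3⟩
        refine ⟨j+1, by omega, fun i hi => ?_, h2, ?_⟩
        · cases i with
          | zero => exact hx
          | succ i => exact h1 i (by omega)
        · rw [stp_cons, th_cons]; exact h3
    · rw [Ex_out _ hx]; exact hbase _ x Ev hκ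

lemma lim_le (hP : ∀ x, IsSRWLaw (P x) x) (x : V d) {E : ℕ → Set (ℕ → V d)} (hm : Monotone E) {b : ℝ}
    (h : ∀ T, pr P x (E T) ≤ b) : pr P x (⋃ T, E T) ≤ b := by
  have := (hP x).1
  have h1 := tendsto_measure_iUnion_atTop (μ := P x) hm
  have h2 := (ENNReal.tendsto_toReal (by finiteness)).comp h1
  exact le_of_tendsto' h2 h

lemma hit_meas (A : Set (V d)) {E : Set (ℕ → V d)} (hE : MeasurableSet E) (T : ℕ) :
    MeasurableSet {ω : ℕ → V d | ∃ t ≤ T, ω t ∈ A ∧ th t ω ∈ E} := by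
  have : {ω : ℕ → V d | ∃ t ≤ T, ω t ∈ A ∧ th t ω ∈ E} =
      ⋃ t, {ω | stp t ω ∈ {γ | t ≤ T ∧ γ t ∈ A} ∧ th t ω ∈ (fun _ => E) (stp t ω)} := by
    ext ω; simp [stp, and_assoc]
  rw [this]; exact MeasurableSet.iUnion fun j => meas_mk _ _ (fun _ => hE)

lemma hit_fin (hd : 0 < d) (hP : ∀ x, IsSRWLaw (P x) x) {A : Set (V d)} {E : Set (ℕ → V d)} (hE : MeasurableSet E)
    {F : V d → ℝ} (h0 : ∀ w, 0 ≤ F w) (h1 : ∀ w ∉ A, avg F w ≤ F w)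
    (h2 : ∀ w ∈ A, pr P w E + avg F w ≤ F w ∨ 1 ≤ F w) (T : ℕ) (x : V d) :
    pr P x {ω | ∃ t ≤ T, ω t ∈ A ∧ th t ω ∈ E} ≤ F x := by
  induction T generalizing x with
  | zero =>
    by_cases hx : x ∈ A
    · rcases h2 x hx with h | h
      · have := avg_nonneg h0 x
        refine le_trans (pr_mono hP x ?_) (by linarith : pr P x E ≤ F x)
        rintro ω ⟨t, ht, -, h⟩
        obtain rfl : t = 0 := by omega
        exact h
      · exact (pr_le_one hP _ _).trans h
    · refine le_trans (pr_mono_ae hP x (F := ∅) ?_) (by simpa [pr] using h0 x)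
      rintro ω h0 ⟨t, ht, h, -⟩
      obtain rfl : t = 0 := by omega
      rw [h0] at h; exact hx h
  | succ T ih =>
    have key : pr P x {ω | ∃ t, t ≤ T+1 ∧ 1 ≤ t ∧ ω t ∈ A ∧ th t ω ∈ E} ≤ avg F x := by
      have hm : MeasurableSet {ω : ℕ → V d | ∃ t, t ≤ T+1 ∧ 1 ≤ t ∧ ω t ∈ A ∧ th t ω ∈ E} := by
        have := th_meas 1 (hit_meas A hE T)
        convert this using 1
        ext ω
        simp only [Set.mem_ofPred_eq, Set.mem_preimage]
        constructor
        · rintro ⟨t, h1, h2, h3, h4⟩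
          obtain ⟨s, rfl⟩ : ∃ s, t = s + 1 := ⟨t-1, by omega⟩
          exact ⟨s, by omega, h3, by simpa only [th_th] using h4⟩
        · rintro ⟨s, h1, h3, h4⟩
          exact ⟨s+1, by omega, by omega, h3, by simpa only [th_th] using h4⟩
      rw [M1 hd hP x hm]
      refine avg_mono' (fun y => (pr_mono hP y ?_).trans (ih y)) x
      rintro ω ⟨t, h1, h2, h3, h4⟩
      obtain ⟨s, rfl⟩ : ∃ s, t = s + 1 := ⟨t-1, by omega⟩
      exact ⟨s, by omega, h3, h4⟩
    by_cases hx : x ∈ A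
    · rcases h2 x hx with h | h
      · have hu : pr P x {ω | ∃ t ≤ T+1, ω t ∈ A ∧ th t ω ∈ E} ≤
            pr P x (E ∪ {ω | ∃ t, t ≤ T+1 ∧ 1 ≤ t ∧ ω t ∈ A ∧ th t ω ∈ E}) := by
          refine pr_mono hP x ?_
          rintro ω ⟨t, ht, h3, h4⟩
          rcases Nat.eq_zero_or_pos t with rfl | h5
          · exact Or.inl h4
          · exact Or.inr ⟨t, ht, h5, h3, h4⟩
        have := measureReal_union_le (μ := P x) E {ω | ∃ t, t ≤ T+1 ∧ 1 ≤ t ∧ ω t ∈ A ∧ th t ω ∈ E}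
        unfold pr at *; linarith
      · exact (pr_le_one hP _ _).trans h
    · refine le_trans (pr_mono_ae hP x ?_) (key.trans (h1 x hx))
      rintro ω h0 ⟨t, ht, h3, h4⟩
      refine ⟨t, ht, ?_, h3, h4⟩
      by_contra hc
      obtain rfl : t = 0 := by omega
      rw [h0] at h3; exact hx h3

lemma hit_inf (hd : 0 < d) (hP : ∀ x, IsSRWLaw (P x) x) {A : Set (V d)} {E : Set (ℕ → V d)} (hE : MeasurableSet E)
    {F : V d → ℝ} (h0 : ∀ w, 0 ≤ F w) (h1 : ∀ w ∉ A, avg F w ≤ F w)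
    (h2 : ∀ w ∈ A, pr P w E + avg F w ≤ F w ∨ 1 ≤ F w) (x : V d) :
    pr P x {ω | ∃ t, ω t ∈ A ∧ th t ω ∈ E} ≤ F x := by
  have : {ω : ℕ → V d | ∃ t, ω t ∈ A ∧ th t ω ∈ E} = ⋃ T, {ω | ∃ t ≤ T, ω t ∈ A ∧ th t ω ∈ E} := by
    ext ω; simp only [Set.mem_iUnion, Set.mem_ofPred_eq]
    exact ⟨fun ⟨t, h⟩ => ⟨t, t, le_rfl, h⟩, fun ⟨T, t, _, h⟩ => ⟨t, h⟩⟩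
  rw [this]
  refine lim_le hP x ?_ (fun T => hit_fin hd hP hE h0 h1 h2 T x)
  rintro T T' hT ω ⟨t, h, h'⟩
  exact ⟨t, h.trans hT, h'⟩

lemma hit_le (hd : 0 < d) (hP : ∀ x, IsSRWLaw (P x) x) {A : Set (V d)}
    {F : V d → ℝ} (h0 : ∀ w, 0 ≤ F w) (h1 : ∀ w, avg F w ≤ F w)
    (h2 : ∀ w ∈ A, 1 ≤ F w) (x : V d) :
    pr P x {ω | ∃ t, ω t ∈ A} ≤ F x := by
  have := hit_inf hd hP (A := A) (E := Set.univ) MeasurableSet.univ h0 (fun w _ => h1 w) (fun w hw => Or.inr (h2 w hw)) x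
  simpa using this

lemma avg_iter (hd : 0 < d) (hP : ∀ x, IsSRWLaw (P x) x) {f : V d → ℝ} {C : ℝ} (hC : ∀ y, |f y| ≤ C) (t : ℕ) (x : V d) :
    ∫ ω, f (ω t) ∂(P x) = avg^[t] f x := by
  have := fun x => (hP x).1
  induction t generalizing x with
  | zero =>
    rw [integral_congr_ae (g := fun _ => f x)]
    · simp
    · filter_upwards [pr_start hP x] with ω h; rw [h]
  | succ t ih =>
    rw [M1i hd hP x (F := fun ω => f (ω (t+1))) (measurable_of_countable f |>.comp (measurable_pi_apply _)) (fun ω => hC _)]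
    rw [Function.iterate_succ_apply']
    congr 1; funext y; exact ih y

lemma avg_diff (hd : 0 < d) (hP : ∀ x, IsSRWLaw (P x) x) {f : V d → ℝ} {C : ℝ} (hC : ∀ y, |f y| ≤ C) (j s : ℕ) (x : V d) :
    ∫ ω, f (ω (j + s) - ω j) ∂(P x) = avg^[s] f 0 := by
  have := fun x => (hP x).1
  induction j generalizing x with
  | zero =>
    rw [integral_congr_ae (g := fun ω => f (ω s - x))]
    · rw [avg_iter hd hP (f := fun y => f (y - x)) (fun y => hC _)]
      have : ∀ s y, avg^[s] (fun y => f (y - x)) y = avg^[s] f (y - x) := by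
        intro s
        induction s with
        | zero => intro y; rfl
        | succ s ih =>
          intro y
          rw [Function.iterate_succ_apply', Function.iterate_succ_apply', show avg^[s] (fun y => f (y - x)) = fun y => avg^[s] f (y + -x) from
            funext fun y => by rw [ih y, sub_eq_add_neg], avg_shift, sub_eq_add_neg]
      rw [this, sub_self]
    · filter_upwards [pr_start hP x] with ω h; rw [h, zero_add]
  | succ j ih =>
    rw [M1i hd hP x (F := fun ω => f (ω (j+1+s) - ω (j+1))) (C := C)]
    · rw [show (fun y => ∫ ω, f (cons x ω (j+1+s) - cons x ω (j+1)) ∂(P y)) = fun y => avg^[s] f 0 from funext fun y => by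
        rw [← ih y]; simp only [cons_succ, show j+1+s = (j+s)+1 by ring]]
      exact avg_const hd _ x
    · exact (measurable_of_countable f).comp ((measurable_pi_apply _).sub (measurable_pi_apply _))
    · exact fun ω => hC _

lemma count_le {μ : Measure (ℕ → V d)} [IsProbabilityMeasure μ] (n : ℕ) {E : ℕ → Set (ℕ → V d)} {F : Set (ℕ → V d)}
    (hE : ∀ i, MeasurableSet (E i)) (hF : MeasurableSet F) (hEF : ∀ i, E i ⊆ F) {b : ℝ} (hb : 0 ≤ b) :
    ∑ i ∈ Finset.range n, μ.real (E i) ≤ b * μ.real F +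
      n * μ.real {ω | ω ∈ F ∧ b < ∑ i ∈ Finset.range n, (E i).indicator (fun _ => (1:ℝ)) ω} := by
  have hm : Measurable fun ω => ∑ i ∈ Finset.range n, (E i).indicator (fun _ => (1:ℝ)) ω :=
    Finset.measurable_sum _ fun i _ => measurable_const.indicator (hE i)
  have hG : MeasurableSet {ω | ω ∈ F ∧ b < ∑ i ∈ Finset.range n, (E i).indicator (fun _ => (1:ℝ)) ω} :=
    hF.inter (measurableSet_lt measurable_const hm)
  set Gs := {ω | ω ∈ F ∧ b < ∑ i ∈ Finset.range n, (E i).indicator (fun _ => (1:ℝ)) ω} with hGs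
  have hi : ∀ s : Set (ℕ → V d), MeasurableSet s → Integrable (s.indicator (fun _ => (1:ℝ))) μ :=
    fun s hs => (integrable_const _).indicator hs
  have hI : ∀ s : Set (ℕ → V d), MeasurableSet s → ∫ ω, s.indicator (fun _ => (1:ℝ)) ω ∂μ = μ.real s :=
    fun s hs => by rw [integral_indicator hs]; simp
  rw [← hI F hF, ← hI Gs hG, ← integral_const_mul, ← integral_const_mul, ← integral_add ((hi F hF).const_mul _) ((hi Gs hG).const_mul _)]
  rw [Finset.sum_congr rfl fun i _ => (hI (E i) (hE i)).symm, ← integral_finsetSum _ fun i _ => hi _ (hE i)]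
  apply integral_mono (integrable_finsetSum _ fun i _ => hi _ (hE i)) (((hi F hF).const_mul _).add ((hi Gs hG).const_mul _))
  intro ω
  simp only [Pi.add_apply]
  by_cases h1 : ω ∈ F
  · by_cases h2 : ω ∈ Gs
    · rw [Set.indicator_of_mem h1, Set.indicator_of_mem h2]
      have : ∑ i ∈ Finset.range n, (E i).indicator (fun _ => (1:ℝ)) ω ≤ ∑ i ∈ Finset.range n, 1 :=
        Finset.sum_le_sum fun i _ => Set.indicator_le_self' (fun _ _ => zero_le_one) _
      simp at this; linarith
    · rw [Set.indicator_of_mem h1, Set.indicator_of_notMem h2]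
      have : ¬ (b < ∑ i ∈ Finset.range n, (E i).indicator (fun _ => (1:ℝ)) ω) := fun h => h2 ⟨h1, h⟩
      linarith
  · have : ∑ i ∈ Finset.range n, (E i).indicator (fun _ => (1:ℝ)) ω = 0 :=
      Finset.sum_eq_zero fun i _ => Set.indicator_of_notMem (fun h => h1 (hEF i h)) _
    rw [this, Set.indicator_of_notMem h1, Set.indicator_of_notMem (fun h => h1 h.1)]; simp

end USFPaper

namespace USFPaper
variable {d : ℕ}

/-- properties of the escape probability used below -/
structure HH (CC : ℝ) (N n : ℕ) (h : V d → ℝ) : Prop where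
  hn : n ≤ N
  hN : 1 ≤ N
  nonneg : ∀ x, 0 ≤ h x
  le1 : ∀ x, h x ≤ 1
  sup : ∀ x i, (n:ℤ) < |x i| → avg h x ≤ h x
  sub : ∀ x, (∀ i, |x i| ≤ 4 * (N:ℤ)) → h x ≤ avg h x
  far : ∀ x, CC * N^2 ≤ nsq x → 1/2 ≤ h x

lemma esc (hd : 5 ≤ d) (CC : ℝ) (Λ : ℕ) : ∃ c > 0, ∀ (N n : ℕ) (h : V d → ℝ), HH CC N n h → ∀ r : ℕ, 1 ≤ r → N ≤ Λ * r →
    ∀ (y : V d) (j : Fin d), (n:ℤ) + r ≤ |y j| → c ≤ h y := by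
  obtain ⟨B, hB⟩ := exists_nat_ge (max CC 1)
  have hB1 : CC ≤ B := (le_max_left _ _).trans hB
  have hB2 : (1:ℝ) ≤ B := (le_max_right _ _).trans hB
  have hB3 : 1 ≤ B := by exact_mod_cast hB2
  obtain ⟨c, hc, H⟩ := wharnack hd (6 * B * (Λ + 1))
  refine ⟨min (1/2) (c * (1/2)), by positivity, fun N n h hh r0 hr0 hΛ0 y j hy0 => ?_⟩
  have hn := hh.hn
  have hN := hh.hN
  obtain ⟨r, hr, hΛ, hrN, hy⟩ : ∃ r, 1 ≤ r ∧ N ≤ (Λ+1) * r ∧ r ≤ N ∧ (n:ℤ) + r ≤ |y j| := by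
    rcases le_total r0 N with h | h
    · exact ⟨r0, hr0, by nlinarith, h, hy0⟩
    · exact ⟨N, hN, by nlinarith, le_rfl, by omega⟩
  set R := B * N with hR
  have hNR : N ≤ R := by rw [hR]; nlinarith
  have far : ∀ w : V d, ∀ i, (R:ℤ) ≤ |w i| → 1/2 ≤ h w := fun w i hw => by
    apply hh.far
    have h1 : (R:ℝ) ≤ |(w i:ℝ)| := by exact_mod_cast hw
    have h2 : (R:ℝ)^2 ≤ (w i:ℝ)^2 := by rw [← sq_abs (w i:ℝ)]; gcongr
    have h3 := sq_le_nsq w i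
    have : CC * (N:ℝ)^2 ≤ (R:ℝ)^2 := by
      rw [hR]; push_cast; rw [mul_pow]; gcongr; nlinarith
    linarith
  by_cases hf : ∃ i, (R:ℤ) ≤ |y i|
  · obtain ⟨i, hi⟩ := hf
    exact (min_le_left _ _).trans (far y i hi)
  push Not at hf
  refine (min_le_right _ _).trans ?_
  let lo : V d := fun i => if i = j ∧ 0 ≤ y j then n + r else -(3*R)
  let hi : V d := fun i => if i = j ∧ y j < 0 then -(n+r) else 3*R
  let b : V d := fun i => if i = j then (if 0 ≤ y j then 2*R else -(2*R)) else 0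
  have hyj := hf j
  refine H r hr lo hi h (1/2) (fun i => ?_) hh.nonneg ?_ (by norm_num) b ?_ ?_ y ?_
  · have : 6 * (R:ℤ) ≤ ((6 * B * (Λ+1) * r : ℕ) : ℤ) := by
      have : 6 * R ≤ 6 * B * (Λ+1) * r := by rw [hR]; nlinarith [Nat.mul_le_mul_left (6*B) hΛ]
      exact_mod_cast this
    refine le_trans ?_ this
    simp only [lo, hi]; split_ifs <;> omega
  · intro z hz w hw
    apply hh.sup w j
    have h1 : lo j ≤ z j := hz.1 j
    have h2 : z j ≤ hi j := hz.2 j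
    have h3 := abs_le.1 (hw j)
    simp only [lo, hi, true_and] at h1 h2
    by_cases hs : 0 ≤ y j
    · rw [if_pos hs] at h1
      exact lt_of_lt_of_le (by omega) (le_abs_self _)
    · rw [if_pos (by omega)] at h2
      exact lt_of_lt_of_le (by omega) (neg_le_abs _)
  · constructor
    · intro i
      change lo i ≤ b i
      simp only [lo, b]; split_ifs <;> omega
    · intro i
      change b i ≤ hi i
      simp only [hi, b]; split_ifs <;> omega
  · intro w hw
    apply far w j
    have h3 := abs_le.1 (hw j)
    simp only [b, if_true] at h3
    by_cases hs : 0 ≤ y j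
    · rw [if_pos hs] at h3
      exact le_trans (by omega) (le_abs_self _)
    · rw [if_neg hs] at h3
      exact le_trans (by omega) (neg_le_abs _)
  · constructor
    · intro i
      change lo i ≤ y i
      have := abs_lt.1 (hf i)
      simp only [lo]; split_ifs with h1
      · rw [h1.1]; rw [abs_of_nonneg h1.2] at hy; exact hy
      · omega
    · intro i
      change y i ≤ hi i
      have := abs_lt.1 (hf i)
      simp only [hi]; split_ifs with h1
      · rw [h1.1]; rw [abs_of_neg h1.2] at hy; omega
      · omega

lemma nb_ne {x y : V d} (h : nb x y) (i : Fin d) : y i ≤ x i + 1 ∧ x i - 1 ≤ y i := by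
  obtain ⟨j, h⟩ := h
  have h1 := abs_le.1 (ev_abs j i)
  rcases h with rfl | rfl <;> simp only [Pi.add_apply, Pi.sub_apply] <;> omega

lemma reflh (hd : 5 ≤ d) (CC : ℝ) : ∃ C > 0, ∀ (N n : ℕ) (h : V d → ℝ), HH CC N n h → ∀ (ρ : ℕ) (i₀ : Fin d) (σ : ℤ), ρ ≤ N →
    σ * σ = 1 → ∀ x : V d, σ * x i₀ ≤ n + ρ → h x ≤ C * h (rf i₀ (2 * (σ * (n + ρ))) x) := by
  obtain ⟨c, hc, H⟩ := esc hd CC 1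
  refine ⟨max 1 c⁻¹, by positivity, fun N n h hh ρ i₀ σ hρ hσ x hx => ?_⟩
  set C := max 1 c⁻¹ with hC
  have hC1 : 1 ≤ C := le_max_left _ _
  have hC2 : 1 ≤ C * c := by
    rw [← inv_mul_cancel₀ hc.ne']; gcongr; exact le_max_right _ _
  have hn := hh.hn
  have hN := hh.hN
  set R := rf i₀ (2 * (σ * (n + ρ))) with hR
  have hRs : ∀ y, σ * (R y) i₀ = 2 * (n+ρ) - σ * y i₀ := fun y => by
    rw [hR, rf_self, mul_sub, ← mul_assoc, mul_comm σ 2, mul_assoc 2 σ, ← mul_assoc σ σ, hσ]; ring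
  let f : V d → ℝ := fun y => if n + ρ ≤ σ * y i₀ then C * h y - h (R y) else 0
  let B : Set (V d) := {y | n + ρ < σ * y i₀ ∧ ∀ i, |R y i| ≤ 4 * (N:ℤ)}
  have hf : 0 ≤ f (R x) := by
    have hoff : ∀ y ∉ B, 0 ≤ f y := by
      intro y hy
      simp only [f]; split_ifs with h1
      swap
      · exact le_rfl
      rcases h1.eq_or_lt with h2 | h2
      · have : R y = y := by
          funext i; by_cases hi : i = i₀
          · subst hi
            have h3 := hRs y
            rcases sig hσ with h4 | h4 <;> rw [h4] at h3 h2 <;> omega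
          · exact rf_ne hi _ _
        rw [this]; nlinarith [hh.nonneg y]
      · have h3 : ∃ i, 4 * (N:ℤ) < |R y i| := by
          by_contra hc; push Not at hc; exact hy ⟨h2, hc⟩
        obtain ⟨i, hi⟩ := h3
        have h4 : (n:ℤ) + N ≤ |y i| := by
          by_cases hii : i = i₀
          · subst hii
            have h3 := hRs y
            rcases sig hσ with h4 | h4 <;> rw [h4] at h3 h2 <;> rcases abs_cases (R y i) with h5 | h5 <;>
              rcases abs_cases (y i) with h6 | h6 <;> omega
          · rw [hR, rf_ne hii] at hi; omega
        have h5 := H N n h hh N hN (by omega) y i h4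
        have h6 := hh.le1 (R y)
        nlinarith
    refine minP (by omega) (B := B) ?_ hoff ?_ _
    · intro y hy
      have hup : f y = C * h y - h (R y) := if_pos hy.1.le
      have h1 : avg f y = avg (fun z => C * h z - h (R z)) y := by
        apply le_antisymm <;> apply avg_mono_nb <;> intro z hz <;> (
          apply le_of_eq
          have h2 := nb_ne hz i₀
          have h3 : n + ρ ≤ σ * z i₀ := by
            have h4 := hy.1
            rcases sig hσ with h5 | h5 <;> rw [h5] at h4 ⊢ <;> omega
          simp only [f, if_pos h3])
      rw [h1, hup, avg_sub, avg_smul, avg_rf]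
      have h2 : avg h y ≤ h y := hh.sup y i₀ (by
        have h4 := hy.1
        rcases sig hσ with h5 | h5 <;> rw [h5] at h4 <;> rcases abs_cases (y i₀) with h6 | h6 <;> omega)
      have h3 := hh.sub (R y) hy.2
      nlinarith
    · intro ε hε
      refine ((cube_finite (0 : V d) (4*N)).image R).subset fun y hy => ?_
      have : y ∈ B := by
        by_contra hc; have := hoff y hc; simp only [Set.mem_ofPred_eq] at hy; linarith
      refine ⟨R y, fun i => ?_, rf_rf _ _ _⟩
      have := this.2 i; simpa using this
  have h1 : f (R x) = C * h (R x) - h x := by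
    simp only [f]; rw [if_pos (by rw [hRs]; omega), hR, rf_rf]
  linarith

/-- Carleson-type estimate -/
lemma car (hd : 5 ≤ d) (CC : ℝ) (Λ : ℕ) : ∃ C > 0, ∀ (N n : ℕ) (h : V d → ℝ), HH CC N n h → ∀ (r : ℕ) (i₀ : Fin d) (σ : ℤ) (x₀ : V d), 1 ≤ r →
    σ * σ = 1 → x₀ i₀ = σ * n → (∀ i, |x₀ i| ≤ n) →
    ∀ x ∈ cube x₀ (Λ * r), ∀ y ∈ cube x₀ (Λ * r), r ≤ ht i₀ σ x₀ y → h x ≤ C * h y := by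
  obtain ⟨C1, hC1, H1⟩ := reflh hd CC
  obtain ⟨c, hc, H2⟩ := esc hd CC (4*Λ)
  obtain ⟨C3, hC3, H3⟩ := harnack hd (3*Λ)
  refine ⟨max (C1 * C3) c⁻¹, by positivity, fun N n h hh r i₀ σ x₀ hr hσ hx0 hxn x hx y hy hty => ?_⟩
  have hn := hh.hn
  have hN := hh.hN
  have hyh := hh.nonneg y
  have hyr : n + r ≤ σ * y i₀ := by
    unfold ht at hty; rw [hx0, mul_sub, ← mul_assoc, hσ] at hty; omega
  by_cases hcase : 4 * Λ * r ≤ N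
  · have h1 := H1 N n h hh (Λ * r) i₀ σ (by nlinarith) hσ x (by
      have h2 := abs_le.1 (hx i₀)
      rcases sig hσ with h5 | h5 <;> rw [h5] at hx0 ⊢ <;> push_cast at * <;> omega)
    set R := rf i₀ (2 * (σ * ((n:ℤ) + (Λ * r : ℕ)))) with hR
    have hRs : σ * (R x) i₀ = 2 * ((n:ℤ)+(Λ * r : ℕ)) - σ * x i₀ := by
      rw [hR, rf_self, mul_sub, ← mul_assoc, mul_comm σ 2, mul_assoc 2 σ, ← mul_assoc σ σ, hσ]; ring
    set ρ := Λ * r with hρ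
    have hρN : 4 * ρ ≤ N := by rw [hρ]; nlinarith
    have hrρ : r ≤ ρ := by
      have := abs_le.1 (hy i₀)
      rcases sig hσ with h5 | h5 <;> rw [h5] at hx0 hyr <;> omega
    let lo : V d := fun i => if i = i₀ then (if σ = 1 then n + r else -(n + 3*ρ)) else x₀ i - ρ
    let hi : V d := fun i => if i = i₀ then (if σ = 1 then n + 3*ρ else -(n + r)) else x₀ i + ρ
    have h2 := H3 r hr lo hi h (fun i => ?_) hh.nonneg ?_ (R x) ?_ y ?_
    · calc h x ≤ C1 * h (R x) := h1
        _ ≤ C1 * (C3 * h y) := by gcongr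
        _ = (C1 * C3) * h y := by ring
        _ ≤ _ := by gcongr; exact le_max_left _ _
    · rw [mul_assoc, ← hρ]; push_cast
      simp only [lo, hi]; split_ifs <;> omega
    · intro z hz w hw
      have hb : (n:ℤ) < |w i₀| ∧ |w i₀| ≤ 4 * (N:ℤ) := by
        have h1 : lo i₀ ≤ z i₀ := hz.1 i₀
        have h2 : z i₀ ≤ hi i₀ := hz.2 i₀
        have h3 := abs_le.1 (hw i₀)
        simp only [lo, hi, if_true] at h1 h2
        rcases sig hσ with h5 | h5 <;> simp only [h5] at h1 h2 <;>
          rcases abs_cases (w i₀) with h6 | h6 <;> norm_num at h1 h2 <;> omega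
      apply le_antisymm (hh.sup w i₀ hb.1)
      apply hh.sub
      intro i
      by_cases hii : i = i₀
      · rw [hii]; exact hb.2
      · have h1 : lo i ≤ z i := hz.1 i
        have h2 : z i ≤ hi i := hz.2 i
        have h3 := abs_le.1 (hw i)
        have h4 := abs_le.1 (hxn i)
        simp only [lo, hi, if_neg hii] at h1 h2
        rw [abs_le]; omega
    · have h4 := abs_le.1 (hx i₀)
      constructor
      · intro i; change lo i ≤ R x i
        simp only [lo]; split_ifs with h5 h6
        · rw [h5]; rw [h6] at hRs hx0; omega
        · rw [h5]; rw [(sig hσ).resolve_left h6] at hRs hx0; omega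
        · rw [hR, rf_ne h5]; have := abs_le.1 (hx i); omega
      · intro i; change R x i ≤ hi i
        simp only [hi]; split_ifs with h5 h6
        · rw [h5]; rw [h6] at hRs hx0; omega
        · rw [h5]; rw [(sig hσ).resolve_left h6] at hRs hx0; omega
        · rw [hR, rf_ne h5]; have := abs_le.1 (hx i); omega
    · have h4 := abs_le.1 (hy i₀)
      constructor
      · intro i; change lo i ≤ y i
        simp only [lo]; split_ifs with h5 h6
        · rw [h5]; rw [h6] at hyr hx0; omega
        · rw [h5]; rw [(sig hσ).resolve_left h6] at hyr hx0; omega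
        · have := abs_le.1 (hy i); omega
      · intro i; change y i ≤ hi i
        simp only [hi]; split_ifs with h5 h6
        · rw [h5]; rw [h6] at hyr hx0; omega
        · rw [h5]; rw [(sig hσ).resolve_left h6] at hyr hx0; omega
        · have := abs_le.1 (hy i); omega
  · have h1 := H2 N n h hh r hr (by omega) y i₀ (by
      rcases sig hσ with h5 | h5 <;> rw [h5] at hyr <;> rcases abs_cases (y i₀) with h6 | h6 <;> omega)
    have h2 := hh.le1 x
    have : c⁻¹ * h y ≤ max (C1 * C3) c⁻¹ * h y := by gcongr; exact le_max_right _ _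
    have h3 : 1 ≤ c⁻¹ * h y := by rw [← inv_mul_cancel₀ hc.ne']; gcongr
    linarith
end USFPaper

namespace USFPaper
variable {d : ℕ} {P : V d → Measure (ℕ → V d)}

/-- avoid `K` up to exit from `D` -/
def AV (D K : Set (V d)) : Set (ℕ → V d) := {ω | ∀ j, (∀ i < j, ω i ∈ D) → ω j ∉ K}
/-- avoid `K` at positive times up to exit from `D` -/
def AVp (D K : Set (V d)) : Set (ℕ → V d) := {ω | ∀ j, 1 ≤ j → (∀ i < j, ω i ∈ D) → ω j ∉ K}

lemma le_exit (D : Set (V d)) (ω : ℕ → V d) (j : ℕ) : (j : ENat) ≤ exitTimeE D ω ↔ ∀ i < j, ω i ∈ D := by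
  unfold exitTimeE
  split_ifs with h
  · rw [Nat.cast_le, Nat.le_find_iff]; simp
  · push Not at h; simp [h]

lemma AVp_meas (D K : Set (V d)) : MeasurableSet (AVp D K) := by
  have : AVp D K = ⋂ j, {ω | 1 ≤ j → (∀ i < j, ω i ∈ D) → ω j ∉ K} := by ext; simp [AVp]
  rw [this]
  refine MeasurableSet.iInter fun j => meas_loc' j ?_
  intro ω ω' h h1 h2 h3
  rw [← h j le_rfl]; exact h1 h2 fun i hi => by rw [h i hi.le]; exact h3 i hi

lemma AV_meas (D K : Set (V d)) : MeasurableSet (AV D K) := by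
  have : AV D K = ⋂ j, {ω | (∀ i < j, ω i ∈ D) → ω j ∉ K} := by ext; simp [AV]
  rw [this]
  refine MeasurableSet.iInter fun j => meas_loc' j ?_
  intro ω ω' h h1 h3
  rw [← h j le_rfl]; exact h1 fun i hi => by rw [h i hi.le]; exact h3 i hi

lemma AVp_cons {D K : Set (V d)} {x : V d} (hx : x ∈ D) : cons x ⁻¹' AVp D K = AV D K := by
  ext ω
  constructor
  · intro h j hj
    refine h (j+1) (by omega) fun i hi => ?_
    cases i with
    | zero => exact hx
    | succ i => exact hj i (by omega)
  · intro h j h1 hj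
    obtain ⟨s, rfl⟩ : ∃ s, j = s + 1 := ⟨j-1, by omega⟩
    exact h s fun i hi => hj (i+1) (by omega)

lemma AV_th {D K : Set (V d)} {ω : ℕ → V d} (h : ω ∈ AV D K) {t : ℕ} (ht : ∀ i < t, ω i ∈ D) : th t ω ∈ AV D K := by
  intro j hj
  refine h (j+t) fun i hi => ?_
  by_cases hit : i < t
  · exact ht i hit
  · have := hj (i - t) (by omega)
    rwa [th, Nat.sub_add_cancel (by omega)] at this

/-- escape probability -/
noncomputable def hK (P : V d → Measure (ℕ → V d)) (D K : Set (V d)) (x : V d) : ℝ := pr P x (AV D K)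

lemma avp_eq (hd : 0 < d) (hP : ∀ x, IsSRWLaw (P x) x) {D K : Set (V d)} {x : V d} (hx : x ∈ D) :
    pr P x (AVp D K) = avg (hK P D K) x := by
  rw [M1 hd hP x (AVp_meas D K), AVp_cons hx]; rfl

lemma hK_zero (hP : ∀ x, IsSRWLaw (P x) x) {D K : Set (V d)} {x : V d} (hx : x ∈ K) : hK P D K x = 0 := by
  apply le_antisymm _ (pr_nonneg _ _)
  refine (pr_mono_ae hP x (F := ∅) fun ω h0 h => ?_).trans (by simp [pr])
  exact absurd hx (by rw [← h0]; exact h 0 (by simp))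

lemma hK_in (hd : 0 < d) (hP : ∀ x, IsSRWLaw (P x) x) {D K : Set (V d)} {x : V d} (hx : x ∈ D) (hk : x ∉ K) :
    hK P D K x = avg (hK P D K) x := by
  rw [← avp_eq hd hP hx]
  apply le_antisymm
  · exact pr_mono hP x fun ω h j _ hj => h j hj
  · refine pr_mono_ae hP x fun ω h0 h j hj => ?_
    rcases Nat.eq_zero_or_pos j with rfl | h1
    · rw [h0]; exact hk
    · exact h j h1 hj

lemma hK_HH (hd : 5 ≤ d) : ∃ CC : ℝ, ∀ (P : V d → Measure (ℕ → V d)), (∀ x, IsSRWLaw (P x) x) → ∀ (N n : ℕ) (D K : Set (V d)), 1 ≤ N → n ≤ N →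
    cube 0 (4*N) ⊆ D → K ⊆ cube 0 n → HH CC N n (hK P D K) := by
  have hd0 : 0 < d := by omega
  have hd' : (5:ℝ) ≤ d := by exact_mod_cast hd
  obtain ⟨A, hA, c, hc, H⟩ := rad_gain' hd0 (α := 1/2) (by norm_num) (by linarith)
  refine ⟨4 * (d + A), fun P hP N n D K hN hn hD hK' => ?_⟩
  have hN' : (1:ℝ) ≤ N := by exact_mod_cast hN
  have avg1 : ∀ x, avg (hK P D K) x ≤ 1 := fun x =>
    (avg_mono' (g := fun _ => 1) (fun y => pr_le_one hP y _) x).trans (avg_const hd0 _ _).le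
  have hsub : ∀ x ∈ D, hK P D K x ≤ avg (hK P D K) x := fun x hx => by
    by_cases hk : x ∈ K
    · rw [hK_zero hP hk]; exact avg_nonneg (fun y => pr_nonneg _ _) x
    · exact (hK_in hd0 hP hx hk).le
  refine ⟨hn, hN, fun x => pr_nonneg _ _, fun x => pr_le_one hP x _, ?_, ?_, ?_⟩
  · intro x i hi
    have hk : x ∉ K := fun h => by have := hK' h i; simp at this; omega
    by_cases hx : x ∈ D
    · exact (hK_in hd0 hP hx hk).ge
    · refine (avg1 x).trans ?_
      have h1 : pr P x Set.univ ≤ hK P D K x := pr_mono_ae hP x fun ω h0 _ j hj => by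
        rcases Nat.eq_zero_or_pos j with rfl | h1
        · rw [h0]; exact hk
        · have := hj 0 h1; rw [h0] at this; exact absurd this hx
      have := (hP x).1
      simpa [pr] using h1
  · intro x hx
    exact hsub x (hD fun i => by simpa using hx i)
  · intro x hx
    have h1 := hit_le hd0 hP (A := K) (F := fun y => (((d:ℝ) + A) * N^2)^(1/2:ℝ) * rad (1/2) A y) (fun w =>
      mul_nonneg (by positivity) (rad_pos (by linarith) w).le) (fun w => by
        rw [avg_smul]; gcongr
        have := H A le_rfl w
        have := mul_pos hc (rad_pos (α := 1/2+1) (by linarith : 0 < A) w)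
        linarith) (fun w hw => by
        have h2 : nsq w + A ≤ ((d:ℝ) + A) * N^2 := by
          have : nsq w ≤ d * (N:ℝ)^2 := by
            have : nsq w ≤ ∑ _j : Fin d, (N:ℝ)^2 := by
              refine Finset.sum_le_sum fun j _ => ?_
              have h3 := hK' hw j
              rw [← sq_abs (w j : ℝ)]
              have h4 : |(w j:ℝ)| ≤ N := by
                have : |w j| ≤ (N:ℤ) := by simp at h3; omega
                exact_mod_cast this
              gcongr
            simpa using this
          have h1 : (1:ℝ) ≤ (N:ℝ)^2 := one_le_pow₀ (by exact_mod_cast hN)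
          nlinarith
        have h3 := nsq_nonneg w
        rw [rad, Real.rpow_neg (by linarith), ← div_eq_mul_inv, one_le_div (by positivity)]
        gcongr) x
    have h2 : (((d:ℝ) + A) * N^2)^(1/2:ℝ) * rad (1/2) A x ≤ 1/2 := by
      have h3 : 4 * (((d:ℝ) + A) * N^2) ≤ nsq x + A := by linarith
      have hp : 0 < ((d:ℝ) + A) * N^2 := by positivity
      rw [rad, Real.rpow_neg (by linarith), ← div_eq_mul_inv, div_le_iff₀ (by apply Real.rpow_pos_of_pos; linarith)]
      rw [← Real.sqrt_eq_rpow, ← Real.sqrt_eq_rpow]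
      have : Real.sqrt (4 * (((d:ℝ) + A) * N^2)) ≤ Real.sqrt (nsq x + A) := Real.sqrt_le_sqrt h3
      rw [Real.sqrt_mul (by norm_num), show Real.sqrt 4 = 2 by rw [show (4:ℝ) = 2^2 by norm_num]; exact Real.sqrt_sq (by norm_num)] at this
      linarith
    have := (hP x).1
    have hm : MeasurableSet {ω : ℕ → V d | ∃ t, ω t ∈ K} := by
      have := MeasurableSet.iUnion fun t : ℕ => (measurable_pi_apply t : Measurable fun ω : ℕ → V d => ω t) (MeasurableSet.of_discrete (s := K))
      convert this using 1; ext; simp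
    have h4 := probReal_compl_eq_one_sub (μ := P x) hm
    have h5 : pr P x {ω : ℕ → V d | ∃ t, ω t ∈ K}ᶜ ≤ hK P D K x := pr_mono hP x fun ω h j _ hc => h ⟨j, hc⟩
    unfold pr at h5 h1
    linarith

lemma green (hd : 5 ≤ d) (hP : ∀ x, IsSRWLaw (P x) x) {E : Set (ℕ → V d)} (hE : MeasurableSet E) (w v : V d) :
    pr P w {ω | ∃ t, ω t = v ∧ th t ω ∈ E} ≤ G (w - v) * pr P v E := by
  have h := hit_inf (by omega) hP (A := {v}) hE (F := fun w => pr P v E * G (w - v)) (fun w => mul_nonneg (pr_nonneg _ _) (G_nonneg _))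
    (fun w hw => by
      rw [avg_smul, avg_Gs hd]
      have := dl_nonneg (w - v)
      have := pr_nonneg (P := P) v E
      nlinarith)
    (fun w hw => by
      left
      rw [Set.mem_singleton_iff] at hw; subst hw
      rw [avg_smul, avg_Gs hd, sub_self]; simp only [dl, if_true]
      linarith) w
  simpa [mul_comm] using h

lemma avoid (hd : 5 ≤ d) (hP : ∀ x, IsSRWLaw (P x) x) (D K : Set (V d)) (S : Finset (V d)) (w : V d) :
    hK P D K w - ∑ v ∈ S, G (w - v) * hK P D K v ≤ pr P w (AV D (K ∪ S)) := by
  have := (hP w).1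
  have h1 : pr P w (AV D K) ≤ pr P w (AV D (K ∪ S) ∪ ⋃ v ∈ S, {ω | ∃ t, ω t = v ∧ th t ω ∈ AV D K}) := by
    refine pr_mono hP w fun ω h => ?_
    by_cases h2 : ω ∈ AV D (K ∪ S)
    · exact Or.inl h2
    · right
      simp only [AV, Set.mem_ofPred_eq] at h2; push Not at h2
      obtain ⟨j, hj, h3⟩ := h2
      simp only [Set.mem_iUnion]
      have h4 : ω j ∈ S := by
        rcases h3 with h3 | h3
        · exact absurd h3 (h j hj)
        · exact h3
      exact ⟨ω j, h4, j, rfl, AV_th h hj⟩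
  have h2 := measureReal_union_le (μ := P w) (AV D (K ∪ S)) (⋃ v ∈ S, {ω | ∃ t, ω t = v ∧ th t ω ∈ AV D K})
  have h3 := measureReal_biUnion_finset_le (μ := P w) S (fun v => {ω | ∃ t, ω t = v ∧ th t ω ∈ AV D K})
  have h4 : ∑ v ∈ S, (P w).real {ω | ∃ t, ω t = v ∧ th t ω ∈ AV D K} ≤ ∑ v ∈ S, G (w - v) * hK P D K v :=
    Finset.sum_le_sum fun v _ => green hd hP (AV_meas D K) w v
  unfold hK at *; unfold pr at *; linarith

lemma G_fin (hd : 5 ≤ d) (S : Finset (V d)) {ε : ℝ} (hε : 0 < ε) : {x : V d | ε < ∑ v ∈ S, G (x - v)}.Finite := by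
  obtain ⟨C, hC, hU⟩ := GU hd
  have key : ∀ v : V d, {x : V d | ε / (S.card + 1) ≤ G (x - v)}.Finite := by
    intro v
    obtain ⟨r, hr⟩ := exists_nat_gt (C * (S.card + 1) / ε)
    have hrp : (0:ℝ) < r := lt_of_le_of_lt (by positivity) hr
    have hr1 : (1:ℝ) ≤ r := by exact_mod_cast (by exact_mod_cast hrp : 0 < r)
    refine (cube_finite v r).subset fun x hx i => ?_
    by_contra hc
    have h1 := hU r (by exact_mod_cast hr1) (x - v) i (by simp only [Pi.sub_apply]; omega)
    have h2 : (r:ℝ) ≤ r^(d-2) := le_self_pow₀ hr1 (by omega)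
    simp only [Set.mem_ofPred_eq] at hx
    rw [div_lt_iff₀ hε] at hr
    rw [div_le_iff₀ (by positivity)] at hx
    have h3 : G (x - v) * r ≤ C := (mul_le_mul_of_nonneg_left h2 (G_nonneg _)).trans h1
    have h4 : ε * r ≤ G (x - v) * (S.card + 1) * r := mul_le_mul_of_nonneg_right hx hrp.le
    nlinarith [mul_le_mul_of_nonneg_right h3 (by positivity : (0:ℝ) ≤ S.card + 1)]
  refine (Set.Finite.biUnion S.finite_toSet fun v _ => key v).subset fun x hx => ?_
  by_contra hc
  simp only [Set.mem_iUnion, not_exists, Set.mem_ofPred_eq, not_le] at hc hx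
  have h1 : ∑ v ∈ S, G (x - v) ≤ ∑ v ∈ S, ε / (S.card + 1) := Finset.sum_le_sum fun v hv => (hc v hv).le
  rw [Finset.sum_const, nsmul_eq_mul, mul_div_assoc', ] at h1
  have : (S.card:ℝ) * ε / (S.card + 1) ≤ ε := by rw [div_le_iff₀ (by positivity)]; nlinarith
  linarith

lemma avg_sumG (hd : 5 ≤ d) (S : Finset (V d)) (x : V d) : avg (fun y => ∑ v ∈ S, G (y - v)) x = (∑ v ∈ S, G (x - v)) - ind S x := by
  rw [avg_sum, Finset.sum_congr rfl fun v _ => avg_Gs hd v x, Finset.sum_sub_distrib]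
  congr 1
  by_cases h : x ∈ S
  · rw [ind_pos (by exact_mod_cast h), Finset.sum_eq_single x]
    · simp [dl]
    · intro b _ hb; simp [dl, sub_eq_zero, hb.symm]
    · exact fun h' => absurd h h'
  · rw [ind_neg (by exact_mod_cast h)]
    refine Finset.sum_eq_zero fun v hv => ?_
    simp only [dl, sub_eq_zero]; rw [if_neg]; rintro rfl; exact h hv

/-- cube as finset -/
noncomputable def cb (x : V d) (m : ℕ) : Finset (V d) := (cube_finite x m).toFinset

lemma mem_cb {x y : V d} {m : ℕ} : y ∈ cb x m ↔ y ∈ cube x m := by simp [cb]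

lemma nsq_cube {x y : V d} {m : ℕ} (h : y ∈ cube x m) : nsq (y - x) ≤ d * (m:ℝ)^2 := by
  have : nsq (y - x) ≤ ∑ _j : Fin d, (m:ℝ)^2 := by
    refine Finset.sum_le_sum fun j _ => ?_
    rw [← sq_abs]
    have h4 : |(((y - x) j : ℤ):ℝ)| ≤ m := by have := h j; exact_mod_cast this
    gcongr
  simpa using this

lemma sumG (hd : 5 ≤ d) : ∃ C > 0, ∀ m : ℕ, 1 ≤ m → ∀ x z : V d, ∑ v ∈ cb x m, G (z - v) ≤ C * (m:ℝ)^2 := by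
  have hd' : (5:ℝ) ≤ d := by exact_mod_cast hd
  obtain ⟨A, hA, c, hc, H⟩ := rad_gain' (d := d) (by omega) (α := 1) (by norm_num) (by linarith)
  refine ⟨(d + A)^2 / c / A, by positivity, fun m hm x z => ?_⟩
  have hm' : (1:ℝ) ≤ m := by exact_mod_cast hm
  set B := A * (m:ℝ)^2 with hB
  have hBA : A ≤ B := by
    rw [hB]; have h1 : (1:ℝ) ≤ (m:ℝ)^2 := one_le_pow₀ hm'
    nlinarith
  set κ := ((d:ℝ) + A)^2 * m^4 / c with hκ
  have hκ0 : 0 ≤ κ := by positivity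
  have hB0 : 0 < B := by linarith
  have h := minP (d := d) (by omega) (f := fun y => κ * rad 1 B (y + -x) - ∑ v ∈ cb x m, G (y - v)) (B := Set.univ) (fun y _ => ?_)
    (fun y hy => absurd (Set.mem_univ y) hy) (fun ε hε => (G_fin hd (cb x m) hε).subset fun y hy => ?_) z
  · have h2 : rad 1 B (z + -x) ≤ B⁻¹ := by
      rw [rad, Real.rpow_neg_one]
      have := nsq_nonneg (z + -x)
      gcongr; linarith
    have h3 : κ * rad 1 B (z + -x) ≤ κ * B⁻¹ := by gcongr
    have h4 : κ * B⁻¹ = (d + A)^2 / c / A * (m:ℝ)^2 := by rw [hκ, hB]; field_simp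
    linarith
  · rw [avg_sub, avg_smul, avg_sumG hd, avg_shift]
    have h1 := H B hBA (y + -x)
    have h2 : ind (cb x m : Set (V d)) y ≤ κ * (c * rad (1+1) B (y + -x)) := by
      by_cases hy : y ∈ cube x m
      · refine (ind_le_one _ _).trans ?_
        have h3 := nsq_cube hy
        rw [sub_eq_add_neg] at h3
        have h0 := nsq_nonneg (y + -x)
        rw [rad, show (-(1+1) : ℝ) = ((-2 : ℤ) : ℝ) by norm_num, Real.rpow_intCast, zpow_neg, hκ]
        have h5 : nsq (y + -x) + B ≤ (d + A) * m^2 := by rw [hB]; linarith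
        have h6 : (nsq (y + -x) + B)^2 ≤ ((d + A) * m^2)^2 := by gcongr
        have h7 : 0 < (nsq (y + -x) + B)^2 := by positivity
        rw [show ((d:ℝ)+A)^2 * m^4 / c * (c * ((nsq (y + -x) + B)^(2:ℤ))⁻¹) = ((d + A) * m^2)^2 / (nsq (y + -x) + B)^2 by
          rw [show (nsq (y + -x) + B)^(2:ℤ) = (nsq (y + -x) + B)^2 from zpow_natCast _ 2]; field_simp]
        rwa [one_le_div h7]
      · rw [ind_neg (by simpa [mem_cb] using hy)]
        have := (rad_pos (α := 1+1) hB0 (y + -x)).le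
        positivity
    nlinarith
  · simp only [Set.mem_ofPred_eq] at *
    have := mul_nonneg hκ0 (rad_pos (α := 1) hB0 (y + -x)).le
    linarith

lemma cheb {μ : Measure (ℕ → V d)} [IsProbabilityMeasure μ] (s : Finset (V d)) {E : V d → Set (ℕ → V d)}
    (hE : ∀ i, MeasurableSet (E i)) {b : ℝ} (hb : 0 ≤ b) :
    b * μ.real {ω | b < ∑ i ∈ s, (E i).indicator (fun _ => (1:ℝ)) ω} ≤ ∑ i ∈ s, μ.real (E i) := by
  have hm : Measurable fun ω => ∑ i ∈ s, (E i).indicator (fun _ => (1:ℝ)) ω :=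
    Finset.measurable_sum _ fun i _ => measurable_const.indicator (hE i)
  have hi : ∀ s : Set (ℕ → V d), MeasurableSet s → Integrable (s.indicator (fun _ => (1:ℝ))) μ :=
    fun s hs => (integrable_const _).indicator hs
  have hI : ∀ s : Set (ℕ → V d), MeasurableSet s → ∫ ω, s.indicator (fun _ => (1:ℝ)) ω ∂μ = μ.real s :=
    fun s hs => by rw [integral_indicator hs]; simp
  have h1 := mul_meas_ge_le_integral_of_nonneg (μ := μ) (f := fun ω => ∑ i ∈ s, (E i).indicator (fun _ => (1:ℝ)) ω)
    (Filter.Eventually.of_forall fun ω => Finset.sum_nonneg fun i _ => Set.indicator_nonneg (fun _ _ => zero_le_one) _)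
    (integrable_finsetSum _ fun i _ => hi _ (hE i)) b
  rw [integral_finsetSum _ fun i _ => hi _ (hE i), Finset.sum_congr rfl fun i _ => hI _ (hE i)] at h1
  refine le_trans ?_ h1
  exact mul_le_mul_of_nonneg_left (measureReal_mono (fun ω h => by
    simp only [Set.mem_ofPred_eq] at *; exact le_of_lt h) (measure_ne_top _ _)) hb

/-- points of the cube visited by the stopped path -/
def Vis (D : Set (V d)) (x : V d) (m : ℕ) (ω : ℕ → V d) : Set (V d) := {v | v ∈ cube x m ∧ ∃ t, (∀ i < t, ω i ∈ D) ∧ ω t = v}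

lemma vis_meas (D : Set (V d)) (v : V d) : MeasurableSet {ω : ℕ → V d | ∃ t, (∀ i < t, ω i ∈ D) ∧ ω t = v} := by
  have : {ω : ℕ → V d | ∃ t, (∀ i < t, ω i ∈ D) ∧ ω t = v} = ⋃ t, {ω | (∀ i < t, ω i ∈ D) ∧ ω t = v} := by ext; simp
  rw [this]
  refine MeasurableSet.iUnion fun j => meas_loc' j ?_
  rintro ω ω' h ⟨h1, h2⟩
  exact ⟨fun i hi => by rw [← h i hi.le]; exact h1 i hi, by rw [← h j le_rfl]; exact h2⟩

/-- many visits event -/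
def VisB (D K : Set (V d)) (x : V d) (m : ℕ) (b : ℝ) : Set (ℕ → V d) :=
  {ω | b < ∑ v ∈ cb x m, (AV D K ∩ {ω : ℕ → V d | ∃ t, (∀ i < t, ω i ∈ D) ∧ ω t = v}).indicator (fun _ => (1:ℝ)) ω}

lemma VisB_meas (D K : Set (V d)) (x : V d) (m : ℕ) (b : ℝ) : MeasurableSet (VisB D K x m b) :=
  measurableSet_lt measurable_const (Finset.measurable_sum _ fun v _ =>
    measurable_const.indicator ((AV_meas D K).inter (vis_meas D v)))

lemma VisB_card {D K : Set (V d)} {x : V d} {m : ℕ} {b : ℝ} {ω : ℕ → V d} (h : ω ∈ AV D K) (h2 : ω ∉ VisB D K x m b) :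
    ((Vis D x m ω).ncard : ℝ) ≤ b := by
  simp only [VisB, Set.mem_ofPred_eq, not_lt] at h2
  refine le_trans (le_of_eq ?_) h2
  have : Vis D x m ω = ((cb x m).filter fun v => ω ∈ (AV D K ∩ {ω : ℕ → V d | ∃ t, (∀ i < t, ω i ∈ D) ∧ ω t = v}) : Finset (V d)) := by
    ext v; simp only [Vis, Finset.coe_filter, mem_cb, Set.mem_ofPred_eq, Set.mem_inter_iff]; tauto
  rw [this, Set.ncard_coe_finset, Finset.card_filter]
  push_cast
  exact Finset.sum_congr rfl fun v _ => by simp only [Set.indicator_apply]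

lemma VisB_le (hd : 5 ≤ d) : ∃ C > 0, ∀ (P : V d → Measure (ℕ → V d)), (∀ x, IsSRWLaw (P x) x) → ∀ (D K : Set (V d)) (x : V d) (m : ℕ) (b η : ℝ) (z : V d), 1 ≤ m → 0 ≤ b →
    (∀ y ∈ cube x m, hK P D K y ≤ η) → b * pr P z (VisB D K x m b) ≤ C * (m:ℝ)^2 * η := by
  obtain ⟨C, hC, H⟩ := sumG hd
  refine ⟨C, hC, fun P hP D K x m b η z hm hb hη => ?_⟩
  have := (hP z).1
  have h1 := cheb (μ := P z) (cb x m) (E := fun v => AV D K ∩ {ω : ℕ → V d | ∃ t, (∀ i < t, ω i ∈ D) ∧ ω t = v})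
    (fun v => (AV_meas D K).inter (vis_meas D v)) hb
  have h0 : 0 ≤ η := le_trans (pr_nonneg _ _) (hη x (fun i => by simp))
  refine h1.trans ?_
  calc _ ≤ ∑ v ∈ cb x m, G (z - v) * η := Finset.sum_le_sum fun v hv => by
        have h2 : pr P z (AV D K ∩ {ω : ℕ → V d | ∃ t, (∀ i < t, ω i ∈ D) ∧ ω t = v}) ≤ _ :=
          (pr_mono hP z (by rintro ω ⟨h3, t, h4, h5⟩; exact ⟨t, h5, AV_th h3 h4⟩)).trans (green hd hP (AV_meas D K) z v)
        exact h2.trans (mul_le_mul_of_nonneg_left (hη v (mem_cb.1 hv)) (G_nonneg _))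
    _ = (∑ v ∈ cb x m, G (z - v)) * η := by rw [Finset.sum_mul]
    _ ≤ _ := by gcongr; exact H m hm x z

end USFPaper

namespace USFPaper
variable {d : ℕ} {P : V d → Measure (ℕ → V d)}

lemma avg_negv (f : V d → ℝ) (x : V d) : avg (fun y => f (-y)) x = avg f (-x) := by
  unfold avg; congr 1; refine Finset.sum_congr rfl fun i _ => ?_
  beta_reduce
  rw [add_comm, show -(x + ev i) = -x - ev i by abel, show -(x - ev i) = -x + ev i by abel]

lemma G_neg (x : V d) : G (-x) = G x := by
  unfold G
  congr 1; funext t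
  have : ∀ x : V d, avg^[t] dl (-x) = avg^[t] dl x := by
    induction t with
    | zero => intro x; simp [dl]
    | succ t ih =>
      intro x
      simp only [Function.iterate_succ', Function.comp]
      rw [← avg_negv]; congr 1; funext y; exact ih y
  exact this x

lemma hit_eq_union (A : Set (V d)) : MeasurableSet {ω : ℕ → V d | ∃ t, ω t ∈ A} := by
  have : {ω : ℕ → V d | ∃ t, ω t ∈ A} = ⋃ t, {ω | ω t ∈ A} := by ext; simp
  rw [this]
  exact MeasurableSet.iUnion fun t => meas_loc' t fun ω ω' h h1 => by
    simp only [Set.mem_ofPred_eq] at *; rw [← h t le_rfl]; exact h1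

lemma cap (hd : 5 ≤ d) (hP : ∀ x, IsSRWLaw (P x) x) (Z : Finset (V d)) {M : ℝ} (hM0 : 0 ≤ M)
    (hM : ∀ w ∈ Z, ∑ v ∈ Z, G (w - v) ≤ M) (x : V d) :
    ∑ v ∈ Z, G (x - v) ≤ M * pr P x {ω | ∃ t, ω t ∈ (Z : Set (V d))} := by
  set E : Set (ℕ → V d) := {ω | ∃ t, ω t ∈ (Z : Set (V d))} with hE
  have key := minP (d := d) (by omega) (f := fun y => M * pr P y E - ∑ v ∈ Z, G (y - v)) (B := (Z : Set (V d))ᶜ)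
    (fun y hy => ?_) (fun y hy => ?_) (fun ε hε => (G_fin hd Z hε).subset fun y hy => ?_) x
  · linarith
  · rw [avg_sub, avg_smul, avg_sumG hd, ind_neg hy]
    have : avg (fun y => pr P y E) y ≤ pr P y E := by
      rw [M1 (by omega) hP y (hit_eq_union _)]
      refine avg_mono' (fun w => pr_mono hP w ?_) y
      rintro ω ⟨t, ht⟩
      exact ⟨t+1, by rw [cons_succ]; exact ht⟩
    have := mul_le_mul_of_nonneg_left this hM0
    linarith
  · simp only [Set.mem_compl_iff, not_not, Finset.mem_coe] at hy
    have h1 : pr P y E = 1 := by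
      apply le_antisymm (pr_le_one hP y E)
      have h2 : pr P y Set.univ = 1 := by have := (hP y).1; simp [pr]
      rw [← h2]
      exact pr_mono_ae hP y fun ω h0 _ => ⟨0, by rw [h0]; exact hy⟩
    have := hM y hy
    rw [h1]; linarith
  · simp only [Set.mem_ofPred_eq] at *
    have := mul_nonneg hM0 (pr_nonneg (P := P) y E)
    linarith

lemma cap_times (hd : 5 ≤ d) (hP : ∀ x, IsSRWLaw (P x) x) (I : Finset ℕ) (w : ℕ → V d) (hw : Set.InjOn w I)
    {M g : ℝ} (hM0 : 0 ≤ M) (hM : ∀ t ∈ I, ∑ s ∈ I with s < t, G (w t - w s) ≤ M) (x : V d)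
    (hg0 : 0 ≤ g) (hg : ∀ t ∈ I, g ≤ G (x - w t)) :
    (I.card / 2 : ℝ) * g ≤ 2 * (2 * M + G (0 : V d)) * pr P x {ω | ∃ n, ∃ t ∈ I, ω n = w t} := by
  set b := 2 * M + G (0 : V d) with hb
  have hb0 : 0 < b := by have := G_pos hd (0 : V d); linarith
  have h1 : ∑ t ∈ I, ∑ s ∈ I, G (w t - w s) ≤ I.card * b := by
    have e : ∀ t ∈ I, ∑ s ∈ I, G (w t - w s) = G (0 : V d) + ∑ s ∈ I with s < t, G (w t - w s) + ∑ s ∈ I with t < s, G (w t - w s) := by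
      intro t ht
      rw [← Finset.sum_filter_add_sum_filter_not I (fun s => s < t), ← Finset.sum_filter_add_sum_filter_not (I.filter (fun s => ¬ s < t)) (fun s => t < s)]
      rw [Finset.filter_filter, Finset.filter_filter]
      have e1 : I.filter (fun s => ¬ s < t ∧ t < s) = I.filter (fun s => t < s) := by
        apply Finset.filter_congr; intro s _; constructor <;> intro h <;> omega
      have e2 : I.filter (fun s => ¬ s < t ∧ ¬ t < s) = {t} := by
        ext s; simp only [Finset.mem_filter, Finset.mem_singleton]
        constructor
        · rintro ⟨_, h⟩; omega
        · rintro rfl; exact ⟨ht, by omega⟩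
      rw [e1, e2, Finset.sum_singleton, sub_self]; ring
    rw [Finset.sum_congr rfl e, Finset.sum_add_distrib, Finset.sum_add_distrib]
    have hA : ∑ t ∈ I, ∑ s ∈ I with s < t, G (w t - w s) ≤ I.card * M := by
      have := Finset.sum_le_sum hM; simpa using this
    have hB : ∑ t ∈ I, ∑ s ∈ I with t < s, G (w t - w s) = ∑ t ∈ I, ∑ s ∈ I with s < t, G (w t - w s) := by
      simp only [Finset.sum_filter]
      rw [Finset.sum_comm]
      refine Finset.sum_congr rfl fun t _ => Finset.sum_congr rfl fun s _ => ?_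
      rw [← G_neg (w s - w t), neg_sub]
    rw [hB]; simp only [Finset.sum_const, nsmul_eq_mul]; rw [hb]; linarith
  set J := I.filter (fun t => ∑ s ∈ I, G (w t - w s) ≤ 2 * b) with hJ
  have h2 : (I.card / 2 : ℝ) ≤ J.card := by
    have h3 : ∑ t ∈ I with ¬ (∑ s ∈ I, G (w t - w s) ≤ 2 * b), (2 * b) ≤ ∑ t ∈ I, ∑ s ∈ I, G (w t - w s) := by
      refine (Finset.sum_le_sum (g := fun t => ∑ s ∈ I, G (w t - w s)) fun t ht => ?_).trans
        (Finset.sum_le_sum_of_subset_of_nonneg (Finset.filter_subset _ _) fun t _ _ => Finset.sum_nonneg fun s _ => G_nonneg _)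
      exact (not_le.1 (Finset.mem_filter.1 ht).2).le
    have h4 := Finset.card_filter_add_card_filter_not (s := I) (fun t => ∑ s ∈ I, G (w t - w s) ≤ 2 * b)
    rw [Finset.sum_const, nsmul_eq_mul] at h3
    have h5 : (J.card : ℝ) + (I.filter (fun t => ¬ (∑ s ∈ I, G (w t - w s) ≤ 2 * b))).card = I.card := by exact_mod_cast h4
    have h6 : ((I.filter (fun t => ¬ (∑ s ∈ I, G (w t - w s) ≤ 2 * b))).card : ℝ) * 2 ≤ I.card := by
      have h7 := h3.trans h1
      rw [← mul_assoc] at h7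
      exact le_of_mul_le_mul_right h7 hb0
    linarith
  have hJw : Set.InjOn w J := hw.mono fun t ht => (Finset.mem_filter.1 (Finset.mem_coe.1 ht)).1
  have h3 := cap hd hP (J.image w) (M := 2 * b) (by linarith) (fun v hv => by
    obtain ⟨t, ht, rfl⟩ := Finset.mem_image.1 hv
    rw [Finset.sum_image hJw]
    exact (Finset.sum_le_sum_of_subset_of_nonneg (Finset.filter_subset _ _) fun t _ _ => G_nonneg _).trans (Finset.mem_filter.1 ht).2) x
  rw [Finset.sum_image hJw] at h3
  have h4 : (J.card : ℝ) * g ≤ ∑ t ∈ J, G (x - w t) := by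
    have := Finset.sum_le_sum (s := J) (f := fun _ => g) (g := fun t => G (x - w t)) fun t ht => hg t (Finset.mem_filter.1 ht).1
    simpa using this
  have h5 : pr P x {ω | ∃ t, ω t ∈ ((J.image w : Finset (V d)) : Set (V d))} ≤ pr P x {ω | ∃ n, ∃ t ∈ I, ω n = w t} := by
    refine pr_mono hP x ?_
    rintro ω ⟨n, hn⟩
    obtain ⟨t, ht, e⟩ := Finset.mem_image.1 (Finset.mem_coe.1 hn)
    exact ⟨n, t, (Finset.mem_filter.1 ht).1, e.symm⟩
  have h6 := mul_le_mul_of_nonneg_left h5 (by linarith : 0 ≤ 2 * b)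
  have h7 := mul_le_mul_of_nonneg_right h2 hg0
  linarith
end USFPaper

namespace USFPaper
variable {d : ℕ} {P : V d → Measure (ℕ → V d)}

/-- killed kernel -/
noncomputable def Kl (B : Set (V d)) (f : V d → ℝ) (x : V d) : ℝ := if x ∈ B then avg f x else 0

lemma Kl_in {B : Set (V d)} (f : V d → ℝ) {x : V d} (h : x ∈ B) : Kl B f x = avg f x := if_pos h
lemma Kl_out {B : Set (V d)} (f : V d → ℝ) {x : V d} (h : x ∉ B) : Kl B f x = 0 := if_neg h

lemma Kl_mono {B : Set (V d)} {f g : V d → ℝ} (h : ∀ y, f y ≤ g y) (x : V d) : Kl B f x ≤ Kl B g x := by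
  unfold Kl; split_ifs; exacts [avg_mono' h x, le_rfl]

lemma Kl_nonneg {B : Set (V d)} {f : V d → ℝ} (h : ∀ y, 0 ≤ f y) (t : ℕ) (x : V d) : 0 ≤ (Kl B)^[t] f x := by
  induction t generalizing x with
  | zero => exact h x
  | succ t ih =>
    rw [Function.iterate_succ']; simp only [Function.comp, Kl]
    split_ifs; exacts [avg_nonneg ih x, le_rfl]

lemma Kl_pot {B : Set (V d)} {f F : V d → ℝ} (h : ∀ x, f x + Kl B F x ≤ F x) (h0 : ∀ x, 0 ≤ F x) (T : ℕ) (x : V d) :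
    ∑ t ∈ Finset.range T, (Kl B)^[t] f x ≤ F x := by
  induction T generalizing x with
  | zero => simpa using h0 x
  | succ T ih =>
    rw [Finset.sum_range_succ']
    have : ∑ t ∈ Finset.range T, (Kl B)^[t+1] f x ≤ Kl B F x := by
      by_cases hx : x ∈ B
      · rw [Kl_in _ hx]
        refine le_trans (le_of_eq ?_) (avg_mono' ih x)
        rw [avg_sum]; refine Finset.sum_congr rfl fun t _ => ?_
        rw [Function.iterate_succ']; simp [Kl_in _ hx]
      · rw [Kl_out _ hx]
        refine (Finset.sum_eq_zero fun t _ => ?_).le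
        rw [Function.iterate_succ']; simp [Kl_out _ hx]
    have := h x
    simp only [Function.iterate_zero, id]; linarith

lemma Kl_pr (hd : 0 < d) (hP : ∀ x, IsSRWLaw (P x) x) {B Y : Set (V d)} (hY : Y ⊆ B) (t : ℕ) (x : V d) :
    pr P x {ω | (∀ i ≤ t, ω i ∈ B) ∧ ω t ∈ Y} = (Kl B)^[t] (ind Y) x := by
  have hmeas : ∀ t, MeasurableSet {ω : ℕ → V d | (∀ i ≤ t, ω i ∈ B) ∧ ω t ∈ Y} := fun t => by
    refine meas_loc' t ?_
    rintro ω ω' h ⟨h1, h2⟩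
    exact ⟨fun i hi => by rw [← h i hi]; exact h1 i hi, by rw [← h t le_rfl]; exact h2⟩
  have hu : ∀ x, pr P x Set.univ = 1 := fun x => by have := (hP x).1; simp [pr]
  have he : ∀ x, pr P x ∅ = 0 := fun x => by simp [pr]
  induction t generalizing x with
  | zero =>
    simp only [Function.iterate_zero, id]
    by_cases h : x ∈ Y
    · rw [ind_pos h]
      apply le_antisymm (pr_le_one hP x _)
      rw [← hu x]
      refine pr_mono_ae hP x fun ω h0 _ => ⟨fun i hi => ?_, by rw [h0]; exact h⟩
      obtain rfl : i = 0 := by omega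
      rw [h0]; exact hY h
    · rw [ind_neg h]
      apply le_antisymm _ (pr_nonneg x _)
      rw [← he x]
      exact pr_mono_ae hP x fun ω h0 h1 => h (by rw [← h0]; exact h1.2)
  | succ t ih =>
    rw [Function.iterate_succ']; simp only [Function.comp]
    by_cases h : x ∈ B
    · rw [Kl_in _ h, M1 hd hP x (hmeas _)]
      congr 1; funext y; rw [← ih]; congr 1; ext ω
      simp only [Set.mem_preimage, Set.mem_ofPred_eq, cons_succ]
      constructor
      · rintro ⟨h1, h2⟩
        exact ⟨fun i hi => by have := h1 (i+1) (by omega); rwa [cons_succ] at this, h2⟩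
      · rintro ⟨h1, h2⟩
        refine ⟨fun i hi => ?_, h2⟩
        rcases i with _ | i
        · rw [cons_zero]; exact h
        · rw [cons_succ]; exact h1 i (by omega)
    · rw [Kl_out _ h]
      apply le_antisymm _ (pr_nonneg x _)
      rw [← he x]
      exact pr_mono_ae hP x fun ω h0 h1 => h (by rw [← h0]; exact h1.1 0 (by omega))

lemma avg_tsum {g : ℕ → V d → ℝ} (h : ∀ y, Summable fun t => g t y) (x : V d) :
    avg (fun y => ∑' t, g t y) x = ∑' t, avg (g t) x := by
  unfold avg
  rw [tsum_mul_left, Summable.tsum_finsetSum (fun i _ => (h _).add (h _))]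
  congr 1
  exact Finset.sum_congr rfl fun i _ => ((h _).tsum_add (h _)).symm

lemma occ (hd : 0 < d) (hP : ∀ x, IsSRWLaw (P x) x) {B Y : Set (V d)} (hY : Y ⊆ B) {R : ℝ} {F : V d → ℝ}
    (hF0 : ∀ x, 0 ≤ F x) (hFR : ∀ x, F x ≤ R) (hF : ∀ x, ind B x + Kl B F x ≤ F x) :
    ∃ u : V d → ℝ, (∀ x, 0 ≤ u x) ∧ (∀ x ∈ B, avg u x = u x - ind Y x) ∧ ∀ (T : ℕ) x,
      (T:ℝ) * (u x - ∑ t ∈ Finset.range T, pr P x {ω | (∀ i ≤ t, ω i ∈ B) ∧ ω t ∈ Y}) ≤ R * R := by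
  have hR : 0 ≤ R := (hF0 0).trans (hFR 0)
  have hYB : ∀ x, ind Y x ≤ ind B x := fun x => by
    by_cases h : x ∈ Y
    · rw [ind_pos h, ind_pos (hY h)]
    · rw [ind_neg h]; exact ind_nonneg _ _
  have n0 : ∀ t x, 0 ≤ (Kl B)^[t] (ind Y) x := fun t x => Kl_nonneg (fun y => ind_nonneg _ _) t x
  have hb : ∀ T x, ∑ t ∈ Finset.range T, (Kl B)^[t] (ind Y) x ≤ F x := fun T x =>
    Kl_pot (fun x => by have := hF x; have := hYB x; linarith) hF0 T x
  have hs : ∀ x, Summable fun t => (Kl B)^[t] (ind Y) x := fun x => summable_of_sum_range_le (fun t => n0 t x) (fun T => hb T x)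
  have hout : ∀ x ∉ B, ∀ t, (Kl B)^[t] (ind Y) x = 0 := fun x hx t => by
    rcases t with _ | t
    · exact ind_neg fun h => hx (hY h)
    · rw [Function.iterate_succ']; exact Kl_out _ hx
  set u : V d → ℝ := fun x => ∑' t, (Kl B)^[t] (ind Y) x with hu
  have hu1 : ∀ x ∈ B, avg u x = u x - ind Y x := fun x hx => by
    rw [hu, avg_tsum hs]
    have h1 := (hs x).tsum_eq_zero_add
    have : ∀ t, (Kl B)^[t+1] (ind Y) x = avg ((Kl B)^[t] (ind Y)) x := fun t => by
      rw [Function.iterate_succ']; exact Kl_in _ hx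
    simp only [this, Function.iterate_zero, id] at h1
    linarith
  refine ⟨u, fun x => tsum_nonneg fun t => n0 t x, hu1, fun T x => ?_⟩
  simp only [Kl_pr hd hP hY]
  have hD : ∀ T x, u x - ∑ t ∈ Finset.range T, (Kl B)^[t] (ind Y) x ≤ R * (Kl B)^[T] (ind B) x := by
    intro T
    induction T with
    | zero =>
      intro x
      simp only [Finset.range_zero, Finset.sum_empty, sub_zero, Function.iterate_zero, id]
      by_cases hx : x ∈ B
      · rw [ind_pos hx, mul_one]
        exact ((hs x).tsum_le_of_sum_range_le (fun T => hb T x)).trans (hFR x)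
      · rw [ind_neg hx, mul_zero]; simp [hu, hout x hx]
    | succ T ih =>
      intro x
      by_cases hx : x ∈ B
      · have h1 := hu1 x hx
        have h2 := avg_mono' ih x
        rw [avg_sub, avg_smul, avg_sum] at h2
        rw [Finset.sum_range_succ', Function.iterate_succ', Function.comp, Kl_in _ hx]
        have : ∀ t, (Kl B)^[t+1] (ind Y) x = avg ((Kl B)^[t] (ind Y)) x := fun t => by
          rw [Function.iterate_succ']; exact Kl_in _ hx
        simp only [this, Function.iterate_zero, id]
        linarith
      · have : u x = 0 := by simp [hu, hout x hx]
        rw [this, Finset.sum_eq_zero fun t _ => hout x hx t, Function.iterate_succ']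
        simp [Kl_out _ hx]
  have hdec : ∀ t x, (Kl B)^[t+1] (ind B) x ≤ (Kl B)^[t] (ind B) x := by
    intro t
    induction t with
    | zero =>
      intro x
      simp only [Function.iterate_zero, Function.iterate_succ, Function.comp, id]
      by_cases hx : x ∈ B
      · rw [Kl_in _ hx, ind_pos hx, ← avg_const hd 1 x]; exact avg_mono' (fun y => ind_le_one _ _) x
      · rw [Kl_out _ hx]; exact ind_nonneg _ _
    | succ t ih =>
      intro x
      rw [Function.iterate_succ', Function.comp]
      conv_rhs => rw [Function.iterate_succ', Function.comp]
      exact Kl_mono ih x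
  have hT : (T:ℝ) * (Kl B)^[T] (ind B) x ≤ R := by
    have h1 : ∑ t ∈ Finset.range T, (Kl B)^[T] (ind B) x ≤ ∑ t ∈ Finset.range T, (Kl B)^[t] (ind B) x :=
      Finset.sum_le_sum fun t ht => antitone_nat_of_succ_le (f := fun t => (Kl B)^[t] (ind B) x) (fun t => hdec t x) (Finset.mem_range.1 ht).le
    rw [Finset.sum_const, Finset.card_range, nsmul_eq_mul] at h1
    exact h1.trans ((Kl_pot hF hF0 T x).trans (hFR x))
  calc _ ≤ (T:ℝ) * (R * (Kl B)^[T] (ind B) x) := mul_le_mul_of_nonneg_left (hD T x) (Nat.cast_nonneg _)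
    _ = R * (T * (Kl B)^[T] (ind B) x) := by ring
    _ ≤ R * R := mul_le_mul_of_nonneg_left hT hR
end USFPaper

namespace USFPaper
variable {d : ℕ} {P : V d → Measure (ℕ → V d)}

/-- outward direction -/
def dr (i₀ : Fin d) (σ : ℤ) : V d := Pi.single i₀ σ

lemma dr_self (i₀ : Fin d) (σ : ℤ) : dr i₀ σ i₀ = σ := by simp [dr]
lemma dr_ne {i₀ i : Fin d} (h : i ≠ i₀) (σ : ℤ) : dr i₀ σ i = 0 := by simp [dr, h]

lemma ht_up {i₀ : Fin d} {σ : ℤ} (hσ : σ * σ = 1) (x₀ y : V d) (k : ℤ) :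
    ht i₀ σ x₀ (y + k • dr i₀ σ) = ht i₀ σ x₀ y + k := by
  simp only [ht, Pi.add_apply, Pi.smul_apply, dr_self, smul_eq_mul]
  linear_combination k * hσ

lemma up_ne {i₀ i : Fin d} (h : i ≠ i₀) (σ : ℤ) (y : V d) (k : ℤ) : (y + k • dr i₀ σ) i = y i := by
  simp [dr_ne h]

lemma ht_abs {i₀ : Fin d} {σ : ℤ} (hσ : σ * σ = 1) (x₀ y : V d) : |ht i₀ σ x₀ y| = |y i₀ - x₀ i₀| := by
  rcases sig hσ with rfl | rfl
  · simp [ht]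
  · rw [ht, neg_one_mul, abs_neg]

lemma ht_diff {i₀ : Fin d} {σ : ℤ} (hσ : σ * σ = 1) (x₀ y z : V d) :
    |ht i₀ σ x₀ y - ht i₀ σ x₀ z| = |y i₀ - z i₀| := by
  rw [← ht_abs (x₀ := z) hσ]; congr 1; simp only [ht]; ring

/-- membership in a cube via height and lateral coordinates -/
lemma mem_cube_ht {i₀ : Fin d} {σ : ℤ} (hσ : σ * σ = 1) (x₀ y z : V d) (r : ℕ) :
    y ∈ cube z r ↔ |ht i₀ σ x₀ y - ht i₀ σ x₀ z| ≤ r ∧ ∀ i ≠ i₀, |y i - z i| ≤ r := by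
  rw [ht_diff hσ]
  constructor
  · intro h; exact ⟨h i₀, fun i _ => h i⟩
  · rintro ⟨h1, h2⟩ i
    by_cases hi : i = i₀
    · subst hi; exact h1
    · exact h2 i hi

def Tube (i₀ : Fin d) (σ : ℤ) (x₀ : V d) (m : ℕ) : Set (V d) := {y | 1 ≤ ht i₀ σ x₀ y ∧ y ∈ cube x₀ (m-1)}

lemma ht_self (i₀ : Fin d) (σ : ℤ) (x₀ : V d) : ht i₀ σ x₀ x₀ = 0 := by simp [ht]

lemma avg_nsq (hd : 0 < d) (x₀ x : V d) : avg (fun y => nsq (y - x₀)) x = nsq (x - x₀) + 1 := by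
  unfold avg
  have : ∀ i : Fin d, nsq (x + ev i - x₀) + nsq (x - ev i - x₀) = 2 * (nsq (x - x₀) + 1) := fun i => by
    rw [show x + ev i - x₀ = x - x₀ + ev i by abel, show x - ev i - x₀ = x - x₀ - ev i by abel, nsq_add, nsq_sub]; ring
  have hd' : (0:ℝ) < d := by exact_mod_cast hd
  simp only [this, Finset.sum_const, Finset.card_univ, Fintype.card_fin, nsmul_eq_mul]
  field_simp

lemma nsq_gt {x y : V d} {r : ℕ} (h : y ∉ cube x r) : (r:ℝ)^2 < nsq (y - x) := by
  simp only [cube, Set.mem_ofPred_eq, not_forall, not_le] at h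
  obtain ⟨i, hi⟩ := h
  refine lt_of_lt_of_le ?_ (sq_le_nsq (y - x) i)
  rw [← sq_abs (((y - x) i : ℤ) : ℝ)]
  have : (r:ℝ) < |(((y - x) i : ℤ) : ℝ)| := by exact_mod_cast hi
  gcongr

lemma nb_cube {x y z : V d} {r : ℕ} (h : nb x y) (hx : x ∈ cube z r) : y ∈ cube z (r+1) := by
  intro j
  obtain ⟨i, h⟩ := h
  have h1 := abs_le.1 (ev_abs i j)
  have h2 := abs_le.1 (hx j)
  rw [abs_le]
  rcases h with rfl | rfl <;> simp only [Pi.add_apply, Pi.sub_apply] <;> push_cast <;> constructor <;> omega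

lemma occ_low (hd : 5 ≤ d) : ∃ c > 0, ∀ (P : V d → Measure (ℕ → V d)), (∀ x, IsSRWLaw (P x) x) →
    ∀ (q m : ℕ) (i₀ : Fin d) (σ : ℤ) (x₀ z : V d), 1 ≤ q → 64 * (d * q) ≤ m → m ≤ 256 * (d * q) → σ * σ = 1 →
    ht i₀ σ x₀ z = q → (∀ i ≠ i₀, |z i - x₀ i| ≤ 9 * (d * q : ℕ)) → ∀ T : ℕ,
    (T:ℝ) * (c * q^2 - ∑ t ∈ Finset.range T, pr P z {ω | (∀ i ≤ t, ω i ∈ Tube i₀ σ x₀ m) ∧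
      ω t ∈ cube (x₀ + ((m/2:ℕ):ℤ) • dr i₀ σ) (m/8)}) ≤ (d * (m:ℝ)^2) * (d * (m:ℝ)^2) := by
  obtain ⟨c, hc, W⟩ := wharnack hd (256 * d)
  refine ⟨c, hc, fun P hP q m i₀ σ x₀ z hq hm1 hm2 hσ hz hzl T => ?_⟩
  have hdq : q ≤ d * q := Nat.le_mul_of_pos_left _ (by omega)
  have hm5 : 5 * q ≤ d * q := Nat.mul_le_mul_right _ hd
  set bc := x₀ + ((m/2:ℕ):ℤ) • dr i₀ σ with hbc
  have hbh : ht i₀ σ x₀ bc = (m/2:ℕ) := by rw [hbc, ht_up hσ, ht_self]; simp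
  have hbl : ∀ i ≠ i₀, bc i = x₀ i := fun i hi => by rw [hbc, up_ne hi]
  set A := d * q with hA
  have hYT : cube bc (m/8) ⊆ Tube i₀ σ x₀ m := by
    intro y hy
    rw [mem_cube_ht hσ x₀ (i₀ := i₀), hbh] at hy
    obtain ⟨h1, h2⟩ := hy
    rw [abs_le] at h1
    refine ⟨by omega, ?_⟩
    rw [mem_cube_ht hσ x₀ (i₀ := i₀), ht_self, abs_le]
    refine ⟨⟨by omega, by omega⟩, fun i hi => ?_⟩
    have := h2 i hi
    rw [hbl i hi, abs_le] at this
    rw [abs_le]; constructor <;> omega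
  set F : V d → ℝ := fun x => if x ∈ Tube i₀ σ x₀ m then d * (m:ℝ)^2 - nsq (x - x₀) else 0 with hF
  have hin : ∀ x ∈ cube x₀ m, 0 ≤ d * (m:ℝ)^2 - nsq (x - x₀) := fun x hx => by have := nsq_cube hx; linarith
  have hcc : ∀ {y : V d}, y ∈ cube x₀ (m-1) → y ∈ cube x₀ m := fun {y} hy i => (hy i).trans (by omega)
  have hm0 : 1 ≤ m := by omega
  obtain ⟨u, hu0, hu1, hu2⟩ := occ (by omega) hP hYT (F := F) (R := d * (m:ℝ)^2) (fun x => by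
      simp only [hF]; split_ifs with h
      · exact hin x (hcc h.2)
      · exact le_rfl) (fun x => by
      simp only [hF]; split_ifs with h
      · have := nsq_nonneg (x - x₀); linarith
      · positivity) (fun x => by
      by_cases h : x ∈ Tube i₀ σ x₀ m
      · rw [ind_pos h, Kl_in _ h]
        have h1 : avg F x ≤ avg (fun y => d * (m:ℝ)^2 - nsq (y - x₀)) x := by
          refine avg_mono_nb fun y hy => ?_
          simp only [hF]; split_ifs with h2
          · exact le_rfl
          · have := nb_cube hy h.2
            rw [Nat.sub_add_cancel hm0] at this
            exact hin y this
        rw [avg_sub, avg_const (by omega), avg_nsq (by omega)] at h1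
        simp only [hF, if_pos h]; linarith
      · rw [ind_neg h, Kl_out _ h]; simp [hF, h])
  refine le_trans (mul_le_mul_of_nonneg_left (sub_le_sub_right ?_ _) (Nat.cast_nonneg T)) (hu2 T z)
  have hlow : ∀ y, 0 ≤ u y - ((m/8:ℕ):ℝ)^2 + nsq (y - bc) := by
    refine minP (d := d) (by omega) (f := fun y => u y - ((m/8:ℕ):ℝ)^2 + nsq (y - bc)) (B := cube bc (m/8)) (fun y hy => ?_) (fun y hy => ?_) (fun ε hε => ?_)
    · rw [avg_add, avg_sub, avg_const (by omega), avg_nsq (by omega), hu1 y (hYT hy), ind_pos hy]; linarith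
    · have := nsq_gt hy; have := hu0 y; linarith
    · refine ((cube_finite bc (m/8))).subset fun y hy => ?_
      by_contra h
      have := nsq_gt h; have := hu0 y
      simp only [Set.mem_ofPred_eq] at hy; linarith
  have hq' : (1:ℝ) ≤ q := by exact_mod_cast hq
  have hd' : (5:ℝ) ≤ d := by exact_mod_cast hd
  have hnear : ∀ y ∈ cube bc q, (q:ℝ)^2 ≤ u y := fun y hy => by
    have h1 := hlow y
    have h2 := nsq_cube hy
    have h3 : (8 * (d * q) : ℝ) ≤ ((m/8:ℕ):ℝ) := by
      have : 8 * A ≤ m/8 := by omega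
      rw [hA] at this; exact_mod_cast this
    have h4 : (8 * (d * q) : ℝ)^2 ≤ ((m/8:ℕ):ℝ)^2 := by gcongr
    have h5 : ((d:ℝ)+1) * q^2 ≤ (8 * (d * q) : ℝ)^2 := by
      rw [show (8 * (d * q) : ℝ)^2 = (64*d^2) * q^2 by ring]
      gcongr; nlinarith
    linarith
  -- box
  set s : ℤ := ((m/2:ℕ):ℤ) with hs
  set lo : V d := fun i => if i = i₀ then min (x₀ i₀ + σ * q) (x₀ i₀ + σ * s) else x₀ i - 9 * A with hlo
  set hi : V d := fun i => if i = i₀ then max (x₀ i₀ + σ * q) (x₀ i₀ + σ * s) else x₀ i + 9 * A with hhi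
  have hloi : lo i₀ = min (x₀ i₀ + σ * q) (x₀ i₀ + σ * s) := by simp [hlo]
  have hhii : hi i₀ = max (x₀ i₀ + σ * q) (x₀ i₀ + σ * s) := by simp [hhi]
  have hlon : ∀ i ≠ i₀, lo i = x₀ i - 9 * A := fun i h => by simp [hlo, h]
  have hhin : ∀ i ≠ i₀, hi i = x₀ i + 9 * A := fun i h => by simp [hhi, h]
  have hqs : (q:ℤ) ≤ s := by omega
  have hmem : ∀ y : V d, y ∈ Set.Icc lo hi ↔ ((q:ℤ) ≤ ht i₀ σ x₀ y ∧ ht i₀ σ x₀ y ≤ s) ∧ ∀ i ≠ i₀, |y i - x₀ i| ≤ 9 * A := by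
    intro y
    have e0 : (lo i₀ ≤ y i₀ ∧ y i₀ ≤ hi i₀) ↔ ((q:ℤ) ≤ ht i₀ σ x₀ y ∧ ht i₀ σ x₀ y ≤ s) := by
      rw [hloi, hhii, ht]
      rcases sig hσ with rfl | rfl <;> constructor <;> rintro ⟨h1, h2⟩ <;> constructor <;> omega
    constructor
    · rintro ⟨h1, h2⟩
      refine ⟨e0.1 ⟨h1 i₀, h2 i₀⟩, fun i hne => ?_⟩
      have a1 : lo i ≤ y i := h1 i; have a2 : y i ≤ hi i := h2 i
      rw [hlon i hne] at a1; rw [hhin i hne] at a2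
      rw [abs_le]; constructor <;> omega
    · rintro ⟨h1, h2⟩
      have := e0.2 h1
      constructor <;> intro i <;> by_cases hne : i = i₀
      · subst hne; exact this.1
      · have := abs_le.1 (h2 i hne)
        show lo i ≤ y i
        rw [hlon i hne]; omega
      · subst hne; exact this.2
      · have := abs_le.1 (h2 i hne)
        show y i ≤ hi i
        rw [hhin i hne]; omega
  have hKr : (256 * d * q : ℕ) = 256 * A := by rw [hA]; ring
  refine W q hq lo hi u (q^2) (fun i => ?_) hu0 (fun y hy w hw => ?_) (by positivity) bc ?_ hnear z ?_
  · rw [hKr]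
    by_cases h : i = i₀
    · subst h; rw [hloi, hhii]
      rcases sig hσ with rfl | rfl <;> push_cast <;> omega
    · rw [hlon i h, hhin i h]; push_cast; omega
  · have h := (hmem y).1 hy
    rw [mem_cube_ht hσ x₀ (i₀ := i₀)] at hw
    have hw1 := abs_le.1 hw.1
    have : w ∈ Tube i₀ σ x₀ m := by
      refine ⟨by omega, ?_⟩
      rw [mem_cube_ht hσ x₀ (i₀ := i₀), ht_self, abs_le]
      refine ⟨⟨by omega, by omega⟩, fun i hi => ?_⟩
      have h1 := abs_le.1 (hw.2 i hi)
      have h2 := abs_le.1 (h.2 i hi)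
      rw [abs_le]; constructor <;> omega
    rw [hu1 w this]; have := ind_nonneg (cube bc (m/8)) w; linarith
  · rw [hmem, hbh]
    refine ⟨⟨hqs, le_rfl⟩, fun i hi => ?_⟩
    rw [hbl i hi]; simp
  · rw [hmem, hz]
    exact ⟨⟨le_rfl, hqs⟩, fun i hi => by have := hzl i hi; push_cast at this ⊢; exact this⟩
end USFPaper

namespace USFPaper
variable {d : ℕ} {P : V d → Measure (ℕ → V d)}

lemma G_bdd (hd : 5 ≤ d) : ∃ C > 0, ∀ x : V d, G x ≤ C := by
  obtain ⟨_, A, hA, C, hC, H⟩ := G_basic (d := d) hd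
  refine ⟨C, hC, fun x => (H x).trans ?_⟩
  have h1 : rad (ex d) A x ≤ 1 := by
    have h5 : (5:ℝ) ≤ d := by exact_mod_cast hd
    refine Real.rpow_le_one_of_one_le_of_nonpos (by have := nsq_nonneg x; linarith) ?_
    unfold ex; linarith
  nlinarith

lemma Gpot (hd : 5 ≤ d) : ∃ (φ : V d → ℝ), ∃ C > 0, (∀ x, 0 ≤ φ x) ∧ (∀ x, φ x ≤ C) ∧ (∀ x, G x + avg φ x ≤ φ x) ∧
    ∀ L : ℕ, 1 ≤ L → ∀ (x : V d) i, (L:ℤ) ≤ |x i| → φ x * L ≤ C := by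
  obtain ⟨_, A1, hA1, C, hC, H⟩ := G_basic (d := d) hd
  have h5 : (5:ℝ) ≤ d := by exact_mod_cast hd
  obtain ⟨A, hA, c, hc, R⟩ := rad_gain' (d := d) (by omega) (α := 1/2) (by norm_num) (by linarith)
  have hA0 : 0 < A := by linarith
  set κ := C * A ^ (3/2 : ℝ) / c with hκ
  have hκ0 : 0 < κ := by have := Real.rpow_pos_of_pos hA0 (3/2:ℝ); positivity
  have hG : ∀ x : V d, G x ≤ κ * (c * rad (1/2+1) A x) := fun x => by
    refine (H x).trans ?_
    have hn := nsq_nonneg x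
    have h1 : rad (ex d) A1 x ≤ (nsq x + A1) ^ (-(3/2) : ℝ) := by
      unfold rad; apply Real.rpow_le_rpow_of_exponent_le (by linarith); unfold ex; linarith
    have h2 : (nsq x + A1) ^ (-(3/2) : ℝ) ≤ ((nsq x + A)/A) ^ (-(3/2) : ℝ) := by
      apply Real.rpow_le_rpow_of_nonpos (by positivity) _ (by norm_num)
      rw [div_le_iff₀ hA0]; nlinarith
    rw [Real.div_rpow (by linarith) hA0.le, Real.rpow_neg hA0.le, div_inv_eq_mul] at h2
    calc C * rad (ex d) A1 x ≤ C * ((nsq x + A) ^ (-(3/2):ℝ) * A^(3/2:ℝ)) := by gcongr; linarith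
      _ = κ * (c * rad (1/2+1) A x) := by
        rw [hκ, rad, show (-(1/2+1):ℝ) = -(3/2) by norm_num]; field_simp
  refine ⟨fun x => κ * rad (1/2) A x, κ, hκ0, fun x => ?_, fun x => ?_, fun x => ?_, fun L hL x i hx => ?_⟩
  · have := (rad_pos (α := 1/2) hA0 x).le; positivity
  · have : rad (1/2) A x ≤ 1 := Real.rpow_le_one_of_one_le_of_nonpos (by have := nsq_nonneg x; linarith) (by norm_num)
    nlinarith
  · rw [avg_smul]
    have := mul_le_mul_of_nonneg_left (R A le_rfl x) hκ0.le
    have := hG x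
    linarith
  · have hL' : (0:ℝ) < L := by exact_mod_cast hL
    have h1 : rad (1/2) A x ≤ (L:ℝ)⁻¹ := by
      have h2 : (L:ℝ)^2 ≤ nsq x + A := by
        have := sq_le_nsq x i
        have h3 : (L:ℝ) ≤ |(x i:ℝ)| := by exact_mod_cast hx
        have h4 : (L:ℝ)^2 ≤ |(x i:ℝ)|^2 := by gcongr
        rw [sq_abs] at h4; linarith
      rw [rad, Real.rpow_neg (by have := nsq_nonneg x; linarith), ← Real.sqrt_eq_rpow]
      gcongr
      exact Real.le_sqrt_of_sq_le h2
    calc κ * rad (1/2) A x * L ≤ κ * (L:ℝ)⁻¹ * L := by gcongr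
      _ = κ := by field_simp

/-- interaction functional -/
noncomputable def kk (i₀ : Fin d) (σ : ℤ) (L : ℕ) (M ε : ℝ) (u : V d) : ℝ :=
  M⁻¹ * G u + (ε⁻¹ * G (u + ((2*L:ℕ):ℤ) • dr i₀ σ) + ∑ i ∈ Finset.Ioc L (2*L), dl (u + (i:ℤ) • dr i₀ σ))

lemma up_abs {i₀ : Fin d} {σ : ℤ} (hσ : σ * σ = 1) (k : ℕ) : (k:ℤ) ≤ |((0:V d) + (k:ℤ) • dr i₀ σ) i₀| := by
  simp only [Pi.add_apply, Pi.smul_apply, dr_self, smul_eq_mul, Pi.zero_apply, zero_add]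
  rcases sig hσ with rfl | rfl <;> simp

lemma past (hd : 5 ≤ d) : ∃ C > 0, ∀ (P : V d → Measure (ℕ → V d)), (∀ x, IsSRWLaw (P x) x) →
    ∀ (i₀ : Fin d) (σ : ℤ) (L : ℕ) (M ε : ℝ), σ * σ = 1 → 1 ≤ L → 0 < M → 0 < ε → ∀ (z : V d) (t : ℕ),
    pr P z {ω | 1 ≤ ∑ j ∈ Finset.range t, kk i₀ σ L M ε (ω t - ω j)} ≤ C / M + C / (L * ε) + C / L := by
  obtain ⟨φ, C1, hC1, f0, fb, fp, fL⟩ := Gpot (d := d) hd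
  obtain ⟨C2, hC2, hU⟩ := GU (d := d) hd
  obtain ⟨C3, hC3, hB⟩ := G_bdd (d := d) hd
  refine ⟨C1 + C2, by positivity, fun P hP i₀ σ L M ε hσ hL hM hε z t => ?_⟩
  have hL' : (1:ℝ) ≤ L := by exact_mod_cast hL
  set k := kk i₀ σ L M ε with hk
  have k0 : ∀ u : V d, 0 ≤ k u := fun u => by
    simp only [hk, kk]
    have := G_nonneg u; have := G_nonneg (u + ((2*L:ℕ):ℤ) • dr i₀ σ)
    have : 0 ≤ ∑ i ∈ Finset.Ioc L (2*L), dl (u + (i:ℤ) • dr i₀ σ) := Finset.sum_nonneg fun i _ => dl_nonneg _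
    positivity
  have kb : ∀ u : V d, |k u| ≤ M⁻¹ * C3 + (ε⁻¹ * C3 + L) := fun u => by
    rw [abs_of_nonneg (k0 u)]
    simp only [hk, kk]
    have h3 : ∑ i ∈ Finset.Ioc L (2*L), dl (u + (i:ℤ) • dr i₀ σ) ≤ ∑ i ∈ Finset.Ioc L (2*L), (1:ℝ) :=
      Finset.sum_le_sum fun i _ => by unfold dl; split_ifs <;> norm_num
    simp only [Finset.sum_const, Nat.card_Ioc, nsmul_eq_mul, mul_one] at h3
    rw [show 2 * L - L = L by omega] at h3
    have h1 := hB u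
    have h2 := hB (u + ((2*L:ℕ):ℤ) • dr i₀ σ)
    gcongr
  set F : V d → ℝ := fun u => M⁻¹ * φ u + (ε⁻¹ * φ (u + ((2*L:ℕ):ℤ) • dr i₀ σ) + ∑ i ∈ Finset.Ioc L (2*L), G (u + (i:ℤ) • dr i₀ σ)) with hF
  have hF0 : ∀ u, 0 ≤ F u := fun u => by
    simp only [hF]
    have := f0 u; have := f0 (u + ((2*L:ℕ):ℤ) • dr i₀ σ)
    have : 0 ≤ ∑ i ∈ Finset.Ioc L (2*L), G (u + (i:ℤ) • dr i₀ σ) := Finset.sum_nonneg fun i _ => G_nonneg _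
    positivity
  have hpot : ∀ u, k u + avg F u ≤ F u := fun u => by
    simp only [hF, hk, kk]
    rw [avg_add, avg_smul, avg_add, avg_smul, avg_sum, avg_shift φ]
    have h1 := mul_le_mul_of_nonneg_left (fp u) (inv_nonneg.2 hM.le)
    have h2 := mul_le_mul_of_nonneg_left (fp (u + ((2*L:ℕ):ℤ) • dr i₀ σ)) (inv_nonneg.2 hε.le)
    have h3 : ∑ i ∈ Finset.Ioc L (2*L), avg (fun u => G (u + (i:ℤ) • dr i₀ σ)) u =
        ∑ i ∈ Finset.Ioc L (2*L), G (u + (i:ℤ) • dr i₀ σ) - ∑ i ∈ Finset.Ioc L (2*L), dl (u + (i:ℤ) • dr i₀ σ) := by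
      rw [← Finset.sum_sub_distrib]
      exact Finset.sum_congr rfl fun i _ => by rw [avg_shift, avg_G hd]
    rw [h3]; linarith
  have hpl := pot_le hpot hF0 (t+1) 0
  have := (hP z).1
  have hkm : ∀ j, Measurable fun ω : ℕ → V d => k (ω t - ω j) := fun j => by
    have h1 : Measurable k := measurable_of_countable k
    exact h1.comp (by fun_prop)
  have hint : ∀ j, Integrable (fun ω : ℕ → V d => k (ω t - ω j)) (P z) := fun j =>
    Integrable.of_bound (hkm j).aestronglyMeasurable _ (Filter.Eventually.of_forall fun ω => by rw [Real.norm_eq_abs]; exact kb _)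
  have hmk := mul_meas_ge_le_integral_of_nonneg (μ := P z) (f := fun ω => ∑ j ∈ Finset.range t, k (ω t - ω j))
    (Filter.Eventually.of_forall fun ω => Finset.sum_nonneg fun i _ => k0 _) (integrable_finsetSum _ fun j _ => hint j) 1
  rw [one_mul, integral_finsetSum _ fun j _ => hint j] at hmk
  have h4 : ∑ j ∈ Finset.range t, ∫ ω, k (ω t - ω j) ∂(P z) ≤ ∑ s ∈ Finset.range (t+1), avg^[s] k 0 := by
    rw [← Finset.sum_range_reflect, Finset.sum_range_succ']
    refine le_trans (Finset.sum_le_sum (g := fun s => avg^[s+1] k 0) fun s hs => ?_) (by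
      have := k0 0; simp only [Function.iterate_zero, id]; linarith)
    have hs := Finset.mem_range.1 hs
    have := avg_diff (by omega) hP kb (t - 1 - s) (s+1) z
    rw [show t - 1 - s + (s+1) = t by omega] at this
    exact this.le
  have h5 : F 0 ≤ (C1 + C2) / M + (C1 + C2) / (L * ε) + (C1 + C2) / L := by
    have a1 : M⁻¹ * φ 0 ≤ (C1 + C2) / M := by
      rw [div_eq_inv_mul]; have := fb 0; gcongr; linarith
    have a2 : ε⁻¹ * φ (0 + ((2*L:ℕ):ℤ) • dr i₀ σ) ≤ (C1 + C2) / (L * ε) := by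
      have b1 := fL L hL (0 + ((2*L:ℕ):ℤ) • dr i₀ σ) i₀ (by have := up_abs (d := d) (i₀ := i₀) hσ (2*L); push_cast at *; linarith)
      have b2 : φ (0 + ((2*L:ℕ):ℤ) • dr i₀ σ) ≤ (C1 + C2) / L := by
        rw [le_div_iff₀ (by linarith)]; linarith
      calc _ ≤ ε⁻¹ * ((C1 + C2) / L) := by gcongr
        _ = _ := by field_simp
    have a3 : ∑ i ∈ Finset.Ioc L (2*L), G ((0:V d) + (i:ℤ) • dr i₀ σ) ≤ (C1 + C2) / L := by
      have b : ∀ i ∈ Finset.Ioc L (2*L), G ((0:V d) + (i:ℤ) • dr i₀ σ) ≤ C2 / L^2 := fun i hi => by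
        have hi := (Finset.mem_Ioc.1 hi).1
        have b1 := hU L hL ((0:V d) + (i:ℤ) • dr i₀ σ) i₀ (by have := up_abs (d := d) (i₀ := i₀) hσ i; omega)
        rw [le_div_iff₀ (by positivity)]
        refine le_trans ?_ b1
        have := G_nonneg ((0:V d) + (i:ℤ) • dr i₀ σ)
        gcongr
        omega
      have := Finset.sum_le_sum b
      simp only [Finset.sum_const, Nat.card_Ioc, nsmul_eq_mul] at this
      rw [show 2 * L - L = L by omega] at this
      refine this.trans ?_
      rw [show (L:ℝ) * (C2 / L^2) = C2 / L by field_simp]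
      gcongr; linarith
    simp only [hF]; linarith
  exact (hmk.trans h4).trans (hpl.trans h5)
end USFPaper

namespace USFPaper
variable {d : ℕ} {P : V d → Measure (ℕ → V d)}

lemma adj_dr {i₀ : Fin d} {σ : ℤ} (hσ : σ * σ = 1) (x : V d) : adj x (x + dr i₀ σ) := by
  rcases sig hσ with rfl | rfl
  · exact (adj_ev x i₀).1
  · have : x + dr i₀ (-1) = x - ev i₀ := by simp [dr, ev, sub_eq_add_neg, Pi.single_neg]
    rw [this]; exact (adj_ev x i₀).2

lemma line_fut (hd : 0 < d) (hP : ∀ x, IsSRWLaw (P x) x) {i₀ : Fin d} {σ : ℤ} (hσ : σ * σ = 1) (l : ℕ) (y : V d)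
    {E : Set (ℕ → V d)} (hE : MeasurableSet E) :
    (2 * (d:ℝ))⁻¹ ^ l * pr P (y + (l:ℤ) • dr i₀ σ) E ≤
      pr P y {ω | (∀ i ≤ l, ω i = y + (i:ℤ) • dr i₀ σ) ∧ th l ω ∈ E} := by
  have h := markov_ge hd hP l (κ := pr P (y + (l:ℤ) • dr i₀ σ) E) y {γ | ∀ i ≤ l, γ i = y + (i:ℤ) • dr i₀ σ}
    (Ev := fun _ => E) (fun _ => hE) (fun γ hγ => by rw [hγ l le_rfl])
  have e : ∀ ω : ℕ → V d, stp l ω ∈ {γ : ℕ → V d | ∀ i ≤ l, γ i = y + (i:ℤ) • dr i₀ σ} ↔ ∀ i ≤ l, ω i = y + (i:ℤ) • dr i₀ σ := by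
    intro ω
    simp only [Set.mem_ofPred_eq, stp]
    exact forall₂_congr fun i hi => by rw [min_eq_left hi]
  simp only [e] at h
  rw [mul_comm]
  refine le_trans (le_of_eq ?_) h
  congr 1
  have h2 := cyl_full hd (hP y) l (fun i => y + (i:ℤ) • dr i₀ σ)
  rw [if_pos ⟨by simp, fun i _ => by
    have := adj_dr (i₀ := i₀) hσ (y + (i:ℤ) • dr i₀ σ)
    rw [add_assoc, ← add_one_zsmul] at this; exact_mod_cast this⟩] at h2
  unfold pr Measure.real
  rw [show {ω : ℕ → V d | ∀ i ≤ l, ω i = y + (i:ℤ) • dr i₀ σ} = cyl l (fun i => y + (i:ℤ) • dr i₀ σ) from rfl, h2]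
  simp

lemma usum {A B : Finset (V d)} {f : V d → ℝ} (h : ∀ v, 0 ≤ f v) : ∑ v ∈ A ∪ B, f v ≤ ∑ v ∈ A, f v + ∑ v ∈ B, f v := by
  rw [← Finset.sum_union_inter]
  have := Finset.sum_nonneg (s := A ∩ B) fun v _ => h v
  linarith

/-- the set to be avoided after the line -/
noncomputable def Sf (i₀ : Fin d) (σ : ℤ) (S0 : Finset (V d)) (L t : ℕ) (γ : ℕ → V d) : Finset (V d) :=
  S0 ∪ ((Finset.range t).image γ ∪ (Finset.range (L+1)).image fun i : ℕ => γ t + (i:ℤ) • dr i₀ σ)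

lemma kk_nonneg (i₀ : Fin d) (σ : ℤ) (L : ℕ) {M ε : ℝ} (hM : 0 < M) (hε : 0 < ε) (u : V d) :
    M⁻¹ * G u ≤ kk i₀ σ L M ε u ∧ ε⁻¹ * G (u + ((2*L:ℕ):ℤ) • dr i₀ σ) ≤ kk i₀ σ L M ε u ∧
    (∑ i ∈ Finset.Ioc L (2*L), dl (u + (i:ℤ) • dr i₀ σ)) ≤ kk i₀ σ L M ε u ∧ 0 ≤ kk i₀ σ L M ε u := by
  have h1 : 0 ≤ M⁻¹ * G u := by have := G_nonneg u; positivity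
  have h2 : 0 ≤ ε⁻¹ * G (u + ((2*L:ℕ):ℤ) • dr i₀ σ) := by have := G_nonneg (u + ((2*L:ℕ):ℤ) • dr i₀ σ); positivity
  have h3 : 0 ≤ ∑ i ∈ Finset.Ioc L (2*L), dl (u + (i:ℤ) • dr i₀ σ) := Finset.sum_nonneg fun i _ => dl_nonneg _
  unfold kk
  exact ⟨by linarith, by linarith, by linarith, by linarith⟩

lemma futA (hd : 5 ≤ d) (hP : ∀ x, IsSRWLaw (P x) x) {D K : Set (V d)} {i₀ : Fin d} {σ : ℤ} (hσ : σ * σ = 1) {x₀ : V d}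
    {C a CU δ M ε : ℝ} {L q t : ℕ} {γ : ℕ → V d} {S0 : Finset (V d)} (hC : 0 < C) (ha : 0 ≤ a) (hM : 0 < M) (hε : 0 < ε)
    (hL : 1 ≤ L) (hq : 1 ≤ q) (hCU : 0 < CU)
    (hU : ∀ r : ℕ, 1 ≤ r → ∀ (x : V d) i, (r:ℤ) ≤ |x i| → G x * (r:ℝ)^(d-2) ≤ CU)
    (h1 : a ≤ C * hK P D K (γ t + ((2*L:ℕ):ℤ) • dr i₀ σ))
    (h2 : ∀ v ∈ Sf i₀ σ S0 L t γ, hK P D K v ≤ C * a)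
    (h3 : ∑ j ∈ Finset.range t, kk i₀ σ L M ε (γ t - γ j) < 1)
    (h4 : ∀ v ∈ S0, (q:ℤ) ≤ ht i₀ σ x₀ (γ t) - ht i₀ σ x₀ v)
    (n1 : S0.card * (CU / q^3) ≤ δ) (n2 : ε ≤ δ) (n3 : 2 * CU / L ≤ δ) (n4 : 3 * δ * C^2 ≤ 1/2) :
    a / (2 * C) ≤ pr P (γ t + ((2*L:ℕ):ℤ) • dr i₀ σ) (AV D (K ∪ Sf i₀ σ S0 L t γ)) := by
  refine le_trans ?_ (avoid hd hP D K _ _)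
  set w := γ t + ((2*L:ℕ):ℤ) • dr i₀ σ with hw
  have hL' : (1:ℝ) ≤ L := by exact_mod_cast hL
  have hq' : (1:ℝ) ≤ q := by exact_mod_cast hq
  have hGb : ∀ (r : ℕ), 1 ≤ r → ∀ x : V d, (r:ℤ) ≤ |x i₀| → G x ≤ CU / r^3 := fun r hr x hx => by
    have h := hU r hr x i₀ hx
    have hr' : (1:ℝ) ≤ r := by exact_mod_cast hr
    rw [le_div_iff₀ (by positivity)]
    refine le_trans ?_ h
    have := G_nonneg x
    gcongr
    omega
  have hs : ∑ v ∈ Sf i₀ σ S0 L t γ, G (w - v) ≤ 3 * δ := by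
    have g0 : ∀ v, 0 ≤ G (w - v) := fun v => G_nonneg _
    have s1 : ∑ v ∈ S0, G (w - v) ≤ δ := by
      refine le_trans ((Finset.sum_le_sum (g := fun _ => CU / (q:ℝ)^3) fun v hv => hGb q hq _ ?_)) (by simpa using n1)
      have e1 := h4 v hv
      rw [Pi.sub_apply, ← ht_diff hσ x₀, hw, ht_up hσ]
      refine le_trans ?_ (le_abs_self _); omega
    have s2 : ∑ v ∈ (Finset.range t).image γ, G (w - v) ≤ δ := by
      refine (Finset.sum_image_le_of_nonneg (fun v _ => g0 v)).trans ?_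
      have : ∑ j ∈ Finset.range t, ε⁻¹ * G (w - γ j) ≤ 1 := by
        refine le_trans (Finset.sum_le_sum fun j _ => ?_) h3.le
        have := (kk_nonneg i₀ σ L hM hε (γ t - γ j)).2.1
        rwa [show γ t - γ j + ((2*L:ℕ):ℤ) • dr i₀ σ = w - γ j by rw [hw]; abel] at this
      rw [← Finset.mul_sum, inv_mul_le_iff₀ hε] at this
      linarith
    have s3 : ∑ v ∈ (Finset.range (L+1)).image (fun i : ℕ => γ t + (i:ℤ) • dr i₀ σ), G (w - v) ≤ δ := by
      refine (Finset.sum_image_le_of_nonneg (fun v _ => g0 v)).trans ?_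
      refine le_trans (Finset.sum_le_sum (g := fun _ => CU / (L:ℝ)^3) fun i hi => hGb L hL _ ?_) ?_
      · have hi := Finset.mem_range.1 hi
        rw [Pi.sub_apply, ← ht_diff hσ x₀, hw, ht_up hσ, ht_up hσ]
        refine le_trans ?_ (le_abs_self _); push_cast; omega
      · refine le_trans ?_ n3
        rw [Finset.sum_const, Finset.card_range, nsmul_eq_mul]; push_cast
        rw [show ((L:ℝ)+1) * (CU / L^3) = ((L+1) / L^2) * CU / L by field_simp]
        have : ((L:ℝ)+1)/L^2 ≤ 2 := by rw [div_le_iff₀ (by positivity)]; nlinarith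
        gcongr
    have := usum (A := S0) (B := (Finset.range t).image γ ∪ (Finset.range (L+1)).image fun i : ℕ => γ t + (i:ℤ) • dr i₀ σ) g0
    have := usum (A := (Finset.range t).image γ) (B := (Finset.range (L+1)).image fun i : ℕ => γ t + (i:ℤ) • dr i₀ σ) g0
    unfold Sf; linarith
  have hs2 : ∑ v ∈ Sf i₀ σ S0 L t γ, G (w - v) * hK P D K v ≤ 3 * δ * (C * a) := by
    calc _ ≤ ∑ v ∈ Sf i₀ σ S0 L t γ, G (w - v) * (C * a) := Finset.sum_le_sum fun v hv => mul_le_mul_of_nonneg_left (h2 v hv) (G_nonneg _)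
      _ = (∑ v ∈ Sf i₀ σ S0 L t γ, G (w - v)) * (C * a) := by rw [Finset.sum_mul]
      _ ≤ _ := by gcongr
  have h5 : a / C ≤ hK P D K w := by rw [div_le_iff₀ hC]; linarith
  have h6 : 3 * δ * (C * a) ≤ a / (2 * C) := by
    rw [le_div_iff₀ (by positivity)]
    have := mul_le_mul_of_nonneg_right n4 ha
    nlinarith
  have h7 : a / C = a / (2*C) + a/(2*C) := by field_simp; ring
  linarith
end USFPaper

namespace USFPaper
variable {d : ℕ} {P : V d → Measure (ℕ → V d)}

/-- good time -/
def Et (D K : Set (V d)) (i₀ : Fin d) (σ : ℤ) (x₀ : V d) (m : ℕ) (S0 : Finset (V d)) (L : ℕ) (M ε : ℝ) (t : ℕ) : Set (ℕ → V d) :=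
  {ω | ((∀ i ≤ t, ω i ∈ Tube i₀ σ x₀ m) ∧ ω t ∈ cube (x₀ + ((m/2:ℕ):ℤ) • dr i₀ σ) (m/8) ∧
    ∑ j ∈ Finset.range t, kk i₀ σ L M ε (ω t - ω j) < 1) ∧
    (∀ i ≤ 2*L, ω (i + t) = ω t + (i:ℤ) • dr i₀ σ) ∧ th (2*L) (th t ω) ∈ AV D (K ∪ Sf i₀ σ S0 L t ω)}

lemma Sf_stp (i₀ : Fin d) (σ : ℤ) (S0 : Finset (V d)) (L t : ℕ) (ω : ℕ → V d) : Sf i₀ σ S0 L t (stp t ω) = Sf i₀ σ S0 L t ω := by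
  have h1 : (Finset.range t).image (stp t ω) = (Finset.range t).image ω :=
    Finset.image_congr fun i hi => by
      have : i < t := by simpa using hi
      simp [stp, this.le]
  unfold Sf
  rw [h1]; simp [stp]

lemma Et_eq (D K : Set (V d)) (i₀ : Fin d) (σ : ℤ) (x₀ : V d) (m : ℕ) (S0 : Finset (V d)) (L : ℕ) (M ε : ℝ) (t : ℕ) :
    Et D K i₀ σ x₀ m S0 L M ε t = {ω | stp t ω ∈ {γ : ℕ → V d | (∀ i ≤ t, γ i ∈ Tube i₀ σ x₀ m) ∧
      γ t ∈ cube (x₀ + ((m/2:ℕ):ℤ) • dr i₀ σ) (m/8) ∧ ∑ j ∈ Finset.range t, kk i₀ σ L M ε (γ t - γ j) < 1} ∧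
      th t ω ∈ (fun γ : ℕ → V d => {ω' : ℕ → V d | (∀ i ≤ 2*L, ω' i = γ t + (i:ℤ) • dr i₀ σ) ∧
        th (2*L) ω' ∈ AV D (K ∪ Sf i₀ σ S0 L t γ)}) (stp t ω)} := by
  ext ω
  have e1 : ∀ i ≤ t, stp t ω i = ω i := fun i hi => by simp [stp, hi]
  simp only [Et, Set.mem_ofPred_eq, Sf_stp, e1 t le_rfl]
  have e2 : ∑ j ∈ Finset.range t, kk i₀ σ L M ε (ω t - stp t ω j) = ∑ j ∈ Finset.range t, kk i₀ σ L M ε (ω t - ω j) :=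
    Finset.sum_congr rfl fun j hj => by rw [e1 j (Finset.mem_range.1 hj).le]
  have e3 : (∀ i ≤ t, stp t ω i ∈ Tube i₀ σ x₀ m) ↔ ∀ i ≤ t, ω i ∈ Tube i₀ σ x₀ m :=
    forall₂_congr fun i hi => by rw [e1 i hi]
  rw [e2, e3]; rfl

lemma Ev_meas (D K : Set (V d)) (i₀ : Fin d) (σ : ℤ) (S0 : Finset (V d)) (L t : ℕ) (γ : ℕ → V d) :
    MeasurableSet {ω' : ℕ → V d | (∀ i ≤ 2*L, ω' i = γ t + (i:ℤ) • dr i₀ σ) ∧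
        th (2*L) ω' ∈ AV D (K ∪ Sf i₀ σ S0 L t γ)} := by
  refine MeasurableSet.inter (meas_loc' (2*L) (A := {ω' : ℕ → V d | ∀ i ≤ 2*L, ω' i = γ t + (i:ℤ) • dr i₀ σ}) ?_) (th_meas _ (AV_meas _ _))
  intro ω ω' h h1 i hi
  rw [← h i hi]; exact h1 i hi

lemma Et_meas (D K : Set (V d)) (i₀ : Fin d) (σ : ℤ) (x₀ : V d) (m : ℕ) (S0 : Finset (V d)) (L : ℕ) (M ε : ℝ) (t : ℕ) :
    MeasurableSet (Et D K i₀ σ x₀ m S0 L M ε t) := by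
  rw [Et_eq]; exact meas_mk t _ fun γ => Ev_meas D K i₀ σ S0 L t γ

lemma Et_AV {D K : Set (V d)} {i₀ : Fin d} {σ : ℤ} (hσ : σ * σ = 1) {x₀ : V d} {m : ℕ} {S0 : Finset (V d)} {L : ℕ} {M ε : ℝ} {t : ℕ}
    (hK0 : ∀ y ∈ K, ht i₀ σ x₀ y ≤ 0) : Et D K i₀ σ x₀ m S0 L M ε t ⊆ AV D K := by
  rintro ω ⟨⟨h1, -, -⟩, h2, h3⟩ j hj hjK
  have h4 := hK0 _ hjK
  by_cases hjt : j ≤ t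
  · have := (h1 j hjt).1; omega
  by_cases hj2 : j ≤ t + 2*L
  · have e := h2 (j-t) (by omega)
    rw [show j - t + t = j by omega] at e
    rw [e, ht_up hσ] at h4
    have := (h1 t le_rfl).1; omega
  · have := h3 (j - t - 2*L) (fun i hi => hj _ (by omega))
    apply this
    left
    simpa only [th, show j - t - 2*L + 2*L + t = j by omega] using hjK

set_option maxHeartbeats 1000000 in
lemma stage2 (hd : 5 ≤ d) : ∃ (q0 L Tc : ℕ) (M ε c0 c5 C3 C : ℝ), 1 ≤ q0 ∧ L ≤ q0 ∧ 1 ≤ L ∧ 0 < M ∧ 0 < ε ∧ 0 < c0 ∧ 0 < c5 ∧ 0 < C3 ∧ 0 < C ∧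
    ∀ (P : V d → Measure (ℕ → V d)), (∀ x, IsSRWLaw (P x) x) → ∀ (N n : ℕ) (D K : Set (V d)) (i₀ : Fin d) (σ : ℤ) (x₀ : V d),
    1 ≤ N → n ≤ N → cube 0 (4*N) ⊆ D → K ⊆ cube 0 n → σ * σ = 1 → x₀ i₀ = σ * n → (∀ i, |x₀ i| ≤ n) → (∀ y ∈ K, ht i₀ σ x₀ y ≤ 0) →
    ∀ q m : ℕ, q0 ≤ q → 64 * (d * q) ≤ m → m ≤ 256 * (d * q) →
    (∀ y ∈ cube x₀ m, hK P D K y ≤ C * hK P D K (x₀ + (q:ℤ) • dr i₀ σ)) ∧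
    ∀ S0 : Finset (V d), S0.card ≤ 200 * (d * q^2) → (∀ v ∈ S0, ht i₀ σ x₀ v ≤ q ∧ v ∈ cube x₀ m) →
    ∀ z, ht i₀ σ x₀ z = q → (∀ i ≠ i₀, |z i - x₀ i| ≤ 9 * (d * q : ℕ)) →
    c5 * hK P D K (x₀ + (q:ℤ) • dr i₀ σ) ≤ pr P z ({ω | ω ∈ AV D K ∧
      c0 * q^2 < ∑ t ∈ Finset.range (Tc * q^2), (Et D K i₀ σ x₀ m S0 L M ε t).indicator (fun _ => (1:ℝ)) ω} \ VisB D K x₀ m (C3 * m^2)) := by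
  obtain ⟨CC, HC⟩ := hK_HH hd
  obtain ⟨C, hC, Hcar⟩ := car hd CC (300*d)
  obtain ⟨co, hco, Hocc⟩ := occ_low hd
  obtain ⟨C', hC', Hpast⟩ := past hd
  obtain ⟨CU, hCU, hU⟩ := GU (d := d) hd
  obtain ⟨Cv, hCv, HV⟩ := VisB_le hd
  have hd' : (5:ℝ) ≤ d := by exact_mod_cast hd
  set δ : ℝ := 1/(6*C^2) with hδ
  have hδ0 : 0 < δ := by positivity
  have n4 : 3 * δ * C^2 ≤ 1/2 := by rw [hδ]; field_simp; norm_num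
  obtain ⟨Tc, hTc⟩ := exists_nat_ge (2 * (d^2*(256*d)^4) / co)
  have hTc0 : (0:ℝ) < Tc := lt_of_lt_of_le (by positivity) hTc
  set M : ℝ := 12 * Tc * C' / co with hM
  have hM0 : 0 < M := by positivity
  obtain ⟨L, hL⟩ := exists_nat_ge (12 * Tc * C' / (co * δ) + 12 * Tc * C' / co + 2 * CU / δ + 1)
  have p1 : 0 < 12 * Tc * C' / (co * δ) := by positivity
  have p2 : 0 < 12 * Tc * C' / co := by positivity
  have p3 : 0 < 2 * CU / δ := by positivity
  have hL1 : (1:ℝ) ≤ L := by linarith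
  have hL1' : 1 ≤ L := by exact_mod_cast hL1
  have b1 : Tc * (C' / M) ≤ co / 12 := by rw [hM]; apply le_of_eq; field_simp
  have b2 : Tc * (C' / (L * δ)) ≤ co / 12 := by
    have : 12 * Tc * C' / (co * δ) ≤ L := by linarith
    rw [div_le_iff₀ (by positivity)] at this
    rw [← mul_div_assoc, div_le_iff₀ (by positivity)]; linarith
  have b3 : Tc * (C' / L) ≤ co / 12 := by
    have : 12 * Tc * C' / co ≤ L := by linarith
    rw [div_le_iff₀ (by positivity)] at this
    rw [← mul_div_assoc, div_le_iff₀ (by positivity)]; linarith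
  have n3 : 2 * CU / L ≤ δ := by
    have : 2 * CU / δ ≤ L := by linarith
    rw [div_le_iff₀ (by positivity)] at this ⊢; linarith
  obtain ⟨q0, hq0⟩ := exists_nat_ge (200 * d * CU / δ + L)
  have p4 : 0 < 200 * d * CU / δ := by positivity
  have hLq : L ≤ q0 := by have : (L:ℝ) ≤ q0 := by linarith
                          exact_mod_cast this
  set κ0 : ℝ := (2 * (d:ℝ))⁻¹ ^ (2*L) / (2*C) with hκ0
  have hκ : 0 < κ0 := by positivity
  set c0 := κ0 * co / (8 * C) with hc0
  set c5 := κ0 * co / (8 * Tc) with hc5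
  have hc5' : 0 < c5 := by positivity
  refine ⟨q0, L, Tc, M, δ, c0, c5/2, 2 * Cv * C / c5, C, by omega, hLq, hL1', hM0, hδ0, by positivity, by positivity, by positivity, hC, ?_⟩
  intro P hP N n D K i₀ σ x₀ hN hn hD hK' hσ hx0 hxn hK0 q m hq hm1 hm2
  have hh := HC P hP N n D K hN hn hD hK'
  have hdq : 5 * q ≤ d * q := Nat.mul_le_mul_right _ hd
  have hq1 : 1 ≤ q := by omega
  have hq' : (1:ℝ) ≤ q := by exact_mod_cast hq1
  set a := hK P D K (x₀ + (q:ℤ) • dr i₀ σ) with ha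
  have ha0 : 0 ≤ a := pr_nonneg _ _
  have hΛ : m ≤ 300 * d * q := by rw [mul_assoc]; omega
  have cmono : ∀ y : V d, ∀ r s : ℕ, r ≤ s → y ∈ cube x₀ r → y ∈ cube x₀ s := fun y r s h hy i => (hy i).trans (by exact_mod_cast h)
  have hxq : x₀ + (q:ℤ) • dr i₀ σ ∈ cube x₀ (300 * d * q) := by
    rw [mem_cube_ht (i₀ := i₀) hσ x₀, ht_up hσ, ht_self]
    refine ⟨by rw [mul_assoc]; simp only [zero_add, sub_zero]; rw [abs_of_nonneg (by positivity)]; push_cast; nlinarith, fun i hi => by rw [up_ne hi]; simp; positivity⟩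
  have hup : ∀ y ∈ cube x₀ m, hK P D K y ≤ C * a := fun y hy =>
    Hcar N n _ hh q i₀ σ x₀ hq1 hσ hx0 hxn y (cmono y _ _ hΛ hy) _ hxq (by rw [ht_up hσ, ht_self]; simp)
  refine ⟨hup, fun S0 hS1 hS2 z hz hzl => ?_⟩
  have hlow : ∀ y ∈ cube x₀ m, (q:ℤ) ≤ ht i₀ σ x₀ y → a ≤ C * hK P D K y := fun y hy h =>
    Hcar N n _ hh q i₀ σ x₀ hq1 hσ hx0 hxn _ hxq y (cmono y _ _ hΛ hy) h
  have hzc : z ∈ cube x₀ m := by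
    rw [mem_cube_ht (i₀ := i₀) hσ x₀, ht_self, hz]
    refine ⟨by rw [sub_zero, abs_of_nonneg (by positivity)]; exact_mod_cast (by omega), fun i hi => (hzl i hi).trans (by exact_mod_cast (by omega))⟩
  set E := Et D K i₀ σ x₀ m S0 L M δ with hE
  have := (hP z).1
  -- lower bound for a single good time
  have hEt : ∀ t, κ0 * a * (pr P z {ω | (∀ i ≤ t, ω i ∈ Tube i₀ σ x₀ m) ∧ ω t ∈ cube (x₀ + ((m/2:ℕ):ℤ) • dr i₀ σ) (m/8)} -
      (C' / M + C' / (L * δ) + C' / L)) ≤ pr P z (E t) := by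
    intro t
    have g1 : κ0 * a * pr P z {ω | stp t ω ∈ {γ : ℕ → V d | (∀ i ≤ t, γ i ∈ Tube i₀ σ x₀ m) ∧
      γ t ∈ cube (x₀ + ((m/2:ℕ):ℤ) • dr i₀ σ) (m/8) ∧ ∑ j ∈ Finset.range t, kk i₀ σ L M δ (γ t - γ j) < 1}} ≤ pr P z (E t) := by
      rw [hE, Et_eq]
      refine markov_ge (by omega) hP t z _ (fun γ => Ev_meas D K i₀ σ S0 L t γ) ?_
      rintro γ ⟨γ1, γ2, γ3⟩
      refine le_trans ?_ (line_fut (by omega) hP hσ (2*L) (γ t) (AV_meas D (K ∪ Sf i₀ σ S0 L t γ)))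
      have hb := (mem_cube_ht (i₀ := i₀) hσ x₀ _ _ _).1 γ2
      have hb2 : ht i₀ σ x₀ (x₀ + ((m/2:ℕ):ℤ) • dr i₀ σ) = ((m/2:ℕ):ℤ) := by rw [ht_up hσ, ht_self]; simp
      rw [hb2, abs_le] at hb
      obtain ⟨⟨hb3, hb4⟩, hb5⟩ := hb
      have hln : ∀ i : ℕ, i ≤ 2*L → γ t + (i:ℤ) • dr i₀ σ ∈ cube x₀ m := by
        intro i hi
        rw [mem_cube_ht (i₀ := i₀) hσ x₀, ht_up hσ, ht_self]
        refine ⟨by rw [abs_le]; constructor <;> omega, fun k hk => ?_⟩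
        rw [up_ne hk]
        have := hb5 k hk
        rw [up_ne hk] at this; omega
      have := futA (γ := γ) (t := t) (S0 := S0) (x₀ := x₀) (D := D) (K := K) (P := P) (q := q) hd hP hσ hC ha0 hM0 hδ0 hL1' hq1 hCU hU
        (hlow _ (hln _ le_rfl) (by rw [ht_up hσ]; push_cast; omega)) (fun v hv => ?_) γ3 (fun v hv => ?_) ?_ le_rfl n3 n4
      · calc κ0 * a = (2 * (d:ℝ))⁻¹ ^ (2*L) * (a / (2*C)) := by rw [hκ0]; ring
          _ ≤ _ := by gcongr
      · apply hup
        simp only [Sf, Finset.mem_union, Finset.mem_image, Finset.mem_range] at hv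
        rcases hv with hv | ⟨i, hi, rfl⟩ | ⟨i, hi, rfl⟩
        · exact (hS2 v hv).2
        · exact cmono _ _ _ (by omega) (γ1 i hi.le).2
        · exact hln i (by omega)
      · have := (hS2 v hv).1; omega
      · have h1 : (S0.card:ℝ) ≤ 200 * (d * q^2) := by exact_mod_cast hS1
        have h2 : 200 * d * CU / δ ≤ q := by have : (q0:ℝ) ≤ q := by exact_mod_cast hq
                                             linarith
        rw [div_le_iff₀ hδ0] at h2
        calc S0.card * (CU / (q:ℝ)^3) ≤ 200 * (d * q^2) * (CU / (q:ℝ)^3) := by gcongr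
          _ = 200 * d * CU / q := by field_simp
          _ ≤ δ := by rw [div_le_iff₀ (by positivity)]; linarith
    refine le_trans (mul_le_mul_of_nonneg_left ?_ (by positivity)) g1
    have g2 := Hpast P hP i₀ σ L M δ hσ hL1' hM0 hδ0 z t
    refine (tsub_le_iff_right (b := (C' / M + C' / (L * δ) + C' / L))).2 (le_trans ?_ (add_le_add_right g2 _))
    refine le_trans (pr_mono hP z ?_) (measureReal_union_le _ _)
    rintro ω ⟨w1, w2⟩
    by_cases hw : 1 ≤ ∑ j ∈ Finset.range t, kk i₀ σ L M δ (ω t - ω j)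
    · exact Or.inr hw
    · left
      have e1 : ∀ i ≤ t, stp t ω i = ω i := fun i hi => by simp [stp, hi]
      refine ⟨fun i hi => by rw [e1 i hi]; exact w1 i hi, by rw [e1 t le_rfl]; exact w2, ?_⟩
      rw [e1 t le_rfl, Finset.sum_congr rfl fun j hj => by rw [e1 j (Finset.mem_range.1 hj).le]]
      exact not_le.1 hw
  have hsum : κ0 * a * (co * q^2 / 4) ≤ ∑ t ∈ Finset.range (Tc * q^2), pr P z (E t) := by
    refine le_trans ?_ (Finset.sum_le_sum fun t _ => hEt t)
    rw [← Finset.mul_sum]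
    refine mul_le_mul_of_nonneg_left ?_ (by positivity)
    rw [Finset.sum_sub_distrib, Finset.sum_const, Finset.card_range, nsmul_eq_mul]
    have g := Hocc P hP q m i₀ σ x₀ z hq1 hm1 hm2 hσ hz hzl (Tc * q^2)
    set S := ∑ t ∈ Finset.range (Tc * q^2), pr P z {ω | (∀ i ≤ t, ω i ∈ Tube i₀ σ x₀ m) ∧ ω t ∈ cube (x₀ + ((m/2:ℕ):ℤ) • dr i₀ σ) (m/8)} with hS
    have gS : co * q^2 / 2 ≤ S := by
      by_contra hc
      push Not at hc
      have hm' : (m:ℝ) ≤ 256 * d * q := by rw [mul_assoc]; exact_mod_cast hm2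
      have k1 : (d * (m:ℝ)^2) * (d * (m:ℝ)^2) ≤ (d * (256 * d * q)^2) * (d * (256 * d * q)^2) := by gcongr
      have k2 : (d * (256 * d * q)^2) * (d * (256 * d * q)^2) = (d^2*(256*d)^4 : ℝ) * q^4 := by ring
      rw [div_le_iff₀ hco] at hTc
      have k3 : (Tc * q^2 : ℝ) * (co * q^2/2) < (Tc * q^2 : ℝ) * (co * q^2 - S) := by
        apply mul_lt_mul_of_pos_left _ (by positivity); linarith
      have k4 : (d^2*(256*d)^4 : ℝ) * q^4 ≤ (Tc * co / 2) * q^4 := by gcongr; linarith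
      push_cast at g
      have k5 : (Tc * q^2 : ℝ) * (co * q^2/2) = (Tc * co / 2) * q^4 := by ring
      linarith only [g, k1, k2, k3, k4, k5]
    have : ((Tc * q^2 : ℕ):ℝ) * (C' / M + C' / (L * δ) + C' / L) ≤ co * q^2 / 4 := by
      push_cast
      have : Tc * (C' / M + C' / (L * δ) + C' / L) ≤ co / 4 := by linarith
      have := mul_le_mul_of_nonneg_right this (by positivity : (0:ℝ) ≤ (q:ℝ)^2)
      linarith
    linarith
  have hcount := count_le (μ := P z) (Tc * q^2) (E := E) (F := AV D K) (fun i => Et_meas _ _ _ _ _ _ _ _ _ _ _) (AV_meas D K) (fun i => Et_AV hσ hK0) (b := c0 * q^2) (by positivity)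
  set R := {ω | ω ∈ AV D K ∧ c0 * q^2 < ∑ t ∈ Finset.range (Tc * q^2), (E t).indicator (fun _ => (1:ℝ)) ω} with hR
  have f1 : c5 * a ≤ pr P z R := by
    have e1 : c0 * q^2 * (P z).real (AV D K) ≤ κ0 * a * (co * q^2 / 8) := by
      have : (P z).real (AV D K) ≤ C * a := hup z hzc
      calc c0 * q^2 * (P z).real (AV D K) ≤ c0 * q^2 * (C * a) := by gcongr
        _ = _ := by rw [hc0]; field_simp
    have e2 : κ0 * a * (co * q^2 / 8) ≤ (Tc * q^2) * pr P z R := by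
      have : (((Tc * q^2 : ℕ):ℝ)) * (P z).real R = (Tc * q^2) * pr P z R := by push_cast; rfl
      have h3 : ∑ t ∈ Finset.range (Tc * q^2), (P z).real (E t) = ∑ t ∈ Finset.range (Tc * q^2), pr P z (E t) := rfl
      linarith
    have e3 : κ0 * a * co / 8 ≤ Tc * pr P z R := by
      have hq2 : (0:ℝ) < q^2 := by positivity
      refine le_of_mul_le_mul_right ?_ hq2
      linarith
    rw [hc5, div_mul_eq_mul_div, div_le_iff₀ (by positivity)]; linarith
  have f2 : pr P z (VisB D K x₀ m (2 * Cv * C / c5 * m^2)) ≤ c5 / 2 * a := by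
    have hm0 : (1:ℝ) ≤ m := by exact_mod_cast (by omega : 1 ≤ m)
    have g := HV P hP D K x₀ m (2 * Cv * C / c5 * m^2) (C * a) z (by omega) (by positivity) hup
    refine le_of_mul_le_mul_left (le_trans g (le_of_eq ?_)) (by positivity : (0:ℝ) < 2 * Cv * C / c5 * m^2)
    field_simp
  have f3 : pr P z R ≤ pr P z (R \ VisB D K x₀ m (2 * Cv * C / c5 * m^2)) + pr P z (VisB D K x₀ m (2 * Cv * C / c5 * m^2)) := by
    refine le_trans (pr_mono hP z ?_) (measureReal_union_le _ _)
    intro ω hω; by_cases h : ω ∈ VisB D K x₀ m (2 * Cv * C / c5 * m^2)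
    · exact Or.inr h
    · exact Or.inl ⟨hω, h⟩
  linarith
end USFPaper

namespace USFPaper
variable {d : ℕ} {P : V d → Measure (ℕ → V d)}

/-- local cut time -/
def cutP (D : Set (V d)) (x₀ : V d) (m : ℕ) (ω : ℕ → V d) (τ : ℕ) : Prop :=
  (∀ i ≤ τ, ω i ∈ D ∧ ω i ∈ cube x₀ (m-1)) ∧ ∀ i ≤ τ, ∀ j > τ, (∀ l < j, ω l ∈ D) → ω i ≠ ω j
/-- local cut points -/
def cutS (D : Set (V d)) (x₀ : V d) (m : ℕ) (ω : ℕ → V d) : Set (V d) := {w | ∃ τ, ω τ = w ∧ cutP D x₀ m ω τ}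

/-- good one-step event -/
def OK (P : V d → Measure (ℕ → V d)) (D K : Set (V d)) (bc x₀ : V d) (m : ℕ) (x2 : V d) (c1 C2 : ℝ) : Set (ℕ → V d) :=
  {ω | ω ∈ AVp D K ∧ c1 * (m:ℝ)^((4:ℤ)-(d:ℤ)) ≤ pr P x2 {ω' | ∃ t, ω' t ∈ cube bc (m/4) ∧ ω' t ∈ cutS D x₀ m ω} ∧
    ((Vis D x₀ m ω).ncard : ℝ) ≤ C2 * (m:ℝ)^2}

lemma det_large (hd : 5 ≤ d) {i₀ : Fin d} {σ : ℤ} (hσ : σ * σ = 1) {x₀ : V d} {q m L s t : ℕ} {M ε : ℝ} (hM : 0 < M) (hε : 0 < ε)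
    (hLq : L ≤ q) (hq : 1 ≤ q) (hm : 64 * (d * q) ≤ m)
    {D K : Set (V d)} (hD : cube x₀ m ⊆ D) {S0 : Finset (V d)} {ω : ℕ → V d} (hS : ∀ i < s, ω i ∈ S0)
    (hS2 : ∀ v ∈ S0, ht i₀ σ x₀ v ≤ q ∧ v ∈ cube x₀ (m-1)) (hE : th s ω ∈ Et D K i₀ σ x₀ m S0 L M ε t) :
    cutP D x₀ m ω (t+L+s) ∧ ω (t+L+s) = ω (t+s) + (L:ℤ) • dr i₀ σ ∧ ω (t+L+s) ∈ cube (x₀ + ((m/2:ℕ):ℤ) • dr i₀ σ) (m/4) := by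
  obtain ⟨⟨h1, h2, h3⟩, h4, h5⟩ := hE
  have hdq : 5 * q ≤ d * q := Nat.mul_le_mul_right _ hd
  have hb := (mem_cube_ht (i₀ := i₀) hσ x₀ _ _ _).1 h2
  have hb2 : ht i₀ σ x₀ (x₀ + ((m/2:ℕ):ℤ) • dr i₀ σ) = ((m/2:ℕ):ℤ) := by rw [ht_up hσ, ht_self]; simp
  rw [hb2, abs_le] at hb
  obtain ⟨⟨hb3, hb4⟩, hb5⟩ := hb
  set ω2 := th s ω with hω2
  have hln : ∀ i : ℕ, i ≤ 2*L → ω2 t + (i:ℤ) • dr i₀ σ ∈ cube x₀ (m-1) := by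
    intro i hi
    rw [mem_cube_ht (i₀ := i₀) hσ x₀, ht_up hσ, ht_self]
    refine ⟨by rw [abs_le]; constructor <;> omega, fun k hk => ?_⟩
    rw [up_ne hk]
    have := hb5 k hk
    rw [up_ne hk] at this; omega
  have hin : ∀ i ≤ t + L, ω2 i ∈ Sf i₀ σ S0 L t ω2 ∧ ω2 i ∈ cube x₀ (m-1) := by
    intro i hi
    by_cases hit : i < t
    · refine ⟨?_, (h1 i hit.le).2⟩
      simp only [Sf, Finset.mem_union, Finset.mem_image, Finset.mem_range]
      exact Or.inr (Or.inl ⟨i, hit, rfl⟩)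
    · have e := h4 (i-t) (by omega)
      rw [show i - t + t = i by omega] at e
      rw [e]
      refine ⟨?_, hln _ (by omega)⟩
      simp only [Sf, Finset.mem_union, Finset.mem_image, Finset.mem_range]
      exact Or.inr (Or.inr ⟨i-t, by omega, rfl⟩)
  have hin' : ∀ i ≤ t + L + s, ω i ∈ Sf i₀ σ S0 L t ω2 ∧ ω i ∈ cube x₀ (m-1) := by
    intro i hi
    by_cases his : i < s
    · exact ⟨by simp only [Sf, Finset.mem_union]; exact Or.inl (hS i his), (hS2 _ (hS i his)).2⟩
    · have := hin (i-s) (by omega)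
      simpa only [hω2, th, show i - s + s = i by omega] using this
  have hL : ω2 (t+L) = ω2 t + (L:ℤ) • dr i₀ σ := by rw [add_comm t L]; exact h4 L (by omega)
  refine ⟨⟨fun i hi => ⟨hD fun k => ((hin' i hi).2 k).trans (by exact_mod_cast (by omega)), (hin' i hi).2⟩, ?_⟩, hL, ?_⟩
  · intro i hi j hj hl heq
    by_cases hj2 : j ≤ t + 2 * L + s
    · have e := h4 (j - s - t) (by omega)
      rw [show j - s - t + t = j - s by omega] at e
      have e' : ω j = ω2 t + ((j - s - t : ℕ):ℤ) • dr i₀ σ := by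
        rw [← e]; simp only [hω2, th]; congr 1; omega
      rw [← heq] at e'
      have e2 : ht i₀ σ x₀ (ω i) = ht i₀ σ x₀ (ω2 t) + ((j - s - t : ℕ):ℤ) := by rw [e', ht_up hσ]
      by_cases his : i < s
      · have := (hS2 _ (hS i his)).1
        omega
      by_cases hit : i < s + t
      · have e3 : ω2 (i - s) = ω i := by simp only [hω2, th]; congr 1; omega
        have hk : (1:ℝ) ≤ kk i₀ σ L M ε (ω2 t - ω2 (i-s)) := by
          refine le_trans ?_ (kk_nonneg i₀ σ L hM hε _).2.2.1
          refine le_trans ?_ (Finset.single_le_sum (fun k _ => dl_nonneg _) (Finset.mem_Ioc.2 ⟨(by omega : L < j - s - t), by omega⟩))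
          rw [e3, e']
          rw [show ω2 t - (ω2 t + ((j - s - t : ℕ):ℤ) • dr i₀ σ) + ((j - s - t : ℕ):ℤ) • dr i₀ σ = 0 by abel]
          simp [dl]
        have := Finset.single_le_sum (f := fun k => kk i₀ σ L M ε (ω2 t - ω2 k)) (fun k _ => (kk_nonneg i₀ σ L hM hε _).2.2.2)
          (Finset.mem_range.2 (by omega : i - s < t))
        linarith
      · have e4 := h4 (i - s - t) (by omega)
        have e5 : ω i = ω2 t + ((i - s - t : ℕ):ℤ) • dr i₀ σ := by
          rw [← e4]; simp only [hω2, th]; congr 1; omega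
        rw [e5, ht_up hσ] at e2
        omega
    · have := h5 (j - s - t - 2*L) (fun k hk => hl _ (by omega))
      apply this
      right
      simp only [hω2, th, show j - s - t - 2*L + 2*L + t + s = j by omega]
      rw [← heq]; exact (hin' i hi).1
  · have : ω (t+L+s) = ω2 t + (L:ℤ) • dr i₀ σ := hL
    rw [this, mem_cube_ht (i₀ := i₀) hσ x₀, hb2, ht_up hσ]
    refine ⟨by rw [abs_le]; constructor <;> omega, fun k hk => ?_⟩
    rw [up_ne hk]
    have := hb5 k hk; omega

lemma zp (hd : 5 ≤ d) {m : ℕ} (hm : 1 ≤ m) : (m:ℝ)^((4:ℤ)-(d:ℤ)) = m^2 / m^(d-2) := by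
  have hm0 : (1:ℝ) ≤ m := by exact_mod_cast hm
  rw [eq_div_iff (by positivity), ← zpow_natCast, ← zpow_natCast, ← zpow_add₀ (by positivity)]
  congr 1; push_cast [Nat.cast_sub (by omega : 2 ≤ d)]; ring

lemma cap_large (hd : 5 ≤ d) : ∀ (q0 L Tc : ℕ) (M ε c0 : ℝ), 1 ≤ q0 → L ≤ q0 → 0 < M → 0 < ε → 0 < c0 → ∃ c1 > 0,
    ∀ (P : V d → Measure (ℕ → V d)), (∀ x, IsSRWLaw (P x) x) → ∀ (D K : Set (V d)) (i₀ : Fin d) (σ : ℤ) (x₀ x2 : V d) (q m s : ℕ)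
    (S0 : Finset (V d)) (ω : ℕ → V d), σ * σ = 1 → q0 ≤ q → 64 * (d * q) ≤ m → m ≤ 256 * (d * q) → cube x₀ m ⊆ D → x2 ∈ cube x₀ (2*m) →
    (∀ i < s, ω i ∈ S0) → (∀ v ∈ S0, ht i₀ σ x₀ v ≤ q ∧ v ∈ cube x₀ (m-1)) →
    c0 * q^2 < ∑ t ∈ Finset.range (Tc * q^2), (Et D K i₀ σ x₀ m S0 L M ε t).indicator (fun _ => (1:ℝ)) (th s ω) →
    c1 * (m:ℝ)^((4:ℤ)-(d:ℤ)) ≤ pr P x2 {ω' | ∃ t, ω' t ∈ cube (x₀ + ((m/2:ℕ):ℤ) • dr i₀ σ) (m/4) ∧ ω' t ∈ cutS D x₀ m ω} := by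
  intro q0 L Tc M ε c0 hq0 hLq hM hε hc0
  obtain ⟨cl, hcl, HL⟩ := GLow (d := d) hd
  have hG0 := G_pos hd (0 : V d)
  have hd' : (5:ℝ) ≤ d := by exact_mod_cast hd
  refine ⟨c0 / (256*d)^2 / 2 * (cl / 4^(d-2)) / (2 * (2 * M + G (0 : V d))), by positivity, ?_⟩
  intro P hP D K i₀ σ x₀ x2 q m s S0 ω hσ hq hm1 hm2 hD hx2 hS hS2 hc
  have hdq : 5 * q ≤ d * q := Nat.mul_le_mul_right _ hd
  have hdet := fun t h => det_large (K := K) (t := t) hd hσ hM hε (hLq.trans hq) (by omega) hm1 hD hS hS2 h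
  set I := (Finset.range (Tc * q^2)).filter (fun t => th s ω ∈ Et D K i₀ σ x₀ m S0 L M ε t) with hI
  have hcard : c0 * q^2 < I.card := by
    refine lt_of_lt_of_le hc (le_of_eq ?_)
    simp [Set.indicator_apply, hI]
  have hIE : ∀ t ∈ I, th s ω ∈ Et D K i₀ σ x₀ m S0 L M ε t := fun t ht => (Finset.mem_filter.1 ht).2
  have hm0 : (1:ℝ) ≤ m := by exact_mod_cast (by omega : 1 ≤ m)
  have hne : ∀ t ∈ I, ∀ t' ∈ I, t < t' → ω (t+L+s) ≠ ω (t'+L+s) := fun t ht t' ht' h =>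
    (hdet t (hIE t ht)).1.2 _ le_rfl _ (by omega) fun l hl => ((hdet t' (hIE t' ht')).1.1 l hl.le).1
  have h := cap_times hd hP I (fun t => ω (t+L+s)) (fun t ht t' ht' he => ?_) hM.le (fun t ht => ?_) x2 (g := cl / (4*m)^(d-2)) (by positivity) (fun t ht => ?_)
  · have h2 : pr P x2 {ω' | ∃ n, ∃ t ∈ I, ω' n = ω (t+L+s)} ≤ pr P x2 {ω' | ∃ t, ω' t ∈ cube (x₀ + ((m/2:ℕ):ℤ) • dr i₀ σ) (m/4) ∧ ω' t ∈ cutS D x₀ m ω} := by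
      refine pr_mono hP x2 ?_
      rintro ω' ⟨n, t, ht, e⟩
      have := hdet t (hIE t ht)
      exact ⟨n, by rw [e]; exact this.2.2, by rw [e]; exact ⟨_, rfl, this.1⟩⟩
    set p := pr P x2 {ω' | ∃ t, ω' t ∈ cube (x₀ + ((m/2:ℕ):ℤ) • dr i₀ σ) (m/4) ∧ ω' t ∈ cutS D x₀ m ω}
    have hm' : (m:ℝ) ≤ 256 * d * q := by rw [mul_assoc]; exact_mod_cast hm2
    have h3 : c0 / (256*d)^2 * m^2 ≤ I.card := by
      refine le_trans ?_ hcard.le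
      rw [div_mul_eq_mul_div, div_le_iff₀ (by positivity)]
      calc c0 * (m:ℝ)^2 ≤ c0 * (256 * d * q)^2 := by gcongr
        _ = _ := by ring
    rw [zp hd (by omega), div_mul_eq_mul_div, div_le_iff₀ (by positivity)]
    calc c0 / (256*d)^2 / 2 * (cl / 4^(d-2)) * (m^2 / m^(d-2)) = (c0 / (256*d)^2 * m^2) / 2 * (cl / (4*m)^(d-2)) := by
          rw [mul_pow]; ring
      _ ≤ (I.card / 2 : ℝ) * (cl / (4*m)^(d-2)) := by gcongr
      _ ≤ _ := h
      _ ≤ _ := by rw [mul_comm]; gcongr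
  · rcases lt_trichotomy t t' with h | h | h
    · exact absurd he (hne t ht t' ht' h)
    · exact h
    · exact absurd he.symm (hne t' ht' t ht h)
  · have e1 := (hIE t ht).1.2.2
    have e2 : ∀ s' ∈ I, ω (t+L+s) - ω (s'+L+s) = th s ω t - th s ω s' := fun s' hs' => by
      rw [(hdet t (hIE t ht)).2.1, (hdet s' (hIE s' hs')).2.1]; simp only [th]; abel
    rw [Finset.sum_congr rfl fun s' hs' => by rw [e2 s' (Finset.mem_filter.1 hs').1]]
    have e3 : ∑ s' ∈ I with s' < t, M⁻¹ * G (th s ω t - th s ω s') ≤ 1 := by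
      refine le_trans ?_ e1.le
      refine le_trans (Finset.sum_le_sum_of_subset_of_nonneg (t := Finset.range t) (fun k hk => Finset.mem_range.2 (Finset.mem_filter.1 hk).2)
        fun k _ _ => by have := G_nonneg (th s ω t - th s ω k); positivity) (Finset.sum_le_sum fun k _ => (kk_nonneg i₀ σ L hM hε _).1)
    rw [← Finset.mul_sum, inv_mul_le_iff₀ hM] at e3
    linarith
  · rw [div_le_iff₀ (by positivity)]
    have := HL (4*m) (by omega) (x2 - ω (t+L+s)) fun i => ?_
    · push_cast at this; exact this
    · have a1 := hx2 i
      have a2 := ((hdet t (hIE t ht)).1.1 _ le_rfl).2 i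
      have : x2 i - ω (t+L+s) i = (x2 i - x₀ i) - (ω (t+L+s) i - x₀ i) := by ring
      rw [Pi.sub_apply, this]
      refine (abs_sub _ _).trans ?_
      push_cast at *; omega
end USFPaper

namespace USFPaper
variable {d : ℕ} {P : V d → Measure (ℕ → V d)}

lemma Ex_mono_on {B Cl : Set (V d)} {f g : V d → ℝ} (hB : ∀ x ∈ B, ∀ y, nb x y → y ∈ Cl) (h : ∀ x ∈ Cl, f x ≤ g x) (k : ℕ) {x : V d} (hx : x ∈ Cl) :
    Ex B f k x ≤ Ex B g k x := by
  induction k generalizing x with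
  | zero => exact h x hx
  | succ k ih =>
    rw [Ex, Ex]; split_ifs with hxB
    · exact avg_mono_nb fun y hy => ih (hB x hxB y hy)
    · exact h x hx

lemma Ex_smul (B : Set (V d)) (a : ℝ) (f : V d → ℝ) (k : ℕ) (x : V d) : Ex B (fun y => a * f y) k x = a * Ex B f k x := by
  induction k generalizing x with
  | zero => rfl
  | succ k ih =>
    rw [Ex, Ex]; split_ifs
    · rw [← avg_smul]; congr 1; funext y; exact ih y
    · rfl

lemma stage_meas (T : ℕ) {A B : Set (V d)} {Ev : ℕ → (ℕ → V d) → Set (ℕ → V d)} (hE : ∀ j γ, MeasurableSet (Ev j γ)) :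
    MeasurableSet {ω : ℕ → V d | ∃ j ≤ T, (∀ i < j, ω i ∈ B) ∧ ω j ∈ A ∧ th j ω ∈ Ev j (stp j ω)} := by
  have : {ω : ℕ → V d | ∃ j ≤ T, (∀ i < j, ω i ∈ B) ∧ ω j ∈ A ∧ th j ω ∈ Ev j (stp j ω)} =
      ⋃ j, {ω | stp j ω ∈ {γ | j ≤ T ∧ (∀ i < j, γ i ∈ B) ∧ γ j ∈ A} ∧ th j ω ∈ Ev j (stp j ω)} := by
    ext ω
    simp only [Set.mem_iUnion, Set.mem_ofPred_eq, stp, min_self]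
    refine exists_congr fun j => ?_
    have : (∀ i < j, ω (min i j) ∈ B) ↔ (∀ i < j, ω i ∈ B) :=
      forall₂_congr fun i hi => by rw [min_eq_left hi.le]
    rw [this]; tauto
  rw [this]; exact MeasurableSet.iUnion fun j => meas_mk _ _ (hE j)

lemma FB_cube (hd : 5 ≤ d) {i₀ : Fin d} {σ : ℤ} (hσ : σ * σ = 1) {x₀ y : V d} {q : ℕ} (h1 : |ht i₀ σ x₀ y| ≤ q) (h2 : lt2 i₀ x₀ y ≤ 72 * d * (q:ℝ)^2) :
    (∀ i ≠ i₀, |y i - x₀ i| ≤ 9 * (d * q : ℕ)) ∧ ∀ m : ℕ, 64 * (d * q) ≤ m → 1 ≤ q → y ∈ cube x₀ (m-1) := by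
  have hd' : (5:ℝ) ≤ d := by exact_mod_cast hd
  have h3 : ∀ i ≠ i₀, |y i - x₀ i| ≤ 9 * (d * q : ℕ) := fun i hi => by
    have h := (sq_le_lt2 hi x₀ y).trans h2
    have : |((y i - x₀ i : ℤ):ℝ)| ≤ 9 * (d * q) := by
      refine abs_le_of_sq_le_sq (h.trans ?_) (by positivity)
      have : (0:ℝ) ≤ d * q^2 := by positivity
      nlinarith
    exact_mod_cast this
  refine ⟨h3, fun m hm hq => ?_⟩
  have hdq : 5 * q ≤ d * q := Nat.mul_le_mul_right _ hd
  rw [mem_cube_ht (i₀ := i₀) hσ x₀, ht_self, sub_zero]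
  exact ⟨h1.trans (by exact_mod_cast (by omega)), fun i hi => (h3 i hi).trans (by exact_mod_cast (by omega))⟩

/-- one-step estimate -/
def OneS (d : ℕ) (p : ℕ → Prop) (c c1 C2 : ℝ) : Prop := ∀ (P : V d → Measure (ℕ → V d)), (∀ x, IsSRWLaw (P x) x) →
  ∀ (N n : ℕ) (D K : Set (V d)) (i₀ : Fin d) (σ : ℤ) (x₀ x2 : V d) (m : ℕ), n + m ≤ N → cube 0 (4*N) ⊆ D → K ⊆ cube 0 n → σ * σ = 1 →
  x₀ i₀ = σ * n → (∀ i, |x₀ i| ≤ n) → 4 ≤ m → p m → x2 ∈ cube x₀ (2*m) →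
  ∃ E : Set (ℕ → V d), MeasurableSet E ∧ (∀ ω ∈ E, ω 0 = x₀ → ω ∈ OK P D K (x₀ + ((m/2:ℕ):ℤ) • dr i₀ σ) x₀ m x2 c1 C2) ∧
    c * pr P x₀ (AVp D K) ≤ pr P x₀ E

lemma geo {N n m : ℕ} {D K : Set (V d)} {i₀ : Fin d} {σ : ℤ} {x₀ : V d} (hn : n + m ≤ N) (hD : cube 0 (4*N) ⊆ D) (hK' : K ⊆ cube 0 n) (hσ : σ * σ = 1)
    (hx0 : x₀ i₀ = σ * n) (hxn : ∀ i, |x₀ i| ≤ n) : cube x₀ m ⊆ D ∧ ∀ y ∈ K, ht i₀ σ x₀ y ≤ 0 := by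
  constructor
  · intro y hy
    refine hD fun i => ?_
    have h1 := hy i
    have h2 := hxn i
    rw [Pi.zero_apply, sub_zero]
    rw [abs_le] at *
    push_cast; omega
  · intro y hy
    have h1 := hK' hy i₀
    rw [Pi.zero_apply, sub_zero, abs_le] at h1
    unfold ht
    rw [hx0]
    rcases sig hσ with rfl | rfl <;> omega

lemma vis_split {D : Set (V d)} {x₀ : V d} {m s : ℕ} {ω : ℕ → V d} {S0 : Finset (V d)} (hS : ∀ i < s, ω i ∈ S0) :
    (Vis D x₀ m ω).ncard ≤ S0.card + (Vis D x₀ m (th s ω)).ncard := by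
  have h : Vis D x₀ m ω ⊆ (S0 : Set (V d)) ∪ Vis D x₀ m (th s ω) := by
    rintro v ⟨h1, t, h2, h3⟩
    by_cases hts : t < s
    · left; rw [← h3]; exact hS t hts
    · right
      exact ⟨h1, t - s, fun i hi => h2 _ (by omega), by simp only [th, show t - s + s = t by omega]; exact h3⟩
  have hf : (Vis D x₀ m (th s ω)).Finite := (cube_finite x₀ m).subset fun v hv => hv.1
  refine (Set.ncard_le_ncard h (S0.finite_toSet.union hf)).trans ((Set.ncard_union_le _ _).trans ?_)
  rw [Set.ncard_coe_finset]

set_option maxHeartbeats 800000 in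
lemma large (hd : 5 ≤ d) : ∃ (m0 : ℕ) (c c1 C2 : ℝ), 0 < c ∧ 0 < c1 ∧ 0 < C2 ∧ OneS d (fun m => m0 ≤ m) c c1 C2 := by
  obtain ⟨q0, L, Tc, M, ε, c0, c5, C3, C, hq0, hLq, hL1, hM, hε, hc0, hc5, hC3, hC, H⟩ := stage2 hd
  obtain ⟨c1, hc1, Hcap⟩ := cap_large hd q0 L Tc M ε c0 hq0 hLq hM hε hc0
  have hd' : (5:ℝ) ≤ d := by exact_mod_cast hd
  have hd0 : 0 < d := by omega
  refine ⟨256 * (d * q0), c5 / (C * (2 * d)), c1, C3 + 1, by positivity, hc1, by positivity, ?_⟩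
  intro P hP N n D K i₀ σ x₀ x2 m hn hD hK' hσ hx0 hxn hm4 hm0 hx2
  obtain ⟨hxD, hK0⟩ := geo hn hD hK' hσ hx0 hxn
  -- choice of scale
  obtain ⟨a, ha1, ha2⟩ : ∃ a : ℕ, 64 * (d * 4^a) ≤ m ∧ m < 256 * (d * 4^a) := by
    have h0 : m / (64 * d) ≠ 0 := by
      rw [Nat.div_ne_zero_iff]; refine ⟨by omega, ?_⟩
      nlinarith
    refine ⟨Nat.log 4 (m / (64*d)), ?_, ?_⟩
    · have := Nat.pow_log_le_self 4 h0
      rw [Nat.le_div_iff_mul_le (by omega)] at this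
      linarith
    · have := Nat.lt_pow_succ_log_self (b := 4) (by norm_num) (m / (64*d))
      rw [Nat.div_lt_iff_lt_mul (by omega), pow_succ] at this
      linarith
  set q := 4^a with hq
  have hq0q : q0 ≤ q := by
    have h1 : 256 * (d * q0) < 256 * (d * q) := by omega
    have h2 : d * q0 < d * q := by omega
    exact (Nat.lt_of_mul_lt_mul_left h2).le
  have hq1 : 1 ≤ q := by omega
  have hq' : (1:ℝ) ≤ q := by exact_mod_cast hq1
  have hdq : 5 * q ≤ d * q := Nat.mul_le_mul_right _ hd
  obtain ⟨hup, Hz⟩ := H P hP N n D K i₀ σ x₀ (by omega) (by omega) hD hK' hσ hx0 hxn hK0 q m hq0q ha1 ha2.le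
  set α := hK P D K (x₀ + (q:ℤ) • dr i₀ σ) with hα
  have hα0 : 0 ≤ α := pr_nonneg _ _
  set B := FB i₀ σ x₀ q \ K with hB
  set Cl : Set (V d) := {y | |ht i₀ σ x₀ y| ≤ q ∧ lt2 i₀ x₀ y ≤ 72 * d * (q:ℝ)^2} with hCl
  set A : Set (V d) := {y | ht i₀ σ x₀ y = q ∧ ∀ i ≠ i₀, |y i - x₀ i| ≤ 9 * (d * q : ℕ)} with hA
  set T := 128 * d * q^2 with hT
  have hx0B : x₀ ∈ FB i₀ σ x₀ q := by
    refine ⟨by rw [ht_self]; simp; omega, ?_⟩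
    simp [lt2, nsq]; positivity
  have hBCl : ∀ x ∈ B, ∀ y, nb x y → y ∈ Cl := fun x hx y hy => FB_nb hd hq1 hσ hx.1 hy
  have hClc : ∀ y ∈ Cl, y ∈ cube x₀ (m-1) := fun y hy => (FB_cube hd hσ hy.1 hy.2).2 m ha1 hq1
  have hFBCl : ∀ y ∈ FB i₀ σ x₀ q, y ∈ Cl := fun y hy => ⟨hy.1.le, hy.2.le.trans (by gcongr; norm_num)⟩
  have cm : ∀ y ∈ cube x₀ (m-1), y ∈ cube x₀ m := fun y hy i => (hy i).trans (by exact_mod_cast (by omega))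
  let S0 : ℕ → (ℕ → V d) → Finset (V d) := fun j γ => insert x₀ ((Finset.range j).image γ)
  let Ev : ℕ → (ℕ → V d) → Set (ℕ → V d) := fun j γ => {ω | ω ∈ AV D K ∧
      c0 * q^2 < ∑ t ∈ Finset.range (Tc * q^2), (Et D K i₀ σ x₀ m (S0 j γ) L M ε t).indicator (fun _ => (1:ℝ)) ω} \ VisB D K x₀ m (C3 * m^2)
  have hEv : ∀ j γ, MeasurableSet (Ev j γ) := by
    intro j γ
    have h1 : MeasurableSet {ω : ℕ → V d | c0 * q^2 < ∑ t ∈ Finset.range (Tc * q^2), (Et D K i₀ σ x₀ m (S0 j γ) L M ε t).indicator (fun _ => (1:ℝ)) ω} :=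
      measurableSet_lt measurable_const (Finset.measurable_sum _ fun t _ => measurable_const.indicator (Et_meas _ _ _ _ _ _ _ _ _ _ _))
    exact ((AV_meas D K).inter h1).diff (VisB_meas _ _ _ _ _)
  have hS0 : ∀ j ≤ T, ∀ γ : ℕ → V d, (∀ i < j, γ i ∈ B) → (S0 j γ).card ≤ 200 * (d * q^2) ∧
      ∀ v ∈ S0 j γ, ht i₀ σ x₀ v ≤ q ∧ v ∈ cube x₀ (m-1) := by
    intro j hj γ hγ
    constructor
    · refine (Finset.card_insert_le _ _).trans ?_
      have := Finset.card_image_le (s := Finset.range j) (f := γ)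
      rw [Finset.card_range] at this
      have h2 : 1 ≤ d * q^2 := Nat.one_le_iff_ne_zero.2 (by positivity)
      have h3 : T = 128 * (d * q^2) := by rw [hT, mul_assoc]
      omega
    · intro v hv
      have hvF : v ∈ FB i₀ σ x₀ q := by
        rcases Finset.mem_insert.1 hv with rfl | hv
        · exact hx0B
        · obtain ⟨i, hi, rfl⟩ := Finset.mem_image.1 hv
          exact (hγ i (Finset.mem_range.1 hi)).1
      exact ⟨(le_abs_self _).trans hvF.1.le, hClc v (hFBCl v hvF)⟩
  let Es : Set (ℕ → V d) := {ω | ∃ j ≤ T, (∀ i < j, ω i ∈ B) ∧ ω j ∈ A ∧ th j ω ∈ Ev j (stp j ω)}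
  have hst : ∀ y, c5 * α * Ex B (ind A) T y ≤ pr P y Es := fun y =>
    stage hd0 hP T y hEv fun j hj γ hγ hγj =>
      Hz (S0 j γ) (hS0 j hj γ hγ).1 (fun v hv => ⟨((hS0 j hj γ hγ).2 v hv).1, cm v ((hS0 j hj γ hγ).2 v hv).2⟩) _ hγj.1 hγj.2
  refine ⟨th 1 ⁻¹' Es, th_meas 1 (stage_meas T hEv), ?_, ?_⟩
  · -- deterministic part
    rintro ω ⟨j, hjT, h1, h2, ⟨h3, h4⟩, h5⟩ h0
    have hSeq : S0 j (stp j (th 1 ω)) = S0 j (th 1 ω) := by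
      have : (Finset.range j).image (stp j (th 1 ω)) = (Finset.range j).image (th 1 ω) :=
        Finset.image_congr fun i hi => by
          have : i < j := by simpa using hi
          simp [stp, this.le]
      simp only [S0, this]
    rw [hSeq, th_th] at h4
    rw [th_th] at h3 h5
    obtain ⟨hc1, hc2⟩ := hS0 j hjT (th 1 ω) h1
    have hS : ∀ i < j + 1, ω i ∈ S0 j (th 1 ω) := by
      intro i hi
      rcases i with _ | i
      · simp [S0, h0]
      · exact Finset.mem_insert_of_mem (Finset.mem_image.2 ⟨i, Finset.mem_range.2 (by omega), rfl⟩)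
    refine ⟨?_, Hcap P hP D K i₀ σ x₀ x2 q m (j+1) (S0 j (th 1 ω)) ω hσ hq0q ha1 ha2.le hxD hx2 hS hc2 h4, ?_⟩
    · intro l hl hlD
      by_cases hlj : l < j + 1
      · have := (h1 (l-1) (by omega)).2
        simpa only [th, show l - 1 + 1 = l by omega] using this
      · have := h3 (l - (j+1)) (fun i hi => hlD _ (by omega))
        simpa only [th, show l - (j+1) + (j+1) = l by omega] using this
    · have e1 := vis_split (D := D) (x₀ := x₀) (m := m) hS
      have e2 := VisB_card h3 h5
      have e3 : ((Vis D x₀ m ω).ncard : ℝ) ≤ 200 * (d * q^2) + C3 * m^2 := by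
        refine le_trans (by exact_mod_cast e1) (le_trans (Nat.cast_add _ _).le ?_)
        have : ((S0 j (th 1 ω)).card : ℝ) ≤ 200 * (d * q^2) := by exact_mod_cast hc1
        linarith
      have e4 : 64 * ((d:ℝ) * q) ≤ m := by exact_mod_cast ha1
      have e5 : (64 * ((d:ℝ) * q))^2 ≤ (m:ℝ)^2 := by gcongr
      have e6 : (d:ℝ) * q^2 ≤ (d * q)^2 := by
        have : (0:ℝ) ≤ d * q^2 := by positivity
        nlinarith
      nlinarith
  · rw [avp_eq hd0 hP (hxD fun i => by simp)]
    have hnb : ∀ y, nb x₀ y → y ∈ Cl := fun y hy => FB_nb hd hq1 hσ hx0B hy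
    have hBD : ∀ x ∈ B, x ∈ D := fun x hx => hxD (cm x (hClc x (hFBCl x hx.1)))
    have k1 : avg (hK P D K) x₀ ≤ C * α * avg (su i₀ σ x₀ K q T) x₀ := by
      rw [← avg_smul]
      refine avg_mono_nb fun y hy => ?_
      have := Ex_mono_t (B := B) (f := hK P D K) (fun x hx => (hK_in hd0 hP (hBD x hx) hx.2).le) y (Nat.zero_le T)
      refine le_trans this ?_
      rw [su, ← Ex_smul]
      refine Ex_mono_on hBCl (fun x hx => ?_) T (hnb y hy)
      by_cases hxK : x ∈ K
      · rw [hK_zero hP hxK, ind_neg (by simpa using hxK)]; simp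
      · rw [ind_pos (by simpa using hxK), mul_one]; exact hup x (cm x (hClc x hx))
    have k2 := lemA (x₀ := x₀) (i₀ := i₀) hd hσ hK0 a
    rw [← hq, ← hT] at k2
    have k3 : avg (hv i₀ σ x₀ K q T) x₀ ≤ avg (Ex B (ind A) T) x₀ := by
      refine avg_mono_nb fun y hy => Ex_mono_on hBCl (fun x hx => ?_) T (hnb y hy)
      by_cases h : ht i₀ σ x₀ x = q
      · have hxA : x ∈ A := ⟨h, (FB_cube hd hσ hx.1 hx.2).1⟩
        rw [ind_pos hxA]; exact ind_le_one _ _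
      · rw [ind_neg h]; exact ind_nonneg _ _
    rw [M1 hd0 hP x₀ (th_meas 1 (stage_meas T hEv))]
    have k4 : c5 * α * avg (Ex B (ind A) T) x₀ ≤ avg (fun y => pr P y (cons x₀ ⁻¹' (th 1 ⁻¹' Es))) x₀ := by
      rw [← avg_smul]
      exact avg_mono' (fun y => hst y) x₀
    refine le_trans ?_ k4
    rw [div_mul_eq_mul_div, div_le_iff₀ (by positivity)]
    calc c5 * avg (hK P D K) x₀ ≤ c5 * (C * α * (2 * d * avg (Ex B (ind A) T) x₀)) := by
          refine mul_le_mul_of_nonneg_left (k1.trans (mul_le_mul_of_nonneg_left (k2.trans ?_) (by positivity))) hc5.le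
          exact mul_le_mul_of_nonneg_left k3 (by positivity)
      _ = _ := by ring
end USFPaper

namespace USFPaper
variable {d : ℕ} {P : V d → Measure (ℕ → V d)}

lemma small (hd : 5 ≤ d) (m0 : ℕ) : ∃ (c c1 C2 : ℝ), 0 < c ∧ 0 < c1 ∧ 0 < C2 ∧ OneS d (fun m => m < m0) c c1 C2 := by
  by_cases hm00 : m0 = 0
  · exact ⟨1, 1, 1, one_pos, one_pos, one_pos, fun P hP N n D K i₀ σ x₀ x2 m hn hD hK' hσ hx0 hxn hm4 hm => by omega⟩
  obtain ⟨CC, HC⟩ := hK_HH hd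
  obtain ⟨C, hC, Hcar⟩ := car hd CC 1
  obtain ⟨CU, hCU, hU⟩ := GU (d := d) hd
  obtain ⟨Cv, hCv, HV⟩ := VisB_le hd
  obtain ⟨cl, hcl, HL⟩ := GLow (d := d) hd
  have hG0 := G_pos hd (0 : V d)
  have hd' : (5:ℝ) ≤ d := by exact_mod_cast hd
  have hd0 : 0 < d := by omega
  obtain ⟨h, hh⟩ := exists_nat_ge (m0 * CU * (2 * C) + 1)
  have hm0' : (1:ℝ) ≤ m0 := by exact_mod_cast Nat.one_le_iff_ne_zero.2 hm00
  have hh1 : (1:ℝ) ≤ h := by have : 0 ≤ m0 * CU * (2 * C) := by positivity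
                             linarith
  have hh1' : 1 ≤ h := by exact_mod_cast hh1
  set H := m0 + h with hH
  refine ⟨(2 * (d:ℝ))⁻¹ ^ H / (4 * C), cl / (4 * G (0 : V d) * 4^(d-2) * m0^2), H + 1 + 4 * Cv * C, by positivity, by positivity, by positivity, ?_⟩
  intro P hP N n D K i₀ σ x₀ x2 m hn hD hK' hσ hx0 hxn hm4 hm hx2
  obtain ⟨hxD, hK0⟩ := geo hn hD hK' hσ hx0 hxn
  have hhK := HC P hP N n D K (by omega) (by omega) hD hK'
  set w := x₀ + (H:ℤ) • dr i₀ σ with hw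
  have hln : ∀ i r : ℕ, i ≤ r → x₀ + (i:ℤ) • dr i₀ σ ∈ cube x₀ r := by
    intro i r hi
    rw [mem_cube_ht (i₀ := i₀) hσ x₀, ht_up hσ, ht_self]
    exact ⟨by rw [abs_le]; constructor <;> omega, fun k hk => by rw [up_ne hk]; simp⟩
  have hup : ∀ y ∈ cube x₀ H, hK P D K y ≤ C * hK P D K w := fun y hy =>
    Hcar N n _ hhK H i₀ σ x₀ (by omega) hσ hx0 hxn y (by rwa [one_mul]) w (by rw [one_mul]; exact hln H H le_rfl) (by rw [hw, ht_up hσ, ht_self]; simp)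
  have hw0 : 0 ≤ hK P D K w := pr_nonneg _ _
  have hm1 : (1:ℝ) ≤ m := by exact_mod_cast (by omega : 1 ≤ m)
  set S : Finset (V d) := (Finset.range (m/2+1)).image (fun i : ℕ => x₀ + (i:ℤ) • dr i₀ σ) with hS
  have cmono : ∀ y, y ∈ cube x₀ m → y ∈ cube x₀ H := fun y hy i => (hy i).trans (by exact_mod_cast (by omega))
  have f1 : hK P D K w / 2 ≤ pr P w (AV D (K ∪ S)) := by
    refine le_trans ?_ (avoid hd hP D K S w)
    have : ∑ v ∈ S, G (w - v) * hK P D K v ≤ ∑ i ∈ Finset.range (m/2+1), CU / (h:ℝ)^3 * (C * hK P D K w) := by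
      refine (Finset.sum_image_le_of_nonneg (fun v _ => mul_nonneg (G_nonneg _) (pr_nonneg _ _))).trans ?_
      refine Finset.sum_le_sum fun i hi => ?_
      have hi := Finset.mem_range.1 hi
      have g1 := hU h hh1' (w - (x₀ + (i:ℤ) • dr i₀ σ)) i₀ (by
        rw [Pi.sub_apply, ← ht_diff hσ x₀, hw, ht_up hσ, ht_up hσ]
        refine le_trans ?_ (le_abs_self _); push_cast; omega)
      refine mul_le_mul ?_ (hup _ (hln i H (by omega))) (pr_nonneg _ _) (by positivity)
      rw [le_div_iff₀ (by positivity)]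
      refine le_trans ?_ g1
      have := G_nonneg (w - (x₀ + (i:ℤ) • dr i₀ σ))
      gcongr
      omega
    rw [Finset.sum_const, Finset.card_range, nsmul_eq_mul] at this
    have g2 : ((m/2+1:ℕ):ℝ) * (CU / (h:ℝ)^3 * (C * hK P D K w)) ≤ hK P D K w / 2 := by
      have a1 : ((m/2+1:ℕ):ℝ) ≤ m0 := by exact_mod_cast (by omega)
      have a2 : (h:ℝ) ≤ h^3 := le_self_pow₀ hh1 (by norm_num)
      have a3 : m0 * CU * (2 * C) / h^3 ≤ 1 := by rw [div_le_one (by positivity)]; linarith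
      calc ((m/2+1:ℕ):ℝ) * (CU / (h:ℝ)^3 * (C * hK P D K w)) ≤ m0 * (CU / (h:ℝ)^3 * (C * hK P D K w)) := by gcongr
        _ = (m0 * CU * (2 * C) / h^3) * (hK P D K w / 2) := by ring
        _ ≤ 1 * (hK P D K w / 2) := by gcongr
        _ = _ := one_mul _
    linarith
  have f2 : pr P w (VisB D K x₀ m (4 * Cv * C * m^2)) ≤ hK P D K w / 4 := by
    have g := HV P hP D K x₀ m (4 * Cv * C * m^2) (C * hK P D K w) w (by omega) (by positivity) fun y hy => hup y (cmono y hy)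
    refine le_of_mul_le_mul_left (le_trans g (le_of_eq ?_)) (by positivity : (0:ℝ) < 4 * Cv * C * m^2)
    ring
  have f3 : pr P w (AV D (K ∪ S)) ≤ pr P w (AV D (K ∪ S) \ VisB D K x₀ m (4 * Cv * C * m^2)) + pr P w (VisB D K x₀ m (4 * Cv * C * m^2)) := by
    have := (hP w).1
    refine le_trans (pr_mono hP w ?_) (measureReal_union_le _ _)
    intro ω hω; by_cases h : ω ∈ VisB D K x₀ m (4 * Cv * C * m^2)
    · exact Or.inr h
    · exact Or.inl ⟨hω, h⟩
  have hEm : MeasurableSet (AV D (K ∪ S) \ VisB D K x₀ m (4 * Cv * C * m^2)) := (AV_meas _ _).diff (VisB_meas _ _ _ _ _)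
  refine ⟨{ω | (∀ i ≤ H, ω i = x₀ + (i:ℤ) • dr i₀ σ) ∧ th H ω ∈ AV D (K ∪ S) \ VisB D K x₀ m (4 * Cv * C * m^2)}, ?_, ?_, ?_⟩
  · refine MeasurableSet.inter (meas_loc' H (A := {ω : ℕ → V d | ∀ i ≤ H, ω i = x₀ + (i:ℤ) • dr i₀ σ}) ?_) (th_meas _ hEm)
    intro ω ω' h h1 i hi
    rw [← h i hi]; exact h1 i hi
  · rintro ω ⟨h1, h2, h3⟩ h0
    have h2K : th H ω ∈ AV D K := fun j hj hjK => h2 j hj (Or.inl hjK)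
    have hcut : cutP D x₀ m ω (m/2) := by
      refine ⟨fun i hi => ?_, fun i hi j hj hl heq => ?_⟩
      · rw [h1 i (by omega)]; exact ⟨hxD (hln i m (by omega)), hln i (m-1) (by omega)⟩
      · rw [h1 i (by omega)] at heq
        by_cases hjH : j ≤ H
        · rw [h1 j hjH] at heq
          have := congrArg (ht i₀ σ x₀) heq
          rw [ht_up hσ, ht_up hσ] at this; omega
        · apply h2 (j - H) (fun l hl' => hl _ (by omega))
          right
          simp only [th, show j - H + H = j by omega]
          rw [← heq]
          exact Finset.mem_coe.2 (Finset.mem_image.2 ⟨i, Finset.mem_range.2 (by omega), rfl⟩)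
    refine ⟨?_, ?_, ?_⟩
    · intro j hj hjD hjK
      by_cases hjH : j ≤ H
      · have := hK0 _ hjK
        rw [h1 j hjH, ht_up hσ, ht_self] at this; omega
      · apply h2K (j - H) (fun l hl => hjD _ (by omega))
        simpa only [th, show j - H + H = j by omega] using hjK
    · have hcap := cap_times hd hP {0} (fun _ => ω (m/2)) (by simp) le_rfl (by intro t ht; simp [Finset.filter_singleton, Finset.mem_singleton.1 ht]) x2 (g := cl / (4*m)^(d-2)) (by positivity) (fun t _ => by
        rw [div_le_iff₀ (by positivity)]
        have := HL (4*m) (by omega) (x2 - ω (m/2)) fun i => by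
          have a1 := hx2 i
          have a2 := (hcut.1 _ le_rfl).2 i
          have : x2 i - ω (m/2) i = (x2 i - x₀ i) - (ω (m/2) i - x₀ i) := by ring
          rw [Pi.sub_apply, this]
          refine (abs_sub _ _).trans ?_
          push_cast at *; omega
        push_cast at this; exact this)
      have h2 : pr P x2 {ω' | ∃ n, ∃ t ∈ ({0}:Finset ℕ), ω' n = ω (m/2)} ≤ pr P x2 {ω' | ∃ t, ω' t ∈ cube (x₀ + ((m/2:ℕ):ℤ) • dr i₀ σ) (m/4) ∧ ω' t ∈ cutS D x₀ m ω} := by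
        refine pr_mono hP x2 ?_
        rintro ω' ⟨n, t, ht, e⟩
        exact ⟨n, by rw [e, h1 _ (by omega)]; intro i; simp; positivity, by rw [e]; exact ⟨_, rfl, hcut⟩⟩
      set p := pr P x2 {ω' | ∃ t, ω' t ∈ cube (x₀ + ((m/2:ℕ):ℤ) • dr i₀ σ) (m/4) ∧ ω' t ∈ cutS D x₀ m ω}
      rw [zp hd (by omega), div_mul_eq_mul_div, div_le_iff₀ (by positivity)]
      have hmm : (m:ℝ) ≤ m0 := by exact_mod_cast hm.le
      have hcap' : cl / (4*m)^(d-2) ≤ 4 * G (0 : V d) * p := by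
        have := mul_le_mul_of_nonneg_left h2 (by positivity : 0 ≤ 2 * (2 * 0 + G (0 : V d)))
        simp only [Finset.card_singleton, Nat.cast_one] at hcap
        linarith
      calc cl * ((m:ℝ)^2 / m^(d-2)) ≤ cl * ((m0:ℝ)^2 / m^(d-2)) := by gcongr
        _ = (cl / (4*m)^(d-2)) * (4^(d-2) * m0^2) := by rw [mul_pow]; field_simp
        _ ≤ (4 * G (0 : V d) * p) * (4^(d-2) * m0^2) := by gcongr
        _ = _ := by ring
    · have e1 := vis_split (D := D) (x₀ := x₀) (m := m) (s := H) (S0 := (Finset.range H).image ω) (fun i hi => Finset.mem_image.2 ⟨i, Finset.mem_range.2 hi, rfl⟩)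
      have e2 := VisB_card h2K h3
      have e4 := Finset.card_image_le (s := Finset.range H) (f := ω)
      rw [Finset.card_range] at e4
      have e3 : ((Vis D x₀ m ω).ncard : ℝ) ≤ H + 4 * Cv * C * m^2 := by
        refine le_trans (by exact_mod_cast e1) (le_trans (Nat.cast_add _ _).le ?_)
        have : (((Finset.range H).image ω).card : ℝ) ≤ H := by exact_mod_cast e4
        linarith
      have e5 : (1:ℝ) ≤ m^2 := one_le_pow₀ hm1
      have e6 : (0:ℝ) ≤ H := by positivity
      nlinarith
  · rw [avp_eq hd0 hP (hxD fun i => by simp)]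
    refine le_trans ?_ (line_fut hd0 hP hσ H x₀ hEm)
    have k1 : avg (hK P D K) x₀ ≤ C * hK P D K w := by
      rw [← avg_const hd0 (C * hK P D K w) x₀]
      refine avg_mono_nb fun y hy => hup y fun i => ?_
      have := nb_cube hy (z := x₀) (r := 0) (by intro i; simp) i
      exact this.trans (by exact_mod_cast (by omega))
    have k2 : hK P D K w / 4 ≤ pr P w (AV D (K ∪ S) \ VisB D K x₀ m (4 * Cv * C * m^2)) := by linarith
    calc (2 * (d:ℝ))⁻¹ ^ H / (4 * C) * avg (hK P D K) x₀ ≤ (2 * (d:ℝ))⁻¹ ^ H / (4 * C) * (C * hK P D K w) := by gcongr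
      _ = (2 * (d:ℝ))⁻¹ ^ H * (hK P D K w / 4) := by field_simp
      _ ≤ _ := by gcongr

lemma oneS (hd : 5 ≤ d) : ∃ (c c1 C2 : ℝ), 0 < c ∧ 0 < c1 ∧ 0 < C2 ∧ OneS d (fun _ => True) c c1 C2 := by
  obtain ⟨m0, c, c1, C2, hc, hc1, hC2, h⟩ := large hd
  obtain ⟨c', c1', C2', hc', hc1', hC2', h'⟩ := small hd m0
  refine ⟨min c c', min c1 c1', max C2 C2', by positivity, by positivity, by positivity, ?_⟩
  intro P hP N n D K i₀ σ x₀ x2 m hn hD hK' hσ hx0 hxn hm4 _ hx2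
  by_cases hm : m0 ≤ m
  · obtain ⟨E, h1, h2, h3⟩ := h P hP N n D K i₀ σ x₀ x2 m hn hD hK' hσ hx0 hxn hm4 hm hx2
    refine ⟨E, h1, fun ω hω h0 => ?_, le_trans (mul_le_mul_of_nonneg_right (min_le_left _ _) (pr_nonneg _ _)) h3⟩
    obtain ⟨a, b, e⟩ := h2 ω hω h0
    exact ⟨a, le_trans (mul_le_mul_of_nonneg_right (min_le_left _ _) (by positivity)) b, e.trans (by gcongr; exact le_max_left _ _)⟩
  · obtain ⟨E, h1, h2, h3⟩ := h' P hP N n D K i₀ σ x₀ x2 m hn hD hK' hσ hx0 hxn hm4 (not_le.1 hm) hx2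
    refine ⟨E, h1, fun ω hω h0 => ?_, le_trans (mul_le_mul_of_nonneg_right (min_le_right _ _) (pr_nonneg _ _)) h3⟩
    obtain ⟨a, b, e⟩ := h2 ω hω h0
    exact ⟨a, le_trans (mul_le_mul_of_nonneg_right (min_le_right _ _) (by positivity)) b, e.trans (by gcongr; exact le_max_right _ _)⟩
end USFPaper

namespace USFPaper
variable {d : ℕ}

/-- nice paths -/
def nice : Set (ℕ → V d) := {ω | ω 0 = 0 ∧ (∀ i, adj (ω i) (ω (i+1))) ∧ ∀ j, ∃ T, ∀ s ≥ T, ω s ≠ ω j}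

lemma stop_eq {D : Set (V d)} {ω : ℕ → V d} {s : ℕ} (h : ∀ l < s, ω l ∈ D) : stopAt D ω s = ω s := by
  unfold stopAt; rw [if_pos ((le_exit D ω s).2 h)]

lemma stop_iff {D : Set (V d)} {ω : ℕ → V d} {s : ℕ} {v : V d} (hv : v ∈ D) :
    stopAt D ω s = v ↔ (∀ l ≤ s, ω l ∈ D) ∧ ω s = v := by
  constructor
  · intro h
    by_cases h1 : ∀ l < s, ω l ∈ D
    · rw [stop_eq h1] at h
      refine ⟨fun l hl => ?_, h⟩
      rcases hl.lt_or_eq with h2 | h2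
      · exact h1 l h2
      · rw [h2, h]; exact hv
    · exfalso
      unfold stopAt at h; rw [if_neg (by rw [le_exit]; exact h1)] at h
      push Not at h1
      obtain ⟨l, _, hl⟩ := h1
      have h3 : ∃ j, ω j ∉ D := ⟨l, hl⟩
      have h4 : exitTime D ω = Nat.find h3 := by unfold exitTime exitTimeE; rw [dif_pos h3]; rfl
      rw [h4] at h
      exact Nat.find_spec h3 (h ▸ hv)
  · rintro ⟨h, h2⟩
    rw [stop_eq fun l hl => h l hl.le, h2]

lemma lv_eq {W : ℕ → V d} {u s : ℕ} (h1 : u ≤ s) (h2 : W s = W u) (h3 : ∀ r > s, W r ≠ W u) : lastVisit W u = s := by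
  unfold lastVisit
  apply le_antisymm
  · refine csSup_le ⟨u, le_rfl, rfl⟩ fun r hr => ?_
    by_contra h; push Not at h; exact h3 r h hr.2
  · refine le_csSup ⟨s, fun r hr => ?_⟩ ⟨h1, h2⟩
    by_contra h; push Not at h; exact h3 r h hr.2

lemma lv_spec {D : Set (V d)} {ω : ℕ → V d} (hω : ω ∈ nice) {u : ℕ} (hu : stopAt D ω u ∈ D) :
    u ≤ lastVisit (stopAt D ω) u ∧ stopAt D ω (lastVisit (stopAt D ω) u) = stopAt D ω u ∧
      ∀ r > lastVisit (stopAt D ω) u, stopAt D ω r ≠ stopAt D ω u := by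
  have h0 := (stop_iff hu).1 rfl
  obtain ⟨T, hT⟩ := hω.2.2 u
  have hb : ∀ r, stopAt D ω r = stopAt D ω u → r ≤ T := fun r hr => by
    by_contra h; push Not at h
    have := (stop_iff hu).1 hr
    exact hT r h.le (by rw [this.2, h0.2])
  have hbd : BddAbove {j | u ≤ j ∧ stopAt D ω j = stopAt D ω u} := ⟨T, fun r hr => hb r hr.2⟩
  have hm := Nat.sSup_mem (s := {j | u ≤ j ∧ stopAt D ω j = stopAt D ω u}) ⟨u, le_rfl, rfl⟩ hbd
  refine ⟨hm.1, hm.2, fun r hr h => ?_⟩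
  have h5 : u ≤ lastVisit (stopAt D ω) u := hm.1
  have : r ≤ lastVisit (stopAt D ω) u := le_csSup hbd ⟨by omega, h⟩
  omega

/-- loop erasure times -/
noncomputable abbrev rh (D : Set (V d)) (ω : ℕ → V d) (i : ℕ) : ℕ := leTime (stopAt D ω) i
noncomputable def uu (D : Set (V d)) (ω : ℕ → V d) (i : ℕ) : ℕ := match i with | 0 => 0 | i+1 => rh D ω i + 1

lemma rh_eq (D : Set (V d)) (ω : ℕ → V d) (i : ℕ) : rh D ω i = lastVisit (stopAt D ω) (uu D ω i) := by
  cases i <;> rfl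

/-- the loop erasure is inside D up to index a -/
def okk (D : Set (V d)) (ω : ℕ → V d) (a : ℕ) : Prop := ∀ i ≤ a, stopAt D ω (uu D ω i) ∈ D


lemma rh_spec {D : Set (V d)} {ω : ℕ → V d} (hω : ω ∈ nice) {a : ℕ} (h : okk D ω a) {i : ℕ} (hi : i ≤ a) : uu D ω i ≤ rh D ω i ∧ lerw D ω i = stopAt D ω (uu D ω i) ∧
    lerw D ω i ∈ D ∧ (∀ l ≤ rh D ω i, ω l ∈ D) ∧ ω (rh D ω i) = lerw D ω i ∧ ∀ r > rh D ω i, stopAt D ω r ≠ lerw D ω i := by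
  have h1 := lv_spec hω (h i hi)
  rw [← rh_eq] at h1
  have h2 : lerw D ω i = stopAt D ω (uu D ω i) := h1.2.1
  have h3 : lerw D ω i ∈ D := h2 ▸ h i hi
  have h4 := (stop_iff (ω := ω) (s := rh D ω i) h3).1 rfl
  exact ⟨h1.1, h2, h3, h4.1, h4.2, h2 ▸ h1.2.2⟩

lemma rh_lt {D : Set (V d)} {ω : ℕ → V d} (hω : ω ∈ nice) {a : ℕ} (h : okk D ω a) {i j : ℕ} (hj : j ≤ a) (hij : i < j) : rh D ω i < rh D ω j := by
  induction j with
  | zero => omega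
  | succ j ih =>
    have h1 := (rh_spec hω h hj).1
    have h2 : uu D ω (j+1) = rh D ω j + 1 := rfl
    rcases (Nat.lt_succ_iff.1 hij).lt_or_eq with h3 | h3
    · have := ih (by omega) h3; omega
    · subst h3; omega

lemma rh_ge {D : Set (V d)} {ω : ℕ → V d} (hω : ω ∈ nice) {a : ℕ} (h : okk D ω a) {i j : ℕ} (hj : i + j ≤ a) : rh D ω i + j ≤ rh D ω (i + j) := by
  induction j with
  | zero => simp
  | succ j ih =>
    have := ih (by omega)
    have := rh_lt hω h (i := i + j) (j := i + (j+1)) hj (by omega)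
    omega

lemma ler_inj {D : Set (V d)} {ω : ℕ → V d} (hω : ω ∈ nice) {a : ℕ} (h : okk D ω a) {i j : ℕ} (hj : j ≤ a) (hij : i < j) : lerw D ω i ≠ lerw D ω j := by
  intro he
  have h1 := rh_spec hω h (i := i) (by omega)
  have h2 := rh_spec hω h hj
  refine h1.2.2.2.2.2 (rh D ω j) (rh_lt hω h hj hij) ?_
  rw [he]; exact (stop_iff h2.2.2.1).2 ⟨h2.2.2.2.1, h2.2.2.2.2.1⟩

lemma ler_step {D : Set (V d)} {ω : ℕ → V d} (hω : ω ∈ nice) {a : ℕ} (h : okk D ω a) : adj (lerw D ω a) (stopAt D ω (uu D ω (a+1))) := by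
  have h1 := rh_spec hω h le_rfl
  have h2 : uu D ω (a+1) = rh D ω a + 1 := rfl
  rw [h2, stop_eq fun l hl => h1.2.2.2.1 l (by omega), ← h1.2.2.2.2.1]
  exact hω.2.1 _

lemma ler_stay {D : Set (V d)} {ω : ℕ → V d} (hω : ω ∈ nice) {a r : ℕ} {z : V d} (h : okk D ω a) (hz : cube z r ⊆ D) (ha : lerw D ω a ∈ cube z r) {k : ℕ} (hk : a ≤ k)
    (hn : ∀ i, a ≤ i → i < k → lerw D ω i ∉ innerBdry (cube z r)) :
    okk D ω k ∧ ∀ i, a ≤ i → i ≤ k → lerw D ω i ∈ cube z r := by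
  induction k, hk using Nat.le_induction with
  | base => exact ⟨h, fun i h1 h2 => by rw [le_antisymm h2 h1]; exact ha⟩
  | succ k hk ih =>
    obtain ⟨h1, h2⟩ := ih fun i h3 h4 => hn i h3 (by omega)
    have h3 := ler_step hω h1
    have h4 : stopAt D ω (uu D ω (k+1)) ∈ cube z r := by
      by_contra hc
      exact hn k hk (by omega) ⟨h2 k hk le_rfl, _, h3, hc⟩
    have h5 : okk D ω (k+1) := fun i hi => by
      rcases hi.lt_or_eq with h6 | h6
      · exact h1 i (by omega)
      · rw [h6]; exact hz h4
    refine ⟨h5, fun i h6 h7 => ?_⟩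
    rcases h7.lt_or_eq with h8 | h8
    · exact h2 i h6 (by omega)
    · rw [h8, (rh_spec hω h5 le_rfl).2.1]; exact h4

/-- first hit of the boundary of a cube -/
lemma HF {D : Set (V d)} {ω : ℕ → V d} (hω : ω ∈ nice) {a r : ℕ} {z : V d} (h : okk D ω a) (hz : cube z r ⊆ D) (ha : lerw D ω a ∈ cube z r) {k : ℕ}
    (hk : k = hitIdxFrom (innerBdry (cube z r)) a (lerw D ω)) :
    a ≤ k ∧ okk D ω k ∧ lerw D ω k ∈ innerBdry (cube z r) ∧ (∀ i, a ≤ i → i ≤ k → lerw D ω i ∈ cube z r) ∧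
      ∀ i, a ≤ i → i < k → lerw D ω i ∉ innerBdry (cube z r) := by
  have hex : ∃ j, a ≤ j ∧ lerw D ω j ∈ innerBdry (cube z r) := by
    by_contra hc; push Not at hc
    have h1 := fun k hk => ler_stay hω h hz ha (k := k) hk fun i h1 _ => hc i h1
    refine Set.infinite_of_injective_forall_mem (f := fun i => lerw D ω (a + i)) ?_ (fun i => (h1 (a+i) (by omega)).2 _ (by omega) le_rfl) (cube_finite z r)
    intro i j hij
    by_contra hne
    rcases lt_or_gt_of_ne hne with h2 | h2
    · exact ler_inj hω (h1 (a + j) (by omega)).1 le_rfl (by omega) hij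
    · exact ler_inj hω (h1 (a + i) (by omega)).1 le_rfl (by omega) hij.symm
  unfold hitIdxFrom at hk; rw [dif_pos hex] at hk
  have h1 := Nat.find_spec hex
  rw [← hk] at h1
  have h2 : ∀ i, a ≤ i → i < k → lerw D ω i ∉ innerBdry (cube z r) := fun i h3 h4 h5 => by
    rw [hk] at h4; exact Nat.find_min hex h4 ⟨h3, h5⟩
  have h3 := ler_stay hω h hz ha h1.1 h2
  exact ⟨h1.1, h3.1, h1.2, h3.2, h2⟩

lemma HF_mono {D : Set (V d)} {ω : ℕ → V d} (hω : ω ∈ nice) {a r r' k' : ℕ} {z z' : V d} (h : okk D ω a) (hz : cube z r ⊆ D) (ha : lerw D ω a ∈ cube z r)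
    (hzz : cube z r ⊆ cube z' r') (hak : a ≤ k') (hk' : lerw D ω k' ∈ innerBdry (cube z' r')) :
    hitIdxFrom (innerBdry (cube z r)) a (lerw D ω) ≤ k' := by
  by_contra hc; push Not at hc
  obtain ⟨_, _, _, h4, h5⟩ := HF hω h hz ha rfl
  obtain ⟨_, y, hy, hy2⟩ := hk'
  exact h5 k' hak hc ⟨h4 k' hak hc.le, y, hy, fun h => hy2 (hzz h)⟩
lemma hit_from (A : Set (V d)) (γ : ℕ → V d) : hitIdx A γ = hitIdxFrom A 0 γ := by
  unfold hitIdx hitTimeE hitIdxFrom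
  by_cases h : ∃ j, γ j ∈ A
  · rw [dif_pos h, dif_pos (by simpa using h)]; simp
  · rw [dif_neg h, dif_neg (by simpa using h)]; rfl

lemma hif_eq {A : Set (V d)} {γ : ℕ → V d} {a k : ℕ} (h1 : a ≤ k) (h2 : γ k ∈ A) (h3 : ∀ i, a ≤ i → i < k → γ i ∉ A) :
    hitIdxFrom A a γ = k := by
  have h : ∃ j, a ≤ j ∧ γ j ∈ A := ⟨k, h1, h2⟩
  unfold hitIdxFrom; rw [dif_pos h, Nat.find_eq_iff]
  exact ⟨⟨h1, h2⟩, fun n hn hc => h3 n hc.1 hn hc.2⟩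

/-- hitting index, time -/
noncomputable def ki (D : Set (V d)) (n : ℕ) (ω : ℕ → V d) : ℕ := hitIdx (innerBdry (cube 0 n)) (lerw D ω)
noncomputable def tt (D : Set (V d)) (n : ℕ) (ω : ℕ → V d) : ℕ := rh D ω (ki D n ω)
def KK (D : Set (V d)) (n : ℕ) (ω : ℕ → V d) : Set (V d) := {v | ∃ i ≤ ki D n ω, v = lerw D ω i}

lemma zero_mem_cube (n : ℕ) : (0 : V d) ∈ cube 0 n := fun i => by simp

lemma ok0 {D : Set (V d)} {ω : ℕ → V d} (hω : ω ∈ nice) (h0 : (0 : V d) ∈ D) : okk D ω 0 ∧ lerw D ω 0 = 0 := by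
  have h1 : stopAt D ω (uu D ω 0) = 0 := by change stopAt D ω 0 = 0; rw [stop_eq (by simp), hω.1]
  have h2 : okk D ω 0 := fun i hi => by rw [Nat.le_zero.1 hi, h1]; exact h0
  exact ⟨h2, by rw [(rh_spec hω h2 le_rfl).2.1, h1]⟩

lemma ki_spec {D : Set (V d)} {ω : ℕ → V d} {n : ℕ} (hω : ω ∈ nice) (hD : cube 0 n ⊆ D) :
    okk D ω (ki D n ω) ∧ lerw D ω (ki D n ω) ∈ innerBdry (cube 0 n) ∧ (∀ i ≤ ki D n ω, lerw D ω i ∈ cube 0 n) ∧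
      ∀ i < ki D n ω, lerw D ω i ∉ innerBdry (cube 0 n) := by
  obtain ⟨h1, h2⟩ := ok0 hω (hD (zero_mem_cube n))
  obtain ⟨_, h3, h4, h5, h6⟩ := HF hω h1 hD (by rw [h2]; exact zero_mem_cube n) (hit_from _ _)
  exact ⟨h3, h4, fun i hi => h5 i (by omega) hi, fun i hi => h6 i (by omega) hi⟩

/-- equal states -/
lemma state_eq {D : Set (V d)} {ω ω₀ : ℕ → V d} {n : ℕ} (hω : ω ∈ nice) (hω₀ : ω₀ ∈ nice) (hD : cube 0 n ⊆ D)
    (ht : tt D n ω = tt D n ω₀) (he : ∀ i ≤ tt D n ω₀, ω i = ω₀ i) :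
    ki D n ω = ki D n ω₀ ∧ ∀ i ≤ ki D n ω₀, rh D ω i = rh D ω₀ i ∧ lerw D ω i = lerw D ω₀ i := by
  obtain ⟨a1, a2, a3, a4⟩ := ki_spec hω hD
  obtain ⟨b1, b2, b3, b4⟩ := ki_spec hω₀ hD
  have mono : ∀ ω : ℕ → V d, ω ∈ nice → ∀ i ≤ ki D n ω, rh D ω i ≤ tt D n ω := fun ω h i hi => by
    rcases hi.lt_or_eq with h2 | h2
    · exact (rh_lt h (ki_spec h hD).1 le_rfl h2).le
    · rw [h2]; rfl
  have hW : ∀ i ≤ tt D n ω₀, stopAt D ω i = stopAt D ω₀ i := fun i hi => by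
    rw [stop_eq, stop_eq, he i hi]
    · exact fun l hl => (rh_spec hω₀ b1 le_rfl).2.2.2.1 l (by change l ≤ tt D n ω₀; omega)
    · exact fun l hl => (rh_spec hω a1 le_rfl).2.2.2.1 l (by change l ≤ tt D n ω; omega)
  have hst : ∀ i, i ≤ ki D n ω → i ≤ ki D n ω₀ → uu D ω i = uu D ω₀ i → rh D ω i = rh D ω₀ i := by
    intro i h1 h2 hu
    have e1 := rh_spec hω a1 h1
    have e2 := rh_spec hω₀ b1 h2
    have m1 := mono ω hω i h1
    have m2 := mono ω₀ hω₀ i h2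
    have e3 := hW (uu D ω₀ i) (by omega)
    have e4 := e1.2.1
    rw [hu, e3, ← e2.2.1] at e4
    rcases lt_trichotomy (rh D ω i) (rh D ω₀ i) with h | h | h
    · exfalso; refine e1.2.2.2.2.2 _ h ?_
      rw [hW _ m2, e4]; rfl
    · exact h
    · exfalso; refine e2.2.2.2.2.2 _ h ?_
      rw [← hW _ (by omega), ← e4]; rfl
  have key : ∀ i, i ≤ ki D n ω → i ≤ ki D n ω₀ → rh D ω i = rh D ω₀ i := by
    intro i
    induction i with
    | zero => exact fun h1 h2 => hst 0 h1 h2 rfl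
    | succ i ih =>
      intro h1 h2
      refine hst _ h1 h2 ?_
      change rh D ω i + 1 = rh D ω₀ i + 1
      rw [ih (by omega) (by omega)]
  have hk : ki D n ω = ki D n ω₀ := by
    rcases lt_trichotomy (ki D n ω) (ki D n ω₀) with h | h | h
    · exfalso
      have h1 := key _ le_rfl h.le
      have h2 := rh_lt hω₀ b1 le_rfl h
      change tt D n ω = _ at h1; change _ < tt D n ω₀ at h2; omega
    · exact h
    · exfalso
      have h1 := key _ h.le le_rfl
      have h2 := rh_lt hω a1 le_rfl h
      change _ = tt D n ω₀ at h1; change _ < tt D n ω at h2; omega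
  refine ⟨hk, fun i hi => ⟨key i (hk ▸ hi) hi, ?_⟩⟩
  have h1 := key i (hk ▸ hi) hi
  change stopAt D ω (rh D ω i) = stopAt D ω₀ (rh D ω₀ i)
  rw [h1]; exact hW _ (mono ω₀ hω₀ i hi)

lemma state_av {D : Set (V d)} {ω ω₀ : ℕ → V d} {n : ℕ} (hω : ω ∈ nice) (hω₀ : ω₀ ∈ nice) (hD : cube 0 n ⊆ D)
    (he : ∀ i ≤ tt D n ω₀, ω i = ω₀ i) : tt D n ω = tt D n ω₀ ↔ th (tt D n ω₀) ω ∈ AVp D (KK D n ω₀) := by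
  obtain ⟨b1, b2, b3, b4⟩ := ki_spec hω₀ hD
  have hin := (rh_spec hω₀ b1 le_rfl).2.2.2.1
  change ∀ l ≤ tt D n ω₀, ω₀ l ∈ D at hin
  have mono : ∀ i ≤ ki D n ω₀, rh D ω₀ i ≤ tt D n ω₀ := fun i hi => by
    rcases hi.lt_or_eq with h2 | h2
    · exact (rh_lt hω₀ b1 le_rfl h2).le
    · rw [h2]; rfl
  constructor
  · intro ht j hj hjD hK
    obtain ⟨hk, h1⟩ := state_eq hω hω₀ hD ht he
    obtain ⟨i, hi, hv⟩ := hK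
    obtain ⟨a1, _⟩ := ki_spec hω hD
    have h2 := rh_spec hω a1 (hk ▸ hi)
    have h3 := mono i hi
    refine h2.2.2.2.2.2 (j + tt D n ω₀) (by rw [(h1 i hi).1]; omega) ?_
    rw [(h1 i hi).2, ← hv, stop_eq]; · rfl
    intro l hl
    by_cases hlt : l ≤ tt D n ω₀
    · rw [he l hlt]; exact hin l hlt
    · have := hjD (l - tt D n ω₀) (by omega)
      unfold th at this; rwa [Nat.sub_add_cancel (by omega)] at this
  · intro hav
    have hW : ∀ i ≤ tt D n ω₀, stopAt D ω i = stopAt D ω₀ i := fun i hi => by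
      rw [stop_eq, stop_eq, he i hi]
      · exact fun l hl => hin l (by omega)
      · exact fun l hl => by rw [he l (by omega)]; exact hin l (by omega)
    have hst : ∀ i, i ≤ ki D n ω₀ → uu D ω i = uu D ω₀ i → rh D ω i = rh D ω₀ i := by
      intro i h2 hu
      have e2 := rh_spec hω₀ b1 h2
      have m2 := mono i h2
      have e3 := hW (uu D ω₀ i) (by omega)
      rw [rh_eq, hu]
      refine lv_eq e2.1 ?_ ?_
      · rw [hW _ m2, e3, ← e2.2.1]; rfl
      · intro r hr hc
        rw [e3, ← e2.2.1] at hc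
        by_cases hrt : r ≤ tt D n ω₀
        · rw [hW r hrt] at hc; exact e2.2.2.2.2.2 r hr hc
        · have h5 := (stop_iff e2.2.2.1).1 hc
          refine hav (r - tt D n ω₀) (by omega) (fun l hl => h5.1 _ (by omega)) ?_
          unfold th; rw [Nat.sub_add_cancel (by omega), h5.2]; exact ⟨i, h2, rfl⟩
    have key : ∀ i, i ≤ ki D n ω₀ → rh D ω i = rh D ω₀ i := by
      intro i
      induction i with
      | zero => exact fun h2 => hst 0 h2 rfl
      | succ i ih =>
        intro h2
        refine hst _ h2 ?_
        change rh D ω i + 1 = rh D ω₀ i + 1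
        rw [ih (by omega)]
    have hl : ∀ i, i ≤ ki D n ω₀ → lerw D ω i = lerw D ω₀ i := fun i hi => by
      change stopAt D ω (rh D ω i) = stopAt D ω₀ (rh D ω₀ i)
      rw [key i hi]; exact hW _ (mono i hi)
    have hk : ki D n ω = ki D n ω₀ := by
      unfold ki; rw [hit_from]
      refine hif_eq (by omega) (by have := b2; rw [← hl _ le_rfl] at this; exact this) fun i _ hi => ?_
      rw [hl i (Nat.le_of_lt hi)]; exact b4 i hi
    unfold tt; rw [hk]; exact key _ le_rfl
end USFPaper

namespace USFPaper
variable {d : ℕ}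

noncomputable def k2 (D : Set (V d)) (n m : ℕ) (ω : ℕ → V d) : ℕ := hitIdxFrom (innerBdry (cube (hitPt D n ω) m)) (ki D n ω) (lerw D ω)

lemma beta_eq (D : Set (V d)) (n m : ℕ) (ω : ℕ → V d) :
    betaList D n m ω = (List.range (k2 D n m ω - ki D n ω + 1)).map fun i => lerw D ω (ki D n ω + i) := rfl

lemma cube_sub {x : V d} {n m : ℕ} (h : x ∈ cube 0 n) : cube x m ⊆ cube 0 (n + m) := fun y hy i => by
  have h1 : |x i - 0| ≤ (n:ℤ) := h i
  have h2 : |y i - x i| ≤ (m:ℤ) := hy i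
  change |y i - 0| ≤ ((n + m : ℕ) : ℤ)
  rw [abs_le] at *; push_cast; omega

lemma cube_mono {z : V d} {n m : ℕ} (h : n ≤ m) : cube z n ⊆ cube z m := fun y hy i => (hy i).trans (by exact_mod_cast h)

lemma k2_spec {D : Set (V d)} {ω : ℕ → V d} {n m : ℕ} (hω : ω ∈ nice) (hD : cube 0 (n + m) ⊆ D) :
    ki D n ω ≤ k2 D n m ω ∧ okk D ω (k2 D n m ω) ∧ lerw D ω (k2 D n m ω) ∈ innerBdry (cube (hitPt D n ω) m) ∧
      (∀ i, ki D n ω ≤ i → i ≤ k2 D n m ω → lerw D ω i ∈ cube (hitPt D n ω) m) ∧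
      (∀ i, ki D n ω ≤ i → i < k2 D n m ω → lerw D ω i ∉ innerBdry (cube (hitPt D n ω) m)) ∧
      ∀ n', n + m ≤ n' → cube 0 n' ⊆ D → k2 D n m ω ≤ ki D n' ω := by
  have hn : cube 0 n ⊆ D := (cube_mono (by omega)).trans hD
  obtain ⟨a1, a2, a3, a4⟩ := ki_spec hω hn
  have hx : hitPt D n ω ∈ cube 0 n := a3 _ le_rfl
  have hc := cube_sub (m := m) hx
  have hs : lerw D ω (ki D n ω) ∈ cube (hitPt D n ω) m := fun i => by
    change |hitPt D n ω i - hitPt D n ω i| ≤ _; simp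
  obtain ⟨h1, h2, h3, h4, h5⟩ := HF hω a1 (hc.trans hD) hs rfl
  refine ⟨h1, h2, h3, h4, h5, fun n' hn' hD' => ?_⟩
  obtain ⟨b1, b2, b3, b4⟩ := ki_spec hω hD'
  obtain ⟨h7, h8⟩ := ok0 hω (hD' (zero_mem_cube n'))
  refine HF_mono hω a1 (hc.trans hD) hs (hc.trans (cube_mono hn')) ?_ b2
  unfold ki; rw [hit_from]
  exact HF_mono hω h7 hn (by rw [h8]; exact zero_mem_cube n) (cube_mono (by omega)) (by omega) b2

lemma det_same {D : Set (V d)} {ω ω₀ : ℕ → V d} {n m n' : ℕ} (hω : ω ∈ nice) (hω₀ : ω₀ ∈ nice) (hn : n + m ≤ n') (hD : cube 0 n' ⊆ D)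
    (ht : tt D n' ω = tt D n' ω₀) (he : ∀ i ≤ tt D n' ω₀, ω i = ω₀ i) :
    hitPt D n ω = hitPt D n ω₀ ∧ betaList D n m ω = betaList D n m ω₀ := by
  obtain ⟨hk, h1⟩ := state_eq hω hω₀ hD ht he
  have hD1 : cube 0 (n+m) ⊆ D := (cube_mono hn).trans hD
  obtain ⟨a1, a2, a3, a4, a5, a6⟩ := k2_spec hω₀ hD1
  obtain ⟨b1, b2, b3, b4⟩ := ki_spec hω₀ ((cube_mono (show n ≤ n + m by omega)).trans hD1)
  have a7 := a6 n' hn hD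
  have e1 : ki D n ω = ki D n ω₀ := by
    unfold ki; rw [hit_from]
    refine hif_eq (by omega) ?_ fun i _ hi => ?_
    · rw [(h1 _ (by change ki D n ω₀ ≤ _; omega)).2]; exact b2
    · change i < ki D n ω₀ at hi
      rw [(h1 i (by omega)).2]; exact b4 i hi
  have e2 : hitPt D n ω = hitPt D n ω₀ := by
    change lerw D ω (ki D n ω) = lerw D ω₀ (ki D n ω₀)
    rw [e1, (h1 _ (by omega)).2]
  have e3 : k2 D n m ω = k2 D n m ω₀ := by
    rw [k2, e1, e2]
    refine hif_eq a1 ?_ fun i h2 hi => ?_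
    · rw [(h1 _ (by omega)).2]; exact a3
    · rw [(h1 i (by omega)).2]; exact a5 i h2 hi
  refine ⟨e2, ?_⟩
  rw [beta_eq, beta_eq, e1, e3]
  refine List.map_congr_left fun i hi => ?_
  rw [List.mem_range] at hi
  exact (h1 _ (by omega)).2

lemma mem_beta {D : Set (V d)} {ω : ℕ → V d} {n m : ℕ} (hω : ω ∈ nice) (hD : cube 0 (n + m) ⊆ D) (v : V d) :
    v ∈ betaList D n m ω ↔ ∃ i, ki D n ω ≤ i ∧ i ≤ k2 D n m ω ∧ lerw D ω i = v := by
  have := (k2_spec hω hD).1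
  rw [beta_eq, List.mem_map]
  constructor
  · rintro ⟨i, hi, h⟩
    rw [List.mem_range] at hi
    exact ⟨_, by omega, by omega, h⟩
  · rintro ⟨i, h1, h2, h3⟩
    exact ⟨i - ki D n ω, List.mem_range.2 (by omega), by rw [Nat.add_sub_cancel' h1]; exact h3⟩

lemma th_start {D : Set (V d)} {ω : ℕ → V d} {n : ℕ} (hω : ω ∈ nice) (hD : cube 0 n ⊆ D) : ω (tt D n ω) = hitPt D n ω :=
  (rh_spec hω (ki_spec hω hD).1 le_rfl).2.2.2.2.1

lemma cut_beta {D : Set (V d)} {ω : ℕ → V d} {n m : ℕ} (hm : 1 ≤ m) (hω : ω ∈ nice) (hD : cube 0 (n + m) ⊆ D) :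
    cutS D (hitPt D n ω) m (th (tt D n ω) ω) ⊆ {v | v ∈ betaList D n m ω} := by
  rintro w ⟨τ, hw, hc1, hc2⟩
  set t := tt D n ω with ht
  obtain ⟨a1, a2, a3, a4, a5, -⟩ := k2_spec hω hD
  obtain ⟨b1, b2, b3, b4⟩ := ki_spec hω ((cube_mono (show n ≤ n + m by omega)).trans hD)
  have hin := (rh_spec hω b1 le_rfl).2.2.2.1
  change ∀ l ≤ t, ω l ∈ D at hin
  have hseg : ∀ r, t ≤ r → r ≤ t + τ → ω r ∈ D ∧ ω r ∈ cube (hitPt D n ω) (m-1) := fun r h1 h2 => by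
    have := hc1 (r - t) (by omega)
    unfold th at this; rwa [Nat.sub_add_cancel h1] at this
  have hDall : ∀ r ≤ t + τ, ω r ∈ D := fun r hr => by
    by_cases h : r ≤ t
    · exact hin r h
    · exact (hseg r (by omega) hr).1
  have hdis : ∀ r s, t ≤ r → r ≤ t + τ → t + τ < s → stopAt D ω s ≠ ω r := fun r s h1 h2 h3 h4 => by
    have h5 := (stop_iff (hseg r h1 h2).1).1 h4
    refine hc2 (r - t) (by omega) (s - t) (by omega) (fun l hl => h5.1 _ (by omega)) ?_
    unfold th; rw [Nat.sub_add_cancel h1, Nat.sub_add_cancel (by omega), h5.2]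
  have hstep : ∀ j, (∃ k ≥ ki D n ω, okk D ω k ∧ rh D ω k = t + τ) ∨ (okk D ω (ki D n ω + j) ∧ rh D ω (ki D n ω + j) < t + τ) := by
    intro j
    have fin : ∀ k ≥ ki D n ω, okk D ω k → rh D ω k ≤ t + τ → (∃ k ≥ ki D n ω, okk D ω k ∧ rh D ω k = t + τ) ∨ (okk D ω k ∧ rh D ω k < t + τ) :=
      fun k hk ho h => by
        rcases h.lt_or_eq with h | h
        · exact Or.inr ⟨ho, h⟩
        · exact Or.inl ⟨k, hk, ho, h⟩
    induction j with
    | zero => exact fin _ le_rfl b1 (by change t ≤ _; omega)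
    | succ j ih =>
      rcases ih with h | ⟨h1, h2⟩
      · exact Or.inl h
      · have h3 : t + j ≤ rh D ω (ki D n ω + j) := rh_ge hω h1 le_rfl
        have hu : uu D ω (ki D n ω + (j+1)) = rh D ω (ki D n ω + j) + 1 := rfl
        have hWu : stopAt D ω (uu D ω (ki D n ω + (j+1))) = ω (rh D ω (ki D n ω + j) + 1) := by
          rw [hu, stop_eq]; exact fun l hl => hDall l (by omega)
        have ho : okk D ω (ki D n ω + (j+1)) := fun i hi => by
          rcases hi.lt_or_eq with h6 | h6
          · exact h1 i (by omega)
          · rw [h6, hWu]; exact hDall _ (by omega)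
        refine fin _ (by omega) ho ?_
        by_contra hc; push Not at hc
        refine hdis (rh D ω (ki D n ω + j) + 1) _ (by omega) (by omega) hc ?_
        rw [← hWu, ← (rh_spec hω ho le_rfl).2.1]; rfl
  obtain ⟨k, hk, hok, hkt⟩ : ∃ k ≥ ki D n ω, okk D ω k ∧ rh D ω k = t + τ := by
    rcases hstep τ with h | ⟨h1, h2⟩
    · exact h
    · have h3 : t + τ ≤ rh D ω (ki D n ω + τ) := rh_ge hω h1 le_rfl
      omega
  have hwk : lerw D ω k = w := by
    rw [← (rh_spec hω hok le_rfl).2.2.2.2.1, hkt, ← hw]; unfold th; rw [add_comm]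
  refine (mem_beta hω hD w).2 ⟨k, hk, ?_, hwk⟩
  by_contra hc; push Not at hc
  have h1 : rh D ω (k2 D n m ω) < t + τ := hkt ▸ rh_lt hω hok le_rfl hc
  have h2 : t ≤ rh D ω (k2 D n m ω) := by
    rcases a1.lt_or_eq with h | h
    · exact (rh_lt hω a2 le_rfl h).le
    · rw [← h]; exact le_rfl
  have h3 := (hseg _ h2 h1.le).2
  rw [(rh_spec hω a2 le_rfl).2.2.2.2.1] at h3
  obtain ⟨-, y, hy, hy2⟩ := a3
  refine hy2 fun i => ?_
  have h4 := abs_le.1 (h3 i)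
  have h5 := nb_ne (adj_nb hy) i
  rw [abs_le]; push_cast [hm] at h4; omega

lemma beta_vis {D : Set (V d)} {ω : ℕ → V d} {n m : ℕ} (hω : ω ∈ nice) (hD : cube 0 (n + m) ⊆ D) :
    cube (hitPt D n ω) m ∩ {v | v ∈ betaList D n m ω} ⊆ Vis D (hitPt D n ω) m (th (tt D n ω) ω) := by
  rintro v ⟨h1, h2⟩
  obtain ⟨i, hi, hi2, rfl⟩ := (mem_beta hω hD v).1 h2
  obtain ⟨a1, a2, a3, a4, a5, -⟩ := k2_spec hω hD
  have h3 := rh_spec hω a2 hi2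
  have h4 : tt D n ω ≤ rh D ω i := by
    rcases hi.lt_or_eq with h | h
    · exact (rh_lt hω a2 hi2 h).le
    · rw [← h]; exact le_rfl
  refine ⟨h1, rh D ω i - tt D n ω, fun l hl => h3.2.2.2.1 _ (by omega), ?_⟩
  unfold th; rw [Nat.sub_add_cancel h4]; exact h3.2.2.2.2.1
end USFPaper

namespace USFPaper
variable {d : ℕ}

lemma expo {Ω S : Type} [MeasurableSpace Ω] [MeasurableSpace S] [MeasurableSingletonClass S] [Countable S] {μ : Measure Ω} [IsProbabilityMeasure μ]
    (k : ℕ) (Φ : ℕ → Ω → S) (hΦ : ∀ j ≤ k, Measurable (Φ j)) (Gd : ℕ → Set Ω) {c : ℝ} (hc1 : c ≤ 1)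
    (h1 : ∀ j < k, ∀ s, c * μ.real (Φ j ⁻¹' {s}) ≤ μ.real (Φ j ⁻¹' {s} ∩ Gd j))
    (h2 : ∀ i j, i < j → j ≤ k → ∀ ω ω', Φ j ω = Φ j ω' → ω ∈ Gd i → ω' ∈ Gd i) :
    ∫⁻ ω, ∏ i ∈ Finset.range k, (if ω ∈ Gd i then (2⁻¹ : ℝ≥0∞) else 1) ∂μ ≤ ENNReal.ofReal (1 - c/2) ^ k := by
  set f : ℕ → Ω → ℝ≥0∞ := fun i ω => if ω ∈ Gd i then (2⁻¹ : ℝ≥0∞) else 1 with hf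
  have hG : ∀ i < k, MeasurableSet (Gd i) := fun i hi => by
    have : Gd i = Φ (i+1) ⁻¹' (Φ (i+1) '' Gd i) := by
      ext ω; constructor
      · exact fun h => ⟨ω, h, rfl⟩
      · rintro ⟨ω', h, h'⟩; exact h2 i (i+1) (by omega) hi ω' ω h' h
    rw [this]; exact hΦ (i+1) hi (Set.to_countable _).measurableSet
  have hfm : ∀ i < k, Measurable (f i) := fun i hi => Measurable.ite (hG i hi) measurable_const measurable_const
  have key : ∀ l ≤ k, ∫⁻ ω, ∏ i ∈ Finset.range l, f i ω ∂μ ≤ ENNReal.ofReal (1 - c/2) ^ l := by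
    intro l
    induction l with
    | zero => intro _; simp
    | succ l ih =>
      intro hl
      have hF : ∃ g : S → ℝ≥0∞, ∀ ω, ∏ i ∈ Finset.range l, f i ω = g (Φ l ω) := by
        refine ⟨fun s => if h : ∃ ω, Φ l ω = s then ∏ i ∈ Finset.range l, f i h.choose else 0, fun ω => ?_⟩
        have h : ∃ ω', Φ l ω' = Φ l ω := ⟨ω, rfl⟩
        simp only [dif_pos h]
        refine Finset.prod_congr rfl fun i hi => ?_
        rw [Finset.mem_range] at hi
        have h3 : ω ∈ Gd i ↔ h.choose ∈ Gd i := ⟨h2 i l hi (by omega) _ _ h.choose_spec.symm, h2 i l hi (by omega) _ _ h.choose_spec⟩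
        simp only [hf, h3]
      obtain ⟨g, hg⟩ := hF
      have hgm : Measurable g := measurable_of_countable g
      simp only [Finset.prod_range_succ, hg] at ih ⊢
      have e1 : ∫⁻ ω, g (Φ l ω) * f l ω ∂μ = ∫⁻ s, g s ∂((μ.withDensity (f l)).map (Φ l)) := by
        rw [lintegral_map hgm (hΦ l (by omega))]
        refine Eq.trans ?_ (lintegral_withDensity_eq_lintegral_mul μ (hfm l hl) (hgm.comp (hΦ l (by omega)))).symm
        refine lintegral_congr fun ω => ?_
        simp [mul_comm]
      have e2 : ∫⁻ ω, g (Φ l ω) ∂μ = ∫⁻ s, g s ∂(μ.map (Φ l)) := by rw [lintegral_map hgm (hΦ l (by omega))]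
      have hfib : ∀ s, ((μ.withDensity (f l)).map (Φ l)) {s} ≤ ENNReal.ofReal (1 - c/2) * (μ.map (Φ l)) {s} := by
        intro s
        have hA : MeasurableSet (Φ l ⁻¹' {s}) := hΦ l (by omega) (measurableSet_singleton s)
        rw [Measure.map_apply (hΦ l (by omega)) (measurableSet_singleton s), Measure.map_apply (hΦ l (by omega)) (measurableSet_singleton s),
          withDensity_apply _ hA]
        set A := Φ l ⁻¹' {s}
        have e3 : ∫⁻ ω in A, f l ω ∂μ = 2⁻¹ * μ (A ∩ Gd l) + μ (A \ Gd l) := by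
          rw [← lintegral_inter_add_sdiff _ A (hG l hl)]
          congr 1
          · rw [setLIntegral_congr_fun (g := fun _ => 2⁻¹) (hA.inter (hG l hl)) (fun ω h => by simp only [hf]; rw [if_pos h.2]), setLIntegral_const]
          · rw [setLIntegral_congr_fun (g := fun _ => 1) (hA.diff (hG l hl)) (fun ω h => by simp only [hf]; rw [if_neg h.2]), setLIntegral_const, one_mul]
        rw [e3]
        have r1 := h1 l hl s
        have r2 : μ.real (A ∩ Gd l) + μ.real (A \ Gd l) = μ.real A := measureReal_inter_add_sdiff (hG l hl)
        have q1 : μ (A ∩ Gd l) = ENNReal.ofReal (μ.real (A ∩ Gd l)) := (ofReal_measureReal).symm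
        have q2 : μ (A \ Gd l) = ENNReal.ofReal (μ.real (A \ Gd l)) := (ofReal_measureReal).symm
        have q3 : μ A = ENNReal.ofReal (μ.real A) := (ofReal_measureReal).symm
        have q4 : (2⁻¹ : ℝ≥0∞) = ENNReal.ofReal 2⁻¹ := by rw [ENNReal.ofReal_inv_of_pos (by norm_num)]; simp
        rw [q1, q2, q3, q4, ← ENNReal.ofReal_mul (by norm_num), ← ENNReal.ofReal_mul (by linarith),
          ← ENNReal.ofReal_add (by positivity) (by positivity)]
        apply ENNReal.ofReal_le_ofReal
        change c * μ.real A ≤ μ.real (A ∩ Gd l) at r1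
        linarith
      have ih2 := ih (by omega)
      rw [e1, lintegral_countable']
      rw [e2, lintegral_countable'] at ih2
      calc _ ≤ ∑' s, ENNReal.ofReal (1 - c/2) * (g s * (μ.map (Φ l)) {s}) := ENNReal.tsum_le_tsum fun s => by
            calc _ ≤ g s * (ENNReal.ofReal (1 - c/2) * (μ.map (Φ l)) {s}) := by gcongr; exact hfib s
              _ = _ := by ring
        _ = ENNReal.ofReal (1 - c/2) * ∑' s, (g s * (μ.map (Φ l)) {s}) := ENNReal.tsum_mul_left
        _ ≤ _ := by rw [pow_succ, mul_comm]; gcongr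
  exact key k le_rfl

lemma expo2 {Ω S : Type} [MeasurableSpace Ω] [MeasurableSpace S] [MeasurableSingletonClass S] [Countable S] {μ : Measure Ω} [IsProbabilityMeasure μ]
    (k : ℕ) (Φ : ℕ → Ω → S) (hΦ : ∀ j ≤ k, Measurable (Φ j)) (Gd : ℕ → Set Ω) {c : ℝ} (hc1 : c ≤ 1)
    (h1 : ∀ j < k, ∀ s, c * μ.real (Φ j ⁻¹' {s}) ≤ μ.real (Φ j ⁻¹' {s} ∩ Gd j))
    (h2 : ∀ i j, i < j → j ≤ k → ∀ ω ω', Φ j ω = Φ j ω' → ω ∈ Gd i → ω' ∈ Gd i) :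
    1 - Real.exp (-(c/4) * k) ≤ μ.real {ω | c/4 * k ≤ (((Finset.range k).filter fun i => ω ∈ Gd i).card : ℝ)} := by
  have h0 := expo k Φ hΦ Gd hc1 h1 h2
  set F : Ω → ℝ≥0∞ := fun ω => ∏ i ∈ Finset.range k, (if ω ∈ Gd i then (2⁻¹ : ℝ≥0∞) else 1) with hF
  set X : Ω → ℕ := fun ω => ((Finset.range k).filter fun i => ω ∈ Gd i).card with hX
  have hFX : ∀ ω, F ω = ENNReal.ofReal (2⁻¹ ^ X ω) := fun ω => by
    simp only [hF, hX]
    rw [Finset.prod_ite, Finset.prod_const, Finset.prod_const_one, mul_one, ENNReal.ofReal_pow (by norm_num), ENNReal.ofReal_inv_of_pos (by norm_num)]; simp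
  set B : Set Ω := {ω | c/4 * k ≤ (X ω : ℝ)} with hB
  have hsub : Bᶜ ⊆ {ω | ENNReal.ofReal (Real.exp (-(c/4) * k)) ≤ F ω} := fun ω hω => by
    simp only [hB, Set.mem_compl_iff, Set.mem_ofPred_eq, not_le] at hω ⊢
    rw [hFX]; apply ENNReal.ofReal_le_ofReal
    have e1 : Real.exp (-(X ω : ℝ)) ≤ 2⁻¹ ^ X ω := by
      have : Real.exp (-1) ≤ 2⁻¹ := by
        rw [Real.exp_neg]; apply inv_anti₀ (by norm_num); have := Real.add_one_le_exp (1:ℝ); linarith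
      calc Real.exp (-(X ω : ℝ)) = Real.exp (-1) ^ X ω := by rw [← Real.exp_nat_mul]; ring_nf
        _ ≤ _ := by gcongr
    refine le_trans (Real.exp_le_exp.2 (by linarith)) e1
  have h3 : ENNReal.ofReal (Real.exp (-(c/4) * k)) * μ Bᶜ ≤ ENNReal.ofReal (1 - c/2) ^ k := by
    refine le_trans ?_ h0
    refine le_trans ?_ (mul_meas_ge_le_lintegral₀ ?_ (ENNReal.ofReal (Real.exp (-(c/4) * k))))
    · gcongr
    · refine (Finset.measurable_prod _ fun i hi => ?_).aemeasurable
      have hi := Finset.mem_range.1 hi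
      refine Measurable.ite ?_ measurable_const measurable_const
      have : Gd i = Φ (i+1) ⁻¹' (Φ (i+1) '' Gd i) := by
        ext ω; constructor
        · exact fun h => ⟨ω, h, rfl⟩
        · rintro ⟨ω', h, h'⟩; exact h2 i (i+1) (by omega) hi ω' ω h' h
      change MeasurableSet (Gd i)
      rw [this]; exact hΦ (i+1) hi (Set.to_countable _).measurableSet
  have h4 : Real.exp (-(c/4) * k) * μ.real Bᶜ ≤ (1 - c/2)^k := by
    have := ENNReal.toReal_mono (by finiteness) h3
    rwa [ENNReal.toReal_mul, ENNReal.toReal_ofReal (Real.exp_pos _).le, ENNReal.toReal_pow, ENNReal.toReal_ofReal (by linarith)] at this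
  have h5 : (1 - c/2)^k ≤ Real.exp (-(c/4) * k) * Real.exp (-(c/4) * k) := by
    rw [← Real.exp_add]
    calc (1 - c/2)^k ≤ Real.exp (-(c/2)) ^ k := by
          have := Real.add_one_le_exp (-(c/2))
          gcongr
          · linarith
          · linarith
      _ = _ := by rw [← Real.exp_nat_mul]; ring_nf
  have h6 : μ.real Bᶜ ≤ Real.exp (-(c/4) * k) := le_of_mul_le_mul_left (h4.trans h5) (Real.exp_pos _)
  have h7 := measureReal_union_le (μ := μ) B Bᶜ
  rw [Set.union_compl_self, probReal_univ] at h7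
  linarith
end USFPaper

namespace USFPaper
variable {d : ℕ} {P : V d → Measure (ℕ → V d)}

lemma nice_meas : MeasurableSet (nice : Set (ℕ → V d)) := by
  have : (nice : Set (ℕ → V d)) = {ω | ω 0 = 0} ∩ ((⋂ i, {ω | adj (ω i) (ω (i+1))}) ∩ ⋂ j, ⋃ T, ⋂ s ≥ T, {ω | ω s ≠ ω j}) := by
    ext ω; simp [nice]
  rw [this]
  refine (meas_loc' 0 fun ω ω' h h1 => ?_).inter (MeasurableSet.inter (MeasurableSet.iInter fun i => meas_loc' (i+1) fun ω ω' h h1 => ?_)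
    (MeasurableSet.iInter fun j => MeasurableSet.iUnion fun T => MeasurableSet.iInter fun s => MeasurableSet.iInter fun _ => meas_loc' (s + j) fun ω ω' h h1 => ?_))
  · rw [Set.mem_ofPred_eq, ← h 0 le_rfl]; exact h1
  · rw [Set.mem_ofPred_eq, ← h i (by omega), ← h (i+1) le_rfl]; exact h1
  · rw [Set.mem_ofPred_eq, ← h s (by omega), ← h j (by omega)]; exact h1

lemma nice_ae (hd : 5 ≤ d) (hP : ∀ x, IsSRWLaw (P x) x) : ∀ᵐ ω ∂(P 0), ω ∈ nice := by
  have := fun x => (hP x).1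
  have h1 : ∀ᵐ ω ∂(P 0), ∀ i, adj (ω i) (ω (i+1)) := by
    rw [ae_all_iff]; intro i
    have hE : MeasurableSet {ω : ℕ → V d | ¬ adj (ω 0) (ω 1)} := meas_loc' 1 fun ω ω' h h1 => by
      rw [Set.mem_ofPred_eq, ← h 0 (by omega), ← h 1 le_rfl]; exact h1
    have h2 := markov_le (by omega) hP i (κ := 0) 0 Set.univ (Ev := fun _ => {ω : ℕ → V d | ¬ adj (ω 0) (ω 1)}) (fun _ => hE) (fun γ _ => by
      rw [M1 (by omega) hP _ hE, avg_nbv]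
      refine le_of_eq (mul_eq_zero_of_right _ (Finset.sum_eq_zero fun p _ => ?_))
      refine le_antisymm ?_ (pr_nonneg _ _)
      refine (pr_mono_ae hP _ (F := ∅) fun ω h0 hω => ?_).trans (by simp [pr])
      apply hω
      change adj (γ i) (ω 0)
      rw [h0]; exact nbv_adj _ _)
    rw [zero_mul] at h2
    have h3 := le_antisymm h2 (pr_nonneg _ _)
    unfold pr at h3
    rw [measureReal_eq_zero_iff] at h3
    rw [ae_iff]; refine measure_mono_null (fun ω hω => ?_) h3
    refine ⟨trivial, ?_⟩
    change ¬ adj (ω (0 + i)) (ω (1 + i))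
    rw [zero_add, add_comm 1]; exact hω
  have h2 : ∀ᵐ ω ∂(P 0), ∀ j, ∃ T, ∀ s ≥ T, ω s ≠ ω j := by
    rw [ae_all_iff]; intro j
    have hb : ∑' s, (P 0) {ω : ℕ → V d | ω (j + s) = ω j} ≠ ∞ := by
      have hs : ∀ s, (P 0) {ω : ℕ → V d | ω (j + s) = ω j} = ENNReal.ofReal (avg^[s] dl (0 : V d)) := fun s => by
        rw [← avg_diff (by omega) hP (f := dl) (C := 1) (fun y => by unfold dl; split_ifs <;> simp) j s 0]
        have hm : MeasurableSet {ω : ℕ → V d | ω (j + s) = ω j} := meas_loc' (j+s) fun ω ω' h h1 => by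
          rw [Set.mem_ofPred_eq, ← h j (by omega), ← h (j+s) le_rfl]; exact h1
        have : (fun ω : ℕ → V d => dl (ω (j + s) - ω j)) = Set.indicator {ω : ℕ → V d | ω (j + s) = ω j} 1 := by
          funext ω; unfold dl Set.indicator; simp [sub_eq_zero]
        rw [this, integral_indicator_one hm, ofReal_measureReal]
      simp only [hs]
      exact ((G_basic hd).1 0).tsum_ofReal_ne_top
    have h3 := measure_setOfPred_frequently_eq_zero hb
    rw [ae_iff]; refine measure_mono_null (fun ω hω => ?_) h3
    simp only [Set.mem_ofPred_eq] at hω ⊢; push Not at hω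
    rw [Filter.frequently_atTop]
    intro T
    obtain ⟨s, h4, h5⟩ := hω (T + j)
    exact ⟨s - j, by omega, by rw [Nat.add_sub_cancel' (by omega)]; exact h5⟩
  filter_upwards [pr_start hP 0, h1, h2] with ω a b c using ⟨a, b, c⟩

/-- the state fibre -/
def Sq (D : Set (V d)) (n : ℕ) (ω₀ : ℕ → V d) : Set (ℕ → V d) := {ω | ω ∈ nice ∧ tt D n ω = tt D n ω₀ ∧ ∀ i ≤ tt D n ω₀, ω i = ω₀ i}

lemma Sq_eq {D : Set (V d)} {n : ℕ} {ω₀ : ℕ → V d} (h0 : ω₀ ∈ nice) (hD : cube 0 n ⊆ D) :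
    Sq D n ω₀ = nice ∩ {ω | stp (tt D n ω₀) ω ∈ ({stp (tt D n ω₀) ω₀} : Set _) ∧ th (tt D n ω₀) ω ∈ AVp D (KK D n ω₀)} := by
  ext ω
  have he : stp (tt D n ω₀) ω ∈ ({stp (tt D n ω₀) ω₀} : Set _) ↔ ∀ i ≤ tt D n ω₀, ω i = ω₀ i := by
    rw [Set.mem_singleton_iff]
    constructor
    · intro h i hi; have := congrFun h i; simpa [stp, hi] using this
    · intro h; funext i; exact h _ (min_le_right _ _)
  simp only [Sq, Set.mem_inter_iff, Set.mem_ofPred_eq, he]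
  constructor
  · rintro ⟨a, b, c⟩; exact ⟨a, c, (state_av a h0 hD c).1 b⟩
  · rintro ⟨a, c, b⟩; exact ⟨a, (state_av a h0 hD c).2 b, c⟩

lemma Sq_meas {D : Set (V d)} {n : ℕ} {ω₀ : ℕ → V d} (h0 : ω₀ ∈ nice) (hD : cube 0 n ⊆ D) : MeasurableSet (Sq D n ω₀) := by
  rw [Sq_eq h0 hD]
  exact nice_meas.inter (meas_mk _ _ (Ev := fun _ => AVp D (KK D n ω₀)) fun _ => AVp_meas _ _)

/-- good event -/
def GD (P : V d → Measure (ℕ → V d)) (D : Set (V d)) (n m : ℕ) (c₁ C₂ : ℝ) : Set (ℕ → V d) :=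
  {ω | c₁ * (m : ℝ) ^ ((4 : ℤ) - (d : ℤ)) ≤
        ((P (x2pt (hitPt D n ω) n m)) { ω' | ∃ t : ℕ, ω' t ∈ boxA (hitPt D n ω) n m ∧ ω' t ∈ betaList D n m ω }).toReal ∧
      ((cube (hitPt D n ω) m ∩ { v | v ∈ betaList D n m ω }).ncard : ℝ) ≤ C₂ * (m : ℝ) ^ 2}

lemma face {x₀ : V d} {n : ℕ} (h : x₀ ∈ innerBdry (cube 0 n)) : ∃ i₀ : Fin d, ∃ σ : ℤ, σ * σ = 1 ∧ x₀ i₀ = σ * n ∧ faceDir x₀ n = dr i₀ σ := by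
  have hex : ∃ i : Fin d, |x₀ i| = (n : ℤ) := by
    obtain ⟨h1, y, hy, hy2⟩ := h
    by_contra hc; push Not at hc
    refine hy2 fun i => ?_
    have h3 : |x₀ i - 0| ≤ (n:ℤ) := h1 i
    have h4 := hc i
    have h5 := nb_ne (adj_nb hy) i
    change |y i - 0| ≤ _
    rw [sub_zero] at h3 ⊢
    have h6 := abs_lt.1 (lt_of_le_of_ne h3 h4)
    rw [abs_le]; omega
  refine ⟨Classical.choose hex, if 0 ≤ x₀ (Classical.choose hex) then 1 else -1, by split_ifs <;> rfl, ?_, ?_⟩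
  · have := Classical.choose_spec hex
    split_ifs with h1
    · rw [abs_of_nonneg h1] at this; omega
    · rw [abs_of_neg (by omega)] at this; omega
  · unfold faceDir; rw [dif_pos hex]
    funext j; unfold dr; rw [Pi.single_apply]

lemma x2_mem (x₀ : V d) (n m : ℕ) : x2pt x₀ n m ∈ cube x₀ (2*m) := by
  intro i
  have h1 : |faceDir x₀ n i| ≤ 1 := by
    unfold faceDir; split_ifs <;> (try dsimp only) <;> (try split_ifs) <;> first | (change |(1:ℤ)| ≤ 1; simp) | (change |(-1:ℤ)| ≤ 1; simp) | (change |(0:ℤ)| ≤ 1; simp)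
  have h2 : |sideDir x₀ n i| ≤ 1 := by
    unfold sideDir; split_ifs <;> (try dsimp only) <;> (try split_ifs) <;> first | (change |(1:ℤ)| ≤ 1; simp) | (change |(-1:ℤ)| ≤ 1; simp) | (change |(0:ℤ)| ≤ 1; simp)
  have h3 : x2pt x₀ n m i - x₀ i = ((m/2 : ℕ) : ℤ) * faceDir x₀ n i + (m:ℤ) * sideDir x₀ n i := by
    simp only [x2pt, x1pt, Pi.add_apply, Pi.smul_apply, smul_eq_mul]; ring
  rw [h3]
  refine (abs_add_le _ _).trans ?_
  rw [abs_mul, abs_mul, Nat.abs_cast, Nat.abs_cast]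
  have h4 : ((m/2 : ℕ) : ℤ) ≤ m := by omega
  have h5 : ((m/2 : ℕ) : ℤ) * |faceDir x₀ n i| ≤ (m/2 : ℕ) := mul_le_of_le_one_right (by omega) h1
  have h6 : (m : ℤ) * |sideDir x₀ n i| ≤ m := mul_le_of_le_one_right (by omega) h2
  push_cast at *; omega

lemma step (hd : 5 ≤ d) (hP : ∀ x, IsSRWLaw (P x) x) {c c₁ C₂ : ℝ} (hc : 0 < c) (H : OneS d (fun _ => True) c c₁ C₂) {D : Set (V d)} {N n m : ℕ}
    (hm : 4 ≤ m) (hn : n + m ≤ N) (hD : cube 0 (4 * N) ⊆ D) {ω₀ : ℕ → V d} (h0 : ω₀ ∈ nice) :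
    c * (P 0).real (Sq D n ω₀) ≤ (P 0).real (Sq D n ω₀ ∩ (nice ∩ GD P D n m c₁ C₂)) := by
  have hD1 : cube 0 (n + m) ⊆ D := (cube_mono (by omega)).trans hD
  have hD0 : cube 0 n ⊆ D := (cube_mono (by omega)).trans hD
  have hnice := nice_ae hd hP
  obtain ⟨a1, a2, a3, a4⟩ := ki_spec h0 hD0
  change hitPt D n ω₀ ∈ _ at a2
  obtain ⟨i₀, σ, hσ, hx0, hfd⟩ := face a2
  set t := tt D n ω₀ with ht
  set x₀ := hitPt D n ω₀ with hx
  have hst := th_start h0 hD0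
  obtain ⟨E, hEm, hEs, hEp⟩ := H P hP N n D (KK D n ω₀) i₀ σ x₀ (x2pt x₀ n m) m hn hD (by rintro v ⟨i, hi, rfl⟩; exact a3 i hi) hσ hx0
    (fun i => by have := a2.1 i; simpa using this) hm trivial (x2_mem _ _ _)
  set A : Set (ℕ → V d) := {stp t ω₀} with hA
  have hAt : ∀ γ ∈ A, γ t = x₀ := fun γ hγ => by
    rw [hA, Set.mem_singleton_iff] at hγ
    rw [hγ, hx, ← hst]; simp [stp, ht]
  have u1 := markov_le (by omega) hP t (κ := pr P x₀ (AVp D (KK D n ω₀))) 0 A (Ev := fun _ => AVp D (KK D n ω₀)) (fun _ => AVp_meas _ _)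
    (fun γ hγ => by rw [hAt γ hγ])
  have u2 := markov_ge (by omega) hP t (κ := pr P x₀ E) 0 A (Ev := fun _ => E) (fun _ => hEm) (fun γ hγ => by rw [hAt γ hγ])
  have u3 : (P 0).real (Sq D n ω₀) ≤ pr P 0 {ω | stp t ω ∈ A ∧ th t ω ∈ AVp D (KK D n ω₀)} := by
    rw [Sq_eq h0 hD0]; exact pr_mono hP 0 Set.inter_subset_right
  have u4 : pr P 0 {ω | stp t ω ∈ A ∧ th t ω ∈ E} ≤ (P 0).real (Sq D n ω₀ ∩ (nice ∩ GD P D n m c₁ C₂)) := by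
    have := (hP 0).1
    refine ENNReal.toReal_mono (by finiteness) (measure_mono_ae ?_)
    filter_upwards [hnice] with ω hω hh
    obtain ⟨h1, h2⟩ := hh
    have hωt : ω t = x₀ := by
      have := hAt _ h1; simpa [stp] using this
    have hok := hEs _ h2 (by change ω (0 + t) = x₀; rw [zero_add, hωt])
    have hS : ω ∈ Sq D n ω₀ := by rw [Sq_eq h0 hD0]; exact ⟨hω, h1, hok.1⟩
    have e1 : hitPt D n ω = x₀ := by rw [← th_start hω hD0, hS.2.1, ← ht, hωt]
    have hcb := cut_beta (n := n) (m := m) (by omega) hω hD1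
    have hbv := beta_vis (n := n) (m := m) hω hD1
    rw [e1, hS.2.1] at hcb hbv
    refine ⟨hS, hω, ?_⟩
    change _ ≤ _ ∧ _ ≤ _
    rw [e1]
    refine ⟨hok.2.1.trans (pr_mono hP _ ?_), le_trans ?_ hok.2.2⟩
    · rintro ω' ⟨s, h3, h4⟩
      refine ⟨s, ?_, hcb h4⟩
      unfold boxA x1pt; rw [hfd]; exact h3
    · exact_mod_cast Set.ncard_le_ncard hbv ((cube_finite x₀ m).subset fun v hv => hv.1)
  have p1 := pr_nonneg (P := P) 0 {ω | stp t ω ∈ A}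
  calc c * (P 0).real (Sq D n ω₀) ≤ c * (pr P x₀ (AVp D (KK D n ω₀)) * pr P 0 {ω | stp t ω ∈ A}) := by gcongr; linarith
    _ = (c * pr P x₀ (AVp D (KK D n ω₀))) * pr P 0 {ω | stp t ω ∈ A} := by ring
    _ ≤ pr P x₀ E * pr P 0 {ω | stp t ω ∈ A} := by gcongr
    _ ≤ _ := by linarith
end USFPaper

namespace USFPaper
variable {d : ℕ} {P : V d → Measure (ℕ → V d)}

noncomputable def Ph (D : Set (V d)) (n : ℕ) (ω : ℕ → V d) : List (V d) := if ω ∈ nice then (List.range (tt D n ω + 1)).map ω else []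

lemma Ph_eq {D : Set (V d)} {n : ℕ} {ω ω₀ : ℕ → V d} (h0 : ω₀ ∈ nice) : Ph D n ω = Ph D n ω₀ ↔ ω ∈ Sq D n ω₀ := by
  unfold Ph Sq
  rw [if_pos h0]
  by_cases h : ω ∈ nice
  · rw [if_pos h]
    constructor
    · intro he
      have h1 : tt D n ω = tt D n ω₀ := by have := congrArg List.length he; simpa using this
      refine ⟨h, h1, fun i hi => ?_⟩
      rw [h1] at he
      exact List.map_inj_left.1 he i (List.mem_range.2 (by omega))
    · rintro ⟨-, h1, h2⟩
      rw [h1]; exact List.map_congr_left fun i hi => h2 i (by have := List.mem_range.1 hi; omega)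
  · rw [if_neg h]
    constructor
    · intro he; have := congrArg List.length he; simp at this
    · exact fun hh => absurd hh.1 h

lemma Ph_nil {D : Set (V d)} {n : ℕ} {ω : ℕ → V d} : Ph D n ω = [] ↔ ω ∉ nice := by
  unfold Ph; split_ifs with h
  · simp [h]
  · simp [h]

lemma Ph_fib {D : Set (V d)} {n : ℕ} (s : List (V d)) : (Ph D n ⁻¹' {s} = ∅) ∨ (Ph D n ⁻¹' {s} = niceᶜ) ∨ ∃ ω₀ ∈ nice, Ph D n ⁻¹' {s} = Sq D n ω₀ := by
  by_cases hs : s = []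
  · right; left; ext ω; rw [hs]; exact Ph_nil
  · by_cases he : ∃ ω, Ph D n ω = s
    · obtain ⟨ω₀, h⟩ := he
      right; right
      have h0 : ω₀ ∈ nice := by by_contra hc; exact hs (h ▸ Ph_nil.2 hc)
      refine ⟨ω₀, h0, ?_⟩
      ext ω; rw [← Ph_eq h0, h]; rfl
    · left; ext ω; simp only [Set.mem_preimage, Set.mem_singleton_iff, Set.mem_empty_iff_false, iff_false]; exact fun h => he ⟨ω, h⟩

lemma mf {s : Finset ℕ} {p : ℕ → Prop} {i : ℕ} (h : i ∈ @Finset.filter _ p (fun a => Classical.propDecidable (p a)) s) : i ∈ s ∧ p i :=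
  Finset.mem_filter.1 h

theorem enough_good_boxes :
    ∀ d : ℕ, 5 ≤ d → ∃ c₁ c₂ c C₂ : ℝ, 0 < c₁ ∧ 0 < c₂ ∧ 0 < c ∧ 0 < C₂ ∧
      ∀ (N k m : ℕ) (D : Set (V d)),
        1 ≤ N → cube 0 (4 * N) ⊆ D → 1 ≤ k → 4 ≤ m →
        N / 2 ≤ k * m → k * m + m < N →
      ∀ P : V d → Measure (ℕ → V d), (∀ x, IsSRWLaw (P x) x) →
      ∀ μ : Measure (ℕ → V d), IsSRWLaw μ 0 →
        1 - Real.exp (-c * (k : ℝ)) ≤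
          (μ { ω | c₂ * (k : ℝ) ≤
              (Set.ncard { j : ℕ | 1 ≤ j ∧ j ≤ k ∧
                  c₁ * (m : ℝ) ^ ((4 : ℤ) - (d : ℤ)) ≤
                    ((P (x2pt (hitPt D (j * m) ω) (j * m) m))
                      { ω' | ∃ t : ℕ, ω' t ∈ boxA (hitPt D (j * m) ω) (j * m) m ∧
                          ω' t ∈ betaList D (j * m) m ω }).toReal ∧
                  ((cube (hitPt D (j * m) ω) m ∩
                      { v | v ∈ betaList D (j * m) m ω }).ncard : ℝ) ≤ C₂ * (m : ℝ) ^ 2 } : ℝ) }).toReal := by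
  intro d hd
  obtain ⟨c0, c₁, C₂, hc0, hc1, hC2, H⟩ := oneS hd
  set c := min c0 1 with hc
  have hcp : 0 < c := lt_min hc0 one_pos
  refine ⟨c₁, c/4, c/4, C₂, hc1, by positivity, by positivity, hC2, ?_⟩
  intro N k m D hN hD hk hm _ hkm P hP μ hμ
  have hμP : μ = P 0 := srw_unique (by omega) hμ (hP 0)
  subst hμP
  have := (hP 0).1
  let _ : MeasurableSpace (List (V d)) := ⊤
  have : MeasurableSingletonClass (List (V d)) := ⟨fun _ => trivial⟩
  have hmul : ∀ j ≤ k, (j + 1) * m ≤ k * m + m := fun j hj => by nlinarith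
  have hDj : ∀ j ≤ k, cube 0 ((j+1) * m) ⊆ D := fun j hj => (cube_mono (by have := hmul j hj; omega)).trans hD
  have hnice := nice_ae hd hP
  have key := expo2 (μ := P 0) k (fun j => Ph D ((j+1) * m)) (fun j hj => measurable_to_countable' fun s => ?_)
    (fun j => nice ∩ GD P D ((j+1) * m) m c₁ C₂) (c := c) (min_le_right _ _) ?_ ?_
  · refine key.trans (measureReal_mono (fun ω hω => ?_) (by finiteness))
    simp only [Set.mem_ofPred_eq] at hω ⊢
    refine hω.trans ?_
    rw [← Finset.card_image_of_injective _ (Nat.succ_injective), ← Set.ncard_coe_finset]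
    refine Nat.cast_le.2 (Set.ncard_le_ncard (fun j hj => ?_) ((Set.finite_Icc 1 k).subset ?_))
    swap
    · rintro j ⟨h1, h2, -⟩; exact ⟨h1, h2⟩
    rw [Finset.mem_coe, Finset.mem_image] at hj
    obtain ⟨i, hi, rfl⟩ := hj
    have hi := mf hi
    rw [Finset.mem_range] at hi
    exact ⟨by omega, by omega, hi.2.2⟩
  · rcases Ph_fib (D := D) (n := (j+1)*m) s with h | h | ⟨ω₀, h0, h⟩ <;> rw [h]
    · exact MeasurableSet.empty
    · exact nice_meas.compl
    · exact Sq_meas h0 (hDj j hj)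
  · intro j hj s
    rcases Ph_fib (D := D) (n := (j+1)*m) s with h | h | ⟨ω₀, h0, h⟩ <;> rw [h]
    · simp
    · have h1 : (P 0).real (niceᶜ) = 0 := by rw [measureReal_eq_zero_iff]; exact hnice
      rw [h1, mul_zero]; exact measureReal_nonneg
    · refine le_trans ?_ (step hd hP hc0 H hm (N := N) (by have := Nat.mul_le_mul_right m (show j + 1 ≤ k from hj); omega) hD h0)
      gcongr; exact min_le_left _ _
  · intro i j hij hj ω ω' he hω
    have h0 : ω ∈ nice := hω.1
    have hS := (Ph_eq h0).1 he.symm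
    have hle : (i+1)*m + m ≤ (j+1)*m := by nlinarith
    obtain ⟨e1, e2⟩ := det_same hS.1 h0 hle (hDj j hj) hS.2.1 hS.2.2
    refine ⟨hS.1, ?_⟩
    have h3 := hω.2
    change _ ≤ _ ∧ _ ≤ _ at h3 ⊢
    rw [e1, e2]; exact h3
end USFPaper
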